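/- Let n ≥ 1 and let s ∈ ℂ ∖ ℤ with Re s > 0. Then the integral transform P : S_ind(n,s) → FE(n,s), defined componentwise by (Pu⃗)_i(ζ) = ∫_0^∞ ( u_i(iy)(∂_x R_ζ^s)(iy) − R_ζ^s(iy)(∂_x u_i)(iy) ) dy for ζ > 0, is a bijection from the space of vector valued cusp forms onto the space of period functions for Γ₀(n) with spectral parameter s. -/

import Mathlib

noncomputable section

open Complex MeasureTheory

/- ## Farey machinery -/

/-- The Farey sequence of level `n`, as a subset of the extended reals;
`⊥ = -∞ = -1/0`, `⊤ = ∞ = 1/0`. -/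
def fareySet (n : ℕ) : Set EReal :=
  {⊥, ⊤, 0} ∪ {x : EReal | ∃ q : ℚ, x = ((q : ℝ) : EReal) ∧ q.num.natAbs ≤ n ∧ q.den ≤ n}

/-- The level of an element of `ℚ ∪ {±∞}`. -/
def flev (x : EReal) : ℕ := sInf {n : ℕ | x ∈ fareySet n}

/-- The left neighbor map: the largest element of `F_{lev x}` strictly below `x`. -/
def fLN (x : EReal) : EReal := sSup {r : EReal | r ∈ fareySet (flev x) ∧ r < x}

/-- The length `L` of the left neighbor sequence: the least `L` with `LN^L q = -∞`. -/
def fL (x : EReal) : ℕ := sInf {L : ℕ | fLN^[L] x = ⊥}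

/-- The members `y_l = LN^{L-l}(q)` of the left neighbor sequence `LNS(q)`. -/
def yseq (q : ℚ) (l : ℕ) : EReal := fLN^[fL ((q : ℝ) : EReal) - l] ((q : ℝ) : EReal)

/-- The fraction `a/c` as an element of `ℚ ∪ {±∞}` (with `1/0 = ∞`, `-1/0 = -∞`). -/
def efrac (a c : ℤ) : EReal :=
  if c = 0 then (if 0 < a then ⊤ else ⊥) else ((((a : ℚ) / (c : ℚ) : ℚ) : ℝ) : EReal)

open Classical in
/-- The numerator of an element of `ℚ ∪ {±∞}` in lowest terms (`-∞ = -1/0`, `∞ = 1/0`). -/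
def enum (x : EReal) : ℤ :=
  if x = ⊥ then -1
  else if x = ⊤ then 1
  else if h : ∃ q : ℚ, x = ((q : ℝ) : EReal) then h.choose.num else 0

open Classical in
/-- The (nonnegative) denominator of an element of `ℚ ∪ {±∞}` in lowest terms. -/
def eden (x : EReal) : ℤ :=
  if x = ⊥ then 0
  else if x = ⊤ then 0
  else if h : ∃ q : ℚ, x = ((q : ℝ) : EReal) then (h.choose.den : ℤ) else 0

/-- The matrix `m_l = [[b_l, -a_l], [b_{l-1}, -a_{l-1}]]` from `M(q) = Σ_l m_l`. -/
def mMat (q : ℚ) (l : ℕ) : Matrix (Fin 2) (Fin 2) ℤ :=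
  !![eden (yseq q l), -enum (yseq q l); eden (yseq q (l - 1)), -enum (yseq q (l - 1))]

/- ## Matrix groups -/

abbrev SL2 := Matrix.SpecialLinearGroup (Fin 2) ℤ

/-- The Hecke congruence subgroup `Γ₀(n)` inside `SL₂(ℤ)`. -/
def Gam0 (n : ℕ) : Set SL2 := {g : SL2 | (n : ℤ) ∣ (g : Matrix (Fin 2) (Fin 2) ℤ) 1 0}

/-- `X_m`: upper triangular integer matrices `[[a,b],[0,d]]` with `ad = m`, `d > b ≥ 0`. -/
def Xset (m : ℕ) : Set (Matrix (Fin 2) (Fin 2) ℤ) :=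
  {A | A 1 0 = 0 ∧ A 0 0 * A 1 1 = (m : ℤ) ∧ 0 ≤ A 0 1 ∧ A 0 1 < A 1 1}

/-- `X_m` as a finite set. -/
def XF (m : ℕ) : Finset (Matrix (Fin 2) (Fin 2) ℤ) :=
  ((m.divisors ×ˢ Finset.range m).filter fun p => p.2 < p.1).image
    fun p => !![((m / p.1 : ℕ) : ℤ), (p.2 : ℤ); 0, (p.1 : ℤ)]

/-- Möbius action of an integer matrix on (a suitable part of) `ℂ`. -/
def moeb (g : Matrix (Fin 2) (Fin 2) ℤ) (z : ℂ) : ℂ :=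
  ((g 0 0 : ℂ) * z + (g 0 1 : ℂ)) / ((g 1 0 : ℂ) * z + (g 1 1 : ℂ))

/-- `α : Fin μ → SL₂(ℤ)` is a full set of representatives of the right cosets
`Γ₀(n) \ SL₂(ℤ)`. -/
def IsCosetReps (n : ℕ) {μ : ℕ} (α : Fin μ → SL2) : Prop :=
  (∀ g : SL2, ∃ j : Fin μ, ∃ γ ∈ Gam0 n, g = γ * α j) ∧
  (∀ j k : Fin μ, (∃ γ ∈ Gam0 n, α j = γ * α k) → j = k)

open Classical in
/-- The representation of `SL₂(ℤ)` induced from the trivial representation of `Γ₀(n)`: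
a permutation matrix realization of the right regular representation. -/
def rho (n : ℕ) {μ : ℕ} (α : Fin μ → SL2) (g : SL2) : Matrix (Fin μ) (Fin μ) ℂ :=
  fun i j => if α i * g * (α j)⁻¹ ∈ Gam0 n then 1 else 0

/- ## Analysis -/

/-- Partial derivative in the `x` (real) direction. -/
def pdx (f : ℂ → ℂ) (z : ℂ) : ℂ := deriv (fun x : ℝ => f (x + z.im * Complex.I)) z.re

/-- Partial derivative in the `y` (imaginary) direction. -/
def pdy (f : ℂ → ℂ) (z : ℂ) : ℂ := deriv (fun y : ℝ => f (z.re + y * Complex.I)) z.im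

/-- The hyperbolic Laplacian `Δ = -y²(∂_x² + ∂_y²)`. -/
def laplace (f : ℂ → ℂ) (z : ℂ) : ℂ := -(z.im : ℂ) ^ 2 * (pdx (pdx f) z + pdy (pdy f) z)

/-- `R_ζ(z) = Im z / |z - ζ|²`. -/
def Rfun (ζ : ℝ) (z : ℂ) : ℝ := z.im / ((z.re - ζ) ^ 2 + z.im ^ 2)

/-- `R_ζ^s(z)`, using the principal branch on the positive real `R_ζ(z)`. -/
def Rpow (s : ℂ) (ζ : ℝ) (z : ℂ) : ℂ := ((Rfun ζ z : ℝ) : ℂ) ^ s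

/-- A Maass cusp form for `Γ₀(n)` with spectral parameter `s`. -/
structure IsCuspForm (n : ℕ) (s : ℂ) (u : ℂ → ℂ) : Prop where
  analytic : AnalyticOnNhd ℝ u {z : ℂ | 0 < z.im}
  invar : ∀ g ∈ Gam0 n, ∀ z : ℂ, 0 < z.im → u (moeb g z) = u z
  eigen : ∀ z : ℂ, 0 < z.im → laplace u z = s * (1 - s) * u z
  decay : ∀ g : SL2, ∀ C : ℝ, ∃ K T : ℝ, ∀ z : ℂ, 0 < z.im → T ≤ z.im →
    ‖u (moeb g z)‖ ≤ K * z.im ^ C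

/-- A vector valued cusp form for `Γ₀(n)` with spectral parameter `s`. -/
structure IsVVCuspForm (n : ℕ) {μ : ℕ} (α : Fin μ → SL2) (s : ℂ) (U : ℂ → Fin μ → ℂ) :
    Prop where
  analytic : ∀ j, AnalyticOnNhd ℝ (fun z => U z j) {z : ℂ | 0 < z.im}
  equivar : ∀ g : SL2, ∀ z : ℂ, 0 < z.im → ∀ j,
    U (moeb g z) j = ∑ k, rho n α g j k * U z k
  eigen : ∀ j, ∀ z : ℂ, 0 < z.im → laplace (fun w => U w j) z = s * (1 - s) * U z j
  decay : ∀ j, ∀ C : ℝ, ∃ K T : ℝ, ∀ z : ℂ, 0 < z.im → T ≤ z.im → ‖U z j‖ ≤ K * z.im ^ C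

/-- The map `Π` from cusp forms to vector valued cusp forms. -/
def PiMap {μ : ℕ} (α : Fin μ → SL2) (u : ℂ → ℂ) : ℂ → Fin μ → ℂ :=
  fun z j => u (moeb (α j : Matrix (Fin 2) (Fin 2) ℤ) z)

/-- The integral transform `P`, componentwise:
`(Pu)(ζ) = ∫_0^∞ (u(iy) ∂_x R_ζ^s(iy) - R_ζ^s(iy) ∂_x u(iy)) dy`. -/
def Ptrans (s : ℂ) (v : ℂ → ℂ) (ζ : ℝ) : ℂ :=
  ∫ y in Set.Ioi (0 : ℝ),
    (v (y * Complex.I) * pdx (Rpow s ζ) (y * Complex.I)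
      - Rpow s ζ (y * Complex.I) * pdx v (y * Complex.I))

def Tmat : SL2 := ⟨!![1, 1; 0, 1], by norm_num [Matrix.det_fin_two_of]⟩

def Tmat' : SL2 := ⟨!![1, 0; 1, 1], by norm_num [Matrix.det_fin_two_of]⟩

/-- A (vector valued) period function for `Γ₀(n)` with spectral parameter `s`. -/
structure IsPeriodFn (n : ℕ) {μ : ℕ} (α : Fin μ → SL2) (s : ℂ) (ψ : ℝ → Fin μ → ℂ) :
    Prop where
  analytic : ∀ i, AnalyticOnNhd ℝ (fun ζ => ψ ζ i) (Set.Ioi 0)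
  threeterm : ∀ ζ : ℝ, 0 < ζ → ∀ i,
    ψ ζ i = ∑ k, rho n α Tmat⁻¹ i k * ψ (ζ + 1) k
      + ((ζ + 1 : ℝ) : ℂ) ^ (-(2 * s)) * ∑ k, rho n α Tmat'⁻¹ i k * ψ (ζ / (ζ + 1)) k
  grow0 : ∀ i, ∃ K ε : ℝ, 0 < ε ∧ ∀ ζ : ℝ, 0 < ζ → ζ < ε →
    ‖ψ ζ i‖ ≤ K * ζ ^ (max 0 (-2 * s.re))
  growInf : ∀ i, ∃ K T : ℝ, ∀ ζ : ℝ, T ≤ ζ → 0 < ζ →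
    ‖ψ ζ i‖ ≤ K * ζ ^ (min 0 (-2 * s.re))


namespace Period

theorem mem_Gam0_iff {n : ℕ} {g : SL2} : g ∈ Gam0 n ↔ g ∈ CongruenceSubgroup.Gamma0 n := by
  rw [CongruenceSubgroup.Gamma0_mem, ZMod.intCast_zmod_eq_zero_iff_dvd]; rfl

section Rep
variable {n μ : ℕ} {α : Fin μ → SL2}

theorem rho_eq_single (hrep : IsCosetReps n α) (g : SL2) (i : Fin μ) :
    ∃ k, α i * g * (α k)⁻¹ ∈ CongruenceSubgroup.Gamma0 n ∧
      ∀ j, rho n α g i j = if j = k then 1 else 0 := by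
  obtain ⟨k, γ, hγ, h⟩ := hrep.1 (α i * g)
  rw [mem_Gam0_iff] at hγ
  refine ⟨k, by rwa [h, mul_inv_cancel_right], fun j => ?_⟩
  simp only [rho]
  congr 1
  rw [mem_Gam0_iff]
  refine propext ⟨fun hj => hrep.2 j k ⟨(α i * g * (α j)⁻¹)⁻¹ * γ, ?_, ?_⟩, ?_⟩
  · exact mem_Gam0_iff.2 (mul_mem (inv_mem hj) hγ)
  · rw [mul_assoc, ← h]; group
  · rintro rfl; rwa [h, mul_inv_cancel_right]

theorem rho_mul (hrep : IsCosetReps n α) (g h : SL2) :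
    rho n α (g * h) = rho n α g * rho n α h := by
  ext i j
  obtain ⟨k, hk, hk'⟩ := rho_eq_single hrep g i
  rw [Matrix.mul_apply]
  simp only [hk', ite_mul, one_mul, zero_mul, Finset.sum_ite_eq', Finset.mem_univ, if_true]
  simp only [rho]
  congr 1
  rw [mem_Gam0_iff, mem_Gam0_iff]
  rw [show α i * (g * h) * (α j)⁻¹ = (α i * g * (α k)⁻¹) * (α k * h * (α j)⁻¹) by group,
    Subgroup.mul_mem_cancel_left _ hk]

theorem rho_eq_one (hrep : IsCosetReps n α) {g : SL2}
    (hg : ∀ i, α i * g * (α i)⁻¹ ∈ CongruenceSubgroup.Gamma0 n) : rho n α g = 1 := by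
  ext i j
  obtain ⟨k, hk, hk'⟩ := rho_eq_single hrep g i
  have : rho n α g i i = 1 := by simp [rho, mem_Gam0_iff, hg i]
  have hik : i = k := by
    by_contra hne
    rw [hk', if_neg hne] at this
    exact zero_ne_one this
  subst hik
  rw [hk', Matrix.one_apply]
  simp [eq_comm]

theorem rho_one (hrep : IsCosetReps n α) : rho n α 1 = 1 :=
  rho_eq_one hrep fun i => by simp [one_mem]

theorem rho_neg_one (hrep : IsCosetReps n α) : rho n α (-1) = 1 :=
  rho_eq_one hrep fun i => by
    rw [mul_neg_one, neg_mul, mul_inv_cancel, CongruenceSubgroup.Gamma0_mem]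
    simp

theorem rho_neg (hrep : IsCosetReps n α) (g : SL2) : rho n α (-g) = rho n α g := by
  rw [← neg_one_mul, rho_mul hrep, rho_neg_one hrep, one_mul]

theorem Tmat_eq : Tmat = ModularGroup.T := rfl

/-- The operator on `ℂ^μ` given by the matrix `ρ(g)`. -/
def rop (n : ℕ) (α : Fin μ → SL2) (g : SL2) : (Fin μ → ℂ) →L[ℂ] (Fin μ → ℂ) :=
  (Matrix.toLin' (rho n α g)).toContinuousLinearMap

theorem rop_apply (g : SL2) (v : Fin μ → ℂ) (i : Fin μ) :
    rop n α g v i = ∑ k, rho n α g i k * v k := by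
  simp [rop, Matrix.mulVec, dotProduct]

theorem rop_mul (hrep : IsCosetReps n α) (g h : SL2) (v : Fin μ → ℂ) :
    rop n α (g * h) v = rop n α g (rop n α h v) := by
  simp [rop, rho_mul hrep]

theorem rop_one (hrep : IsCosetReps n α) (v : Fin μ → ℂ) : rop n α 1 v = v := by
  simp [rop, rho_one hrep]

theorem rop_neg (hrep : IsCosetReps n α) (g : SL2) : rop n α (-g) = rop n α g := by
  simp [rop, rho_neg hrep]

theorem rop_pow (hrep : IsCosetReps n α) (g : SL2) (k : ℕ) (v : Fin μ → ℂ) :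
    rop n α (g ^ k) v = (rop n α g ^ k) v := by
  induction k generalizing v with
  | zero => simp [rop_one hrep]
  | succ k ih => rw [pow_succ, rop_mul hrep, ih, pow_succ]; rfl

theorem rop_eq_one_of_mem_Gamma (hrep : IsCosetReps n α) {g : SL2}
    (hg : g ∈ CongruenceSubgroup.Gamma n) : rop n α g = 1 := by
  have h : rho n α g = 1 := by
    refine rho_eq_one hrep fun i => ?_
    have := (CongruenceSubgroup.Gamma_normal n).conj_mem _ hg (α i)
    rw [CongruenceSubgroup.Gamma_mem] at this
    rw [CongruenceSubgroup.Gamma0_mem]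
    exact this.2.2.1
  ext v : 1
  simp [rop, h]

theorem T_pow_mem_Gamma : Tmat ^ n ∈ CongruenceSubgroup.Gamma n := by
  rw [Tmat_eq, CongruenceSubgroup.Gamma_mem, ← zpow_natCast, ModularGroup.coe_T_zpow]
  simp

theorem rop_T_inv_pow (hrep : IsCosetReps n α) : rop n α Tmat⁻¹ ^ n = 1 := by
  rw [← rop_eq_one_of_mem_Gamma hrep (g := Tmat⁻¹ ^ n)
    (by rw [inv_pow, inv_mem_iff]; exact T_pow_mem_Gamma)]
  ext v : 1
  rw [rop_pow hrep]

theorem rop_T'_inv_pow (hrep : IsCosetReps n α) : rop n α Tmat'⁻¹ ^ n = 1 := by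
  rw [← rop_eq_one_of_mem_Gamma hrep (g := Tmat'⁻¹ ^ n)
    (by
      rw [show Tmat'⁻¹ = ModularGroup.S * Tmat * ModularGroup.S⁻¹ by decide, conj_pow]
      exact (CongruenceSubgroup.Gamma_normal n).conj_mem _ T_pow_mem_Gamma _)]
  ext v : 1
  rw [rop_pow hrep]

theorem rop_S_S (hrep : IsCosetReps n α) (v : Fin μ → ℂ) :
    rop n α ModularGroup.S (rop n α ModularGroup.S v) = v := by
  rw [← rop_mul hrep, show ModularGroup.S * ModularGroup.S = (-1 : SL2) by decide,
    rop_neg hrep, rop_one hrep]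

theorem rop_T_S_T (hrep : IsCosetReps n α) (v : Fin μ → ℂ) :
    rop n α Tmat⁻¹ (rop n α ModularGroup.S (rop n α Tmat⁻¹ v)) = rop n α Tmat'⁻¹ v := by
  rw [← rop_mul hrep, ← rop_mul hrep, ← rop_neg hrep Tmat'⁻¹]
  congr 2
  decide

theorem rop_T_S_T' (hrep : IsCosetReps n α) (v : Fin μ → ℂ) :
    rop n α Tmat⁻¹ (rop n α ModularGroup.S (rop n α Tmat'⁻¹ v)) = rop n α ModularGroup.S v := by
  rw [← rop_mul hrep, ← rop_mul hrep]
  congr 2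
  decide

end Rep
end Period

namespace Period
open Set Filter Topology Metric

section ParametricIntegral
variable {X : Type*} [MeasurableSpace X] {ν : Measure X}
  {E : Type*} [NormedAddCommGroup E] [NormedSpace ℂ E]

theorem hasDerivAt_integral_of_holomorphic {f : ℂ → X → E} {z₀ : ℂ} {r : ℝ} (hr : 0 < r)
    (hmeas : ∀ z ∈ ball z₀ r, AEStronglyMeasurable (f z) ν)
    (hd : ∀ᵐ x ∂ν, DifferentiableOn ℂ (fun z => f z x) (ball z₀ r))
    {bound : X → ℝ} (hbi : Integrable bound ν)
    (hb : ∀ᵐ x ∂ν, ∀ z ∈ ball z₀ r, ‖f z x‖ ≤ bound x) :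
    Integrable (fun x => deriv (fun z => f z x) z₀) ν ∧
    HasDerivAt (fun z => ∫ x, f z x ∂ν) (∫ x, deriv (fun z => f z x) z₀ ∂ν) z₀ := by
  have hd' : ∀ᵐ x ∂ν, ∀ z ∈ ball z₀ r,
      HasDerivAt (fun z => f z x) (deriv (fun z => f z x) z) z := by
    filter_upwards [hd] with x hx z hz
    exact (hx.differentiableAt (isOpen_ball.mem_nhds hz)).hasDerivAt
  have hsub : ball z₀ (r / 2) ⊆ ball z₀ r := ball_subset_ball (by linarith)
  have hm : AEStronglyMeasurable (fun x => deriv (fun z => f z x) z₀) ν := by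
    obtain ⟨w, hw0, hw⟩ : ∃ w : ℕ → ℂ, (∀ k, w k ∈ ball z₀ r \ {z₀}) ∧
        Tendsto w atTop (𝓝 z₀) := by
      have : z₀ ∈ closure (ball z₀ r \ {z₀}) := by
        rw [mem_closure_iff_nhdsWithin_neBot, sdiff_eq,
          nhdsWithin_inter_of_mem (nhdsWithin_le_nhds (ball_mem_nhds _ hr))]
        infer_instance
      exact mem_closure_iff_seq_limit.1 this
    refine aestronglyMeasurable_of_tendsto_ae atTop
      (f := fun k x => (w k - z₀)⁻¹ • (f (w k) x - f z₀ x)) (fun k => ?_) ?_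
    · exact ((hmeas _ (hw0 k).1).sub (hmeas _ (mem_ball_self hr))).const_smul _
    · filter_upwards [hd'] with x hx
      have h1 := (hasDerivAt_iff_tendsto_slope.1 (hx z₀ (mem_ball_self hr)))
      exact h1.comp (tendsto_nhdsWithin_iff.2 ⟨hw, Eventually.of_forall fun k => (hw0 k).2⟩)
  refine hasDerivAt_integral_of_dominated_loc_of_deriv_le (F' := fun z x => deriv (fun z =>
    f z x) z)
    (ball_mem_nhds z₀ (half_pos hr)) (bound := fun x => bound x / (r / 3)) ?_ ?_ hm ?_
    (hbi.div_const _) ?_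
  · filter_upwards [ball_mem_nhds z₀ hr] with z hz using hmeas z hz
  · refine hbi.mono' (hmeas _ (mem_ball_self hr)) ?_
    filter_upwards [hb] with x hx using hx _ (mem_ball_self hr)
  · filter_upwards [hb, hd] with x hx hdx z hz
    have hcl : closedBall z (r / 3) ⊆ ball z₀ r := fun y hy => by
      rw [mem_closedBall] at hy; rw [mem_ball] at hz ⊢
      linarith [dist_triangle y z z₀]
    refine norm_deriv_le_of_forall_mem_sphere_norm_le (by linarith) ?_ fun y hy => hx y ?_
    · exact (hdx.mono hcl).diffContOnCl_ball Subset.rfl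
    · exact hcl (sphere_subset_closedBall hy)
  · filter_upwards [hd'] with x hx z hz using hx z (hsub hz)

theorem differentiableOn_integral_of_holomorphic {f : ℂ → X → E} {U : Set ℂ} (hU : IsOpen U)
    (hmeas : ∀ z ∈ U, AEStronglyMeasurable (f z) ν)
    (hd : ∀ᵐ x ∂ν, DifferentiableOn ℂ (fun z => f z x) U)
    (hb : ∀ z₀ ∈ U, ∃ r > 0, ∃ bound : X → ℝ, Integrable bound ν ∧
      ∀ᵐ x ∂ν, ∀ z ∈ ball z₀ r, ‖f z x‖ ≤ bound x) :
    DifferentiableOn ℂ (fun z => ∫ x, f z x ∂ν) U := by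
  intro z₀ hz₀
  obtain ⟨r, hr, bound, hbi, hbd⟩ := hb z₀ hz₀
  obtain ⟨r', hr', hU'⟩ := Metric.isOpen_iff.1 hU z₀ hz₀
  have h1 : ball z₀ (min r r') ⊆ ball z₀ r := ball_subset_ball (min_le_left _ _)
  have h2 : ball z₀ (min r r') ⊆ U := (ball_subset_ball (min_le_right _ _)).trans hU'
  refine (hasDerivAt_integral_of_holomorphic (lt_min hr hr') (fun z hz => hmeas z (h2 hz)) ?_ hbi
    ?_).2.differentiableAt.differentiableWithinAt
  · filter_upwards [hd] with x hx using hx.mono h2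
  · filter_upwards [hbd] with x hx z hz using hx z (h1 hz)

end ParametricIntegral

theorem isPreconnected_re_pos : IsPreconnected {z : ℂ | 0 < z.re} :=
  (convex_halfSpace_re_gt 0).isPreconnected

theorem isOpen_re_pos : IsOpen {z : ℂ | 0 < z.re} := isOpen_lt continuous_const continuous_re

theorem eqOn_of_eq_on_pos {E : Type*} [NormedAddCommGroup E] [NormedSpace ℂ E] [CompleteSpace E]
    {f g : ℂ → E} {U : Set ℂ} (hU : IsOpen U) (hUc : IsPreconnected U)
    (hf : DifferentiableOn ℂ f U) (hg : DifferentiableOn ℂ g U) {x₀ : ℝ} (hx : (x₀ : ℂ) ∈ U)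
    (h : ∀ᶠ x : ℝ in 𝓝 x₀, f x = g x) : EqOn f g U := by
  refine (hf.analyticOnNhd hU).eqOn_of_preconnected_of_frequently_eq (hg.analyticOnNhd hU) hUc hx ?_
  have h1 : Tendsto (fun x : ℝ => (x : ℂ)) (𝓝[≠] x₀) (𝓝[≠] (x₀ : ℂ)) :=
    continuous_ofReal.continuousAt.continuousWithinAt.tendsto_nhdsWithin
      fun x hx => by simpa using hx
  exact h1.frequently (h.filter_mono nhdsWithin_le_nhds).frequently

theorem differentiableOn_laplace {F : ℝ → ℂ}
    (hc : ContinuousOn F (Ioi 0))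
    (hi : ∀ X : ℝ, 0 < X → IntegrableOn (fun t : ℝ => exp (-(X * t)) * F t) (Ioi 0)) :
    DifferentiableOn ℂ (fun z : ℂ => ∫ t in Ioi (0 : ℝ), exp (-(z * t)) * F t)
      {z : ℂ | 0 < z.re} := by
  refine differentiableOn_integral_of_holomorphic isOpen_re_pos (fun z _ => ?_) ?_ ?_
  · refine ContinuousOn.aestronglyMeasurable ?_ measurableSet_Ioi
    exact ContinuousOn.mul (by fun_prop) hc
  · exact Eventually.of_forall fun t => by fun_prop
  · intro z₀ hz₀
    have hz₀' : 0 < z₀.re := hz₀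
    refine ⟨z₀.re / 2, half_pos hz₀', _, (hi (z₀.re / 2) (half_pos hz₀')).norm, ?_⟩
    filter_upwards [ae_restrict_mem measurableSet_Ioi] with t ht z hz
    have ht' : (0 : ℝ) < t := ht
    simp only [norm_mul, norm_exp]
    refine mul_le_mul_of_nonneg_right (Real.exp_le_exp.2 ?_) (norm_nonneg _)
    have : |(z - z₀).re| < z₀.re / 2 := (abs_re_le_norm _).trans_lt (by rwa [← dist_eq_norm])
    have h3 := (abs_lt.1 this).1
    simp only [sub_re] at h3
    rw [← ofReal_mul, neg_re, neg_re, re_mul_ofReal, ofReal_re]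
    nlinarith

theorem laplace_injective {F : ℝ → ℂ} (hc : ContinuousOn F (Ioi 0))
    (hi : ∀ X : ℝ, 0 < X → IntegrableOn (fun t : ℝ => exp (-(X * t)) * F t) (Ioi 0))
    (h0 : ∀ X : ℝ, 0 < X → ∫ t in Ioi (0 : ℝ), exp (-(X * t)) * F t = 0) :
    ∀ t : ℝ, 0 < t → F t = 0 := by
  have hL : EqOn (fun z : ℂ => ∫ t in Ioi (0 : ℝ), exp (-(z * t)) * F t) (fun _ => 0)
      {z : ℂ | 0 < z.re} := by
    refine eqOn_of_eq_on_pos isOpen_re_pos isPreconnected_re_pos (differentiableOn_laplace hc hi)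
      (differentiableOn_const _) (x₀ := 1) (by simp) ?_
    filter_upwards [lt_mem_nhds one_pos] with x hx using h0 x hx
  intro t ht
  set f : ℝ → ℂ := (Ioi (0 : ℝ)).indicator fun t : ℝ => exp (-((1 : ℝ) * t)) * F t with hf
  have hfi : Integrable f := (hi 1 one_pos).integrable_indicator measurableSet_Ioi
  have hF : FourierTransform.fourier f = 0 := by
    ext w
    rw [Real.fourier_real_eq_integral_exp_smul, Pi.zero_apply]
    refine Eq.trans ?_ (hL (x := 1 + 2 * Real.pi * w * I) (by simp))
    dsimp only
    rw [← integral_indicator measurableSet_Ioi]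
    congr 1
    ext v
    by_cases hv : v ∈ Ioi (0 : ℝ)
    · simp only [hf, indicator_of_mem hv, smul_eq_mul, ← mul_assoc, ← Complex.exp_add]
      congr 2
      push_cast; ring
    · simp [hf, indicator_of_notMem hv]
  have hcont : ContinuousAt f t := by
    refine ContinuousAt.congr (f := fun t : ℝ => exp (-((1 : ℝ) * t)) * F t) ?_ ?_
    · exact ContinuousAt.mul (by fun_prop) (hc.continuousAt (Ioi_mem_nhds ht))
    · filter_upwards [Ioi_mem_nhds ht] with x hx
      rw [hf, indicator_of_mem hx]
  have := hfi.fourierInv_fourier_eq (by rw [hF]; exact integrable_zero _ _ _) hcont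
  rw [hF, Real.fourierInv_eq] at this
  simp [hf, indicator_of_mem (mem_Ioi.2 ht)] at this
  exact this

end Period

namespace Period
open Set Filter Topology Metric

theorem exp_neg_mul_le_rpow {σ t u : ℝ} (hσ : 0 < σ) (ht : 0 < t) (hu : 0 ≤ u) :
    Real.exp (-(t * u)) ≤ (σ / t) ^ σ * (σ / t + u) ^ (-σ) := by
  have hX : 0 < σ / t := div_pos hσ ht
  have h1 : (σ / t + u) ^ σ ≤ (σ / t) ^ σ * Real.exp (t * u) := by
    have : σ / t + u ≤ σ / t * Real.exp (t * u / σ) := by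
      have h2 := Real.add_one_le_exp (t * u / σ)
      calc σ / t + u = σ / t * (t * u / σ + 1) := by field_simp; ring
        _ ≤ _ := by gcongr
    calc (σ / t + u) ^ σ ≤ (σ / t * Real.exp (t * u / σ)) ^ σ := by gcongr
      _ = _ := by
        rw [Real.mul_rpow hX.le (Real.exp_pos _).le, ← Real.exp_mul]
        congr 2
        field_simp
  rw [Real.rpow_neg (by positivity), Real.exp_neg, ← div_eq_mul_inv, le_div_iff₀ (by positivity),
    inv_mul_le_iff₀ (Real.exp_pos _), mul_comm]
  linarith

theorem norm_ofReal_cpow_neg {x : ℝ} (hx : 0 < x) (a : ℂ) : ‖(x : ℂ) ^ (-a)‖ = x ^ (-a.re) := by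
  rw [norm_cpow_eq_rpow_re_of_pos hx, neg_re]

theorem integrableOn_cpow_mul_exp {a : ℂ} (ha : 0 < a.re) {c : ℝ} (hc : 0 < c) :
    IntegrableOn (fun t : ℝ => (t : ℂ) ^ (a - 1) * exp (-(c * t))) (Ioi 0) := by
  have h1 : -1 < a.re - 1 := by linarith
  refine Integrable.mono' (g := fun t : ℝ => t ^ (a.re - 1) * Real.exp (-c * t)) ?_ ?_ ?_
  · exact integrableOn_rpow_mul_exp_neg_mul_rpow (s := a.re - 1) (p := 1) h1 one_pos hc
      |>.congr_fun (fun x _ => by simp) measurableSet_Ioi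
  · refine ContinuousOn.aestronglyMeasurable (fun t ht => ?_) measurableSet_Ioi
    refine ContinuousAt.continuousWithinAt ?_
    refine ContinuousAt.mul ?_ (by fun_prop)
    exact continuousAt_ofReal_cpow_const _ _ (Or.inr (ne_of_gt ht))
  · filter_upwards [ae_restrict_mem measurableSet_Ioi] with t ht
    rw [norm_mul, norm_cpow_eq_rpow_re_of_pos ht, norm_exp]
    simp

section Stieltjes
variable {φ : ℝ → ℂ} {a : ℂ}

theorem integrableOn_mul_exp_sq (ha : 0 < a.re) (hc : ContinuousOn φ (Ioi 0))
    (hi : ∀ X : ℝ, 0 < X → IntegrableOn (fun y : ℝ => φ y * ((X + y ^ 2 : ℝ) : ℂ) ^ (-a)) (Ioi 0))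
    {t : ℝ} (ht : 0 < t) : IntegrableOn (fun y : ℝ => exp (-(t * y ^ 2)) * φ y) (Ioi 0) := by
  have hX : 0 < a.re / t := div_pos ha ht
  refine Integrable.mono' ((hi _ hX).norm.const_mul ((a.re / t) ^ a.re)) ?_ ?_
  · exact ContinuousOn.aestronglyMeasurable (ContinuousOn.mul (by fun_prop) hc) measurableSet_Ioi
  · filter_upwards [ae_restrict_mem measurableSet_Ioi] with y hy
    rw [norm_mul, norm_mul, norm_ofReal_cpow_neg (by positivity), norm_exp]
    have := exp_neg_mul_le_rpow ha ht (sq_nonneg y)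
    have h2 : (-((t : ℂ) * y ^ 2)).re = -(t * y ^ 2) := by
      rw [← ofReal_pow, ← ofReal_mul, neg_re, ofReal_re]
    rw [h2]
    calc _ ≤ (a.re / t) ^ a.re * (a.re / t + y ^ 2) ^ (-a.re) * ‖φ y‖ := by gcongr
      _ = _ := by ring

theorem integrable_prod_exp (ha : 0 < a.re) (hc : ContinuousOn φ (Ioi 0)) {X : ℝ} (hX : 0 < X)
    (hi : IntegrableOn (fun y : ℝ => φ y * ((X + y ^ 2 : ℝ) : ℂ) ^ (-a)) (Ioi 0)) :
    Integrable (fun p : ℝ × ℝ =>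
      (p.1 : ℂ) ^ (a - 1) * exp (-((X + p.2 ^ 2 : ℝ) * p.1)) * φ p.2)
      ((volume.restrict (Ioi 0)).prod (volume.restrict (Ioi 0))) := by
  have hm : AEStronglyMeasurable (fun p : ℝ × ℝ =>
      (p.1 : ℂ) ^ (a - 1) * exp (-((X + p.2 ^ 2 : ℝ) * p.1)) * φ p.2)
      ((volume.restrict (Ioi 0)).prod (volume.restrict (Ioi 0))) := by
    rw [Measure.prod_restrict]
    refine ContinuousOn.aestronglyMeasurable ?_ (measurableSet_Ioi.prod measurableSet_Ioi)
    refine ContinuousOn.mul (ContinuousOn.mul ?_ (by fun_prop)) ?_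
    · intro p hp
      exact ((continuousAt_ofReal_cpow_const p.1 (a - 1) (Or.inr (ne_of_gt hp.1))).comp
        continuousAt_fst).continuousWithinAt
    · exact hc.comp (f := fun p : ℝ × ℝ => p.2) (by fun_prop) fun p hp => hp.2
  refine (integrable_prod_iff' hm).2 ⟨?_, ?_⟩
  · filter_upwards [ae_restrict_mem measurableSet_Ioi] with y hy
    have hXy : 0 < X + y ^ 2 := by positivity
    exact Integrable.mul_const (integrableOn_cpow_mul_exp ha hXy) (φ y)
  · refine (hi.norm.const_mul (Real.Gamma a.re)).congr ?_
    filter_upwards [ae_restrict_mem measurableSet_Ioi] with y hy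
    have hXy : 0 < X + y ^ 2 := by positivity
    have h1 : ∫ t in Ioi (0 : ℝ),
        ‖(t : ℂ) ^ (a - 1) * exp (-((X + y ^ 2 : ℝ) * t)) * φ y‖ =
        ∫ t in Ioi (0 : ℝ), t ^ (a.re - 1) * Real.exp (-((X + y ^ 2) * t)) * ‖φ y‖ := by
      refine setIntegral_congr_fun measurableSet_Ioi fun t ht => ?_
      rw [norm_mul, norm_mul, norm_cpow_eq_rpow_re_of_pos ht, norm_exp,
        ← ofReal_mul, neg_re, ofReal_re, sub_re, one_re]
    rw [h1, integral_mul_const, Real.integral_rpow_mul_exp_neg_mul_Ioi ha hXy, norm_mul,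
      norm_ofReal_cpow_neg hXy, Real.rpow_neg hXy.le, one_div, Real.inv_rpow hXy.le]
    ring

theorem stieltjes_injective (ha : 0 < a.re) (hc : ContinuousOn φ (Ioi 0))
    (hi : ∀ X : ℝ, 0 < X → IntegrableOn (fun y : ℝ => φ y * ((X + y ^ 2 : ℝ) : ℂ) ^ (-a)) (Ioi 0))
    (h0 : ∀ X : ℝ, 0 < X → ∫ y in Ioi (0 : ℝ), φ y * ((X + y ^ 2 : ℝ) : ℂ) ^ (-a) = 0) :
    ∀ y : ℝ, 0 < y → φ y = 0 := by
  set G : ℝ → ℂ := fun v => φ (√v) / (2 * √v) with hG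
  have hGc : ContinuousOn G (Ioi 0) := by
    refine ContinuousOn.div (hc.comp (by fun_prop) fun v hv => Real.sqrt_pos.2 hv) (by fun_prop) ?_
    intro v hv
    have := Real.sqrt_pos.2 hv
    simp [this.ne']
  have hsub : ∀ z : ℂ, ∀ x ∈ Ioi (0 : ℝ), (|(2 : ℝ)| * x ^ ((2 : ℝ) - 1)) •
      (exp (-(z * ((x ^ (2 : ℝ) : ℝ) : ℂ))) * G (x ^ (2 : ℝ))) = exp (-(z * x ^ 2)) * φ x := by
    intro z x hx
    have hx' : (0 : ℝ) < x := hx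
    have : ((x : ℝ) : ℂ) ≠ 0 := by exact_mod_cast hx'.ne'
    simp only [hG]
    rw [Real.rpow_two, Real.sqrt_sq hx'.le]
    norm_num
    field_simp
  have hGi : ∀ X : ℝ, 0 < X → IntegrableOn (fun t : ℝ => exp (-(X * t)) * G t) (Ioi 0) := by
    intro X hX
    refine (integrableOn_Ioi_comp_rpow_iff _ (two_ne_zero)).1 ?_
    refine (integrableOn_congr_fun (hsub X) measurableSet_Ioi).2 ?_
    exact integrableOn_mul_exp_sq ha hc hi hX
  have hL : ∀ t : ℝ, ∫ v in Ioi (0 : ℝ), exp (-(t * v)) * G v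
      = ∫ y in Ioi (0 : ℝ), exp (-(t * y ^ 2)) * φ y := by
    intro t
    rw [← integral_comp_rpow_Ioi (fun v : ℝ => exp (-(t * v)) * G v) two_ne_zero]
    exact setIntegral_congr_fun measurableSet_Ioi (hsub t)
  set L : ℝ → ℂ := fun t => ∫ v in Ioi (0 : ℝ), exp (-(t * v)) * G v with hLdef
  have hLc : ContinuousOn L (Ioi 0) := by
    have := (differentiableOn_laplace hGc hGi).continuousOn
    exact this.comp (f := fun t : ℝ => (t : ℂ)) (by fun_prop) fun t ht => by simpa using ht
  have hInt := fun X hX => integrable_prod_exp ha hc (X := X) hX (hi X hX)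
  have hrw : ∀ X t : ℝ, exp (-((X : ℂ) * t)) * ((t : ℂ) ^ (a - 1) * L t) =
      ∫ y in Ioi (0 : ℝ), (t : ℂ) ^ (a - 1) * exp (-((X + y ^ 2 : ℝ) * t)) * φ y := by
    intro X t
    rw [show L t = _ from hL t, ← integral_const_mul, ← integral_const_mul]
    congr 1
    ext y
    rw [show -(((X + y ^ 2 : ℝ) : ℂ) * t) = -((X : ℂ) * t) + -(t * y ^ 2) by push_cast; ring,
      Complex.exp_add]
    ring
  have hL0 : ∀ t : ℝ, 0 < t → L t = 0 := by
    intro t ht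
    have := laplace_injective (F := fun t : ℝ => (t : ℂ) ^ (a - 1) * L t) ?_ ?_ ?_ t ht
    · refine (mul_eq_zero.1 this).resolve_left ?_
      simp [cpow_eq_zero_iff, ht.ne']
    · refine ContinuousOn.mul (fun t ht => ?_) hLc
      exact (continuousAt_ofReal_cpow_const _ _ (Or.inr (ne_of_gt ht))).continuousWithinAt
    · intro X hX
      simp_rw [hrw]
      exact (hInt X hX).integral_prod_left
    · intro X hX
      simp_rw [hrw]
      rw [integral_integral_swap (hInt X hX)]
      have : ∀ y ∈ Ioi (0 : ℝ), ∫ t in Ioi (0 : ℝ),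
          (t : ℂ) ^ (a - 1) * exp (-((X + y ^ 2 : ℝ) * t)) * φ y =
          Gamma a * (φ y * ((X + y ^ 2 : ℝ) : ℂ) ^ (-a)) := by
        intro y hy
        have hXy : 0 < X + y ^ 2 := by positivity
        rw [integral_mul_const, integral_cpow_mul_exp_neg_mul_Ioi ha hXy, one_div, cpow_neg,
          inv_cpow]
        · ring
        · rw [arg_ofReal_of_nonneg hXy.le]; exact Real.pi_pos.ne
      rw [setIntegral_congr_fun measurableSet_Ioi this, integral_const_mul, h0 X hX, mul_zero]
  intro y hy
  have h2 := laplace_injective hGc hGi hL0 (y ^ 2) (by positivity)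
  simp only [hG, Real.sqrt_sq hy.le] at h2
  have : ((y : ℝ) : ℂ) ≠ 0 := by exact_mod_cast hy.ne'
  simpa [this] using h2

end Stieltjes
end Period

namespace Period
open Set Filter Topology Metric

/-- The upper half-plane as a set of complex numbers. -/
abbrev UH : Set ℂ := {z : ℂ | 0 < z.im}

theorem isOpen_UH : IsOpen UH := isOpen_lt continuous_const continuous_im

section Partial
variable {f g : ℂ → ℂ} {z : ℂ}

theorem pdx_mk (f : ℂ → ℂ) (x y : ℝ) : pdx f (x + y * I) = deriv (fun t : ℝ =>
    f (t + y * I)) x := by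
  simp [pdx]

theorem pdy_mk (f : ℂ → ℂ) (x y : ℝ) : pdy f (x + y * I) = deriv (fun t : ℝ =>
    f (x + t * I)) y := by
  simp [pdy]

theorem hasDerivAt_horizontal {f' : ℂ →L[ℝ] ℂ} {x y : ℝ} (h : HasFDerivAt f f' (x + y * I)) :
    HasDerivAt (fun t : ℝ => f (t + y * I)) (f' 1) x :=
  h.comp_hasDerivAt (f := fun t : ℝ => (t : ℂ) + y * I) x (ofRealCLM.hasDerivAt.add_const _)

theorem hasDerivAt_vertical {f' : ℂ →L[ℝ] ℂ} {x y : ℝ} (h : HasFDerivAt f f' (x + y * I)) :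
    HasDerivAt (fun t : ℝ => f (x + t * I)) (f' I) y := by
  refine h.comp_hasDerivAt (f := fun t : ℝ => (x : ℂ) + t * I) y ?_
  simpa using (ofRealCLM.hasDerivAt.mul_const I).const_add (x : ℂ)

theorem pdx_of_hasFDerivAt {f' : ℂ →L[ℝ] ℂ} (h : HasFDerivAt f f' z) : pdx f z = f' 1 := by
  rw [← re_add_im z] at h ⊢
  rw [pdx_mk]
  exact (hasDerivAt_horizontal h).deriv

theorem pdy_of_hasFDerivAt {f' : ℂ →L[ℝ] ℂ} (h : HasFDerivAt f f' z) : pdy f z = f' I := by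
  rw [← re_add_im z] at h ⊢
  rw [pdy_mk]
  exact (hasDerivAt_vertical h).deriv

theorem pdx_eq_fderiv (h : DifferentiableAt ℝ f z) : pdx f z = fderiv ℝ f z 1 :=
  pdx_of_hasFDerivAt h.hasFDerivAt

theorem pdy_eq_fderiv (h : DifferentiableAt ℝ f z) : pdy f z = fderiv ℝ f z I :=
  pdy_of_hasFDerivAt h.hasFDerivAt

theorem hasDerivAt_pdx {x y : ℝ} (h : DifferentiableAt ℝ f (x + y * I)) :
    HasDerivAt (fun t : ℝ => f (t + y * I)) (pdx f (x + y * I)) x := by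
  rw [pdx_eq_fderiv h]; exact hasDerivAt_horizontal h.hasFDerivAt

theorem hasDerivAt_pdy {x y : ℝ} (h : DifferentiableAt ℝ f (x + y * I)) :
    HasDerivAt (fun t : ℝ => f (x + t * I)) (pdy f (x + y * I)) y := by
  rw [pdy_eq_fderiv h]; exact hasDerivAt_vertical h.hasFDerivAt

theorem pdx_congr (hz : z ∈ UH) (h : EqOn f g UH) : pdx f z = pdx g z := by
  refine EventuallyEq.deriv_eq ?_
  have : Tendsto (fun x : ℝ => (x : ℂ) + z.im * I) (𝓝 z.re) (𝓝 z) := by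
    have : Continuous fun x : ℝ => (x : ℂ) + z.im * I := by fun_prop
    simpa using this.tendsto z.re
  filter_upwards [this.eventually (isOpen_UH.mem_nhds hz)] with x hx using h hx

theorem pdy_congr (hz : z ∈ UH) (h : EqOn f g UH) : pdy f z = pdy g z := by
  refine EventuallyEq.deriv_eq ?_
  have : Tendsto (fun y : ℝ => (z.re : ℂ) + y * I) (𝓝 z.im) (𝓝 z) := by
    have : Continuous fun y : ℝ => (z.re : ℂ) + y * I := by fun_prop
    simpa using this.tendsto z.im
  filter_upwards [this.eventually (isOpen_UH.mem_nhds hz)] with x hx using h hx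

theorem analyticOnNhd_pdx (h : AnalyticOnNhd ℝ f UH) : AnalyticOnNhd ℝ (pdx f) UH := by
  have h1 : AnalyticOnNhd ℝ (fun z => fderiv ℝ f z 1) UH := fun z hz =>
    ((ContinuousLinearMap.apply ℝ ℂ (1 : ℂ)).analyticAt _).comp (h.fderiv z hz)
  exact h1.congr isOpen_UH fun z hz => (pdx_eq_fderiv (h z hz).differentiableAt).symm

theorem analyticOnNhd_pdy (h : AnalyticOnNhd ℝ f UH) : AnalyticOnNhd ℝ (pdy f) UH := by
  have h1 : AnalyticOnNhd ℝ (fun z => fderiv ℝ f z I) UH := fun z hz =>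
    ((ContinuousLinearMap.apply ℝ ℂ I).analyticAt _).comp (h.fderiv z hz)
  exact h1.congr isOpen_UH fun z hz => (pdy_eq_fderiv (h z hz).differentiableAt).symm

theorem hasFDerivAt_fderiv (h : AnalyticOnNhd ℝ f UH) (hz : z ∈ UH) :
    HasFDerivAt (fderiv ℝ f) (fderiv ℝ (fderiv ℝ f) z) z :=
  (h.fderiv z hz).differentiableAt.hasFDerivAt

theorem pdx_pdx_eq (h : AnalyticOnNhd ℝ f UH) (hz : z ∈ UH) :
    pdx (pdx f) z = fderiv ℝ (fderiv ℝ f) z 1 1 := by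
  rw [pdx_congr hz (g := fun z => fderiv ℝ f z 1)
    fun w hw => pdx_eq_fderiv (h w hw).differentiableAt]
  exact pdx_of_hasFDerivAt ((hasFDerivAt_fderiv h hz).clm_apply (hasFDerivAt_const 1 z))
    |>.trans (by simp)

theorem pdy_pdy_eq (h : AnalyticOnNhd ℝ f UH) (hz : z ∈ UH) :
    pdy (pdy f) z = fderiv ℝ (fderiv ℝ f) z I I := by
  rw [pdy_congr hz (g := fun z => fderiv ℝ f z I)
    fun w hw => pdy_eq_fderiv (h w hw).differentiableAt]
  exact pdy_of_hasFDerivAt ((hasFDerivAt_fderiv h hz).clm_apply (hasFDerivAt_const I z))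
    |>.trans (by simp)

theorem fderiv_apply_eq (h : AnalyticOnNhd ℝ f UH) (hz : z ∈ UH) (w : ℂ) :
    fderiv ℝ f z w = w.re * pdx f z + w.im * pdy f z := by
  have hw : w = w.re • (1 : ℂ) + w.im • I := by simp [re_add_im]
  rw [pdx_eq_fderiv (h z hz).differentiableAt, pdy_eq_fderiv (h z hz).differentiableAt]
  conv_lhs => rw [hw, map_add, map_smul, map_smul]
  simp

/-- The Laplacian is the trace of the second derivative in any orthogonal frame `w, i w`. -/
theorem snd_fderiv_trace (h : AnalyticOnNhd ℝ f UH) (hz : z ∈ UH) (w : ℂ) :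
    fderiv ℝ (fderiv ℝ f) z w w + fderiv ℝ (fderiv ℝ f) z (I * w) (I * w) =
      (normSq w : ℂ) * (pdx (pdx f) z + pdy (pdy f) z) := by
  have hs := (h z hz).contDiffAt.isSymmSndFDerivAt_of_omega 1 I
  rw [pdx_pdx_eq h hz, pdy_pdy_eq h hz]
  have hw : w = w.re • (1 : ℂ) + w.im • I := by simp [re_add_im]
  have hw' : I * w = (-w.im) • (1 : ℂ) + w.re • I := by
    conv_lhs => rw [← re_add_im w]
    simp only [real_smul, ofReal_neg]
    linear_combination (w.im : ℂ) * I_sq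
  rw [hw']
  set D := fderiv ℝ (fderiv ℝ f) z
  have e1 : D w w = D (w.re • (1 : ℂ) + w.im • I) (w.re • (1 : ℂ) + w.im • I) := by rw [← hw]
  rw [e1]
  simp only [map_add, map_smul, add_apply, smul_apply]
  rw [← hs]
  simp only [real_smul, normSq_apply]
  push_cast
  ring

theorem pdx_pdy_comm (h : AnalyticOnNhd ℝ f UH) (hz : z ∈ UH) :
    pdx (pdy f) z = pdy (pdx f) z := by
  have hd : HasFDerivAt (fderiv ℝ f) (fderiv ℝ (fderiv ℝ f) z) z :=
    (h.fderiv z hz).differentiableAt.hasFDerivAt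
  have h1 : pdx (pdy f) z = fderiv ℝ (fderiv ℝ f) z 1 I := by
    rw [pdx_congr hz (g := fun z => fderiv ℝ f z I)
      fun w hw => pdy_eq_fderiv (h w hw).differentiableAt]
    exact pdx_of_hasFDerivAt (hd.clm_apply (hasFDerivAt_const I z)) |>.trans (by simp)
  have h2 : pdy (pdx f) z = fderiv ℝ (fderiv ℝ f) z I 1 := by
    rw [pdy_congr hz (g := fun z => fderiv ℝ f z 1)
      fun w hw => pdx_eq_fderiv (h w hw).differentiableAt]
    exact pdy_of_hasFDerivAt (hd.clm_apply (hasFDerivAt_const 1 z)) |>.trans (by simp)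
  rw [h1, h2]
  exact (h z hz).contDiffAt.isSymmSndFDerivAt_of_omega 1 I

end Partial

theorem pdx_sub {a b : ℂ → ℂ} (ha : AnalyticOnNhd ℝ a UH) (hb : AnalyticOnNhd ℝ b UH) {z : ℂ}
    (hz : z ∈ UH) : pdx (fun z => a z - b z) z = pdx a z - pdx b z := by
  rw [pdx_of_hasFDerivAt ((ha z hz).differentiableAt.hasFDerivAt.fun_sub
    (hb z hz).differentiableAt.hasFDerivAt), pdx_eq_fderiv (ha z hz).differentiableAt,
    pdx_eq_fderiv (hb z hz).differentiableAt]; rfl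

theorem pdy_sub {a b : ℂ → ℂ} (ha : AnalyticOnNhd ℝ a UH) (hb : AnalyticOnNhd ℝ b UH) {z : ℂ}
    (hz : z ∈ UH) : pdy (fun z => a z - b z) z = pdy a z - pdy b z := by
  rw [pdy_of_hasFDerivAt ((ha z hz).differentiableAt.hasFDerivAt.fun_sub
    (hb z hz).differentiableAt.hasFDerivAt), pdy_eq_fderiv (ha z hz).differentiableAt,
    pdy_eq_fderiv (hb z hz).differentiableAt]; rfl

/-- Real-analytic solutions of `v_xx + v_yy = -λ y⁻² v` on the upper half-plane. -/
structure IsEigen (l : ℂ) (v : ℂ → ℂ) : Prop where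
  analytic : AnalyticOnNhd ℝ v UH
  eqn : ∀ z ∈ UH, pdx (pdx v) z = -pdy (pdy v) z - l / (z.im : ℂ) ^ 2 * v z

theorem isEigen_iff_laplace {l : ℂ} {v : ℂ → ℂ} (h : AnalyticOnNhd ℝ v UH) :
    IsEigen l v ↔ ∀ z : ℂ, 0 < z.im → laplace v z = l * v z := by
  have key : ∀ z ∈ UH, (pdx (pdx v) z = -pdy (pdy v) z - l / (z.im : ℂ) ^ 2 * v z ↔
      laplace v z = l * v z) := by
    intro z hz
    have hz' : (z.im : ℂ) ≠ 0 := by exact_mod_cast (ne_of_gt hz)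
    rw [laplace]
    constructor
    · intro h; rw [h]; field_simp; ring
    · intro h
      have : pdx (pdx v) z + pdy (pdy v) z = - l / (z.im : ℂ) ^ 2 * v z := by
        field_simp; linear_combination -h
      linear_combination this
  exact ⟨fun H z hz => (key z hz).1 (H.eqn z hz), fun H => ⟨h, fun z hz => (key z hz).2 (H z hz)⟩⟩

namespace IsEigen
variable {l : ℂ} {v w : ℂ → ℂ}

theorem sub (hv : IsEigen l v) (hw : IsEigen l w) : IsEigen l (fun z => v z - w z) := by
  refine ⟨hv.analytic.sub hw.analytic, fun z hz => ?_⟩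
  rw [pdx_congr hz fun _ => pdx_sub hv.analytic hw.analytic, pdy_congr hz fun _ =>
    pdy_sub hv.analytic hw.analytic,
    pdx_sub (analyticOnNhd_pdx hv.analytic) (analyticOnNhd_pdx hw.analytic) hz,
    pdy_sub (analyticOnNhd_pdy hv.analytic) (analyticOnNhd_pdy hw.analytic) hz,
    hv.eqn z hz, hw.eqn z hz]
  ring

theorem pdx_pdy_sq (h : IsEigen l v) {z : ℂ} (hz : z ∈ UH) :
    pdx (pdy (pdy v)) z = pdy (pdy (pdx v)) z := by
  rw [pdx_pdy_comm (analyticOnNhd_pdy h.analytic) hz]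
  exact pdy_congr hz fun w hw => pdx_pdy_comm h.analytic hw

theorem pdx (h : IsEigen l v) : IsEigen l (pdx v) := by
  refine ⟨analyticOnNhd_pdx h.analytic, fun z hz => ?_⟩
  rw [← h.pdx_pdy_sq hz]
  rw [pdx_congr hz h.eqn]
  have h1 := (analyticOnNhd_pdy (analyticOnNhd_pdy h.analytic) z hz).differentiableAt
  have h2 := (h.analytic z hz).differentiableAt
  rw [← re_add_im z] at h1 h2
  have := ((hasDerivAt_pdx h1).neg.sub ((hasDerivAt_pdx h2).const_mul (l / (z.im : ℂ) ^ 2))).deriv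
  simp only [re_add_im] at this
  rw [← this, _root_.pdx]
  simp
  rfl

theorem iterate_pdx (h : IsEigen l v) (k : ℕ) : IsEigen l (_root_.pdx^[k] v) := by
  induction k with
  | zero => exact h
  | succ k ih => rw [Function.iterate_succ_apply']; exact ih.pdx

theorem eq_zero_of_axis (h : IsEigen l v) (h0 : ∀ y : ℝ, 0 < y → v (y * I) = 0)
    (h1 : ∀ y : ℝ, 0 < y → _root_.pdx v (y * I) = 0) : ∀ z ∈ UH, v z = 0 := by
  have hk : ∀ k : ℕ, ∀ y : ℝ, 0 < y → (_root_.pdx^[k] v) (y * I) = 0 ∧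
      (_root_.pdx^[k + 1] v) (y * I) = 0 := by
    intro k
    induction k with
    | zero => exact fun y hy => ⟨h0 y hy, h1 y hy⟩
    | succ k ih =>
      refine fun y hy => ⟨(ih y hy).2, ?_⟩
      rw [Function.iterate_succ_apply', Function.iterate_succ_apply',
        (h.iterate_pdx k).eqn _ (by simpa using hy), (ih y hy).1, mul_zero, sub_zero, neg_eq_zero]
      have hz : ∀ t : ℝ, 0 < t → pdy (_root_.pdx^[k] v) (t * I) = 0 := by
        intro t ht
        have := pdy_mk (_root_.pdx^[k] v) 0 t
        simp only [ofReal_zero, zero_add] at this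
        rw [this]
        refine (EventuallyEq.deriv_eq (f := fun _ => (0 : ℂ)) ?_).trans (deriv_const _ _)
        filter_upwards [lt_mem_nhds ht] with t' ht' using (ih t' ht').1
      have := pdy_mk (pdy (_root_.pdx^[k] v)) 0 y
      simp only [ofReal_zero, zero_add] at this
      rw [this]
      refine (EventuallyEq.deriv_eq (f := fun _ => (0 : ℂ)) ?_).trans (deriv_const _ _)
      filter_upwards [lt_mem_nhds hy] with t' ht' using hz t' ht'
  intro z hz
  set y := z.im with hy
  set H : ℝ → ℂ := fun x => v (x + y * I) with hH
  have hHa : AnalyticOnNhd ℝ H univ := by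
    intro x _
    have hx : (x : ℂ) + y * I ∈ UH := by simpa using hz
    refine (h.analytic _ hx).fun_comp (f := fun x : ℝ => (x : ℂ) + y * I) ?_
    exact (ofRealCLM.analyticAt x).add analyticAt_const
  have hit : ∀ k : ℕ, deriv^[k] H = fun x : ℝ => (_root_.pdx^[k] v) (x + y * I) := by
    intro k
    induction k with
    | zero => rfl
    | succ k ih =>
      rw [Function.iterate_succ_apply', ih]
      ext x
      rw [Function.iterate_succ_apply', pdx_mk]
  have hev : ∀ᶠ x in 𝓝 0, H x = 0 := by
    rw [← analyticOrderAt_eq_top, ENat.eq_top_iff_forall_ge]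
    intro m
    rw [natCast_le_analyticOrderAt_iff_iteratedDeriv_eq_zero (hHa 0 trivial)]
    intro i _
    rw [iteratedDeriv_eq_iterate, hit]
    simpa using (hk i y hz).1
  have := hHa.eqOn_zero_of_preconnected_of_eventuallyEq_zero isPreconnected_univ (mem_univ 0) hev
    (mem_univ z.re)
  simpa [hH, hy] using this

end IsEigen
end Period

namespace Period
open Set Filter Topology Metric

theorem hasDerivAt_intervalIntegral_of_continuousOn {K K' : ℝ → ℝ → ℂ} {a b R r₀ : ℝ}
    (hr₀ : r₀ ∈ ball (0 : ℝ) R)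
    (hK : ∀ r ∈ ball (0 : ℝ) R, Continuous (K r))
    (hd : ∀ r ∈ ball (0 : ℝ) R, ∀ θ, HasDerivAt (fun r => K r θ) (K' r θ) r)
    (hK' : ContinuousOn (Function.uncurry K') (ball (0 : ℝ) R ×ˢ univ)) :
    HasDerivAt (fun r => ∫ θ in a..b, K r θ) (∫ θ in a..b, K' r₀ θ) r₀ := by
  obtain ⟨ε, hε, hsub⟩ := nhds_basis_closedBall.mem_iff.1 (isOpen_ball.mem_nhds hr₀)
  have hcomp : IsCompact (closedBall r₀ ε ×ˢ uIcc a b) :=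
    (isCompact_closedBall _ _).prod isCompact_uIcc
  obtain ⟨C, hC⟩ := hcomp.exists_bound_of_continuousOn
    (hK'.mono (prod_mono hsub (subset_univ _)))
  refine (intervalIntegral.hasDerivAt_integral_of_dominated_loc_of_deriv_le
    (closedBall_mem_nhds r₀ hε) (bound := fun _ => C) ?_ ?_ ?_ ?_ ?_ ?_).2
  · filter_upwards [isOpen_ball.mem_nhds hr₀] with r hr
    exact (hK r hr).aestronglyMeasurable
  · exact (hK r₀ hr₀).intervalIntegrable _ _
  · have : Continuous (K' r₀) := by
      rw [← continuousOn_univ]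
      exact hK'.comp (f := fun θ => (r₀, θ)) (by fun_prop) fun θ _ => ⟨hr₀, trivial⟩
    exact this.aestronglyMeasurable
  · exact Eventually.of_forall fun θ hθ r hr => hC (r, θ) ⟨hr, uIoc_subset_uIcc hθ⟩
  · exact _root_.intervalIntegrable_const
  · exact Eventually.of_forall fun θ _ r hr => hd r (hsub hr) θ


theorem continuous_slice {F : Type*} [TopologicalSpace F] {g : ℝ → ℝ → F} {U : Set ℝ}
    (hg : ContinuousOn (Function.uncurry g) (U ×ˢ univ)) {r : ℝ} (hr : r ∈ U) :
    Continuous (g r) := by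
  rw [← continuousOn_univ]
  exact hg.comp (f := fun θ => (r, θ)) (by fun_prop) fun θ _ => ⟨hr, trivial⟩

/-- Bound for the first angular mode of a function in polar coordinates whose Laplacian is
bounded. -/
theorem norm_angular_mode_le {v a b c d : ℝ → ℝ → ℂ} {k k₁ : ℝ → ℝ} {M L : ℝ}
    (hv : ContinuousOn (Function.uncurry v) (ball 0 2 ×ˢ univ))
    (ha : ContinuousOn (Function.uncurry a) (ball 0 2 ×ˢ univ))
    (hb : ContinuousOn (Function.uncurry b) (ball 0 2 ×ˢ univ))
    (hd : ContinuousOn (Function.uncurry d) (ball 0 2 ×ˢ univ))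
    (hva : ∀ r ∈ ball (0 : ℝ) 2, ∀ θ, HasDerivAt (fun r => v r θ) (a r θ) r)
    (hab : ∀ r ∈ ball (0 : ℝ) 2, ∀ θ, HasDerivAt (fun r => a r θ) (b r θ) r)
    (hvc : ∀ r ∈ ball (0 : ℝ) 2, ∀ θ, HasDerivAt (v r) (c r θ) θ)
    (hcd : ∀ r ∈ ball (0 : ℝ) 2, ∀ θ, HasDerivAt (c r) (d r θ) θ)
    (hvp : ∀ r ∈ ball (0 : ℝ) 2, v r (2 * Real.pi) = v r 0)
    (hcp : ∀ r ∈ ball (0 : ℝ) 2, c r (2 * Real.pi) = c r 0)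
    (hv0 : ∀ θ, v 0 θ = v 0 0)
    (hM : ∀ r ∈ Icc (0 : ℝ) 1, ∀ θ, ‖v r θ‖ ≤ M)
    (hL : ∀ r ∈ Icc (0 : ℝ) 1, ∀ θ, ‖r ^ 2 * b r θ + r * a r θ + d r θ‖ ≤ r ^ 2 * L)
    (hk : ∀ θ, HasDerivAt k (k₁ θ) θ) (hk₁ : ∀ θ, HasDerivAt k₁ (-k θ) θ)
    (hkp : k (2 * Real.pi) = k 0) (hk₁p : k₁ (2 * Real.pi) = k₁ 0) (hkb : ∀ θ, |k θ| ≤ 1) :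
    ‖∫ θ in (0 : ℝ)..2 * Real.pi, a 0 θ * k θ‖ ≤ 2 * Real.pi * (M + L) := by
  have hkc : Continuous k := continuous_iff_continuousAt.2 fun θ => (hk θ).continuousAt
  have hk₁c : Continuous k₁ := continuous_iff_continuousAt.2 fun θ => (hk₁ θ).continuousAt
  have hkc2 : Continuous fun q : ℝ × ℝ => (k q.2 : ℂ) := by fun_prop
  have hpi := Real.two_pi_pos
  set H : ℝ → ℂ := fun r => ∫ θ in (0 : ℝ)..2 * Real.pi, v r θ * k θ with hH
  set H' : ℝ → ℂ := fun r => ∫ θ in (0 : ℝ)..2 * Real.pi, a r θ * k θ with hH'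
  set H'' : ℝ → ℂ := fun r => ∫ θ in (0 : ℝ)..2 * Real.pi, b r θ * k θ with hH''
  have hHd : ∀ r ∈ ball (0 : ℝ) 2, HasDerivAt H (H' r) r := fun r hr =>
    hasDerivAt_intervalIntegral_of_continuousOn (K := fun r θ => v r θ * k θ)
      (K' := fun r θ => a r θ * k θ) hr
      (fun r hr => (continuous_slice hv hr).mul (by fun_prop))
      (fun r hr θ => (hva r hr θ).mul_const _) (ha.mul hkc2.continuousOn)
  have hH'd : ∀ r ∈ ball (0 : ℝ) 2, HasDerivAt H' (H'' r) r := fun r hr =>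
    hasDerivAt_intervalIntegral_of_continuousOn (K := fun r θ => a r θ * k θ)
      (K' := fun r θ => b r θ * k θ) hr
      (fun r hr => (continuous_slice ha hr).mul (by fun_prop))
      (fun r hr θ => (hab r hr θ).mul_const _) (hb.mul hkc2.continuousOn)
  have hparts : ∀ r ∈ ball (0 : ℝ) 2, ∫ θ in (0 : ℝ)..2 * Real.pi, d r θ * k θ = -H r := by
    intro r hr
    have hprim : ∀ θ : ℝ, HasDerivAt (fun θ : ℝ => c r θ * k θ - v r θ * k₁ θ)
        (d r θ * k θ + v r θ * k θ) θ := by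
      intro θ
      refine (((hcd r hr θ).mul (hk θ).ofReal_comp).sub
        ((hvc r hr θ).mul (hk₁ θ).ofReal_comp)).congr_deriv ?_
      push_cast; ring
    have i1 : IntervalIntegrable (fun θ => d r θ * k θ) volume 0 (2 * Real.pi) :=
      ((continuous_slice hd hr).mul (by fun_prop)).intervalIntegrable _ _
    have i2 : IntervalIntegrable (fun θ => v r θ * k θ) volume 0 (2 * Real.pi) :=
      ((continuous_slice hv hr).mul (by fun_prop)).intervalIntegrable _ _
    have := intervalIntegral.integral_eq_sub_of_hasDerivAt (fun θ _ => hprim θ) (i1.add i2)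
    rw [intervalIntegral.integral_add i1 i2, hvp r hr, hcp r hr, hkp, hk₁p, sub_self] at this
    exact eq_neg_of_add_eq_zero_left this
  have hIcc : ∀ r ∈ Icc (0 : ℝ) 1, r ∈ ball (0 : ℝ) 2 := fun r hr => by
    rw [mem_ball_zero_iff, Real.norm_eq_abs, abs_of_nonneg hr.1]; linarith [hr.2]
  have hInt : ∀ {C : ℝ} {w : ℝ → ℂ}, (∀ θ, ‖w θ‖ ≤ C) →
      ‖∫ θ in (0 : ℝ)..2 * Real.pi, w θ * k θ‖ ≤ 2 * Real.pi * C := by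
    intro C w hw
    have := intervalIntegral.norm_integral_le_of_norm_le_const (a := 0) (b := 2 * Real.pi)
      (f := fun θ => w θ * k θ) (C := C) fun θ _ => by
        rw [norm_mul, norm_real]
        exact (mul_le_of_le_one_right (norm_nonneg _) (hkb θ)).trans (hw θ)
    rwa [sub_zero, abs_of_pos hpi, mul_comm C] at this
  set G : ℝ → ℂ := fun r => r ^ 2 * H' r - r * H r with hG
  have hGd : ∀ r ∈ ball (0 : ℝ) 2, HasDerivAt G (r ^ 2 * H'' r + r * H' r - H r) r := by
    intro r hr
    have hr1 : HasDerivAt (fun r : ℝ => (r : ℂ)) 1 r := ofRealCLM.hasDerivAt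
    refine (((hr1.pow 2).mul (hH'd r hr)).sub (hr1.mul (hHd r hr))).congr_deriv ?_
    simp; ring
  have hGd_le : ∀ r ∈ Icc (0 : ℝ) 1, ‖(r : ℂ) ^ 2 * H'' r + r * H' r - H r‖ ≤
      2 * Real.pi * (r ^ 2 * L) := by
    intro r hr
    have hr' := hIcc r hr
    have i1 : IntervalIntegrable (fun θ => d r θ * k θ) volume 0 (2 * Real.pi) :=
      ((continuous_slice hd hr').mul (by fun_prop)).intervalIntegrable _ _
    have i2 : IntervalIntegrable (fun θ => a r θ * k θ) volume 0 (2 * Real.pi) :=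
      ((continuous_slice ha hr').mul (by fun_prop)).intervalIntegrable _ _
    have i3 : IntervalIntegrable (fun θ => b r θ * k θ) volume 0 (2 * Real.pi) :=
      ((continuous_slice hb hr').mul (by fun_prop)).intervalIntegrable _ _
    have : (r : ℂ) ^ 2 * H'' r + r * H' r - H r =
        ∫ θ in (0 : ℝ)..2 * Real.pi, (r ^ 2 * b r θ + r * a r θ + d r θ) * k θ := by
      rw [sub_eq_add_neg, ← hparts r hr', hH', hH'', ← intervalIntegral.integral_const_mul,
        ← intervalIntegral.integral_const_mul, ← intervalIntegral.integral_add
        (i3.const_mul _) (i2.const_mul _), ← intervalIntegral.integral_add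
        ((i3.const_mul _).add (i2.const_mul _)) i1]
      refine intervalIntegral.integral_congr fun θ _ => ?_
      ring
    rw [this]
    exact hInt (hL r hr)
  have hL0 : 0 ≤ L := by
    have := (norm_nonneg _).trans (hL 1 (by simp) 0)
    simpa using this
  have hG0 : G 0 = 0 := by simp [hG]
  have hG_le : ∀ r ∈ Icc (0 : ℝ) 1, ‖G r‖ ≤ 2 * Real.pi * L * r ^ 3 := by
    intro r hr
    have := (convex_Icc (0 : ℝ) r).norm_image_sub_le_of_norm_hasDerivWithin_le
      (C := 2 * Real.pi * (r ^ 2 * L)) (f := G)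
      (fun x hx => (hGd x (hIcc x ⟨hx.1, hx.2.trans hr.2⟩)).hasDerivWithinAt)
      (fun x hx => (hGd_le x ⟨hx.1, hx.2.trans hr.2⟩).trans ?_)
      (left_mem_Icc.2 hr.1) (right_mem_Icc.2 hr.1)
    · rw [hG0, sub_zero, sub_zero, Real.norm_eq_abs, abs_of_nonneg hr.1] at this
      linarith
    · have := pow_le_pow_left₀ hx.1 hx.2 2
      gcongr
  have hH0 : H 0 = 0 := by
    have : ∫ θ in (0 : ℝ)..2 * Real.pi, (k θ : ℂ) = 0 := by
      have := intervalIntegral.integral_eq_sub_of_hasDerivAt (a := 0) (b := 2 * Real.pi)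
        (fun θ _ => (hk₁ θ).neg) (by simpa using hkc.intervalIntegrable _ _)
      simp only [neg_neg, Pi.neg_apply, hk₁p, sub_self] at this
      rw [intervalIntegral.integral_ofReal, this, ofReal_zero]
    simp only [hH, hv0, intervalIntegral.integral_const_mul, this, mul_zero]
  have hquot : ∀ r ∈ Ioc (0 : ℝ) 1, ‖H r / r‖ ≤ 2 * Real.pi * (M + L) := by
    intro r hr
    have hq : ∀ x ∈ Icc r 1, HasDerivWithinAt (fun x : ℝ => H x / x) (G x / x ^ 3) (Icc r 1) x := by
      intro x hx
      have hx0 : (x : ℂ) ≠ 0 := by exact_mod_cast (hr.1.trans_le hx.1).ne'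
      refine (((hHd x (hIcc x ⟨hr.1.le.trans hx.1, hx.2⟩)).div
        (ofRealCLM.hasDerivAt (x := x)) hx0).congr_deriv ?_).hasDerivWithinAt
      simp only [hG, ofRealCLM_apply, ofReal_one]
      field_simp
    have hq' : ∀ x ∈ Icc r 1, ‖G x / (x : ℂ) ^ 3‖ ≤ 2 * Real.pi * L := by
      intro x hx
      have hx0 : 0 < x := hr.1.trans_le hx.1
      rw [norm_div, norm_pow, norm_real, Real.norm_eq_abs, abs_of_pos hx0,
        div_le_iff₀ (by positivity)]
      exact hG_le x ⟨hx0.le, hx.2⟩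
    have h1 := (convex_Icc r 1).norm_image_sub_le_of_norm_hasDerivWithin_le hq hq'
      (right_mem_Icc.2 hr.2) (left_mem_Icc.2 hr.2)
    have h2 : ‖H 1‖ ≤ 2 * Real.pi * M := hInt (hM 1 (by simp))
    have h3 : ‖H r / r‖ ≤ ‖H r / r - H 1 / (1 : ℝ)‖ + ‖H 1 / (1 : ℝ)‖ := by
      simpa using norm_add_le (H r / r - H 1 / (1 : ℝ)) (H 1 / (1 : ℝ))
    have h4 : ‖r - 1‖ ≤ 1 := by
      rw [Real.norm_eq_abs, abs_le]; constructor <;> linarith [hr.1, hr.2]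
    have h5 : 2 * Real.pi * L * ‖r - 1‖ ≤ 2 * Real.pi * L := mul_le_of_le_one_right
      (by positivity) h4
    have h6 : ‖H 1 / ((1 : ℝ) : ℂ)‖ = ‖H 1‖ := by simp
    linarith
  have hlim : Tendsto (fun r : ℝ => H r / r) (𝓝[>] 0) (𝓝 (H' 0)) := by
    have := (hasDerivAt_iff_tendsto_slope_zero.1 (hHd 0 (by simp))).mono_left
      (nhdsGT_le_nhdsNE 0)
    refine this.congr fun r => ?_
    simp [hH0, div_eq_inv_mul]
  refine le_of_tendsto hlim.norm ?_
  filter_upwards [Ioc_mem_nhdsGT zero_lt_one] with r hr using hquot r hr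

section Gradient
variable {l : ℂ} {u : ℂ → ℂ} {z₀ : ℂ}

theorem polar_mem_UH (hz : 2 ≤ z₀.im) {r : ℝ} (hr : r ∈ ball (0 : ℝ) 2) (θ : ℝ) :
    z₀ + r * exp (θ * I) ∈ UH := by
  have h1 : |(r * exp (θ * I)).im| ≤ ‖(r : ℂ) * exp (θ * I)‖ := abs_im_le_norm _
  rw [norm_mul, norm_exp_ofReal_mul_I, norm_real, mul_one] at h1
  rw [mem_ball_zero_iff] at hr
  have := (abs_le.1 h1).1
  simp only [mem_ofPred_eq, add_im]
  linarith

theorem continuousOn_polar {F : Type*} [TopologicalSpace F] {g : ℂ → F} (hg : ContinuousOn g UH)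
    (hz : 2 ≤ z₀.im) : ContinuousOn (Function.uncurry fun r θ : ℝ => g (z₀ + r * exp (θ * I)))
      (ball 0 2 ×ˢ univ) :=
  hg.comp (f := fun q : ℝ × ℝ => z₀ + q.1 * exp (q.2 * I)) (by fun_prop)
    fun q hq => polar_mem_UH hz hq.1 q.2

theorem hasDerivAt_exp_mul_I (θ : ℝ) :
    HasDerivAt (fun θ : ℝ => exp (θ * I)) (I * exp (θ * I)) θ := by
  simpa [mul_comm] using ((ofRealCLM.hasDerivAt (x := θ)).mul_const I).cexp

/-- Angular mode estimate for an eigenfunction. -/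
theorem IsEigen.norm_angular_mode_le (hu : IsEigen l u) (hz : 2 ≤ z₀.im) {M : ℝ}
    (hM : ∀ z ∈ closedBall z₀ 1, ‖u z‖ ≤ M) {k k₁ : ℝ → ℝ}
    (hk : ∀ θ, HasDerivAt k (k₁ θ) θ) (hk₁ : ∀ θ, HasDerivAt k₁ (-k θ) θ)
    (hkp : k (2 * Real.pi) = k 0) (hk₁p : k₁ (2 * Real.pi) = k₁ 0) (hkb : ∀ θ, |k θ| ≤ 1) :
    ‖∫ θ in (0 : ℝ)..2 * Real.pi, fderiv ℝ u z₀ (exp (θ * I)) * k θ‖ ≤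
      2 * Real.pi * (M + ‖l‖ * M) := by
  have hDu : ∀ z ∈ UH, HasFDerivAt u (fderiv ℝ u z) z := fun z hz =>
    (hu.analytic z hz).differentiableAt.hasFDerivAt
  have hr_deriv : ∀ r θ : ℝ, HasDerivAt (fun r : ℝ => z₀ + r * exp (θ * I)) (exp (θ * I)) r := by
    intro r θ
    simpa using ((ofRealCLM.hasDerivAt (x := r)).mul_const (exp (θ * I))).const_add z₀
  have hθ_deriv : ∀ r θ : ℝ, HasDerivAt (fun θ : ℝ => z₀ + r * exp (θ * I))
      (r * (I * exp (θ * I))) θ := fun r θ =>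
    ((hasDerivAt_exp_mul_I θ).const_mul (r : ℂ)).const_add z₀
  set D := fderiv ℝ u with hD
  set D2 := fderiv ℝ D with hD2
  have hDD : ∀ z ∈ UH, HasFDerivAt D (D2 z) z := fun z hz => hasFDerivAt_fderiv hu.analytic hz
  have cD0 : ContinuousOn D UH := hu.analytic.fderiv.continuousOn
  have cD20 : ContinuousOn D2 UH := hu.analytic.fderiv.fderiv.continuousOn
  have cD := continuousOn_polar cD0 hz
  have cD2 := continuousOn_polar cD20 hz
  have cE : ContinuousOn (Function.uncurry fun _ θ : ℝ => exp (θ * I))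
      (ball 0 2 ×ˢ univ) := by
    simp only [Function.uncurry_def]; fun_prop
  have cE' : ContinuousOn (Function.uncurry fun r θ : ℝ => (r : ℂ) * (I * exp (θ * I)))
      (ball 0 2 ×ˢ univ) := by
    simp only [Function.uncurry_def]; fun_prop
  have cE'' : ContinuousOn (Function.uncurry fun r θ : ℝ => (r : ℂ) * (I * (I * exp (θ * I))))
      (ball 0 2 ×ˢ univ) := by
    simp only [Function.uncurry_def]; fun_prop
  have ha : ContinuousOn (Function.uncurry fun r θ : ℝ =>
      D (z₀ + r * exp (θ * I)) (exp (θ * I))) (ball 0 2 ×ˢ univ) := cD.clm_apply cE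
  have hb : ContinuousOn (Function.uncurry fun r θ : ℝ =>
      D2 (z₀ + r * exp (θ * I)) (exp (θ * I)) (exp (θ * I))) (ball 0 2 ×ˢ univ) :=
    (cD2.clm_apply cE).clm_apply cE
  have hd : ContinuousOn (Function.uncurry fun r θ : ℝ =>
      D2 (z₀ + r * exp (θ * I)) (r * (I * exp (θ * I))) (r * (I * exp (θ * I))) +
        D (z₀ + r * exp (θ * I)) (r * (I * (I * exp (θ * I))))) (ball 0 2 ×ˢ univ) :=
    ((cD2.clm_apply cE').clm_apply cE').add (cD.clm_apply cE'')
  have hva : ∀ r ∈ ball (0 : ℝ) 2, ∀ θ : ℝ, HasDerivAt (fun r : ℝ => u (z₀ + r * exp (θ * I)))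
      (D (z₀ + r * exp (θ * I)) (exp (θ * I))) r := fun r hr θ =>
    (hDu _ (polar_mem_UH hz hr θ)).comp_hasDerivAt r (hr_deriv r θ)
  have hvc : ∀ r ∈ ball (0 : ℝ) 2, ∀ θ : ℝ, HasDerivAt (fun θ : ℝ => u (z₀ + r * exp (θ * I)))
      (D (z₀ + r * exp (θ * I)) (r * (I * exp (θ * I)))) θ := fun r hr θ =>
    (hDu _ (polar_mem_UH hz hr θ)).comp_hasDerivAt θ (hθ_deriv r θ)
  have hab : ∀ r ∈ ball (0 : ℝ) 2, ∀ θ : ℝ,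
      HasDerivAt (fun r : ℝ => D (z₀ + r * exp (θ * I)) (exp (θ * I)))
      (D2 (z₀ + r * exp (θ * I)) (exp (θ * I)) (exp (θ * I))) r := fun r hr θ => by
    have h1 : HasDerivAt (fun r : ℝ => D (z₀ + r * exp (θ * I)))
      (D2 (z₀ + r * exp (θ * I)) (exp (θ * I))) r :=
      (hDD _ (polar_mem_UH hz hr θ)).comp_hasDerivAt r (hr_deriv r θ)
    simpa using h1.clm_apply (hasDerivAt_const r (exp (θ * I)))
  have hcd : ∀ r ∈ ball (0 : ℝ) 2, ∀ θ : ℝ,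
      HasDerivAt (fun θ : ℝ => D (z₀ + r * exp (θ * I)) (r * (I * exp (θ * I))))
      (D2 (z₀ + r * exp (θ * I)) (r * (I * exp (θ * I))) (r * (I * exp (θ * I))) +
        D (z₀ + r * exp (θ * I)) (r * (I * (I * exp (θ * I))))) θ := fun r hr θ => by
    have h1 : HasDerivAt (fun θ : ℝ => D (z₀ + r * exp (θ * I)))
      (D2 (z₀ + r * exp (θ * I)) (r * (I * exp (θ * I)))) θ :=
      (hDD _ (polar_mem_UH hz hr θ)).comp_hasDerivAt θ (hθ_deriv r θ)
    exact h1.clm_apply (((hasDerivAt_exp_mul_I θ).const_mul I).const_mul (r : ℂ))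
  have key := Period.norm_angular_mode_le (M := M) (L := ‖l‖ * M)
    (continuousOn_polar hu.analytic.continuousOn hz) ha hb hd hva hab hvc hcd
    (fun r hr => by simp [exp_two_pi_mul_I]) (fun r hr => by simp [exp_two_pi_mul_I])
    (fun θ => by simp) ?_ ?_ hk hk₁ hkp hk₁p hkb
  · simpa using key
  · intro r hr θ
    refine hM _ ?_
    rw [mem_closedBall, dist_eq_norm, add_sub_cancel_left, norm_mul, norm_exp_ofReal_mul_I,
      norm_real, mul_one, Real.norm_eq_abs, abs_of_nonneg hr.1]
    exact hr.2
  · intro r hr θ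
    have hr' : r ∈ ball (0 : ℝ) 2 := by
      rw [mem_ball_zero_iff, Real.norm_eq_abs, abs_of_nonneg hr.1]; linarith [hr.2]
    have hmem := polar_mem_UH hz hr' θ
    set z := z₀ + r * exp (θ * I) with hzdef
    have hzc : z ∈ closedBall z₀ 1 := by
      rw [mem_closedBall, dist_eq_norm, add_sub_cancel_left, norm_mul, norm_exp_ofReal_mul_I,
        norm_real, mul_one, Real.norm_eq_abs, abs_of_nonneg hr.1]
      exact hr.2
    have htr := snd_fderiv_trace hu.analytic hmem (exp (θ * I))
    rw [← hD, ← hD2] at htr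
    have hn : normSq (exp (θ * I)) = 1 := by
      rw [normSq_eq_norm_sq, norm_exp_ofReal_mul_I, one_pow]
    rw [hn, hu.eqn z hmem] at htr
    have e1 : ∀ w : ℂ, (r : ℂ) * w = r • w := fun w => by simp
    have e2 : I * (I * exp (θ * I)) = -exp (θ * I) := by
      linear_combination exp (θ * I) * I_sq
    have e3 : (r : ℂ) ^ 2 * D2 z (exp (θ * I)) (exp (θ * I)) +
        r * D z (exp (θ * I)) + (D2 z (r * (I * exp (θ * I)))
        (r * (I * exp (θ * I))) + D z (r * (I * (I * exp (θ * I))))) =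
        r ^ 2 * (- l / (z.im : ℂ) ^ 2 * u z) := by
      rw [e2, e1 (I * _), e1 (-_)]
      simp only [map_smul, map_neg, smul_apply]
      simp only [real_smul, ofReal_one] at htr ⊢
      linear_combination (r : ℂ) ^ 2 * htr
    have him : 1 ≤ z.im := by
      have h1 := (abs_im_le_norm (z - z₀)).trans (by simpa [dist_eq_norm] using hzc)
      rw [sub_im, abs_le] at h1
      linarith [h1.1]
    rw [e3, norm_mul, norm_pow, norm_real, Real.norm_eq_abs, sq_abs, norm_mul, norm_div, norm_neg,
      norm_pow, norm_real, Real.norm_eq_abs, abs_of_pos (by linarith)]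
    have h2 : ‖l‖ / z.im ^ 2 ≤ ‖l‖ := div_le_self (norm_nonneg _) (one_le_pow₀ him)
    have h3 := hM z hzc
    gcongr

/-- Interior gradient estimate. -/
theorem IsEigen.norm_grad_le (hu : IsEigen l u) (hz : 2 ≤ z₀.im) {M : ℝ}
    (hM : ∀ z ∈ closedBall z₀ 1, ‖u z‖ ≤ M) :
    ‖_root_.pdx u z₀‖ ≤ 2 * (1 + ‖l‖) * M ∧ ‖pdy u z₀‖ ≤ 2 * (1 + ‖l‖) * M := by
  have hz0 : z₀ ∈ UH := by simp only [mem_ofPred_eq]; linarith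
  have hpi := Real.pi_pos
  have hcos := hu.norm_angular_mode_le hz hM (k := Real.cos) (k₁ := fun θ => -Real.sin θ)
    Real.hasDerivAt_cos (fun θ => (Real.hasDerivAt_sin θ).neg) (by simp) (by simp)
    Real.abs_cos_le_one
  have hsin := hu.norm_angular_mode_le hz hM (k := Real.sin) (k₁ := Real.cos)
    Real.hasDerivAt_sin Real.hasDerivAt_cos (by simp) (by simp) Real.abs_sin_le_one
  have e : ∀ θ : ℝ, fderiv ℝ u z₀ (exp (θ * I)) =
      (Real.cos θ : ℂ) * _root_.pdx u z₀ + (Real.sin θ : ℂ) * pdy u z₀ := fun θ => by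
    rw [fderiv_apply_eq hu.analytic hz0, exp_ofReal_mul_I_re, exp_ofReal_mul_I_im]
  have icc : ∫ θ in (0 : ℝ)..2 * Real.pi, ((Real.cos θ ^ 2 : ℝ) : ℂ) = Real.pi := by
    rw [intervalIntegral.integral_ofReal, integral_cos_sq]; simp
  have iss : ∫ θ in (0 : ℝ)..2 * Real.pi, ((Real.sin θ ^ 2 : ℝ) : ℂ) = Real.pi := by
    rw [intervalIntegral.integral_ofReal, integral_sin_sq]; simp
  have isc : ∫ θ in (0 : ℝ)..2 * Real.pi, ((Real.sin θ * Real.cos θ : ℝ) : ℂ) = 0 := by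
    rw [intervalIntegral.integral_ofReal, integral_sin_mul_cos₁]; simp
  have c1 : Continuous fun θ : ℝ => ((Real.cos θ ^ 2 : ℝ) : ℂ) := by fun_prop
  have c2 : Continuous fun θ : ℝ => ((Real.sin θ ^ 2 : ℝ) : ℂ) := by fun_prop
  have c3 : Continuous fun θ : ℝ => ((Real.sin θ * Real.cos θ : ℝ) : ℂ) := by fun_prop
  have j1 : ∫ θ in (0 : ℝ)..2 * Real.pi, fderiv ℝ u z₀ (exp (θ * I)) * Real.cos θ =
      Real.pi * _root_.pdx u z₀ := by
    have : ∀ θ : ℝ, fderiv ℝ u z₀ (exp (θ * I)) * Real.cos θ =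
        ((Real.cos θ ^ 2 : ℝ) : ℂ) * _root_.pdx u z₀ +
          ((Real.sin θ * Real.cos θ : ℝ) : ℂ) * pdy u z₀ := fun θ => by
      rw [e]; push_cast; ring
    simp only [this]
    rw [intervalIntegral.integral_add ((c1.intervalIntegrable _ _).mul_const _)
      ((c3.intervalIntegrable _ _).mul_const _), intervalIntegral.integral_mul_const,
      intervalIntegral.integral_mul_const, icc, isc]
    simp
  have j2 : ∫ θ in (0 : ℝ)..2 * Real.pi, fderiv ℝ u z₀ (exp (θ * I)) * Real.sin θ =
      Real.pi * pdy u z₀ := by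
    have : ∀ θ : ℝ, fderiv ℝ u z₀ (exp (θ * I)) * Real.sin θ =
        ((Real.sin θ * Real.cos θ : ℝ) : ℂ) * _root_.pdx u z₀ +
          ((Real.sin θ ^ 2 : ℝ) : ℂ) * pdy u z₀ := fun θ => by
      rw [e]; push_cast; ring
    simp only [this]
    rw [intervalIntegral.integral_add ((c3.intervalIntegrable _ _).mul_const _)
      ((c2.intervalIntegrable _ _).mul_const _), intervalIntegral.integral_mul_const,
      intervalIntegral.integral_mul_const, iss, isc]
    simp
  rw [j1, norm_mul, norm_real, Real.norm_eq_abs, abs_of_pos hpi] at hcos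
  rw [j2, norm_mul, norm_real, Real.norm_eq_abs, abs_of_pos hpi] at hsin
  exact ⟨le_of_mul_le_mul_left (by linarith) hpi, le_of_mul_le_mul_left (by linarith) hpi⟩

end Gradient
end Period

namespace Period
open Set Filter Topology Metric

/-- Continuous functions on `(0, ∞)` decaying faster than any power at both ends. -/
structure AxisDecay (φ : ℝ → ℂ) : Prop where
  cont : ContinuousOn φ (Ioi 0)
  bound : ∀ C : ℝ, ∃ K : ℝ, ∀ y : ℝ, 0 < y → ‖φ y‖ ≤ K * y ^ C

namespace AxisDecay
variable {φ φ' : ℝ → ℂ}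

theorem integrableOn_norm_mul_rpow (h : AxisDecay φ) (c : ℝ) :
    IntegrableOn (fun y => ‖φ y‖ * y ^ c) (Ioi 0) := by
  have hm : ∀ s ⊆ Ioi (0 : ℝ), MeasurableSet s →
      AEStronglyMeasurable (fun y => ‖φ y‖ * y ^ c) (volume.restrict s) := fun s hs hsm =>
    ContinuousOn.aestronglyMeasurable ((h.cont.mono hs).norm.mul fun y hy =>
      (Real.continuousAt_rpow_const _ _ (Or.inl (ne_of_gt (hs hy)))).continuousWithinAt) hsm
  rw [← Ioc_union_Ioi_eq_Ioi zero_le_one]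
  refine IntegrableOn.union ?_ ?_
  · obtain ⟨K, hK⟩ := h.bound (-c)
    refine Integrable.mono' (g := fun _ => K) (by simp) (hm _ Ioc_subset_Ioi_self
      measurableSet_Ioc) ?_
    filter_upwards [ae_restrict_mem measurableSet_Ioc] with y hy
    rw [norm_mul, norm_norm, Real.norm_eq_abs, abs_of_nonneg (Real.rpow_nonneg hy.1.le _)]
    calc _ ≤ K * y ^ (-c) * y ^ c := by gcongr; exacts [Real.rpow_nonneg hy.1.le _, hK y hy.1]
      _ = K := by rw [mul_assoc, ← Real.rpow_add hy.1]; simp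
  · obtain ⟨K, hK⟩ := h.bound (-2 - c)
    refine Integrable.mono' (g := fun y => K * y ^ (-2 : ℝ))
      ((integrableOn_Ioi_rpow_of_lt (by norm_num) one_pos).const_mul _)
      (hm _ (Ioi_subset_Ioi zero_le_one) measurableSet_Ioi) ?_
    filter_upwards [ae_restrict_mem measurableSet_Ioi] with y hy
    have hy : 0 < y := zero_lt_one.trans hy
    rw [norm_mul, norm_norm, Real.norm_eq_abs, abs_of_nonneg (Real.rpow_nonneg hy.le _)]
    calc _ ≤ K * y ^ (-2 - c) * y ^ c := by gcongr; exact hK y hy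
      _ = K * y ^ (-2 : ℝ) := by rw [mul_assoc, ← Real.rpow_add hy]; simp

end AxisDecay

/-- The Stieltjes-type transform. -/
def stieltjes (a s : ℂ) (φ : ℝ → ℂ) (ζ : ℂ) : ℂ :=
  ∫ y in Ioi (0 : ℝ), φ y * (y : ℂ) ^ s * (ζ ^ 2 + (y : ℂ) ^ 2) ^ (-a)

theorem sq_add_sq_mem_slitPlane {ζ : ℂ} (hζ : 0 < ζ.re) (y : ℝ) :
    ζ ^ 2 + (y : ℂ) ^ 2 ∈ slitPlane := by
  rw [mem_slitPlane_iff]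
  by_cases h : ζ.im = 0
  · left
    simp [sq, h]
    nlinarith
  · right
    have : (ζ ^ 2 + (y : ℂ) ^ 2).im = 2 * (ζ.re * ζ.im) := by simp [sq]; ring
    rw [this]
    exact mul_ne_zero two_ne_zero (mul_ne_zero hζ.ne' h)

theorem re_sq_le_norm_sq_add_sq {ζ : ℂ} (hζ : 0 < ζ.re) (y : ℝ) :
    ζ.re ^ 2 ≤ ‖ζ ^ 2 + (y : ℂ) ^ 2‖ := by
  have : ζ ^ 2 + (y : ℂ) ^ 2 = (ζ + y * I) * (ζ - y * I) := by
    linear_combination (y : ℂ) ^ 2 * I_sq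
  rw [this, norm_mul, sq]
  have h1 : ζ.re ≤ ‖ζ + y * I‖ := by simpa using re_le_norm (ζ + y * I)
  have h2 : ζ.re ≤ ‖ζ - y * I‖ := by simpa using re_le_norm (ζ - y * I)
  gcongr

theorem norm_cpow_neg_le {w a : ℂ} {c : ℝ} (hc : 0 < c) (hw : c ≤ ‖w‖) (ha : 0 ≤ a.re) :
    ‖w ^ (-a)‖ ≤ Real.exp (Real.pi * |a.im|) * c ^ (-a.re) := by
  have hw0 : w ≠ 0 := norm_pos_iff.1 (hc.trans_le hw)
  rw [norm_cpow_of_ne_zero hw0, neg_re, neg_im, div_eq_mul_inv, ← Real.exp_neg, mul_comm]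
  have h1 : -(arg w * -a.im) ≤ Real.pi * |a.im| := by
    rw [mul_neg, neg_neg]
    calc _ ≤ |arg w * a.im| := le_abs_self _
      _ ≤ _ := by rw [abs_mul]; gcongr; exact abs_arg_le_pi w
  have h2 : ‖w‖ ^ (-a.re) ≤ c ^ (-a.re) := Real.rpow_le_rpow_of_nonpos hc hw (by linarith)
  gcongr

section
variable {a s : ℂ} {φ : ℝ → ℂ}

theorem continuousOn_stieltjes_integrand (hφ : ContinuousOn φ (Ioi 0)) {ζ : ℂ} (hζ : 0 < ζ.re) :
    ContinuousOn (fun y : ℝ => φ y * (y : ℂ) ^ s * (ζ ^ 2 + (y : ℂ) ^ 2) ^ (-a)) (Ioi 0) := by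
  refine (hφ.mul fun y hy => ?_).mul fun y _ => ?_
  · exact (continuousAt_ofReal_cpow_const _ _ (Or.inr (ne_of_gt hy))).continuousWithinAt
  · refine ContinuousWithinAt.cpow (by fun_prop) (by fun_prop) (sq_add_sq_mem_slitPlane hζ y)

theorem norm_stieltjes_integrand_le (ha : 0 ≤ a.re) {ζ : ℂ} {c : ℝ} (hc : 0 < c) (hζ : c ≤ ζ.re)
    {y : ℝ} (hy : 0 < y) : ‖φ y * (y : ℂ) ^ s * (ζ ^ 2 + (y : ℂ) ^ 2) ^ (-a)‖ ≤
      Real.exp (Real.pi * |a.im|) * (c ^ 2) ^ (-a.re) * (‖φ y‖ * y ^ s.re) := by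
  rw [norm_mul, norm_mul, norm_cpow_eq_rpow_re_of_pos hy, mul_comm]
  have h1 := norm_cpow_neg_le (w := ζ ^ 2 + (y : ℂ) ^ 2) (a := a) (pow_pos hc 2)
    ((pow_le_pow_left₀ hc.le hζ 2).trans (re_sq_le_norm_sq_add_sq (hc.trans_le hζ) y)) ha
  have := Real.rpow_nonneg hy.le s.re
  gcongr

theorem integrableOn_stieltjes (ha : 0 ≤ a.re) (hφ : AxisDecay φ) {ζ : ℂ} (hζ : 0 < ζ.re) :
    IntegrableOn (fun y : ℝ => φ y * (y : ℂ) ^ s * (ζ ^ 2 + (y : ℂ) ^ 2) ^ (-a)) (Ioi 0) := by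
  refine Integrable.mono' ((hφ.integrableOn_norm_mul_rpow s.re).const_mul
    (Real.exp (Real.pi * |a.im|) * (ζ.re ^ 2) ^ (-a.re)))
    ((continuousOn_stieltjes_integrand hφ.cont hζ).aestronglyMeasurable measurableSet_Ioi) ?_
  filter_upwards [ae_restrict_mem measurableSet_Ioi] with y hy
  exact norm_stieltjes_integrand_le ha hζ le_rfl hy

theorem norm_stieltjes_le (ha : 0 ≤ a.re) (hφ : AxisDecay φ) :
    ∃ K, ∀ ζ : ℝ, 0 < ζ → ‖stieltjes a s φ ζ‖ ≤ K * ζ ^ (-2 * a.re) := by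
  refine ⟨Real.exp (Real.pi * |a.im|) * ∫ y in Ioi (0 : ℝ), ‖φ y‖ * y ^ s.re, fun ζ hζ => ?_⟩
  have h := norm_integral_le_of_norm_le ((hφ.integrableOn_norm_mul_rpow s.re).const_mul
    (Real.exp (Real.pi * |a.im|) * (ζ ^ 2) ^ (-a.re)))
    (f := fun y : ℝ => φ y * (y : ℂ) ^ s * ((ζ : ℂ) ^ 2 + (y : ℂ) ^ 2) ^ (-a)) (by
      filter_upwards [ae_restrict_mem measurableSet_Ioi] with y hy
      exact norm_stieltjes_integrand_le ha hζ (by simp) hy)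
  refine h.trans (le_of_eq ?_)
  rw [integral_const_mul, ← Real.rpow_natCast, ← Real.rpow_mul hζ.le]
  push_cast
  rw [show (2 : ℝ) * -a.re = -2 * a.re by ring]
  ring

theorem norm_stieltjes_le_const (hφ : AxisDecay φ) (a s : ℂ) (ha : 0 ≤ a.re) :
    ∃ K, ∀ ζ : ℝ, 0 < ζ → ‖stieltjes a s φ ζ‖ ≤ K := by
  refine ⟨∫ y in Ioi (0 : ℝ), Real.exp (Real.pi * |a.im|) * (‖φ y‖ * y ^ (s.re - 2 * a.re)),
    fun ζ hζ => ?_⟩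
  refine norm_integral_le_of_norm_le ((hφ.integrableOn_norm_mul_rpow _).const_mul _) ?_
  filter_upwards [ae_restrict_mem measurableSet_Ioi] with y hy
  have hy : 0 < y := hy
  have h1 := norm_cpow_neg_le (w := (ζ : ℂ) ^ 2 + (y : ℂ) ^ 2) (a := a) (pow_pos hy 2) (by
    have : (ζ : ℂ) ^ 2 + (y : ℂ) ^ 2 = ((ζ ^ 2 + y ^ 2 : ℝ) : ℂ) := by push_cast; ring
    rw [this, norm_real, Real.norm_eq_abs, abs_of_pos (by positivity)]
    nlinarith) ha
  rw [norm_mul, norm_mul, norm_cpow_eq_rpow_re_of_pos hy]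
  calc _ ≤ ‖φ y‖ * y ^ s.re * (Real.exp (Real.pi * |a.im|) * (y ^ 2) ^ (-a.re)) := by
        have := Real.rpow_nonneg hy.le s.re
        gcongr
    _ = _ := by
        rw [← Real.rpow_natCast y 2, ← Real.rpow_mul hy.le, sub_eq_add_neg, Real.rpow_add hy]
        push_cast
        rw [show (2 : ℝ) * -a.re = -(2 * a.re) by ring]
        ring

theorem differentiableOn_stieltjes (ha : 0 ≤ a.re) (hφ : AxisDecay φ) :
    DifferentiableOn ℂ (stieltjes a s φ) {ζ | 0 < ζ.re} := by
  refine differentiableOn_integral_of_holomorphic isOpen_re_pos (fun ζ hζ =>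
    (continuousOn_stieltjes_integrand hφ.cont hζ).aestronglyMeasurable measurableSet_Ioi) ?_ ?_
  · refine Eventually.of_forall fun y => ?_
    refine DifferentiableOn.const_mul (fun ζ hζ => ?_) _
    exact (DifferentiableAt.cpow (f := fun ζ : ℂ => ζ ^ 2 + (y : ℂ) ^ 2) (by fun_prop)
      (by fun_prop) (sq_add_sq_mem_slitPlane hζ y)).differentiableWithinAt
  · intro ζ₀ hζ₀
    have hζ₀' : 0 < ζ₀.re := hζ₀
    refine ⟨ζ₀.re / 2, half_pos hζ₀', _, (hφ.integrableOn_norm_mul_rpow s.re).const_mul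
      (Real.exp (Real.pi * |a.im|) * ((ζ₀.re / 2) ^ 2) ^ (-a.re)), ?_⟩
    filter_upwards [ae_restrict_mem measurableSet_Ioi] with y hy ζ hζ
    refine norm_stieltjes_integrand_le ha (half_pos hζ₀') ?_ hy
    have := (abs_re_le_norm (ζ - ζ₀)).trans (mem_ball_iff_norm.1 hζ).le
    rw [sub_re, abs_le] at this
    linarith [this.1]

theorem stieltjes_eq_zero_of_integrableOn (ha : 0 < a.re) (hc : ContinuousOn φ (Ioi 0))
    (hi : ∀ ζ : ℝ, 0 < ζ → IntegrableOn (fun y : ℝ => φ y * (y : ℂ) ^ s *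
      ((ζ : ℂ) ^ 2 + (y : ℂ) ^ 2) ^ (-a)) (Ioi 0))
    (h0 : ∀ ζ : ℝ, 0 < ζ → stieltjes a s φ ζ = 0) : ∀ y : ℝ, 0 < y → φ y = 0 := by
  intro y hy
  have e : ∀ X : ℝ, 0 < X → ∀ y : ℝ, ((X + y ^ 2 : ℝ) : ℂ) = (((√X : ℝ) : ℂ) ^ 2 +
    (y : ℂ) ^ 2) := by
    intro X hX y
    rw [← ofReal_pow, Real.sq_sqrt hX.le]; push_cast; ring
  have := stieltjes_injective (φ := fun y : ℝ => φ y * (y : ℂ) ^ s) ha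
    (hc.mul fun y hy =>
      (continuousAt_ofReal_cpow_const _ _ (Or.inr (ne_of_gt hy))).continuousWithinAt)
    (fun X hX => by
      simp only [e X hX]
      exact hi _ (Real.sqrt_pos.2 hX))
    (fun X hX => by
      simp only [e X hX]
      exact h0 _ (Real.sqrt_pos.2 hX)) y hy
  have hy0 : (y : ℂ) ≠ 0 := by exact_mod_cast hy.ne'
  exact (mul_eq_zero.1 this).resolve_right (by simp [cpow_eq_zero_iff, hy0])

theorem stieltjes_eq_zero (ha : 0 < a.re) (hφ : AxisDecay φ)
    (h0 : ∀ ζ : ℝ, 0 < ζ → stieltjes a s φ ζ = 0) : ∀ y : ℝ, 0 < y → φ y = 0 :=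
  stieltjes_eq_zero_of_integrableOn ha hφ.cont
    (fun _ hζ => integrableOn_stieltjes ha.le hφ (by simpa using hζ)) h0

end

theorem analyticOnNhd_of_differentiableOn {f : ℝ → ℂ} {F : ℂ → ℂ}
    (hF : DifferentiableOn ℂ F {ζ | 0 < ζ.re}) (h : ∀ ζ : ℝ, 0 < ζ → f ζ = F ζ) :
    AnalyticOnNhd ℝ f (Ioi 0) := by
  have h1 : AnalyticOnNhd ℝ (fun ζ : ℝ => F ζ) (Ioi 0) := fun ζ hζ =>
    ((hF.analyticOnNhd isOpen_re_pos ζ hζ).restrictScalars (𝕜 := ℝ)).fun_comp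
      (ofRealCLM.analyticAt ζ)
  exact h1.congr isOpen_Ioi fun ζ hζ => (h ζ hζ).symm

end Period

namespace Period
open Set Filter Topology Metric

section Rpow
variable {s : ℂ} {ζ : ℝ} {z : ℂ}

theorem Rden_pos (hz : z ∈ UH) : 0 < (z.re - ζ) ^ 2 + z.im ^ 2 := by
  have : 0 < z.im := hz
  positivity

theorem Rfun_pos (hz : z ∈ UH) : 0 < Rfun ζ z := div_pos hz (Rden_pos hz)

theorem Rpow_eq_exp (hz : z ∈ UH) : Rpow s ζ z = exp (s * (Real.log (Rfun ζ z) : ℝ)) := by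
  rw [Rpow, cpow_def_of_ne_zero (by exact_mod_cast (Rfun_pos hz).ne'),
    ← ofReal_log (Rfun_pos hz).le,
    mul_comm]

theorem analyticOnNhd_Rpow (s : ℂ) (ζ : ℝ) : AnalyticOnNhd ℝ (Rpow s ζ) UH := by
  have h : AnalyticOnNhd ℝ (fun z => exp (s * (Real.log (Rfun ζ z) : ℝ))) UH := by
    intro z hz
    have hre : AnalyticAt ℝ (fun z : ℂ => z.re) z := reCLM.analyticAt z
    have him : AnalyticAt ℝ (fun z : ℂ => z.im) z := imCLM.analyticAt z
    have h1 : AnalyticAt ℝ (Rfun ζ) z :=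
      him.div (((hre.sub analyticAt_const).pow 2).add (him.pow 2)) (Rden_pos hz).ne'
    have h2 : AnalyticAt ℝ (fun z => ((Real.log (Rfun ζ z) : ℝ) : ℂ)) z :=
      (ofRealCLM.analyticAt _).fun_comp ((_root_.analyticAt_log (Rfun_pos hz)).fun_comp h1)
    exact (analyticAt_cexp.restrictScalars (𝕜 := ℝ)).fun_comp (analyticAt_const.mul h2)
  exact h.congr isOpen_UH fun z hz => (Rpow_eq_exp hz).symm

theorem hasDerivAt_Rpow_line {c : ℝ → ℂ} {c' : ℝ} {t : ℝ} (hc : ∀ᶠ t in 𝓝 t, c t ∈ UH)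
    (h : HasDerivAt (fun t => Real.log (Rfun ζ (c t))) c' t) :
    HasDerivAt (fun t => Rpow s ζ (c t)) (s * c' * Rpow s ζ (c t)) t := by
  have h1 : HasDerivAt (fun t => exp (s * (Real.log (Rfun ζ (c t)) : ℝ)))
      (s * c' * Rpow s ζ (c t)) t := by
    rw [Rpow_eq_exp hc.self_of_nhds]
    exact ((h.ofReal_comp.const_mul s).cexp).congr_deriv (by ring)
  exact h1.congr_of_eventuallyEq (hc.mono fun t ht => Rpow_eq_exp ht)

theorem log_Rfun (hz : z ∈ UH) :
    Real.log (Rfun ζ z) = Real.log z.im - Real.log ((z.re - ζ) ^ 2 + z.im ^ 2) :=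
  Real.log_div (ne_of_gt hz) (Rden_pos hz).ne'

theorem hasDerivAt_log_Rfun_x {x y : ℝ} (hy : 0 < y) :
    HasDerivAt (fun t : ℝ => Real.log (Rfun ζ (t + y * I)))
      (-(2 * (x - ζ) / ((x - ζ) ^ 2 + y ^ 2))) x := by
  have hQ : 0 < (x - ζ) ^ 2 + y ^ 2 := by positivity
  have h : HasDerivAt (fun t : ℝ => Real.log y - Real.log ((t - ζ) ^ 2 + y ^ 2))
      (-(2 * (x - ζ) / ((x - ζ) ^ 2 + y ^ 2))) x := by
    have := (((((hasDerivAt_id x).sub_const ζ).pow 2).add_const (y ^ 2)).log hQ.ne').const_sub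
      (Real.log y)
    simpa using this
  refine h.congr_of_eventuallyEq (Eventually.of_forall fun t => ?_)
  have hz : (t + y * I : ℂ) ∈ UH := by simpa using hy
  simpa using log_Rfun (ζ := ζ) hz

theorem hasDerivAt_log_Rfun_y {x y : ℝ} (hy : 0 < y) :
    HasDerivAt (fun t : ℝ => Real.log (Rfun ζ (x + t * I)))
      (1 / y - 2 * y / ((x - ζ) ^ 2 + y ^ 2)) y := by
  have hQ : 0 < (x - ζ) ^ 2 + y ^ 2 := by positivity
  have h : HasDerivAt (fun t : ℝ => Real.log t - Real.log ((x - ζ) ^ 2 + t ^ 2))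
      (1 / y - 2 * y / ((x - ζ) ^ 2 + y ^ 2)) y := by
    have := ((hasDerivAt_id y).log hy.ne').fun_sub
      ((((hasDerivAt_id y).pow 2).const_add ((x - ζ) ^ 2)).log hQ.ne')
    simpa using this
  refine h.congr_of_eventuallyEq ?_
  filter_upwards [lt_mem_nhds hy] with t ht
  have hz : (x + t * I : ℂ) ∈ UH := by simpa using ht
  simpa using log_Rfun (ζ := ζ) hz

theorem hasDerivAt_Rpow_x {x y : ℝ} (hy : 0 < y) :
    HasDerivAt (fun t : ℝ => Rpow s ζ (t + y * I))
      (s * (-(2 * (x - ζ) / ((x - ζ) ^ 2 + y ^ 2)) : ℝ) * Rpow s ζ (x + y * I)) x :=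
  hasDerivAt_Rpow_line (c := fun t : ℝ => t + y * I) (Eventually.of_forall
    fun t => by simpa using hy)
    (hasDerivAt_log_Rfun_x hy)

theorem hasDerivAt_Rpow_y {x y : ℝ} (hy : 0 < y) :
    HasDerivAt (fun t : ℝ => Rpow s ζ (x + t * I))
      (s * (1 / y - 2 * y / ((x - ζ) ^ 2 + y ^ 2) : ℝ) * Rpow s ζ (x + y * I)) y :=
  hasDerivAt_Rpow_line (c := fun t : ℝ => x + t * I)
    ((lt_mem_nhds hy).mono fun t ht => by simpa using ht) (hasDerivAt_log_Rfun_y hy)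

theorem pdx_Rpow (hz : z ∈ UH) : pdx (Rpow s ζ) z =
    s * (-(2 * (z.re - ζ) / ((z.re - ζ) ^ 2 + z.im ^ 2)) : ℝ) * Rpow s ζ z := by
  have := (hasDerivAt_Rpow_x (s := s) (ζ := ζ) (x := z.re) hz).deriv
  rwa [re_add_im] at this

theorem pdy_Rpow (hz : z ∈ UH) : pdy (Rpow s ζ) z =
    s * (1 / z.im - 2 * z.im / ((z.re - ζ) ^ 2 + z.im ^ 2) : ℝ) * Rpow s ζ z := by
  have := (hasDerivAt_Rpow_y (s := s) (ζ := ζ) (x := z.re) hz).deriv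
  rwa [re_add_im] at this

theorem isEigen_Rpow (s : ℂ) (ζ : ℝ) : IsEigen (s * (1 - s)) (Rpow s ζ) := by
  refine ⟨analyticOnNhd_Rpow s ζ, fun z hz => ?_⟩
  rw [pdx_congr hz fun w hw => pdx_Rpow hw, pdy_congr hz fun w hw => pdy_Rpow hw]
  have hy : 0 < z.im := hz
  set x := z.re
  set y := z.im
  have hQ : 0 < (x - ζ) ^ 2 + y ^ 2 := by positivity
  have d1 : HasDerivAt (fun t : ℝ => -(2 * (t - ζ) / ((t - ζ) ^ 2 + y ^ 2)))
      (-((2 * ((x - ζ) ^ 2 + y ^ 2) - 2 * (x - ζ) * (2 * (x - ζ))) / ((x - ζ) ^ 2 + y ^ 2) ^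
        2)) x := by
    have := ((((hasDerivAt_id x).sub_const ζ).const_mul 2).div
      ((((hasDerivAt_id x).sub_const ζ).pow 2).add_const (y ^ 2)) hQ.ne').neg
    refine this.congr_deriv ?_
    simp
  have d2 : HasDerivAt (fun t : ℝ => 1 / t - 2 * t / ((x - ζ) ^ 2 + t ^ 2))
      (-(1 / y ^ 2) - (2 * ((x - ζ) ^ 2 + y ^ 2) - 2 * y * (2 * y)) / ((x - ζ) ^ 2 +
        y ^ 2) ^ 2) y := by
    have := ((hasDerivAt_const y (1 : ℝ)).div (hasDerivAt_id y) hy.ne').sub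
      (((hasDerivAt_id y).const_mul 2).div
      (((hasDerivAt_id y).pow 2).const_add ((x - ζ) ^ 2)) hQ.ne')
    refine this.congr_deriv ?_
    simp [neg_div]
  have e1 : pdx (fun z => s * (-(2 * (z.re - ζ) / ((z.re - ζ) ^ 2 + z.im ^ 2)) : ℝ) *
    Rpow s ζ z) z =
      deriv (fun t : ℝ => s * (-(2 * (t - ζ) / ((t - ζ) ^ 2 + y ^ 2)) : ℝ) *
        Rpow s ζ (t + y * I)) x := by
    simp [pdx, x, y]
  have e2 : pdy (fun z => s * (1 / z.im - 2 * z.im / ((z.re - ζ) ^ 2 + z.im ^ 2) : ℝ) *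
      Rpow s ζ z) z = deriv (fun t : ℝ => s * (1 / t - 2 * t / ((x - ζ) ^ 2 + t ^ 2) : ℝ) *
        Rpow s ζ (x + t * I)) y := by
    simp [pdy, x, y]
  rw [e1, e2, ((d1.ofReal_comp.const_mul s).fun_mul (hasDerivAt_Rpow_x hy)).deriv,
    ((d2.ofReal_comp.const_mul s).fun_mul (hasDerivAt_Rpow_y hy)).deriv, re_add_im]
  have hyc : (y : ℂ) ≠ 0 := by exact_mod_cast hy.ne'
  have hQc : ((x : ℂ) - ζ) ^ 2 + (y : ℂ) ^ 2 ≠ 0 := by exact_mod_cast hQ.ne'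
  push_cast
  field_simp
  ring

theorem norm_Rpow (hz : z ∈ UH) : ‖Rpow s ζ z‖ = Rfun ζ z ^ s.re :=
  norm_cpow_eq_rpow_re_of_pos (Rfun_pos hz) s

theorem Rfun_le (hz : z ∈ UH) : Rfun ζ z ≤ 1 / z.im := by
  have hy : 0 < z.im := hz
  rw [Rfun, div_le_div_iff₀ (Rden_pos hz) hy]
  nlinarith [sq_nonneg (z.re - ζ)]

theorem norm_Rpow_le (hs : 0 ≤ s.re) (hz : 1 ≤ z.im) : ‖Rpow s ζ z‖ ≤ 1 := by
  have hz0 : z ∈ UH := by simp only [mem_ofPred_eq]; linarith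
  rw [norm_Rpow hz0]
  refine Real.rpow_le_one (Rfun_pos hz0).le ((Rfun_le hz0).trans ?_) hs
  rw [div_le_one (by linarith)]; exact hz

theorem norm_pdy_Rpow_le (hs : 0 ≤ s.re) (hz : 1 ≤ z.im) : ‖pdy (Rpow s ζ) z‖ ≤ 3 * ‖s‖ := by
  have hz0 : z ∈ UH := by simp only [mem_ofPred_eq]; linarith
  have h1 : 1 / z.im ≤ 1 := by rw [div_le_one (by linarith)]; exact hz
  have h0 : 0 ≤ 1 / z.im := by have : 0 < z.im := hz0; positivity
  have h2 : 2 * z.im / ((z.re - ζ) ^ 2 + z.im ^ 2) ≤ 2 := by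
    have := (Rfun_le (ζ := ζ) hz0).trans h1
    rw [Rfun] at this
    rw [mul_div_assoc]; linarith
  have h3 : 0 ≤ 2 * z.im / ((z.re - ζ) ^ 2 + z.im ^ 2) := by
    have : 0 < z.im := hz0
    positivity
  rw [pdy_Rpow hz0, norm_mul, norm_mul, norm_real, Real.norm_eq_abs]
  have h4 : |1 / z.im - 2 * z.im / ((z.re - ζ) ^ 2 + z.im ^ 2)| ≤ 3 := by
    rw [abs_le]; constructor <;> linarith
  calc _ ≤ ‖s‖ * 3 * 1 := by gcongr; exact norm_Rpow_le hs hz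
    _ = _ := by ring

theorem Rpow_axis (hζ : 0 < ζ) {y : ℝ} (hy : 0 < y) :
    Rpow s ζ (y * I) = (y : ℂ) ^ s * ((ζ : ℂ) ^ 2 + (y : ℂ) ^ 2) ^ (-s) := by
  have hQ : 0 < ζ ^ 2 + y ^ 2 := by positivity
  have : ((ζ : ℂ) ^ 2 + (y : ℂ) ^ 2) = ((ζ ^ 2 + y ^ 2 : ℝ) : ℂ) := by push_cast; ring
  rw [this, cpow_neg, ← div_eq_mul_inv, Rpow, Rfun]
  simp only [mul_re, ofReal_re, I_re, mul_zero, ofReal_im, I_im, mul_one, sub_self, zero_sub,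
    even_two, Even.neg_pow, mul_im, add_zero]
  rw [ofReal_div, div_eq_mul_inv, ← ofReal_inv, mul_cpow_ofReal_nonneg hy.le (by positivity),
    ofReal_inv, inv_cpow, div_eq_mul_inv]
  rw [arg_ofReal_of_nonneg hQ.le]
  exact Real.pi_pos.ne

theorem pdx_Rpow_axis (hζ : 0 < ζ) {y : ℝ} (hy : 0 < y) :
    pdx (Rpow s ζ) (y * I) =
      2 * s * ζ * ((y : ℂ) ^ s * ((ζ : ℂ) ^ 2 + (y : ℂ) ^ 2) ^ (-(s + 1))) := by
  have hQ : 0 < ζ ^ 2 + y ^ 2 := by positivity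
  have hQ' : ((ζ : ℂ) ^ 2 + (y : ℂ) ^ 2) ≠ 0 := by exact_mod_cast hQ.ne'
  rw [pdx_Rpow (by simpa using hy), Rpow_axis hζ hy, neg_add, cpow_add _ _ hQ', cpow_neg_one]
  simp
  field_simp

end Rpow

theorem Ptrans_eq {s : ℂ} (hs : 0 < s.re) {v : ℂ → ℂ} (h0 : AxisDecay fun y => v (y * I))
    (h1 : AxisDecay fun y => pdx v (y * I)) {ζ : ℝ} (hζ : 0 < ζ) :
    Ptrans s v ζ = 2 * s * ζ * stieltjes (s + 1) s (fun y => v (y * I)) ζ -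
      stieltjes s s (fun y => pdx v (y * I)) ζ := by
  rw [stieltjes, stieltjes, ← integral_const_mul, ← integral_sub
    ((integrableOn_stieltjes (by simp; linarith) h0 (by simpa using hζ)).const_mul _)
    (integrableOn_stieltjes hs.le h1 (by simpa using hζ)), Ptrans]
  refine setIntegral_congr_fun measurableSet_Ioi fun y hy => ?_
  rw [pdx_Rpow_axis hζ hy, Rpow_axis hζ hy]
  ring

theorem integrableOn_Ptrans {s : ℂ} (hs : 0 < s.re) {v : ℂ → ℂ} (h0 : AxisDecay fun y => v (y * I))
    (h1 : AxisDecay fun y => pdx v (y * I)) {ζ : ℝ} (hζ : 0 < ζ) :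
    IntegrableOn (fun y : ℝ => v (y * I) * pdx (Rpow s ζ) (y * I) -
      Rpow s ζ (y * I) * pdx v (y * I)) (Ioi 0) := by
  have hr : (0 : ℝ) < (ζ : ℂ).re := by simpa using hζ
  have hs1 : 0 ≤ (s + 1).re := by simp; linarith
  have h := ((integrableOn_stieltjes (s := s) hs1 h0 hr).const_mul (2 * s * ζ)).sub
    (integrableOn_stieltjes (s := s) hs.le h1 hr)
  refine IntegrableOn.congr_fun h (fun y hy => ?_) measurableSet_Ioi
  simp only [Pi.sub_apply]
  rw [pdx_Rpow_axis hζ hy, Rpow_axis hζ hy]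
  ring

end Period

namespace Period
open Set Filter Topology Metric

/-- Rapid decay towards the cusp `∞`. -/
def CuspDecay (f : ℂ → ℂ) : Prop :=
  ∀ C : ℝ, ∃ K T : ℝ, ∀ z : ℂ, 0 < z.im → T ≤ z.im → ‖f z‖ ≤ K * z.im ^ C

theorem IsEigen.cuspDecay_grad {l : ℂ} {u : ℂ → ℂ} (hu : IsEigen l u) (h : CuspDecay u) (C : ℝ) :
    ∃ K T : ℝ, ∀ z : ℂ, 0 < z.im → T ≤ z.im →
      ‖_root_.pdx u z‖ ≤ K * z.im ^ C ∧ ‖_root_.pdy u z‖ ≤ K * z.im ^ C := by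
  obtain ⟨K, T, hK⟩ := h (min C 0)
  set C' := min C 0
  have hC0 : C' ≤ 0 := min_le_right _ _
  refine ⟨2 * (1 + ‖l‖) * (|K| * (1 / 2) ^ C'), max 2 (2 * T), fun z hz hT => ?_⟩
  have h2 : 2 ≤ z.im := (le_max_left _ _).trans hT
  have h2T : 2 * T ≤ z.im := (le_max_right _ _).trans hT
  have hM : ∀ w ∈ closedBall z 1, ‖u w‖ ≤ |K| * (z.im * (1 / 2)) ^ C' := by
    intro w hw
    have h3 : |w.im - z.im| ≤ 1 := by
      rw [← sub_im]
      exact (abs_im_le_norm _).trans (by simpa [dist_eq] using hw)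
    have h4 : z.im * (1 / 2) ≤ w.im := by
      have := (abs_le.1 h3).1
      linarith
    have h5 : 0 < w.im := by linarith
    have h6 : 0 < z.im * (1 / 2) := by linarith
    have h7 : w.im ^ C' ≤ (z.im * (1 / 2)) ^ C' := Real.rpow_le_rpow_of_nonpos h6 h4 hC0
    exact (hK w h5 (by linarith)).trans (mul_le_mul (le_abs_self _) h7 (by positivity)
      (abs_nonneg _))
  have h6 : 2 * (1 + ‖l‖) * (|K| * (z.im * (1 / 2)) ^ C') ≤
      2 * (1 + ‖l‖) * (|K| * (1 / 2) ^ C') * z.im ^ C := by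
    rw [Real.mul_rpow hz.le (by norm_num)]
    have : z.im ^ C' ≤ z.im ^ C :=
      Real.rpow_le_rpow_of_exponent_le (by linarith) (min_le_left _ _)
    calc _ = 2 * (1 + ‖l‖) * (|K| * (1 / 2) ^ C') * z.im ^ C' := by ring
      _ ≤ _ := by gcongr
  have := hu.norm_grad_le h2 hM
  exact ⟨this.1.trans h6, this.2.trans h6⟩

theorem axisDecay_of_decay {φ : ℝ → ℂ} (hc : ContinuousOn φ (Ioi 0))
    (h1 : ∀ C : ℝ, ∃ K T : ℝ, ∀ y : ℝ, 0 < y → T ≤ y → ‖φ y‖ ≤ K * y ^ C)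
    (h0 : ∀ C : ℝ, ∃ K T : ℝ, ∀ y : ℝ, 0 < y → T ≤ y → ‖φ y⁻¹‖ ≤ K * y ^ C) : AxisDecay φ := by
  refine ⟨hc, fun C => ?_⟩
  obtain ⟨K₁, T₁, hK₁⟩ := h1 C
  obtain ⟨K₂, T₂, hK₂⟩ := h0 (-C)
  set T := max 1 (max T₁ T₂)
  have hT1 : 1 ≤ T := le_max_left _ _
  have hT0 : 0 < T := by linarith
  have hcpt : IsCompact (Icc T⁻¹ T) := isCompact_Icc
  have hsub : Icc T⁻¹ T ⊆ Ioi 0 := fun y hy => lt_of_lt_of_le (by positivity) hy.1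
  have hcont : ContinuousOn (fun y : ℝ => ‖φ y‖ * y ^ (-C)) (Icc T⁻¹ T) :=
    (hc.mono hsub).norm.mul (continuousOn_id.rpow_const fun y hy => Or.inl (hsub hy).ne')
  obtain ⟨K₃, hK₃⟩ := hcpt.bddAbove_image hcont
  refine ⟨max K₁ (max K₂ K₃), fun y hy => ?_⟩
  have hyC : 0 < y ^ C := Real.rpow_pos_of_pos hy C
  rcases le_total T y with h | h
  · refine (hK₁ y hy (((le_max_left _ _).trans (le_max_right _ _)).trans h)).trans ?_
    gcongr; exact le_max_left _ _
  · rcases le_total T⁻¹ y with h' | h'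
    · have := hK₃ (mem_image_of_mem _ ⟨h', h⟩)
      simp only [Real.rpow_neg hy.le] at this
      rw [← div_eq_mul_inv, div_le_iff₀ hyC] at this
      refine this.trans ?_
      gcongr; exact (le_max_right _ _).trans (le_max_right _ _)
    · have h2 : T ≤ y⁻¹ := (le_inv_comm₀ hT0 hy).2 h'
      have := hK₂ y⁻¹ (by positivity) (((le_max_right _ _).trans (le_max_right _ _)).trans h2)
      rw [inv_inv, Real.inv_rpow hy.le, Real.rpow_neg hy.le, inv_inv] at this
      refine this.trans ?_
      gcongr; exact (le_max_left _ _).trans (le_max_right _ _)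

section Conformal
variable {f g : ℂ → ℂ} {g' z : ℂ}

theorem hasFDerivAt_comp_conformal (hf : DifferentiableAt ℝ f (g z)) (hg : HasDerivAt g g' z) :
    HasFDerivAt (fun w => f (g w))
      ((fderiv ℝ f (g z)).comp ((ContinuousLinearMap.toSpanSingleton ℂ g').restrictScalars ℝ)) z :=
  hf.hasFDerivAt.comp z (hg.hasFDerivAt.restrictScalars ℝ)

theorem pdx_comp_conformal (hf : DifferentiableAt ℝ f (g z)) (hg : HasDerivAt g g' z) :
    pdx (fun w => f (g w)) z = fderiv ℝ f (g z) g' := by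
  rw [pdx_of_hasFDerivAt (hasFDerivAt_comp_conformal hf hg)]
  simp

theorem pdy_comp_conformal (hf : DifferentiableAt ℝ f (g z)) (hg : HasDerivAt g g' z) :
    pdy (fun w => f (g w)) z = fderiv ℝ f (g z) (I * g') := by
  rw [pdy_of_hasFDerivAt (hasFDerivAt_comp_conformal hf hg)]
  simp

end Conformal

section CuspForm
variable {n μ : ℕ} {α : Fin μ → SL2} {s : ℂ} {U : ℂ → Fin μ → ℂ}

theorem isEigen_cuspForm (hU : IsVVCuspForm n α s U) (j : Fin μ) :
    IsEigen (s * (1 - s)) (fun z => U z j) :=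
  (isEigen_iff_laplace (hU.analytic j)).2 (hU.eigen j)

theorem moeb_S (z : ℂ) : moeb (ModularGroup.S : SL2) z = -z⁻¹ := by
  simp [moeb, ModularGroup.S, neg_div]

theorem coe_T_inv : ((Tmat⁻¹ : SL2) : Matrix (Fin 2) (Fin 2) ℤ) = !![1, -1; 0, 1] := by
  rw [Matrix.SpecialLinearGroup.coe_inv]
  simp [Tmat, Matrix.adjugate_fin_two_of]

theorem coe_T'_inv : ((Tmat'⁻¹ : SL2) : Matrix (Fin 2) (Fin 2) ℤ) = !![1, 0; -1, 1] := by
  rw [Matrix.SpecialLinearGroup.coe_inv]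
  simp [Tmat', Matrix.adjugate_fin_two_of]

theorem moeb_T_inv (z : ℂ) : moeb (Tmat⁻¹ : SL2) z = z - 1 := by
  rw [coe_T_inv]
  simp [moeb, sub_eq_add_neg]

theorem moeb_T'_inv (z : ℂ) : moeb (Tmat'⁻¹ : SL2) z = z / (1 - z) := by
  rw [coe_T'_inv]
  simp [moeb, sub_eq_add_neg, add_comm]

theorem neg_inv_mem_UH {z : ℂ} (hz : z ∈ UH) : -z⁻¹ ∈ UH := by
  have h : z ≠ 0 := fun h => by simp [h] at hz
  have : 0 < z.im := hz
  have h2 : 0 < normSq z := normSq_pos.2 h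
  simp only [mem_ofPred_eq, neg_im, inv_im, neg_div, neg_neg]
  positivity

theorem cuspForm_S (hU : IsVVCuspForm n α s U) {z : ℂ} (hz : z ∈ UH) (j : Fin μ) :
    U (-z⁻¹) j = ∑ k, rho n α ModularGroup.S j k * U z k := by
  rw [← moeb_S]; exact hU.equivar _ z hz j

theorem neg_inv_axis (y : ℝ) : -((y⁻¹ : ℝ) * I : ℂ)⁻¹ = y * I := by
  simp [mul_comm]

theorem cuspForm_axis_S (hU : IsVVCuspForm n α s U) {y : ℝ} (hy : 0 < y) (j : Fin μ) :
    U ((y⁻¹ : ℝ) * I) j = ∑ k, rho n α ModularGroup.S j k * U (y * I) k := by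
  have h := cuspForm_S hU (z := y * I) (by simpa using hy) j
  rw [← h, ← neg_inv_axis, inv_inv]

theorem cuspForm_pdx_axis_S (hU : IsVVCuspForm n α s U) {y : ℝ} (hy : 0 < y) (j : Fin μ) :
    pdx (fun w => U w j) ((y⁻¹ : ℝ) * I) =
      -(y : ℂ) ^ 2 * ∑ k, rho n α ModularGroup.S j k * pdx (fun w => U w k) (y * I) := by
  have hz : ((y⁻¹ : ℝ) * I : ℂ) ∈ UH := by simpa using hy
  have hz0 : ((y⁻¹ : ℝ) * I : ℂ) ≠ 0 := by simp [hy.ne']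
  have hy0 : (y : ℂ) ≠ 0 := by exact_mod_cast hy.ne'
  have hyz : (y * I : ℂ) ∈ UH := by simpa using hy
  have hg : HasDerivAt (fun w : ℂ => -w⁻¹) (((-y ^ 2 : ℝ) : ℂ)) ((y⁻¹ : ℝ) * I : ℂ) := by
    refine (hasDerivAt_inv hz0).neg.congr_deriv ?_
    push_cast
    rw [neg_neg, mul_pow, I_sq]
    field_simp
  have hd : ∀ k, DifferentiableAt ℝ (fun w => U w k) (y * I) := fun k =>
    (hU.analytic k _ hyz).differentiableAt
  have e1 : pdx (fun w => U w j) ((y⁻¹ : ℝ) * I) =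
      pdx (fun w => (fun v => ∑ k, rho n α ModularGroup.S j k * U v k) (-w⁻¹)) ((y⁻¹ : ℝ) * I) := by
    refine pdx_congr hz fun w hw => ?_
    have := cuspForm_S hU (neg_inv_mem_UH hw) j
    simpa using this
  have hd' : HasFDerivAt (fun v => ∑ k, rho n α ModularGroup.S j k * U v k)
      (∑ k, rho n α ModularGroup.S j k • fderiv ℝ (fun w => U w k) (y * I)) (y * I) :=
    HasFDerivAt.fun_sum fun k _ => (hd k).hasFDerivAt.const_mul _
  have hdd := hd'.differentiableAt
  rw [e1]
  rw [← neg_inv_axis] at hdd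
  rw [pdx_comp_conformal (g := fun w : ℂ => -w⁻¹) hdd hg, neg_inv_axis, hd'.fderiv, Finset.mul_sum]
  simp only [_root_.sum_apply, _root_.smul_apply]
  refine Finset.sum_congr rfl fun k _ => ?_
  rw [fderiv_apply_eq (hU.analytic k) hyz, ofReal_re, ofReal_im]
  simp
  ring

theorem continuousOn_axis {f : ℂ → ℂ} (hf : AnalyticOnNhd ℝ f UH) :
    ContinuousOn (fun y : ℝ => f (y * I)) (Ioi 0) :=
  hf.continuousOn.comp (by fun_prop) fun y hy => by simpa using hy

theorem sum_decay {φ : Fin μ → ℝ → ℂ} {ψ : ℝ → ℂ} {a : ℝ} (c : Fin μ → ℂ)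
    (h : ∀ k, ∀ C : ℝ, ∃ K T : ℝ, ∀ y : ℝ, 0 < y → T ≤ y → ‖φ k y‖ ≤ K * y ^ C)
    (hψ : ∀ y > 0, ‖ψ y‖ ≤ y ^ a * ‖∑ k, c k * φ k y‖) (C : ℝ) :
    ∃ K T : ℝ, ∀ y : ℝ, 0 < y → T ≤ y → ‖ψ y‖ ≤ K * y ^ C := by
  choose K T hK using fun k => h k (C - a)
  refine ⟨∑ k, ‖c k‖ * K k, ∑ k, |T k|, fun y hy hT => ?_⟩
  have h1 : ∀ k, ‖c k * φ k y‖ ≤ ‖c k‖ * K k * y ^ (C - a) := fun k => by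
    have : T k ≤ y := (le_abs_self _).trans
      ((Finset.single_le_sum (f := fun k => |T k|) (fun _ _ => abs_nonneg _)
        (Finset.mem_univ k)).trans hT)
    rw [norm_mul, mul_assoc]
    exact mul_le_mul_of_nonneg_left (hK k y hy this) (norm_nonneg _)
  calc ‖ψ y‖ ≤ y ^ a * ‖∑ k, c k * φ k y‖ := hψ y hy
    _ ≤ y ^ a * ∑ k, ‖c k‖ * K k * y ^ (C - a) := by
        gcongr; exact (norm_sum_le _ _).trans (Finset.sum_le_sum fun k _ => h1 k)
    _ = (∑ k, ‖c k‖ * K k) * y ^ C := by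
        rw [← Finset.sum_mul, Real.rpow_sub hy]
        have := (Real.rpow_pos_of_pos hy a).ne'
        field_simp

theorem axisDecay_cuspForm (hU : IsVVCuspForm n α s U) (j : Fin μ) :
    AxisDecay fun y => U (y * I) j := by
  have h : ∀ k, ∀ C : ℝ, ∃ K T : ℝ, ∀ y : ℝ, 0 < y → T ≤ y → ‖U (y * I) k‖ ≤ K * y ^ C := by
    intro k C
    obtain ⟨K, T, hK⟩ := hU.decay k C
    exact ⟨K, T, fun y hy hT => by simpa using hK (y * I) (by simpa using hy) (by simpa using hT)⟩
  refine axisDecay_of_decay (continuousOn_axis (hU.analytic j)) (h j)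
    (sum_decay (a := 0) (fun k => rho n α ModularGroup.S j k) h fun y hy => ?_)
  rw [cuspForm_axis_S hU hy]
  simp

theorem axisDecay_pdx_cuspForm (hU : IsVVCuspForm n α s U) (j : Fin μ) :
    AxisDecay fun y => pdx (fun w => U w j) (y * I) := by
  have h : ∀ k, ∀ C : ℝ, ∃ K T : ℝ, ∀ y : ℝ, 0 < y → T ≤ y →
      ‖pdx (fun w => U w k) (y * I)‖ ≤ K * y ^ C := by
    intro k C
    obtain ⟨K, T, hK⟩ := (isEigen_cuspForm hU k).cuspDecay_grad (hU.decay k) C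
    exact ⟨K, T, fun y hy hT => by
      simpa using (hK (y * I) (by simpa using hy) (by simpa using hT)).1⟩
  refine axisDecay_of_decay (continuousOn_axis (analyticOnNhd_pdx (hU.analytic j))) (h j)
    (sum_decay (a := 2) (fun k => rho n α ModularGroup.S j k) h fun y hy => ?_)
  rw [cuspForm_pdx_axis_S hU hy]
  simp

theorem cuspForm_sub {V : ℂ → Fin μ → ℂ} (hU : IsVVCuspForm n α s U)
    (hV : IsVVCuspForm n α s V) : IsVVCuspForm n α s (fun z j => U z j - V z j) where
  analytic j := (hU.analytic j).sub (hV.analytic j)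
  equivar g z hz j := by
    simp only [hU.equivar g z hz j, hV.equivar g z hz j, mul_sub, Finset.sum_sub_distrib]
  eigen j := (isEigen_iff_laplace ((hU.analytic j).sub (hV.analytic j))).1
    ((isEigen_cuspForm hU j).sub (isEigen_cuspForm hV j))
  decay j C := by
    obtain ⟨K₁, T₁, h₁⟩ := hU.decay j C
    obtain ⟨K₂, T₂, h₂⟩ := hV.decay j C
    refine ⟨K₁ + K₂, max T₁ T₂, fun z hz hT => ?_⟩
    rw [add_mul]
    exact (norm_sub_le _ _).trans (add_le_add (h₁ z hz ((le_max_left _ _).trans hT))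
      (h₂ z hz ((le_max_right _ _).trans hT)))

end CuspForm

end Period

namespace Period
open Set Filter Topology Metric

theorem integral_Ioi_comp_inv (g : ℝ → ℂ) :
    ∫ y in Ioi (0 : ℝ), g y = ∫ y in Ioi (0 : ℝ), g y⁻¹ * (y : ℂ) ^ (-2 : ℂ) := by
  rw [← integral_comp_rpow_Ioi g (p := -1) (by norm_num)]
  refine setIntegral_congr_fun measurableSet_Ioi fun y hy => ?_
  have hy0 : (0 : ℝ) ≤ y := le_of_lt hy
  have : (y : ℂ) ^ (-2 : ℂ) = ((y ^ ((-1 : ℝ) - 1) : ℝ) : ℂ) := by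
    rw [ofReal_cpow hy0]; norm_num
  simp only [this, Real.rpow_neg_one, real_smul, abs_neg, abs_one, one_mul]
  ring

theorem integrableOn_Ioi_comp_inv {g : ℝ → ℂ} :
    IntegrableOn (fun y => g y⁻¹ * (y : ℂ) ^ (-2 : ℂ)) (Ioi 0) ↔ IntegrableOn g (Ioi 0) := by
  rw [← integrableOn_Ioi_comp_rpow_iff g (p := -1) (by norm_num)]
  refine integrableOn_congr_fun (fun y hy => ?_) measurableSet_Ioi
  have hy0 : (0 : ℝ) ≤ y := le_of_lt hy
  have : (y : ℂ) ^ (-2 : ℂ) = ((y ^ ((-1 : ℝ) - 1) : ℝ) : ℂ) := by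
    rw [ofReal_cpow hy0]; norm_num
  simp only [this, Real.rpow_neg_one, real_smul, abs_neg, abs_one, one_mul]
  ring

theorem stieltjes_integrand_inv (a s : ℂ) (φ : ℝ → ℂ) {ζ y : ℝ} (hζ : 0 < ζ) (hy : 0 < y) :
    φ y⁻¹ * ((y⁻¹ : ℝ) : ℂ) ^ s * ((ζ : ℂ) ^ 2 + ((y⁻¹ : ℝ) : ℂ) ^ 2) ^ (-a) * (y : ℂ) ^ (-2 : ℂ) =
      (ζ : ℂ) ^ (-2 * a) * (φ y⁻¹ * (y : ℂ) ^ (2 * a - s - 2) *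
        (((ζ⁻¹ : ℝ) : ℂ) ^ 2 + (y : ℂ) ^ 2) ^ (-a)) := by
  have hyc : (y : ℂ) ≠ 0 := by exact_mod_cast hy.ne'
  have hζc : (ζ : ℂ) ≠ 0 := by exact_mod_cast hζ.ne'
  have h1 : (ζ : ℂ) ^ 2 + ((y⁻¹ : ℝ) : ℂ) ^ 2 =
      ((ζ : ℝ) : ℂ) * ((ζ : ℝ) : ℂ) * (((y⁻¹ * y⁻¹ : ℝ) : ℂ) * (((ζ⁻¹ : ℝ) : ℂ) ^ 2 +
        (y : ℂ) ^ 2)) := by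
    push_cast; field_simp; ring
  have h2 : ((ζ⁻¹ : ℝ) : ℂ) ^ 2 + (y : ℂ) ^ 2 = ((ζ⁻¹ ^ 2 + y ^ 2 : ℝ) : ℂ) := by push_cast; ring
  have h3 : ((y⁻¹ : ℝ) : ℂ) ^ s = (y : ℂ) ^ (-s) := by
    rw [ofReal_inv, inv_cpow, cpow_neg]
    rw [arg_ofReal_of_nonneg hy.le]; exact Real.pi_pos.ne
  have h4 : ((y⁻¹ * y⁻¹ : ℝ) : ℂ) ^ (-a) = (y : ℂ) ^ (2 * a) := by
    rw [ofReal_mul, mul_cpow_ofReal_nonneg (by positivity) (by positivity), ofReal_inv, inv_cpow,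
      cpow_neg, inv_inv, two_mul, cpow_add _ _ hyc]
    rw [arg_ofReal_of_nonneg hy.le]; exact Real.pi_pos.ne
  have h5 : (((ζ : ℝ) : ℂ) * ((ζ : ℝ) : ℂ)) ^ (-a) = (ζ : ℂ) ^ (-2 * a) := by
    rw [mul_cpow_ofReal_nonneg hζ.le hζ.le, ← cpow_add _ _ hζc]; ring_nf
  have h6 : (y : ℂ) ^ (2 * a - s - 2) = (y : ℂ) ^ (-s) * (y : ℂ) ^ (2 * a) * (y : ℂ) ^
    (-2 : ℂ) := by
    rw [← cpow_add _ _ hyc, ← cpow_add _ _ hyc]; ring_nf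
  rw [h1, h2, h3, ← ofReal_mul ζ ζ, ← ofReal_mul (y⁻¹ * y⁻¹),
    mul_cpow_ofReal_nonneg (by positivity) (by positivity), ofReal_mul (y⁻¹ * y⁻¹),
    mul_cpow_ofReal_nonneg (by positivity) (by positivity), h4, ofReal_mul, h5, h6]
  ring

theorem stieltjes_inv (a s : ℂ) (φ : ℝ → ℂ) {ζ : ℝ} (hζ : 0 < ζ) :
    stieltjes a s φ ζ = (ζ : ℂ) ^ (-2 * a) *
      stieltjes a (2 * a - s - 2) (fun y => φ y⁻¹) (ζ⁻¹ : ℝ) := by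
  rw [stieltjes, stieltjes, integral_Ioi_comp_inv, ← integral_const_mul]
  exact setIntegral_congr_fun measurableSet_Ioi fun y hy => stieltjes_integrand_inv a s φ hζ hy

theorem integrableOn_stieltjes_inv {a s : ℂ} {φ : ℝ → ℂ} {ζ : ℝ} (hζ : 0 < ζ)
    (h : IntegrableOn (fun y : ℝ => φ y⁻¹ * (y : ℂ) ^ (2 * a - s - 2) *
      (((ζ⁻¹ : ℝ) : ℂ) ^ 2 + (y : ℂ) ^ 2) ^ (-a)) (Ioi 0)) :
    IntegrableOn (fun y : ℝ => φ y * (y : ℂ) ^ s * ((ζ : ℂ) ^ 2 + (y : ℂ) ^ 2) ^ (-a)) (Ioi 0) :=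
  integrableOn_Ioi_comp_inv.1 <| IntegrableOn.congr_fun (h.const_mul ((ζ : ℂ) ^ (-2 * a)))
    (fun _ hy => (stieltjes_integrand_inv a s φ hζ hy).symm) measurableSet_Ioi

theorem stieltjes_congr {a s : ℂ} {φ φ' : ℝ → ℂ} (h : ∀ y > 0, φ y = φ' y) (ζ : ℂ) :
    stieltjes a s φ ζ = stieltjes a s φ' ζ :=
  setIntegral_congr_fun measurableSet_Ioi fun y hy => by simp only [h y hy]

theorem stieltjes_sum {ι : Type*} [Fintype ι] {a s : ℂ} (ha : 0 ≤ a.re) {φ : ι → ℝ → ℂ}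
    (hφ : ∀ k, AxisDecay (φ k)) (c : ι → ℂ) {ζ : ℂ} (hζ : 0 < ζ.re) :
    stieltjes a s (fun y => ∑ k, c k * φ k y) ζ = ∑ k, c k * stieltjes a s (φ k) ζ := by
  simp only [stieltjes, ← integral_const_mul]
  rw [← integral_finsetSum]
  · refine setIntegral_congr_fun measurableSet_Ioi fun y hy => ?_
    simp only [Finset.sum_mul]
    exact Finset.sum_congr rfl fun k _ => by ring
  · exact fun k _ => (integrableOn_stieltjes ha (hφ k) hζ).const_mul _

theorem stieltjes_sq_mul {a s : ℂ} {φ : ℝ → ℂ} {c : ℂ} (ζ : ℂ) :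
    stieltjes a (s - 2) (fun y => c * (y : ℂ) ^ 2 * φ y) ζ = c * stieltjes a s φ ζ := by
  rw [stieltjes, stieltjes, ← integral_const_mul]
  refine setIntegral_congr_fun measurableSet_Ioi fun y hy => ?_
  have hyc : (y : ℂ) ≠ 0 := by exact_mod_cast (ne_of_gt hy)
  simp only [cpow_sub _ _ hyc, cpow_ofNat]
  field_simp

section Inversion
variable {n μ : ℕ} {α : Fin μ → SL2} {s : ℂ} {U V : ℂ → Fin μ → ℂ}

theorem stieltjes_axis_S (hs : 0 < s.re) (hU : IsVVCuspForm n α s U) (j : Fin μ) {ζ : ℝ}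
    (hζ : 0 < ζ) :
    stieltjes (s + 1) s (fun y => U (y * I) j) ζ = (ζ : ℂ) ^ (-2 * (s + 1)) *
      ∑ k, rho n α ModularGroup.S j k * stieltjes (s + 1) s (fun y => U (y * I) k) (ζ⁻¹ : ℝ) := by
  have hs1 : 0 ≤ (s + 1).re := by simp; linarith
  have hr : 0 < ((ζ⁻¹ : ℝ) : ℂ).re := by rw [ofReal_re]; positivity
  have e : 2 * (s + 1) - s - 2 = s := by ring
  rw [stieltjes_inv _ _ _ hζ, e,
    stieltjes_congr fun y hy => cuspForm_axis_S hU hy j,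
    stieltjes_sum hs1 (fun k => axisDecay_cuspForm hU k) _ hr]

theorem stieltjes_pdx_axis_S (hs : 0 < s.re) (hU : IsVVCuspForm n α s U) (j : Fin μ) {ζ : ℝ}
    (hζ : 0 < ζ) :
    stieltjes s s (fun y => pdx (fun w => U w j) (y * I)) ζ = -(ζ : ℂ) ^ (-2 * s) *
      ∑ k, rho n α ModularGroup.S j k *
        stieltjes s s (fun y => pdx (fun w => U w k) (y * I)) (ζ⁻¹ : ℝ) := by
  have hr : 0 < ((ζ⁻¹ : ℝ) : ℂ).re := by rw [ofReal_re]; positivity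
  have e : 2 * s - s - 2 = s - 2 := by ring
  rw [stieltjes_inv _ _ _ hζ, e,
    stieltjes_congr fun y hy => (cuspForm_pdx_axis_S hU hy j).trans
      (by rw [neg_eq_neg_one_mul]), stieltjes_sq_mul,
    stieltjes_sum hs.le (fun k => axisDecay_pdx_cuspForm hU k) _ hr]
  ring

theorem eq_zero_of_Ptrans_eq_zero (hs : 0 < s.re) (hU : IsVVCuspForm n α s U)
    (h : ∀ ζ : ℝ, 0 < ζ → ∀ i, Ptrans s (fun w => U w i) ζ = 0) (j : Fin μ) {z : ℂ}
    (hz : z ∈ UH) : U z j = 0 := by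
  have hs1 : 0 < (s + 1).re := by simp; linarith
  have hs0 : s ≠ 0 := fun h => by simp [h] at hs
  set O : Fin μ → ℝ → ℂ := fun i ζ => stieltjes (s + 1) s (fun y => U (y * I) i) ζ
  set E : Fin μ → ℝ → ℂ := fun i ζ => stieltjes s s (fun y => pdx (fun w => U w i) (y * I)) ζ
  have h1 : ∀ i, ∀ ζ : ℝ, 0 < ζ → 2 * s * ζ * O i ζ - E i ζ = 0 := fun i ζ hζ => by
    rw [← h ζ hζ i, Ptrans_eq hs (axisDecay_cuspForm hU i) (axisDecay_pdx_cuspForm hU i) hζ]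
  have h2 : ∀ i, ∀ ζ : ℝ, 0 < ζ → 2 * s * ζ * O i ζ + E i ζ = 0 := fun i ζ hζ => by
    have hζc : (ζ : ℂ) ≠ 0 := by exact_mod_cast hζ.ne'
    have e1 : O i ζ = (ζ : ℂ) ^ (-2 * (s + 1)) * ∑ k, rho n α ModularGroup.S i k * O k ζ⁻¹ :=
      stieltjes_axis_S hs hU i hζ
    have e2 : E i ζ = -(ζ : ℂ) ^ (-2 * s) * ∑ k, rho n α ModularGroup.S i k * E k ζ⁻¹ :=
      stieltjes_pdx_axis_S hs hU i hζ
    have e3 : (ζ : ℂ) ^ (-2 * (s + 1)) = (ζ : ℂ) ^ (-2 * s) * (ζ : ℂ)⁻¹ ^ 2 := by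
      rw [show -2 * (s + 1) = -2 * s - 2 by ring, cpow_sub _ _ hζc, cpow_ofNat, inv_pow,
        div_eq_mul_inv]
    have e4 : ∑ k, rho n α ModularGroup.S i k * (2 * s * (ζ⁻¹ : ℝ) * O k ζ⁻¹ - E k ζ⁻¹) = 0 :=
      Finset.sum_eq_zero fun k _ => by rw [h1 k ζ⁻¹ (by positivity), mul_zero]
    have e5 : 2 * s * (ζ⁻¹ : ℝ) * ∑ k, rho n α ModularGroup.S i k * O k ζ⁻¹ =
        ∑ k, rho n α ModularGroup.S i k * E k ζ⁻¹ := by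
      rw [← sub_eq_zero, ← e4, Finset.mul_sum, ← Finset.sum_sub_distrib]
      exact Finset.sum_congr rfl fun k _ => by ring
    rw [e1, e2, e3, ← e5]
    push_cast
    field_simp
    ring
  have hO : ∀ y : ℝ, 0 < y → U (y * I) j = 0 :=
    stieltjes_eq_zero hs1 (axisDecay_cuspForm hU j) fun ζ hζ => by
      have : 2 * s * ζ * O j ζ = 0 := by linear_combination (h1 j ζ hζ + h2 j ζ hζ) / 2
      have hζc : (ζ : ℂ) ≠ 0 := by exact_mod_cast hζ.ne'
      simpa [hs0, hζc] using this
  have hE : ∀ y : ℝ, 0 < y → pdx (fun w => U w j) (y * I) = 0 :=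
    stieltjes_eq_zero hs (axisDecay_pdx_cuspForm hU j) fun ζ hζ => by
      linear_combination (h2 j ζ hζ - h1 j ζ hζ) / 2
  exact (isEigen_cuspForm hU j).eq_zero_of_axis hO hE z hz

theorem eq_of_Ptrans_eq (hs : 0 < s.re) (hU : IsVVCuspForm n α s U) (hV : IsVVCuspForm n α s V)
    (h : ∀ ζ : ℝ, 0 < ζ → ∀ i, Ptrans s (fun w => U w i) ζ = Ptrans s (fun w => V w i) ζ)
    {z : ℂ} (hz : z ∈ UH) : U z = V z := by
  funext j
  rw [← sub_eq_zero]
  refine eq_zero_of_Ptrans_eq_zero hs (cuspForm_sub hU hV) (fun ζ hζ i => ?_) j hz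
  rw [← sub_eq_zero.2 (h ζ hζ i), Ptrans, Ptrans, Ptrans, ← integral_sub
    (integrableOn_Ptrans hs (axisDecay_cuspForm hU i) (axisDecay_pdx_cuspForm hU i) hζ)
    (integrableOn_Ptrans hs (axisDecay_cuspForm hV i) (axisDecay_pdx_cuspForm hV i) hζ)]
  refine setIntegral_congr_fun measurableSet_Ioi fun y hy => ?_
  rw [pdx_sub (hU.analytic i) (hV.analytic i) (by simpa using hy)]
  ring

theorem analyticOnNhd_Ptrans (hs : 0 < s.re) (hU : IsVVCuspForm n α s U) (i : Fin μ) :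
    AnalyticOnNhd ℝ (fun ζ => Ptrans s (fun w => U w i) ζ) (Ioi 0) := by
  have hs1 : 0 ≤ (s + 1).re := by simp; linarith
  refine analyticOnNhd_of_differentiableOn
    (F := fun ζ => 2 * s * ζ * stieltjes (s + 1) s (fun y => U (y * I) i) ζ -
      stieltjes s s (fun y => pdx (fun w => U w i) (y * I)) ζ) ?_ fun ζ hζ =>
    Ptrans_eq hs (axisDecay_cuspForm hU i) (axisDecay_pdx_cuspForm hU i) hζ
  exact (DifferentiableOn.mul (by fun_prop)
    (differentiableOn_stieltjes hs1 (axisDecay_cuspForm hU i))).sub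
    (differentiableOn_stieltjes hs.le (axisDecay_pdx_cuspForm hU i))

theorem Ptrans_grow_zero (hs : 0 < s.re) (hU : IsVVCuspForm n α s U) (i : Fin μ) :
    ∃ K ε : ℝ, 0 < ε ∧ ∀ ζ : ℝ, 0 < ζ → ζ < ε →
      ‖Ptrans s (fun w => U w i) ζ‖ ≤ K * ζ ^ (max 0 (-2 * s.re)) := by
  have hs1 : 0 ≤ (s + 1).re := by simp; linarith
  obtain ⟨K₁, h₁⟩ := norm_stieltjes_le_const (axisDecay_cuspForm hU i) (s + 1) s hs1
  obtain ⟨K₂, h₂⟩ := norm_stieltjes_le_const (axisDecay_pdx_cuspForm hU i) s s hs.le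
  refine ⟨‖2 * s‖ * 1 * K₁ + K₂, 1, one_pos, fun ζ hζ hζ1 => ?_⟩
  rw [max_eq_left (by linarith), Real.rpow_zero, mul_one,
    Ptrans_eq hs (axisDecay_cuspForm hU i) (axisDecay_pdx_cuspForm hU i) hζ]
  refine (norm_sub_le _ _).trans (add_le_add ?_ (h₂ ζ hζ))
  rw [norm_mul, norm_mul, norm_real, Real.norm_of_nonneg hζ.le]
  gcongr
  exact h₁ ζ hζ

theorem Ptrans_grow_infty (hs : 0 < s.re) (hU : IsVVCuspForm n α s U) (i : Fin μ) :
    ∃ K T : ℝ, ∀ ζ : ℝ, T ≤ ζ → 0 < ζ →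
      ‖Ptrans s (fun w => U w i) ζ‖ ≤ K * ζ ^ (min 0 (-2 * s.re)) := by
  have hs1 : 0 ≤ (s + 1).re := by simp; linarith
  obtain ⟨K₁, h₁⟩ := norm_stieltjes_le (s := s) hs1 (axisDecay_cuspForm hU i)
  obtain ⟨K₂, h₂⟩ := norm_stieltjes_le (s := s) hs.le (axisDecay_pdx_cuspForm hU i)
  refine ⟨‖2 * s‖ * |K₁| + K₂, 1, fun ζ hT hζ => ?_⟩
  rw [min_eq_right (by linarith),
    Ptrans_eq hs (axisDecay_cuspForm hU i) (axisDecay_pdx_cuspForm hU i) hζ, add_mul]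
  refine (norm_sub_le _ _).trans (add_le_add ?_ (h₂ ζ hζ))
  rw [norm_mul, norm_mul, norm_real, Real.norm_of_nonneg hζ.le]
  have h3 : ζ * ζ ^ (-2 * (s + 1).re) ≤ ζ ^ (-2 * s.re) := by
    nth_rw 1 [← Real.rpow_one ζ]
    rw [← Real.rpow_add hζ]
    exact Real.rpow_le_rpow_of_exponent_le hT (by simp; linarith)
  calc _ ≤ ‖2 * s‖ * ζ * (|K₁| * ζ ^ (-2 * (s + 1).re)) := by
        gcongr; exact (h₁ ζ hζ).trans (by gcongr; exact le_abs_self _)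
    _ = ‖2 * s‖ * |K₁| * (ζ * ζ ^ (-2 * (s + 1).re)) := by ring
    _ ≤ _ := by gcongr

end Inversion

end Period

namespace Period
open Set Filter Topology Metric

/-- The Green form of two functions on the upper half-plane; it is closed if both are
eigenfunctions of the Laplacian with the same eigenvalue. -/
def greenForm (u v : ℂ → ℂ) (z : ℂ) : ℂ →L[ℝ] ℂ :=
  v z • (fderiv ℝ u z).comp (ContinuousLinearMap.mul ℝ ℂ I) -
    u z • (fderiv ℝ v z).comp (ContinuousLinearMap.mul ℝ ℂ I)

theorem greenForm_apply (u v : ℂ → ℂ) (z w : ℂ) :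
    greenForm u v z w = v z * fderiv ℝ u z (I * w) - u z * fderiv ℝ v z (I * w) := by
  simp [greenForm]

theorem snd_fderiv_apply_eq {f : ℂ → ℂ} {z : ℂ} (h : AnalyticOnNhd ℝ f UH) (hz : z ∈ UH)
    (a b : ℂ) : fderiv ℝ (fderiv ℝ f) z a b =
      a.re * b.re * pdx (pdx f) z + (a.re * b.im + a.im * b.re) * pdx (pdy f) z +
        a.im * b.im * pdy (pdy f) z := by
  have hs := (h z hz).contDiffAt.isSymmSndFDerivAt_of_omega 1 I
  have h1 : pdx (pdy f) z = fderiv ℝ (fderiv ℝ f) z 1 I := by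
    rw [pdx_congr hz (g := fun z => fderiv ℝ f z I)
      fun w hw => pdy_eq_fderiv (h w hw).differentiableAt]
    exact pdx_of_hasFDerivAt ((hasFDerivAt_fderiv h hz).clm_apply (hasFDerivAt_const I z)) |>.trans
      (by simp)
  rw [pdx_pdx_eq h hz, pdy_pdy_eq h hz, h1]
  have ha : a = a.re • (1 : ℂ) + a.im • I := by simp [re_add_im]
  have hb : b = b.re • (1 : ℂ) + b.im • I := by simp [re_add_im]
  set D := fderiv ℝ (fderiv ℝ f) z
  have e1 : D a b = D (a.re • (1 : ℂ) + a.im • I) (b.re • (1 : ℂ) + b.im • I) := by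
    rw [← ha, ← hb]
  rw [e1]
  simp only [map_add, map_smul, add_apply, smul_apply]
  rw [← hs]
  simp only [real_smul]
  ring

theorem exists_primitive_greenForm {l : ℂ} {u v : ℂ → ℂ} (hu : IsEigen l u) (hv : IsEigen l v) :
    ∃ F : ℂ → ℂ, ∀ z ∈ UH, HasFDerivAt F (greenForm u v z) z := by
  have hd : ∀ z ∈ UH, DifferentiableAt ℝ (greenForm u v) z := by
    intro z hz
    have h1 := (hu.analytic z hz).differentiableAt
    have h2 := (hv.analytic z hz).differentiableAt
    have h3 := (hasFDerivAt_fderiv hu.analytic hz).differentiableAt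
    have h4 := (hasFDerivAt_fderiv hv.analytic hz).differentiableAt
    exact (h2.fun_smul (h3.clm_comp (differentiableAt_const _))).fun_sub
      (h1.fun_smul (h4.clm_comp (differentiableAt_const _)))
  refine Convex.exists_forall_hasFDerivAt_of_fderiv_symmetric (convex_halfSpace_im_gt 0)
    isOpen_UH (fun z hz => (hd z hz).differentiableWithinAt) fun z hz x y => ?_
  have key : ∀ x y : ℂ, fderiv ℝ (greenForm u v) z x y =
      fderiv ℝ v z x * fderiv ℝ u z (I * y) + v z * fderiv ℝ (fderiv ℝ u) z x (I * y) -
      (fderiv ℝ u z x * fderiv ℝ v z (I * y) + u z * fderiv ℝ (fderiv ℝ v) z x (I * y)) := by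
    intro x y
    have h1 := (hu.analytic z hz).differentiableAt.hasFDerivAt
    have h2 := (hv.analytic z hz).differentiableAt.hasFDerivAt
    have h3 := (hasFDerivAt_fderiv hu.analytic hz).clm_apply (hasFDerivAt_const (I * y) z)
    have h4 := (hasFDerivAt_fderiv hv.analytic hz).clm_apply (hasFDerivAt_const (I * y) z)
    have h5 := (hd z hz).hasFDerivAt.clm_apply (hasFDerivAt_const y z)
    have h6 := (h2.fun_mul h3).fun_sub (h1.fun_mul h4)
    have h7 := h5.unique (h6.congr_of_eventuallyEq (Eventually.of_forall fun w =>
      greenForm_apply u v w y))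
    have h8 := DFunLike.congr_fun h7 x
    simp only [ContinuousLinearMap.comp_zero, zero_add, ContinuousLinearMap.flip_apply,
      add_apply, _root_.sub_apply, smul_apply, smul_eq_mul] at h8
    rw [h8]; ring
  rw [key, key]
  simp only [fderiv_apply_eq hu.analytic hz, fderiv_apply_eq hv.analytic hz,
    snd_fderiv_apply_eq hu.analytic hz, snd_fderiv_apply_eq hv.analytic hz, mul_re, mul_im, I_re,
    I_im, zero_mul, one_mul, zero_sub, zero_add, ofReal_neg, hu.eqn z hz, hv.eqn z hz]
  ring

theorem greenForm_congr {u v u' v' : ℂ → ℂ} (hu : EqOn u u' UH) (hv : EqOn v v' UH) {z : ℂ}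
    (hz : z ∈ UH) : greenForm u v z = greenForm u' v' z := by
  have h1 : u =ᶠ[𝓝 z] u' := hu.eventuallyEq_of_mem (isOpen_UH.mem_nhds hz)
  have h2 : v =ᶠ[𝓝 z] v' := hv.eventuallyEq_of_mem (isOpen_UH.mem_nhds hz)
  rw [greenForm, greenForm, h1.fderiv_eq, h2.fderiv_eq, hu hz, hv hz]

theorem hasFDerivAt_greenForm_comp {u v F g : ℂ → ℂ} {g' z : ℂ}
    (hu : DifferentiableAt ℝ u (g z)) (hv : DifferentiableAt ℝ v (g z))
    (hF : HasFDerivAt F (greenForm u v (g z)) (g z)) (hg : HasDerivAt g g' z) :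
    HasFDerivAt (fun w => F (g w)) (greenForm (fun w => u (g w)) (fun w => v (g w)) z) z := by
  have h := hasFDerivAt_comp_conformal hF.differentiableAt hg
  rw [hF.fderiv] at h
  refine h.congr_fderiv ?_
  ext1 w
  rw [greenForm_apply, (hasFDerivAt_comp_conformal hu hg).fderiv,
    (hasFDerivAt_comp_conformal hv hg).fderiv]
  simp only [ContinuousLinearMap.comp_apply, ContinuousLinearMap.coe_restrictScalars',
    ContinuousLinearMap.toSpanSingleton_apply, greenForm_apply, smul_eq_mul]
  simp only [mul_assoc, mul_left_comm]

theorem tendsto_greenForm_horizontal {u v F : ℂ → ℂ} {B K T : ℝ} {e : ℝ} (he : |e| ≤ 1)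
    (hB : 0 ≤ B)
    (hu : ∀ z ∈ UH, T ≤ z.im → ‖u z‖ ≤ K * z.im⁻¹ ∧ ‖fderiv ℝ u z I‖ ≤ K * z.im⁻¹)
    (hv : ∀ z : ℂ, 1 ≤ z.im → ‖v z‖ ≤ B ∧ ‖fderiv ℝ v z I‖ ≤ B)
    (hF : ∀ z ∈ UH, HasFDerivAt F (greenForm u v z) z) :
    Tendsto (fun τ : ℝ => F (τ * I + e) - F (τ * I)) atTop (𝓝 0) := by
  have h0 : Tendsto (fun τ : ℝ => 2 * B * K * τ⁻¹) atTop (𝓝 0) := by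
    simpa using tendsto_inv_atTop_zero.const_mul (2 * B * K)
  refine squeeze_zero_norm' ?_ h0
  filter_upwards [eventually_ge_atTop (max 1 T)] with τ hτ
  have h1 : 1 ≤ τ := (le_max_left _ _).trans hτ
  have h2 : T ≤ τ := (le_max_right _ _).trans hτ
  have him : ∀ t : ℝ, (τ * I + (t : ℂ) * e : ℂ).im = τ := fun t => by simp
  have hmem : ∀ t : ℝ, (τ * I + (t : ℂ) * e : ℂ) ∈ UH := fun t => by
    simp only [mem_ofPred_eq, him]; linarith
  have hder : ∀ t : ℝ, HasDerivAt (fun t : ℝ => F (τ * I + (t : ℂ) * e))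
      (greenForm u v (τ * I + (t : ℂ) * e) e) t := fun t => by
    have hc : HasDerivAt (fun t : ℝ => (τ * I + (t : ℂ) * e : ℂ)) e t := by
      simpa using ((hasDerivAt_id t).ofReal_comp.mul_const (e : ℂ)).const_add (τ * I : ℂ)
    exact (hF _ (hmem t)).comp_hasDerivAt t hc
  have hb : ∀ t : ℝ, ‖greenForm u v (τ * I + (t : ℂ) * e) e‖ ≤ 2 * B * K * τ⁻¹ := fun t => by
    have e1 : (I * (e : ℂ)) = e • I := by rw [real_smul, mul_comm]
    have hu' := hu _ (hmem t) (by rw [him]; exact h2)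
    have hv' := hv _ (by rw [him]; exact h1 : 1 ≤ (τ * I + (t : ℂ) * e : ℂ).im)
    rw [him] at hu'
    have hKτ : 0 ≤ K * τ⁻¹ := (norm_nonneg _).trans hu'.1
    rw [greenForm_apply, e1, map_smul, map_smul]
    refine (norm_sub_le _ _).trans ?_
    rw [norm_mul, norm_mul, norm_smul, norm_smul, Real.norm_eq_abs]
    calc _ ≤ B * (1 * (K * τ⁻¹)) + (K * τ⁻¹) * (1 * B) := by
          gcongr
          exacts [hv'.1, hu'.2, hu'.1, hv'.2]
      _ = _ := by ring
  have := norm_image_sub_le_of_norm_deriv_le_segment_01'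
    (f := fun t : ℝ => F (τ * I + (t : ℂ) * e)) (fun t _ => (hder t).hasDerivWithinAt)
    (fun t _ => hb t)
  simpa using this

theorem tendsto_intervalIntegral_inv {f : ℝ → ℂ} (hf : IntegrableOn f (Ioi 0)) :
    Tendsto (fun τ : ℝ => ∫ y in τ⁻¹..τ, f y) atTop (𝓝 (∫ y in Ioi 0, f y)) := by
  set g := indicator (Ioi 0) f
  have hg : Integrable g := (integrable_indicator_iff measurableSet_Ioi).2 hf
  have hi : ∀ a b, IntervalIntegrable g volume a b := fun a b => hg.intervalIntegrable
  have h1 : Tendsto (fun τ : ℝ => ∫ y in (0 : ℝ)..τ, g y) atTop (𝓝 (∫ y in Ioi 0, g y)) :=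
    intervalIntegral_tendsto_integral_Ioi 0 hg.integrableOn tendsto_id
  have h2 : Tendsto (fun τ : ℝ => ∫ y in (0 : ℝ)..τ⁻¹, g y) atTop (𝓝 0) := by
    have := ((intervalIntegral.continuous_primitive hi 0).tendsto 0).comp tendsto_inv_atTop_zero
    rw [intervalIntegral.integral_same] at this
    exact this
  have h3 : ∫ y in Ioi 0, g y = ∫ y in Ioi 0, f y :=
    setIntegral_congr_fun measurableSet_Ioi fun y hy => indicator_of_mem hy f
  have h4 := h1.sub h2
  rw [sub_zero, h3] at h4
  refine h4.congr' ?_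
  filter_upwards [eventually_gt_atTop 0] with τ hτ
  rw [intervalIntegral.integral_interval_sub_left (hi _ _) (hi _ _)]
  refine intervalIntegral.integral_congr fun y hy => ?_
  have hy0 : y ∈ Ioi (0 : ℝ) := lt_of_lt_of_le (lt_min (inv_pos.2 hτ) hτ) hy.1
  exact indicator_of_mem hy0 f

section ThreeTerm
variable {n μ : ℕ} {α : Fin μ → SL2} {s : ℂ} {U : ℂ → Fin μ → ℂ}

theorem hasFDerivAt_sum_cuspForm (hU : IsVVCuspForm n α s U) (r : Fin μ → ℂ) {z : ℂ}
    (hz : z ∈ UH) : HasFDerivAt (fun z => ∑ k, r k * U z k)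
      (∑ k, r k • fderiv ℝ (fun w => U w k) z) z :=
  HasFDerivAt.fun_sum fun k _ => (hU.analytic k z hz).differentiableAt.hasFDerivAt.const_mul _

theorem greenForm_sum_apply (hU : IsVVCuspForm n α s U) (r : Fin μ → ℂ) (c : ℂ) (ζ : ℝ) {z : ℂ}
    (hz : z ∈ UH) : greenForm (fun z => ∑ k, r k * U z k) (fun z => c * Rpow s ζ z) z I =
      c * ∑ k, r k * (U z k * pdx (Rpow s ζ) z - Rpow s ζ z * pdx (fun w => U w k) z) := by
  have h1 := (analyticOnNhd_Rpow s ζ z hz).differentiableAt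
  rw [greenForm_apply, (hasFDerivAt_sum_cuspForm hU r hz).fderiv,
    (h1.hasFDerivAt.const_mul c).fderiv, I_mul_I, map_neg, map_neg, pdx_eq_fderiv h1]
  have e1 : ∀ k, pdx (fun w => U w k) z = fderiv ℝ (fun w => U w k) z 1 := fun k =>
    pdx_eq_fderiv (hU.analytic k z hz).differentiableAt
  simp only [_root_.sum_apply, smul_apply, smul_eq_mul, e1]
  have e2 : ∑ k, r k * (U z k * fderiv ℝ (Rpow s ζ) z 1 -
      Rpow s ζ z * fderiv ℝ (fun w => U w k) z 1) = (∑ k, r k * U z k) * fderiv ℝ (Rpow s ζ) z 1 -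
      Rpow s ζ z * ∑ k, r k * fderiv ℝ (fun w => U w k) z 1 := by
    rw [Finset.sum_mul, Finset.mul_sum, ← Finset.sum_sub_distrib]
    exact Finset.sum_congr rfl fun k _ => by ring
  rw [e2]
  ring

theorem tendsto_primitive_axis (hs : 0 < s.re) (hU : IsVVCuspForm n α s U) (r : Fin μ → ℂ)
    (c : ℂ) {ζ : ℝ} (hζ : 0 < ζ) {G : ℂ → ℂ} (hG : ∀ z ∈ UH, HasFDerivAt G
      (greenForm (fun z => ∑ k, r k * U z k) (fun z => c * Rpow s ζ z) z) z) :
    Tendsto (fun τ : ℝ => G (τ * I) - G ((τ⁻¹ : ℝ) * I)) atTop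
      (𝓝 (c * ∑ k, r k * Ptrans s (fun w => U w k) ζ)) := by
  set f : ℝ → ℂ := fun y => c * ∑ k, r k * (U (y * I) k * pdx (Rpow s ζ) (y * I) -
    Rpow s ζ (y * I) * pdx (fun w => U w k) (y * I))
  have hi : ∀ k, IntegrableOn (fun y : ℝ => r k * (U (y * I) k * pdx (Rpow s ζ) (y * I) -
      Rpow s ζ (y * I) * pdx (fun w => U w k) (y * I))) (Ioi 0) := fun k =>
    (integrableOn_Ptrans hs (axisDecay_cuspForm hU k) (axisDecay_pdx_cuspForm hU k) hζ).const_mul _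
  have hf : IntegrableOn f (Ioi 0) :=
    (integrable_finsetSum (f := fun k (y : ℝ) => r k * (U (y * I) k * pdx (Rpow s ζ) (y * I) -
      Rpow s ζ (y * I) * pdx (fun w => U w k) (y * I))) Finset.univ fun k _ => hi k).const_mul c
  have hInt : ∫ y in Ioi 0, f y = c * ∑ k, r k * Ptrans s (fun w => U w k) ζ := by
    rw [integral_const_mul, integral_finsetSum _ fun k _ => hi k]
    simp only [integral_const_mul, Ptrans]
  rw [← hInt]
  refine (tendsto_intervalIntegral_inv hf).congr' ?_
  filter_upwards [eventually_gt_atTop 0] with τ hτ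
  have hpos : ∀ y ∈ uIcc τ⁻¹ τ, 0 < y := fun y hy =>
    lt_of_lt_of_le (lt_min (inv_pos.2 hτ) hτ) hy.1
  refine intervalIntegral.integral_eq_sub_of_hasDerivAt (f := fun y : ℝ => G (y * I))
    (fun y hy => ?_) ?_
  · have hz : (y * I : ℂ) ∈ UH := by simpa using hpos y hy
    have hc : HasDerivAt (fun y : ℝ => (y * I : ℂ)) I y := by
      simpa using (hasDerivAt_id y).ofReal_comp.mul_const I
    refine ((hG _ hz).comp_hasDerivAt y hc).congr_deriv ?_
    rw [greenForm_sum_apply hU r c ζ hz]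
  · rw [intervalIntegrable_iff]
    exact hf.mono_set fun y hy => hpos y (uIoc_subset_uIcc hy)

theorem tendsto_primitive_horizontal (hs : 0 < s.re) (hU : IsVVCuspForm n α s U) (r : Fin μ → ℂ)
    (c : ℂ) (ζ : ℝ) {G : ℂ → ℂ} (hG : ∀ z ∈ UH, HasFDerivAt G
      (greenForm (fun z => ∑ k, r k * U z k) (fun z => c * Rpow s ζ z) z) z) {e : ℝ}
    (he : |e| ≤ 1) : Tendsto (fun τ : ℝ => G (τ * I + e) - G (τ * I)) atTop (𝓝 0) := by
  choose K₁ T₁ h₁ using fun k => hU.decay k (-1)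
  choose K₂ T₂ h₂ using fun k => (isEigen_cuspForm hU k).cuspDecay_grad (hU.decay k) (-1)
  refine tendsto_greenForm_horizontal (B := ‖c‖ * (1 + 3 * ‖s‖))
    (K := ∑ k, ‖r k‖ * (|K₁ k| + |K₂ k|)) (T := ∑ k, (|T₁ k| + |T₂ k|)) he (by positivity)
    (fun z hz hT => ?_) (fun z hz => ?_) hG
  · have hTk : ∀ k, |T₁ k| + |T₂ k| ≤ z.im := fun k =>
      (Finset.single_le_sum (f := fun k => |T₁ k| + |T₂ k|) (fun _ _ => by positivity)
        (Finset.mem_univ k)).trans hT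
    have hz0 : 0 < z.im := hz
    have ha : ∀ k, ‖U z k‖ ≤ (|K₁ k| + |K₂ k|) * z.im⁻¹ := fun k => by
      have : T₁ k ≤ z.im := by linarith [hTk k, le_abs_self (T₁ k), abs_nonneg (T₂ k)]
      refine (h₁ k z hz this).trans ?_
      rw [Real.rpow_neg_one]
      gcongr
      linarith [le_abs_self (K₁ k), abs_nonneg (K₂ k)]
    have hb : ∀ k, ‖fderiv ℝ (fun w => U w k) z I‖ ≤ (|K₁ k| + |K₂ k|) * z.im⁻¹ := fun k => by
      have : T₂ k ≤ z.im := by linarith [hTk k, le_abs_self (T₂ k), abs_nonneg (T₁ k)]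
      rw [← pdy_eq_fderiv (hU.analytic k z hz).differentiableAt]
      refine (h₂ k z hz this).2.trans ?_
      rw [Real.rpow_neg_one]
      gcongr
      linarith [le_abs_self (K₂ k), abs_nonneg (K₁ k)]
    rw [(hasFDerivAt_sum_cuspForm hU r hz).fderiv]
    simp only [_root_.sum_apply, smul_apply, smul_eq_mul, Finset.sum_mul]
    constructor <;> refine (norm_sum_le _ _).trans (Finset.sum_le_sum fun k _ => ?_) <;>
      rw [norm_mul, mul_assoc]
    · exact mul_le_mul_of_nonneg_left (ha k) (norm_nonneg _)
    · exact mul_le_mul_of_nonneg_left (hb k) (norm_nonneg _)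
  · have hz0 : z ∈ UH := by simp only [mem_ofPred_eq]; linarith
    have h1 := (analyticOnNhd_Rpow s ζ z hz0).differentiableAt
    rw [(h1.hasFDerivAt.const_mul c).fderiv]
    simp only [smul_apply, smul_eq_mul, norm_mul, ← pdy_eq_fderiv h1]
    have h2 := norm_Rpow_le (ζ := ζ) hs.le hz
    have h3 := norm_pdy_Rpow_le (ζ := ζ) hs.le hz
    constructor <;> refine mul_le_mul_of_nonneg_left ?_ (norm_nonneg _)
    · linarith [norm_nonneg s]
    · linarith

end ThreeTerm

theorem Rfun_eq (ζ : ℝ) (z : ℂ) : Rfun ζ z = z.im / normSq (z - ζ) := by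
  rw [Rfun, normSq_apply]
  simp [sq]

theorem Rpow_moebius {s z w d : ℂ} {ζ ζ' e : ℝ} (he : 0 < e) (hz : z ∈ UH) (hd : d ≠ 0)
    (him : w.im = z.im / normSq d) (hw : w - ζ = e * (z - ζ') / d) :
    Rpow s ζ w = (e : ℂ) ^ (-(2 * s)) * Rpow s ζ' z := by
  have hec : (e : ℂ) ≠ 0 := by exact_mod_cast he.ne'
  have hR : Rfun ζ w = (e⁻¹ * e⁻¹) * Rfun ζ' z := by
    rw [Rfun_eq, Rfun_eq, hw, him, map_div₀, normSq_mul, normSq_ofReal]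
    have := (normSq_pos.2 hd).ne'
    field_simp
  rw [Rpow, Rpow, hR, ofReal_mul, mul_cpow_ofReal_nonneg (by positivity) (Rfun_pos hz).le,
    ofReal_mul, mul_cpow_ofReal_nonneg (by positivity) (by positivity), ofReal_inv, inv_cpow,
    ← cpow_neg, ← cpow_add _ _ hec]
  · ring_nf
  · rw [arg_ofReal_of_nonneg he.le]; exact Real.pi_pos.ne

theorem Rpow_sub_one (s : ℂ) (ζ : ℝ) (z : ℂ) : Rpow s ζ (z - 1) = Rpow s (ζ + 1) z := by
  have : Rfun ζ (z - 1) = Rfun (ζ + 1) z := by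
    rw [Rfun_eq, Rfun_eq]; simp [sub_sub, add_comm]
  rw [Rpow, Rpow, this]

theorem Rpow_neg_inv (s : ℂ) {ζ : ℝ} (hζ : 0 < ζ) {z : ℂ} (hz : z ∈ UH) :
    Rpow s ζ (-z⁻¹) = (ζ : ℂ) ^ (-(2 * s)) * Rpow s (-ζ⁻¹) z := by
  have hz0 : z ≠ 0 := fun h => by simp [h] at hz
  have hζc : (ζ : ℂ) ≠ 0 := by exact_mod_cast hζ.ne'
  refine Rpow_moebius hζ hz (neg_ne_zero.2 hz0) (by simp [neg_div]) ?_
  push_cast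
  field_simp
  ring

theorem one_sub_ne_zero_of_mem_UH {z : ℂ} (hz : z ∈ UH) : 1 - z ≠ 0 := fun h => by
  rw [sub_eq_zero] at h; simp [← h] at hz

theorem im_div_one_sub (z : ℂ) : (z / (1 - z)).im = z.im / normSq (1 - z) := by
  rw [div_im]
  simp only [sub_re, sub_im, one_re, one_im]
  ring

theorem Rpow_div_one_sub (s : ℂ) {ζ : ℝ} (hζ : 0 < ζ) {z : ℂ} (hz : z ∈ UH) :
    Rpow s ζ (z / (1 - z)) = ((ζ + 1 : ℝ) : ℂ) ^ (-(2 * s)) * Rpow s (ζ / (ζ + 1)) z := by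
  have h1 := one_sub_ne_zero_of_mem_UH hz
  have hζc : (ζ + 1 : ℂ) ≠ 0 := by exact_mod_cast (by positivity : ζ + 1 ≠ 0)
  refine Rpow_moebius (by positivity) hz h1 (im_div_one_sub z) ?_
  push_cast
  field_simp
  ring

theorem hasFDerivAt_greenForm_moebius {n μ : ℕ} {α : Fin μ → SL2} {s : ℂ} {U : ℂ → Fin μ → ℂ}
    (hU : IsVVCuspForm n α s U) (i : Fin μ) {ζ : ℝ} {F : ℂ → ℂ}
    (hF : ∀ z ∈ UH, HasFDerivAt F (greenForm (fun w => U w i) (Rpow s ζ) z) z)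
    (g : ℂ → ℂ) (γ : SL2) (c : ℂ) (ζ' : ℝ) (hg : ∀ z ∈ UH, moeb γ z = g z)
    (hm : ∀ z ∈ UH, g z ∈ UH) (hd : ∀ z ∈ UH, DifferentiableAt ℂ g z)
    (hR : ∀ z ∈ UH, Rpow s ζ (g z) = c * Rpow s ζ' z) {z : ℂ} (hz : z ∈ UH) :
    HasFDerivAt (fun w => F (g w))
      (greenForm (fun z => ∑ k, rho n α γ i k * U z k) (fun z => c * Rpow s ζ' z) z) z := by
  have e1 : EqOn (fun z => ∑ k, rho n α γ i k * U z k) (fun w => U (g w) i) UH := fun w hw => by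
    have := hU.equivar γ w hw i
    rw [hg w hw] at this
    exact this.symm
  have e2 : EqOn (fun z => c * Rpow s ζ' z) (fun w => Rpow s ζ (g w)) UH := fun w hw =>
    (hR w hw).symm
  rw [greenForm_congr e1 e2 hz]
  have d1 : DifferentiableAt ℝ (fun w => U w i) (g z) :=
    (hU.analytic i _ (hm z hz)).differentiableAt
  have d2 : DifferentiableAt ℝ (Rpow s ζ) (g z) :=
    (analyticOnNhd_Rpow s ζ _ (hm z hz)).differentiableAt
  have d3 : HasFDerivAt F (greenForm (fun w => U w i) (Rpow s ζ) (g z)) (g z) := hF _ (hm z hz)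
  exact hasFDerivAt_greenForm_comp (u := fun w => U w i) (v := Rpow s ζ) (F := F) (g := g)
    d1 d2 d3 (hd z hz).hasDerivAt

theorem div_one_sub_mem_UH {z : ℂ} (hz : z ∈ UH) : z / (1 - z) ∈ UH := by
  have h1 : 0 < z.im := hz
  have h2 := normSq_pos.2 (one_sub_ne_zero_of_mem_UH hz)
  simp only [mem_ofPred_eq, im_div_one_sub]
  positivity

theorem ne_zero_of_mem_UH {z : ℂ} (hz : z ∈ UH) : z ≠ 0 := fun h => by simp [h] at hz

theorem moeb_T_inv_mul_S {z : ℂ} (hz : z ∈ UH) :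
    moeb (Tmat⁻¹ * ModularGroup.S : SL2) z = -z⁻¹ - 1 := by
  have h0 := ne_zero_of_mem_UH hz
  rw [Matrix.SpecialLinearGroup.coe_mul, coe_T_inv]
  simp [moeb, ModularGroup.S, Matrix.mul_apply, Fin.sum_univ_two]
  field_simp
  ring

theorem Ptrans_three_term {n μ : ℕ} {α : Fin μ → SL2} {s : ℂ} {U : ℂ → Fin μ → ℂ}
    (hrep : IsCosetReps n α) (hs : 0 < s.re) (hU : IsVVCuspForm n α s U) {ζ : ℝ} (hζ : 0 < ζ)
    (i : Fin μ) : Ptrans s (fun w => U w i) ζ =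
      ∑ k, rho n α Tmat⁻¹ i k * Ptrans s (fun w => U w k) (ζ + 1) +
        ((ζ + 1 : ℝ) : ℂ) ^ (-(2 * s)) *
          ∑ k, rho n α Tmat'⁻¹ i k * Ptrans s (fun w => U w k) (ζ / (ζ + 1)) := by
  obtain ⟨F, hF⟩ := exists_primitive_greenForm (isEigen_cuspForm hU i) (isEigen_Rpow s ζ)
  have hcomp := hasFDerivAt_greenForm_moebius hU i hF
  have mT : ∀ z ∈ UH, z - 1 ∈ UH := fun z hz => by simpa using hz
  have hζ1 : 0 < ζ + 1 := by positivity
  have hζ2 : 0 < ζ / (ζ + 1) := by positivity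
  have g1 := fun z (hz : z ∈ UH) => hcomp (fun z => z) 1 1 ζ (fun z _ => by simp [moeb])
    (fun z hz => hz) (fun z _ => differentiableAt_id) (fun z _ => by simp) hz
  have gT := fun z (hz : z ∈ UH) => hcomp (fun z => z - 1) Tmat⁻¹ 1 (ζ + 1)
    (fun z _ => moeb_T_inv z) mT
    (fun z _ => by fun_prop) (fun z _ => by rw [Rpow_sub_one, one_mul]) hz
  have gT' := fun z (hz : z ∈ UH) => hcomp (fun z => z / (1 - z)) Tmat'⁻¹
    (((ζ + 1 : ℝ) : ℂ) ^ (-(2 * s))) (ζ / (ζ + 1))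
    (fun z _ => moeb_T'_inv z) (fun z hz => div_one_sub_mem_UH hz)
    (fun z hz => (differentiableAt_id).div (by fun_prop) (one_sub_ne_zero_of_mem_UH hz))
    (fun z hz => Rpow_div_one_sub s hζ hz) hz
  have gS := fun z (hz : z ∈ UH) => hcomp (fun z => -z⁻¹) ModularGroup.S
    ((ζ : ℂ) ^ (-(2 * s))) (-ζ⁻¹) (fun z _ => moeb_S z) (fun z hz => neg_inv_mem_UH hz)
    (fun z hz => (differentiableAt_inv (ne_zero_of_mem_UH hz)).neg)
    (fun z hz => Rpow_neg_inv s hζ hz) hz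
  have gTS := fun z (hz : z ∈ UH) => hcomp (fun z => -z⁻¹ - 1) (Tmat⁻¹ * ModularGroup.S)
    (((ζ + 1 : ℝ) : ℂ) ^ (-(2 * s))) (-(ζ + 1)⁻¹)
    (fun z hz => moeb_T_inv_mul_S hz) (fun z hz => mT _ (neg_inv_mem_UH hz))
    (fun z hz => (differentiableAt_inv (ne_zero_of_mem_UH hz)).neg.sub_const 1) (fun z hz => by
      rw [Rpow_sub_one]; exact Rpow_neg_inv s hζ1 hz) hz
  have l1 := tendsto_primitive_axis hs hU _ _ hζ g1
  have lT := tendsto_primitive_axis hs hU _ _ hζ1 gT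
  have lT' := tendsto_primitive_axis hs hU _ _ hζ2 gT'
  have h1 := tendsto_primitive_horizontal hs hU _ _ _ g1 (e := -1) (by norm_num)
  have hS := tendsto_primitive_horizontal hs hU _ _ _ gS (e := 1) (by norm_num)
  have hTS := tendsto_primitive_horizontal hs hU _ _ _ gTS (e := -1) (by norm_num)
  have hsum := ((l1.sub lT).sub lT').add ((h1.sub hS).add hTS)
  have key := tendsto_nhds_unique (hsum.congr' (f₂ := fun _ => 0) ?_) tendsto_const_nhds
  · rw [rho_one hrep] at key
    simp only [Matrix.one_apply, ite_mul, one_mul, zero_mul, Finset.sum_ite_eq, Finset.mem_univ,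
      if_true, sub_zero, add_zero] at key
    linear_combination key
  · filter_upwards [eventually_gt_atTop 1] with τ hτ
    have hτ0 : (τ : ℂ) ≠ 0 := by exact_mod_cast (by linarith : τ ≠ 0)
    have n0 : (τ * I : ℂ) ∈ UH := by simp; linarith
    have n1 : (τ * I + 1 : ℂ) ≠ 0 := ne_zero_of_mem_UH (by simp; linarith)
    have n2 : (1 - τ * I : ℂ) ≠ 0 := one_sub_ne_zero_of_mem_UH n0
    have n3 : (τ * I - 1 : ℂ) ≠ 0 := by rw [← neg_sub]; exact neg_ne_zero.2 n2
    have n4 : (1 - (τ : ℂ)⁻¹ * I : ℂ) ≠ 0 :=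
      one_sub_ne_zero_of_mem_UH (by simp only [mem_ofPred_eq, ← ofReal_inv]; simp; linarith)
    have e0 : -(τ * I : ℂ)⁻¹ = (τ : ℂ)⁻¹ * I := by rw [mul_inv, inv_I]; ring
    have e1 : (τ : ℂ)⁻¹ * I / (1 - (τ : ℂ)⁻¹ * I) = -(τ * I + 1 : ℂ)⁻¹ := by
      rw [div_eq_iff n4]
      field_simp
      linear_combination τ * I_sq
    have e2 : (τ * I : ℂ) / (1 - τ * I) = -(τ * I - 1 : ℂ)⁻¹ - 1 := by
      rw [div_eq_iff n2]
      field_simp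
      ring
    push_cast
    rw [← sub_eq_add_neg, e0, e1, e2]
    ring

end Period

namespace Period
open Set Filter Topology Metric

section PeriodData
variable {E : Type*} [NormedAddCommGroup E] [NormedSpace ℂ E]

theorem exists_holomorphic_extension [CompleteSpace E] {f : ℝ → E} {x : ℝ}
    (hf : AnalyticAt ℝ f x) : ∃ r > 0, ∃ F : ℂ → E, DifferentiableOn ℂ F (ball (x : ℂ) r) ∧
      ∀ t : ℝ, (t : ℂ) ∈ ball (x : ℂ) r → F t = f t := by
  obtain ⟨p, R, hp⟩ := hf
  obtain ⟨r, hr0, hrR⟩ := ENNReal.lt_iff_exists_nnreal_btwn.1 hp.r_pos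
  have hr : (0 : ℝ) < r := by exact_mod_cast hr0
  have hsum := p.summable_norm_mul_pow (hrR.trans_le hp.r_le)
  refine ⟨r, hr, fun z => ∑' n : ℕ, (z - x) ^ n • p.coeff n, ?_, fun t ht => ?_⟩
  · refine differentiableOn_tsum_of_summable_norm hsum (fun n => by fun_prop) isOpen_ball
      fun n z hz => ?_
    rw [norm_smul, norm_pow, p.norm_apply_eq_norm_coef, mul_comm]
    gcongr
    exact (mem_ball_iff_norm.1 hz).le
  · have h1 : t - x ∈ eball (0 : ℝ) R := by
      rw [mem_ball, dist_eq, ← ofReal_sub, norm_real] at ht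
      rw [mem_eball, edist_zero_right, ← ofReal_norm]
      refine lt_trans ?_ hrR
      rw [ENNReal.ofReal_lt_coe_iff]
      exacts [ht, norm_nonneg _]
    have h2 := hp.hasSum h1
    rw [add_sub_cancel] at h2
    rw [← h2.tsum_eq]
    refine tsum_congr fun n => ?_
    rw [p.apply_eq_pow_smul_coeff, ← ofReal_sub, ← ofReal_pow, coe_smul]

/-- Vector valued functions satisfying the three-term relation, abstracting from the
representation. -/
structure PeriodData (A B : E →L[ℂ] E) (N : ℕ) (s : ℂ) (ψ : ℝ → E) : Prop where
  N_pos : 0 < N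
  re_pos : 0 < s.re
  A_pow : A ^ N = 1
  B_pow : B ^ N = 1
  local_ext : ∀ x : ℝ, 0 < x → ∃ r > 0, ∃ F : ℂ → E, DifferentiableOn ℂ F (ball (x : ℂ) r) ∧
      ∀ t : ℝ, (t : ℂ) ∈ ball (x : ℂ) r → F t = ψ t
  three : ∀ x : ℝ, 0 < x →
    ψ x = A (ψ (x + 1)) + ((x + 1 : ℝ) : ℂ) ^ (-(2 * s)) • B (ψ (x / (x + 1)))
  bound : ∃ K, ∀ x : ℝ, 0 < x → ‖ψ x‖ ≤ K ∧ ‖ψ x‖ ≤ K * x ^ (-(2 * s.re))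

/-- The involution `ψ ↦ ζ^{-2s} ψ(1/ζ)`. -/
def dualFn (s : ℂ) (ψ : ℝ → E) (x : ℝ) : E := (x : ℂ) ^ (-(2 * s)) • ψ x⁻¹

theorem norm_ofReal_cpow_neg_two {x : ℝ} (hx : 0 < x) (s : ℂ) :
    ‖(x : ℂ) ^ (-(2 * s))‖ = x ^ (-(2 * s.re)) := by
  rw [norm_cpow_eq_rpow_re_of_pos hx]; simp

theorem inv_mem_of_mem_ball {x r : ℝ} (hx : 0 < x) (hr : 0 < r) : ∃ r' > 0, ∀ z : ℂ,
    z ∈ ball (x : ℂ) r' → z⁻¹ ∈ ball ((x⁻¹ : ℝ) : ℂ) r ∧ 0 < z.re := by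
  have h1 : ContinuousAt (fun z : ℂ => z⁻¹) x :=
    continuousAt_inv₀ (by exact_mod_cast hx.ne')
  have h2 : ∀ᶠ z : ℂ in 𝓝 (x : ℂ), z⁻¹ ∈ ball ((x⁻¹ : ℝ) : ℂ) r := by
    refine h1 ?_
    rw [ofReal_inv]
    exact ball_mem_nhds _ hr
  have h3 : ∀ᶠ z : ℂ in 𝓝 (x : ℂ), 0 < z.re :=
    isOpen_re_pos.mem_nhds (by simpa using hx)
  exact Metric.mem_nhds_iff.1 (h2.and h3)

theorem PeriodData.dual {A B : E →L[ℂ] E} {N : ℕ} {s : ℂ} {ψ : ℝ → E}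
    (h : PeriodData A B N s ψ) : PeriodData B A N s (dualFn s ψ) where
  N_pos := h.N_pos
  re_pos := h.re_pos
  A_pow := h.B_pow
  B_pow := h.A_pow
  local_ext x hx := by
    obtain ⟨r, hr, F, hF, hFψ⟩ := h.local_ext x⁻¹ (inv_pos.2 hx)
    obtain ⟨r', hr', hb⟩ := inv_mem_of_mem_ball hx hr
    refine ⟨r', hr', fun z => z ^ (-(2 * s)) • F z⁻¹, fun z hz => ?_, fun t ht => ?_⟩
    · have h0 : z ≠ 0 := fun h0 => by simpa [h0] using (hb z hz).2
      refine DifferentiableAt.differentiableWithinAt (DifferentiableAt.smul ?_ ?_)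
      · exact differentiableAt_id.cpow_const (Or.inl (hb z hz).2)
      · exact ((hF _ (hb z hz).1).differentiableAt (isOpen_ball.mem_nhds (hb z hz).1)).comp z
          (differentiableAt_inv h0)
    · have := (hb _ ht).1
      rw [← ofReal_inv] at this
      simp only [dualFn]
      rw [← ofReal_inv, hFψ _ this]
  three x hx := by
    have hx1 : 0 < x + 1 := by positivity
    have e1 : x⁻¹ + 1 = (x / (x + 1))⁻¹ := by field_simp; ring
    have e2 : x⁻¹ / (x⁻¹ + 1) = (x + 1)⁻¹ := by field_simp; ring
    have e3 : (x : ℂ) ^ (-(2 * s)) * ((x⁻¹ + 1 : ℝ) : ℂ) ^ (-(2 * s)) =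
        ((x + 1 : ℝ) : ℂ) ^ (-(2 * s)) := by
      rw [← mul_cpow_ofReal_nonneg hx.le (by positivity), ← ofReal_mul]
      congr 2
      field_simp
      ring
    have e4 : ((x + 1 : ℝ) : ℂ) ^ (-(2 * s)) * ((x / (x + 1) : ℝ) : ℂ) ^ (-(2 * s)) =
        (x : ℂ) ^ (-(2 * s)) := by
      rw [← mul_cpow_ofReal_nonneg hx1.le (by positivity), ← ofReal_mul]
      congr 2
      field_simp
    simp only [dualFn, map_smul]
    rw [h.three x⁻¹ (inv_pos.2 hx), smul_add, smul_smul, smul_smul, e3, e4, e2, e1, add_comm]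
  bound := by
    obtain ⟨K, hK⟩ := h.bound
    refine ⟨K, fun x hx => ?_⟩
    have h1 := hK x⁻¹ (inv_pos.2 hx)
    have h2 : 0 < x ^ (-(2 * s.re)) := Real.rpow_pos_of_pos hx _
    rw [dualFn, norm_smul, norm_ofReal_cpow_neg_two hx, mul_comm]
    constructor
    · refine (mul_le_mul_of_nonneg_right h1.2 h2.le).trans_eq ?_
      rw [Real.inv_rpow hx.le, mul_assoc, inv_mul_cancel₀ h2.ne', mul_one]
    · exact mul_le_mul_of_nonneg_right h1.1 h2.le

theorem eq_pow_apply_add_sum {A : E →L[ℂ] E} {f h : ℝ → E} {R c : ℝ} (hc : 0 ≤ c)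
    (hf : ∀ x, R < x → f x = A (f (x + c)) + h x) (m : ℕ) {x : ℝ} (hx : R < x) :
    f x = (A ^ m) (f (x + m * c)) + ∑ j ∈ Finset.range m, (A ^ j) (h (x + j * c)) := by
  induction m with
  | zero => simp
  | succ m ih =>
    have hxm : R < x + m * c := by have : 0 ≤ m * c := by positivity
                                   linarith
    rw [Finset.sum_range_succ, ih]
    conv_lhs => rw [hf _ hxm, map_add]
    rw [pow_succ, mul_apply_eq_comp]
    have : x + m * c + c = x + (m + 1 : ℕ) * c := by push_cast; ring
    rw [this]
    abel

theorem PeriodData.exists_germ {A B : E →L[ℂ] E} {N : ℕ} {s : ℂ} {ψ : ℝ → E}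
    (h : PeriodData A B N s ψ) : ∃ r > 0, ∃ K : ℂ → E, DifferentiableOn ℂ K (ball 0 r) ∧
      ∀ x : ℝ, r⁻¹ < x → ψ x = ψ (x + N) + (x : ℂ) ^ (-(2 * s)) • K (x : ℂ)⁻¹ := by
  obtain ⟨r₁, hr₁, F, hF, hFψ⟩ := h.local_ext 1 one_pos
  have hev : ∀ᶠ w : ℂ in 𝓝 0, ∀ m ∈ Finset.range N, 0 < (1 + (m + 1 : ℂ) * w).re ∧
      (1 + m * w) / (1 + (m + 1 : ℂ) * w) ∈ ball ((1 : ℝ) : ℂ) r₁ := by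
    rw [Filter.eventually_all_finset]
    intro m _
    refine Filter.Eventually.and ?_ ?_
    · have : Continuous fun w : ℂ => (1 + (m + 1 : ℂ) * w).re := by fun_prop
      exact this.continuousAt.eventually (lt_mem_nhds (by simp))
    · have : ContinuousAt (fun w : ℂ => (1 + m * w) / (1 + (m + 1 : ℂ) * w)) 0 :=
        ContinuousAt.div (by fun_prop) (by fun_prop) (by simp)
      refine this.eventually (isOpen_ball.mem_nhds (by simpa using hr₁))
  obtain ⟨r, hr, hb⟩ := Metric.mem_nhds_iff.1 hev
  refine ⟨r, hr, fun w => ∑ m ∈ Finset.range N, (1 + (m + 1 : ℂ) * w) ^ (-(2 * s)) •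
    (A ^ m) (B (F ((1 + m * w) / (1 + (m + 1 : ℂ) * w)))), ?_, fun x hx => ?_⟩
  · refine DifferentiableOn.fun_sum fun m hm w hw => ?_
    obtain ⟨h1, h2⟩ := hb hw m hm
    have h3 : 1 + (m + 1 : ℂ) * w ≠ 0 := fun h0 => by simp [h0] at h1
    refine DifferentiableAt.differentiableWithinAt (DifferentiableAt.smul ?_ ?_)
    · exact DifferentiableAt.cpow_const (by fun_prop) (Or.inl h1)
    · have h4 : DifferentiableAt ℂ (fun w : ℂ => (1 + m * w) / (1 + (m + 1 : ℂ) * w)) w :=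
        DifferentiableAt.div (by fun_prop) (by fun_prop) h3
      have h5 := ((hF _ h2).differentiableAt (isOpen_ball.mem_nhds h2)).comp w h4
      exact ((A ^ m).differentiableAt.comp _ B.differentiableAt).comp w h5
  · have hx0 : 0 < x := (inv_pos.2 hr).trans hx
    have hxc : (x : ℂ) ≠ 0 := by exact_mod_cast hx0.ne'
    have hw : (x : ℂ)⁻¹ ∈ ball (0 : ℂ) r := by
      rw [mem_ball_zero_iff, norm_inv, norm_real, Real.norm_of_nonneg hx0.le]
      exact inv_lt_of_inv_lt₀ hr hx
    have key := eq_pow_apply_add_sum (c := 1) zero_le_one h.three N hx0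
    rw [h.A_pow, mul_one, one_apply_eq_self] at key
    rw [key, Finset.smul_sum]
    congr 1
    refine Finset.sum_congr rfl fun m hm => ?_
    have hm2 := (hb hw m hm).2
    have e1 : (1 + m * (x : ℂ)⁻¹) / (1 + (m + 1 : ℂ) * (x : ℂ)⁻¹) =
        (((x + m * 1) / (x + m * 1 + 1) : ℝ) : ℂ) := by
      have : (x + m + 1 : ℂ) ≠ 0 := by exact_mod_cast (by positivity : x + m + 1 ≠ 0)
      have h2 : (x + (m + 1) : ℂ) ≠ 0 := by rwa [← add_assoc]
      push_cast
      rw [mul_one]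
      field_simp
      rw [add_assoc]
    have e2 : (x : ℂ) ^ (-(2 * s)) * (1 + (m + 1 : ℂ) * (x : ℂ)⁻¹) ^ (-(2 * s)) =
        ((x + m * 1 + 1 : ℝ) : ℂ) ^ (-(2 * s)) := by
      have : (1 + (m + 1 : ℂ) * (x : ℂ)⁻¹) = ((1 + (m + 1) * x⁻¹ : ℝ) : ℂ) := by push_cast; ring
      rw [this, ← mul_cpow_ofReal_nonneg hx0.le (by positivity), ← ofReal_mul]
      congr 2
      field_simp
      ring
    rw [e1] at hm2
    rw [smul_smul, e2, e1, hFψ _ hm2, map_smul]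

theorem PeriodData.germ_zero {A B : E →L[ℂ] E} {N : ℕ} {s : ℂ} {ψ : ℝ → E}
    (h : PeriodData A B N s ψ) {r : ℝ} (hr : 0 < r) {K : ℂ → E}
    (hK : ContinuousAt K 0) (hψ : ∀ x : ℝ, r⁻¹ < x →
      ψ x = ψ (x + N) + (x : ℂ) ^ (-(2 * s)) • K (x : ℂ)⁻¹) : K 0 = 0 := by
  obtain ⟨C, hC⟩ := h.bound
  have hr' := inv_pos.2 hr
  have hk : ∀ k : ℕ, k * ‖K 0‖ ≤ 2 * C := fun k => by
    have hlim : ∀ j : ℕ, Tendsto (fun x : ℝ => (((1 + j * N * x⁻¹ : ℝ) : ℂ) ^ (-(2 * s))) •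
        K ((x + j * N : ℝ) : ℂ)⁻¹) atTop (𝓝 ((((1 + j * N * 0 : ℝ) : ℂ) ^ (-(2 * s))) • K 0)) := by
      intro j
      refine Tendsto.smul ?_ (hK.tendsto.comp ?_)
      · have h1 : Tendsto (fun x : ℝ => (1 + j * N * x⁻¹ : ℝ)) atTop (𝓝 (1 + j * N * 0)) :=
          (tendsto_inv_atTop_zero.const_mul _).const_add _
        have h2 : ContinuousAt (fun y : ℝ => (y : ℂ) ^ (-(2 * s))) (1 + j * N * 0) :=
          (continuousAt_ofReal_cpow_const _ _ (Or.inr (by simp)))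
        exact h2.tendsto.comp h1
      · have h1 : Tendsto (fun x : ℝ => ((x + j * N)⁻¹ : ℝ)) atTop (𝓝 0) :=
          tendsto_inv_atTop_zero.comp (tendsto_atTop_add_const_right _ _ tendsto_id)
        have h2 := (continuous_ofReal.tendsto 0).comp h1
        simpa [Function.comp_def] using h2
    have hsum := tendsto_finsetSum (Finset.range k) fun j _ => hlim j
    simp only [mul_zero, add_zero, ofReal_one, one_cpow, one_smul, Finset.sum_const,
      Finset.card_range] at hsum
    have hn := hsum.norm
    rw [← Nat.cast_smul_eq_nsmul ℝ, norm_smul, Real.norm_of_nonneg k.cast_nonneg] at hn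
    refine le_of_tendsto hn ?_
    filter_upwards [eventually_gt_atTop r⁻¹] with x hx
    have hx0 : 0 < x := hr'.trans hx
    have hxc : (x : ℂ) ^ (-(2 * s)) ≠ 0 := by
      rw [Ne, cpow_eq_zero_iff, not_and_or]; left; exact_mod_cast hx0.ne'
    have key := eq_pow_apply_add_sum (A := (1 : E →L[ℂ] E)) (c := N) N.cast_nonneg
      (f := ψ) (h := fun x => (x : ℂ) ^ (-(2 * s)) • K (x : ℂ)⁻¹) hψ k hx
    simp only [one_pow, one_apply_eq_self] at key
    have e1 : ∑ j ∈ Finset.range k, ((x + j * N : ℝ) : ℂ) ^ (-(2 * s)) • K ((x + j * N : ℝ) : ℂ)⁻¹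
        = (x : ℂ) ^ (-(2 * s)) • ∑ j ∈ Finset.range k, (((1 + j * N * x⁻¹ : ℝ) : ℂ) ^ (-(2 * s))) •
        K ((x + j * N : ℝ) : ℂ)⁻¹ := by
      rw [Finset.smul_sum]
      refine Finset.sum_congr rfl fun j _ => ?_
      rw [smul_smul, ← mul_cpow_ofReal_nonneg hx0.le (by positivity), ← ofReal_mul]
      congr 3
      field_simp
    rw [e1] at key
    set S₀ := ∑ j ∈ Finset.range k, (((1 + j * N * x⁻¹ : ℝ) : ℂ) ^ (-(2 * s))) •
        K ((x + j * N : ℝ) : ℂ)⁻¹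
    have e2 : (x : ℂ) ^ (-(2 * s)) • S₀ = ψ x - ψ (x + k * N) := by rw [key]; abel
    have h1 := (hC x hx0).2
    have hkN : (0 : ℝ) ≤ k * N := by positivity
    have h2 := (hC (x + k * N) (by linarith)).2
    have hC0 : 0 ≤ C := (norm_nonneg _).trans (hC x hx0).1
    have h3 : (x + k * N) ^ (-(2 * s.re)) ≤ x ^ (-(2 * s.re)) :=
      Real.rpow_le_rpow_of_nonpos hx0 (by linarith) (by linarith [h.re_pos])
    have h4 : ‖(x : ℂ) ^ (-(2 * s)) • S₀‖ ≤ 2 * C * x ^ (-(2 * s.re)) := by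
      rw [e2]
      have := mul_le_mul_of_nonneg_left h3 hC0
      linarith [norm_sub_le (ψ x) (ψ (x + k * N))]
    rw [norm_smul, norm_ofReal_cpow_neg_two hx0, mul_comm] at h4
    exact le_of_mul_le_mul_right h4 (Real.rpow_pos_of_pos hx0 _)
  by_contra hne
  have hpos := norm_pos_iff.2 hne
  obtain ⟨k, hk'⟩ := exists_nat_gt (2 * C / ‖K 0‖)
  rw [div_lt_iff₀ hpos] at hk'
  linarith [hk k]

end PeriodData
end Period

namespace Period
open Set Filter Topology Metric

section Sector

/-- The part of the sector `|arg z| < 5π/6` outside the disc of radius `R`. -/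
def sect (R : ℝ) : Set ℂ := {z | R < ‖z‖ ∧ |arg z| < 5 * Real.pi / 6}

theorem sect_ne_zero {R : ℝ} (hR : 0 ≤ R) {z : ℂ} (hz : z ∈ sect R) : z ≠ 0 :=
  norm_pos_iff.1 (hR.trans_lt hz.1)

theorem sect_subset_slitPlane {R : ℝ} (hR : 0 ≤ R) : sect R ⊆ slitPlane := fun z hz => by
  rw [mem_slitPlane_iff_arg]
  refine ⟨fun h => ?_, sect_ne_zero hR hz⟩
  have := hz.2
  rw [h, abs_of_pos Real.pi_pos] at this
  linarith [Real.pi_pos]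

theorem isOpen_sect {R : ℝ} (hR : 0 ≤ R) : IsOpen (sect R) := by
  have h1 : IsOpen (slitPlane ∩ (fun z => |arg z|) ⁻¹' Iio (5 * Real.pi / 6)) :=
    ContinuousOn.isOpen_inter_preimage
      (fun z hz => ((continuousAt_arg hz).abs).continuousWithinAt) isOpen_slitPlane isOpen_Iio
  have h2 : IsOpen {z : ℂ | R < ‖z‖} := isOpen_lt continuous_const continuous_norm
  convert h1.inter h2 using 1
  ext z
  constructor
  · exact fun h => ⟨⟨sect_subset_slitPlane hR h, h.2⟩, h.1⟩
  · exact fun h => ⟨h.2, h.1.2⟩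

theorem isPreconnected_sect {R : ℝ} (hR : 0 < R) : IsPreconnected (sect R) := by
  have h1 : sect R = exp '' {w : ℂ | Real.log R < w.re ∧ |w.im| < 5 * Real.pi / 6} := by
    ext z
    constructor
    · intro h
      have h0 := sect_ne_zero hR.le h
      refine ⟨log z, ⟨?_, ?_⟩, exp_log h0⟩
      · rw [log_re]; exact Real.log_lt_log hR h.1
      · rw [log_im]; exact h.2
    · rintro ⟨w, ⟨h2, h3⟩, rfl⟩
      have h4 := abs_lt.1 h3
      have : arg (exp w) = w.im := by
        rw [← log_im, log_exp (by linarith [Real.pi_pos]) (by linarith [Real.pi_pos])]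
      refine ⟨?_, by rwa [this]⟩
      rw [norm_exp, ← Real.exp_log hR]
      exact Real.exp_lt_exp.2 h2
  rw [h1]
  refine IsPreconnected.image (Convex.isPreconnected ?_) _ continuous_exp.continuousOn
  have h2 : Convex ℝ {w : ℂ | Real.log R < w.re} := convex_halfSpace_re_gt _
  have h3 := (convex_halfSpace_im_lt (5 * Real.pi / 6)).inter
    (convex_halfSpace_im_gt (-(5 * Real.pi / 6)))
  have h4 : {w : ℂ | Real.log R < w.re ∧ |w.im| < 5 * Real.pi / 6} =
      {w | Real.log R < w.re} ∩ ({w | w.im < 5 * Real.pi / 6} ∩ {w | -(5 * Real.pi / 6) <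
        w.im}) := by
    ext w
    exact ⟨fun h => ⟨h.1, (abs_lt.1 h.2).2, (abs_lt.1 h.2).1⟩,
      fun h => ⟨h.1, abs_lt.2 ⟨h.2.2, h.2.1⟩⟩⟩
  rw [h4]
  exact h2.inter h3

theorem ofReal_mem_sect {R x : ℝ} (hR : 0 ≤ R) (hx : R < x) : (x : ℂ) ∈ sect R := by
  have h0 : 0 < x := hR.trans_lt hx
  refine ⟨by rwa [norm_real, Real.norm_of_nonneg h0.le], ?_⟩
  rw [arg_ofReal_of_nonneg h0.le, abs_zero]
  positivity

theorem norm_add_le_of_arg {z : ℂ} (hz : |arg z| ≤ 5 * Real.pi / 6) {t : ℝ} (ht : 0 ≤ t) :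
    ‖z‖ + t ≤ 4 * ‖z + t‖ := by
  have h1 : -(7 / 8) * ‖z‖ ≤ z.re := by
    rw [← norm_mul_cos_arg z, mul_comm]
    refine mul_le_mul_of_nonneg_left ?_ (norm_nonneg z)
    rw [← Real.cos_abs]
    have h2 : Real.cos (5 * Real.pi / 6) ≤ Real.cos |arg z| :=
      Real.cos_le_cos_of_nonneg_of_le_pi (abs_nonneg _) (by linarith [Real.pi_pos]) hz
    have h3 : Real.cos (5 * Real.pi / 6) = -(√3 / 2) := by
      rw [show 5 * Real.pi / 6 = Real.pi - Real.pi / 6 by ring, Real.cos_pi_sub,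
        Real.cos_pi_div_six]
    have h4 : √3 ≤ 7 / 4 := by
      rw [Real.sqrt_le_left (by norm_num)]; norm_num
    linarith
  have h2 : ‖z + t‖ ^ 2 = ‖z‖ ^ 2 + 2 * t * z.re + t ^ 2 := by
    rw [← normSq_eq_norm_sq, ← normSq_eq_norm_sq, normSq_apply, normSq_apply]
    simp
    ring
  have hz0 := norm_nonneg z
  refine le_of_sq_le_sq ?_ (by positivity)
  rw [mul_pow, h2]
  nlinarith [sq_nonneg (‖z‖ - t), mul_nonneg hz0 ht, mul_le_mul_of_nonneg_left h1 ht]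

theorem add_ofReal_mem_slitPlane {z : ℂ} (hz : z ∈ slitPlane) {t : ℝ} (ht : 0 ≤ t) :
    z + t ∈ slitPlane := by
  rw [mem_slitPlane_iff] at *
  rcases hz with h | h
  · left; simp; linarith
  · right; simpa using h

end Sector

theorem sum_add_rpow_le {q a : ℝ} (hq : 0 < q) (ha : 1 ≤ a) (n : ℕ) :
    ∑ j ∈ Finset.range n, (a + j) ^ (-(q + 1)) ≤ (1 + 1 / q) * a ^ (-q) := by
  have ha0 : 0 < a := by linarith
  have hanti : ∀ m : ℕ, ∑ i ∈ Finset.range m, (a + (i + 1 : ℕ)) ^ (-(q + 1)) ≤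
    1 / q * a ^ (-q) := by
    intro m
    have h1 : AntitoneOn (fun x : ℝ => x ^ (-(q + 1))) (Icc a (a + m)) := fun x hx y _ hxy =>
      Real.rpow_le_rpow_of_nonpos (by linarith [hx.1]) hxy (by linarith)
    refine h1.sum_le_integral.trans ?_
    have h0 : (0 : ℝ) ∉ uIcc a (a + m) := by
      rw [uIcc_of_le (by have : (0 : ℝ) ≤ m := m.cast_nonneg
                         linarith)]
      exact fun h => by linarith [h.1]
    rw [integral_rpow (Or.inr ⟨by linarith, h0⟩)]
    have e1 : -(q + 1) + 1 = -q := by ring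
    rw [e1, div_neg, neg_div', div_le_iff₀ hq]
    have h2 : 0 ≤ (a + m) ^ (-q) := by positivity
    have h3 : 1 / q * a ^ (-q) * q = a ^ (-q) := by field_simp
    rw [h3]
    linarith
  cases n with
  | zero => simp; positivity
  | succ n =>
    rw [Finset.sum_range_succ']
    have h1 := hanti n
    have h2 : (a + (0 : ℕ)) ^ (-(q + 1)) ≤ a ^ (-q) := by
      rw [Nat.cast_zero, add_zero]
      exact Real.rpow_le_rpow_of_exponent_le ha (by linarith)
    rw [add_mul, one_mul, add_comm]
    exact add_le_add h2 h1

section Infinity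
variable {E : Type*} [NormedAddCommGroup E] [NormedSpace ℂ E]

theorem exists_norm_le_of_zero {K : ℂ → E} {r : ℝ} (hr : 0 < r)
    (hK : DifferentiableOn ℂ K (ball 0 r)) (h0 : K 0 = 0) :
    ∃ C ≥ 0, ∃ δ > 0, δ ≤ 1 ∧ δ ≤ r ∧ ∀ w ∈ ball (0 : ℂ) δ, ‖K w‖ ≤ C * ‖w‖ := by
  have hd : DifferentiableAt ℂ K 0 := (hK 0 (mem_ball_self hr)).differentiableAt
    (ball_mem_nhds _ hr)
  obtain ⟨C, hC, h1⟩ := hd.isBigO_sub.exists_nonneg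
  obtain ⟨δ, hδ, h2⟩ := Metric.eventually_nhds_iff_ball.1 h1.bound
  refine ⟨C, hC, min δ (min 1 r), by positivity, by simp, by simp, fun w hw => ?_⟩
  have := h2 w (ball_subset_ball (min_le_left _ _) hw)
  simpa [h0] using this

variable [CompleteSpace E] {A B : E →L[ℂ] E} {N : ℕ} {s : ℂ} {ψ : ℝ → E}

theorem PeriodData.exists_infty (h : PeriodData A B N s ψ) : ∃ R ≥ 1, ∃ F : ℂ → E, ∃ C,
    DifferentiableOn ℂ F (sect R) ∧ (∀ x : ℝ, R < x → F x = ψ x) ∧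
      ∀ z ∈ sect R, ‖F z‖ ≤ C * ‖z‖ ^ (-(2 * s.re)) := by
  obtain ⟨r, hr, K, hK, hψ⟩ := h.exists_germ
  have hK0 : K 0 = 0 := h.germ_zero hr
    ((hK 0 (mem_ball_self hr)).differentiableAt (ball_mem_nhds _ hr)).continuousAt hψ
  obtain ⟨C, hC, δ, hδ, hδ1, hδr, hb⟩ := exists_norm_le_of_zero hr hK hK0
  set q := 2 * s.re with hq
  have hq0 : 0 < q := by have := h.re_pos; positivity
  set H : ℂ → E := fun z => z ^ (-(2 * s)) • K z⁻¹ with hH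
  have hinv : ∀ z : ℂ, δ⁻¹ < ‖z‖ → z⁻¹ ∈ ball (0 : ℂ) δ := fun z hz => by
    rw [mem_ball_zero_iff, norm_inv]
    exact inv_lt_of_inv_lt₀ hδ hz
  have hHd : ∀ z ∈ slitPlane, δ⁻¹ < ‖z‖ → DifferentiableAt ℂ H z := fun z hz hzn => by
    have hz0 := slitPlane_ne_zero hz
    have h1 := hinv z hzn
    refine DifferentiableAt.smul ?_ ?_
    · exact differentiableAt_id.cpow_const hz
    · exact ((hK.mono (ball_subset_ball hδr) _ h1).differentiableAt (isOpen_ball.mem_nhds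
        h1)).comp z
        (differentiableAt_inv hz0)
  set M := Real.exp (Real.pi * |(2 * s).im|) with hM
  have hHb : ∀ z : ℂ, δ⁻¹ < ‖z‖ → ‖H z‖ ≤ M * C * ‖z‖ ^ (-(q + 1)) := fun z hzn => by
    have hn : 0 < ‖z‖ := (inv_pos.2 hδ).trans hzn
    have h1 := hb _ (hinv z hzn)
    have h2 := norm_cpow_neg_le (a := 2 * s) hn le_rfl (by simpa using h.re_pos.le)
    have h3 : (2 * s).re = q := by simp [hq]
    rw [h3] at h2
    rw [hH, norm_smul, neg_add, Real.rpow_add hn, Real.rpow_neg_one]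
    rw [norm_inv] at h1
    refine (mul_le_mul h2 h1 (norm_nonneg _) (by positivity)).trans_eq (by ring)
  set R := 4 * δ⁻¹ with hR
  have hδi : 1 ≤ δ⁻¹ := (one_le_inv₀ hδ).2 hδ1
  have hR1 : 1 ≤ R := by linarith
  have hR0 : 0 ≤ R := by linarith
  have hN1 : (1 : ℝ) ≤ N := by exact_mod_cast h.N_pos
  have hshift : ∀ z ∈ sect R, ∀ j : ℕ, (‖z‖ + j) / 4 ≤ ‖z + (j * N : ℝ)‖ := fun z hz j => by
    have h1 := norm_add_le_of_arg hz.2.le (t := j * N) (by positivity)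
    have h2 : (j : ℝ) ≤ j * N := le_mul_of_one_le_right j.cast_nonneg hN1
    linarith
  have hlarge : ∀ z ∈ sect R, ∀ j : ℕ, δ⁻¹ < ‖z + (j * N : ℝ)‖ := fun z hz j => by
    have h1 := hshift z hz j
    have h2 : (0 : ℝ) ≤ j := j.cast_nonneg
    have h3 := hz.1
    linarith
  set M' := M * C * 4⁻¹ ^ (-(q + 1)) with hM'
  have hM0 : 0 ≤ M' := by positivity
  have hterm : ∀ z ∈ sect R, ∀ j : ℕ, ‖H (z + (j * N : ℝ))‖ ≤ M' * (‖z‖ + j) ^ (-(q + 1)) := by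
    intro z hz j
    refine (hHb _ (hlarge z hz j)).trans ?_
    have hp : 0 < ‖z‖ + j := by
      have := hz.1
      have h2 : (0 : ℝ) ≤ j := j.cast_nonneg
      linarith
    rw [hM', mul_assoc _ (4⁻¹ ^ _), ← Real.mul_rpow (by norm_num) hp.le]
    refine mul_le_mul_of_nonneg_left ?_ (by positivity)
    refine Real.rpow_le_rpow_of_nonpos (by positivity) ?_ (by linarith)
    have := hshift z hz j
    linarith
  have hbase : ∀ a : ℝ, 1 ≤ a → Summable fun j : ℕ => M' * (a + j) ^ (-(q + 1)) := fun a ha =>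
    (summable_of_sum_range_le (fun j => by positivity) (sum_add_rpow_le hq0 ha)).mul_left _
  refine ⟨R, hR1, fun z => ∑' j : ℕ, H (z + (j * N : ℝ)), M' * (1 + 1 / q), ?_, ?_, ?_⟩
  · refine differentiableOn_tsum_of_summable_norm (hbase R hR1) (fun j z hz => ?_)
      (isOpen_sect hR0) fun j z hz => ?_
    · have := hHd _ (add_ofReal_mem_slitPlane (sect_subset_slitPlane hR0 hz)
        (by positivity : (0 : ℝ) ≤ j * N)) (hlarge z hz j)
      exact (DifferentiableAt.comp (g := H) (f := fun z => z + ((j * N : ℝ) : ℂ)) z this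
        (by fun_prop)).differentiableWithinAt
    · refine (hterm z hz j).trans (mul_le_mul_of_nonneg_left ?_ hM0)
      refine Real.rpow_le_rpow_of_nonpos (by positivity) ?_ (by linarith)
      linarith [hz.1]
  · intro x hx
    have hx0 : 0 < x := by linarith
    have hxs := ofReal_mem_sect hR0 hx
    have hx1 : 1 ≤ ‖(x : ℂ)‖ := hR1.trans hxs.1.le
    have hs : Summable fun j : ℕ => H (x + (j * N : ℝ)) :=
      Summable.of_norm_bounded (hbase _ hx1) (hterm _ hxs)
    have h1 := hs.hasSum.tendsto_sum_nat
    obtain ⟨C₀, hC₀⟩ := h.bound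
    have h2 : Tendsto (fun k : ℕ => ψ (x + k * N)) atTop (𝓝 0) := by
      have h3 : Tendsto (fun k : ℕ => C₀ * (x + k * N) ^ (-q)) atTop (𝓝 0) := by
        have h4 : Tendsto (fun k : ℕ => x + k * N) atTop (atTop : Filter ℝ) :=
          tendsto_atTop_add_const_left _ _
            (tendsto_natCast_atTop_atTop.atTop_mul_const (by linarith : (0 : ℝ) < N))
        simpa using ((tendsto_rpow_neg_atTop hq0).comp h4).const_mul C₀
      exact squeeze_zero_norm (fun k => (hC₀ (x + k * N) (by positivity)).2) h3
    have hrx : r⁻¹ < x := by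
      have : r⁻¹ ≤ δ⁻¹ := inv_anti₀ hδ hδr
      linarith
    have h3 : ∀ k : ℕ, ∑ j ∈ Finset.range k, H (x + (j * N : ℝ)) = ψ x - ψ (x + k * N) :=
      fun k => by
      have key := eq_pow_apply_add_sum (A := (1 : E →L[ℂ] E)) (c := N) N.cast_nonneg
        (f := ψ) (h := fun x => (x : ℂ) ^ (-(2 * s)) • K (x : ℂ)⁻¹) hψ k hrx
      simp only [one_pow, one_apply_eq_self, ofReal_add] at key
      rw [key, hH]
      abel
    simp only [h3] at h1
    have h4 := h2.const_sub (ψ x)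
    rw [sub_zero] at h4
    exact tendsto_nhds_unique h1 h4
  · intro z hz
    have hz1 : 1 ≤ ‖z‖ := hR1.trans hz.1.le
    refine tsum_of_norm_bounded ((hbase _ hz1).hasSum) (hterm z hz) |>.trans ?_
    rw [tsum_mul_left, mul_assoc M']
    exact mul_le_mul_of_nonneg_left (Real.tsum_le_of_sum_range_le (fun j => by positivity)
      (sum_add_rpow_le hq0 hz1)) hM0

end Infinity
end Period

namespace Period
open Set Filter Topology Metric

section Glue
variable {E : Type*} [NormedAddCommGroup E] [NormedSpace ℂ E]

/-- `F` extends `ψ` holomorphically to a convex region `D` which retracts to the positive reals. -/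
structure IsLocalExt (ψ : ℝ → E) (D : Set ℂ) (F : ℂ → E) : Prop where
  isOpen : IsOpen D
  convex : Convex ℝ D
  re_mem : ∀ z ∈ D, (z.re : ℂ) ∈ D
  diff : DifferentiableOn ℂ F D
  eq : ∀ x : ℝ, (x : ℂ) ∈ D → F x = ψ x

theorem IsLocalExt.eqOn [CompleteSpace E] {ψ : ℝ → E} {D D' : Set ℂ} {F F' : ℂ → E}
    (h : IsLocalExt ψ D F) (h' : IsLocalExt ψ D' F') : EqOn F F' (D ∩ D') := fun z hz => by
  have hx : (z.re : ℂ) ∈ D ∩ D' := ⟨h.re_mem z hz.1, h'.re_mem z hz.2⟩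
  have ho := h.isOpen.inter h'.isOpen
  refine eqOn_of_eq_on_pos ho (h.convex.inter h'.convex).isPreconnected
    (h.diff.mono inter_subset_left) (h'.diff.mono inter_subset_right) hx ?_ hz
  filter_upwards [continuous_ofReal.continuousAt.preimage_mem_nhds (ho.mem_nhds hx)] with x hx
  rw [h.eq x hx.1, h'.eq x hx.2]

theorem exists_glue [CompleteSpace E] (ψ : ℝ → E) : ∃ Ψ : ℂ → E, ∀ D F, IsLocalExt ψ D F →
    EqOn Ψ F D := by
  classical
  refine ⟨fun z => if h : ∃ p : Set ℂ × (ℂ → E), IsLocalExt ψ p.1 p.2 ∧ z ∈ p.1 then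
    h.choose.2 z else 0, fun D F hD z hz => ?_⟩
  have h : ∃ p : Set ℂ × (ℂ → E), IsLocalExt ψ p.1 p.2 ∧ z ∈ p.1 := ⟨(D, F), hD, hz⟩
  simp only [dif_pos h]
  exact h.choose_spec.1.eqOn hD ⟨h.choose_spec.2, hz⟩

theorem dualFn_dualFn (s : ℂ) (ψ : ℝ → E) {x : ℝ} (hx : 0 < x) :
    dualFn s (dualFn s ψ) x = ψ x := by
  simp only [dualFn, inv_inv, smul_smul]
  rw [← mul_cpow_ofReal_nonneg hx.le (inv_nonneg.2 hx.le), ← ofReal_mul,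
    mul_inv_cancel₀ hx.ne', ofReal_one, one_cpow, one_smul]

theorem inv_re_gt_iff {z : ℂ} (hz : 0 < z.re) (R : ℝ) :
    R < (z⁻¹).re ↔ R * (z.re ^ 2 + z.im ^ 2) < z.re := by
  have : 0 < normSq z := normSq_pos.2 fun h => by simp [h] at hz
  rw [inv_re, lt_div_iff₀ this, normSq_apply, sq, sq]

theorem re_gt_subset_sect {R : ℝ} (hR : 0 ≤ R) {z : ℂ} (hz : R < z.re) : z ∈ sect R := by
  refine ⟨hz.trans_le (re_le_norm z), ?_⟩
  have := abs_arg_lt_pi_div_two_iff.2 (Or.inl (hR.trans_lt hz))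
  linarith [Real.pi_pos]

/-- The open wedge `|Im z| < δ Re z`. -/
def wedge (δ : ℝ) : Set ℂ := {z | |z.im| < δ * z.re}

theorem isOpen_wedge (δ : ℝ) : IsOpen (wedge δ) :=
  isOpen_lt (by fun_prop) (by fun_prop)

theorem convex_wedge (δ : ℝ) : Convex ℝ (wedge δ) := by
  intro z hz w hw a b ha hb hab
  simp only [wedge, mem_ofPred_eq] at *
  simp only [add_im, add_re, smul_re, smul_im, smul_eq_mul]
  rw [abs_lt] at *
  rcases ha.eq_or_lt with rfl | ha
  · have : b = 1 := by linarith
    subst this; simpa using hw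
  · constructor <;> nlinarith [mul_lt_mul_of_pos_left hz.1 ha, mul_lt_mul_of_pos_left hz.2 ha,
      mul_le_mul_of_nonneg_left hw.1.le hb, mul_le_mul_of_nonneg_left hw.2.le hb]

theorem re_pos_of_mem_wedge {δ : ℝ} (hδ : 0 < δ) {z : ℂ} (hz : z ∈ wedge δ) : 0 < z.re :=
  pos_of_mul_pos_right ((abs_nonneg _).trans_lt hz) hδ.le

theorem ofReal_mem_wedge {δ : ℝ} (hδ : 0 < δ) {x : ℝ} (hx : 0 < x) : (x : ℂ) ∈ wedge δ := by
  simp only [wedge, mem_ofPred_eq, ofReal_im, ofReal_re, abs_zero]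
  positivity

theorem add_one_mem_wedge {δ : ℝ} (hδ : 0 < δ) {z : ℂ} (hz : z ∈ wedge δ) : z + 1 ∈ wedge δ := by
  simp only [wedge, mem_ofPred_eq, add_im, add_re, one_im, one_re, add_zero] at *
  linarith

theorem div_add_one_re {z : ℂ} : (z / (z + 1)).re = (normSq z + z.re) / normSq (z + 1) := by
  rw [div_re, ← add_div]
  congr 1
  simp [normSq_apply]; ring

theorem div_add_one_im {z : ℂ} : (z / (z + 1)).im = z.im / normSq (z + 1) := by
  rw [div_im, ← sub_div]
  congr 1
  simp; ring

theorem div_add_one_mem_wedge {δ : ℝ} (hδ : 0 < δ) {z : ℂ} (hz : z ∈ wedge δ) :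
    z / (z + 1) ∈ wedge δ := by
  have hre := re_pos_of_mem_wedge hδ (add_one_mem_wedge hδ hz)
  have hpos : 0 < normSq (z + 1) := normSq_pos.2 fun h => by simp [h] at hre
  simp only [wedge, mem_ofPred_eq] at *
  rw [div_add_one_re, div_add_one_im, abs_div, abs_of_pos hpos, mul_div_assoc',
    div_lt_div_iff_of_pos_right hpos]
  have := mul_nonneg hδ.le (normSq_nonneg z)
  linarith

variable [CompleteSpace E] {A B : E →L[ℂ] E} {N : ℕ} {s : ℂ} {ψ : ℝ → E}

theorem PeriodData.exists_wedge (h : PeriodData A B N s ψ) : ∃ δ > 0, ∃ Ψ : ℂ → E,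
    DifferentiableOn ℂ Ψ (wedge δ) ∧ ∀ x : ℝ, 0 < x → Ψ x = ψ x := by
  obtain ⟨Ψ, hΨ⟩ := exists_glue ψ
  set W : Set ℂ := {z | ∃ D F, IsLocalExt ψ D F ∧ z ∈ D} with hW
  have hWo : IsOpen W := isOpen_iff_mem_nhds.2 fun z ⟨D, F, hD, hz⟩ =>
    mem_of_superset (hD.isOpen.mem_nhds hz) fun w hw => ⟨D, F, hD, hw⟩
  have hpos : ∀ x : ℝ, 0 < x → (x : ℂ) ∈ W := fun x hx => by
    obtain ⟨r, hr, F, hF, hFψ⟩ := h.local_ext x hx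
    refine ⟨ball x r, F, ⟨isOpen_ball, convex_ball _ _, fun z hz => ?_, hF, hFψ⟩, mem_ball_self hr⟩
    rw [mem_ball, dist_eq] at *
    refine lt_of_le_of_lt ?_ hz
    rw [← ofReal_sub, norm_real, Real.norm_eq_abs]
    simpa using abs_re_le_norm (z - x)
  obtain ⟨R, hR, F, C, hF, hFψ, -⟩ := h.exists_infty
  obtain ⟨R', hR', F', C', hF', hFψ', -⟩ := h.dual.exists_infty
  have hR0 : 0 ≤ R := by linarith
  have hR0' : 0 < R' := by linarith
  have hinf : ∀ z : ℂ, R < z.re → z ∈ W := fun z hz =>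
    ⟨{z | R < z.re}, F, ⟨isOpen_lt continuous_const continuous_re, convex_halfSpace_re_gt _,
      fun z hz => hz, hF.mono fun w hw => re_gt_subset_sect hR0 hw, fun x hx => hFψ x hx⟩, hz⟩
  have hzero : ∀ z : ℂ, 0 < z.re → |z.im| < z.re → z.re < 1 / (2 * R') → z ∈ W := by
    intro z hz h1 h2
    have hball : ∀ z : ℂ, z ∈ ball ((1 / (2 * R') : ℝ) : ℂ) (1 / (2 * R')) ↔
        R' * (z.re ^ 2 + z.im ^ 2) < z.re := fun z => by
      rw [mem_ball_iff_norm, ← sq_lt_sq₀ (norm_nonneg _) (by positivity), ← normSq_eq_norm_sq,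
        normSq_apply]
      simp only [sub_re, sub_im, ofReal_re, ofReal_im]
      constructor
      · intro h3
        have : R' * ((z.re - 1 / (2 * R')) * (z.re - 1 / (2 * R')) + (z.im - 0) * (z.im - 0))
          < R' * (1 / (2 * R')) ^ 2 := mul_lt_mul_of_pos_left h3 hR0'
        field_simp at this
        nlinarith
      · intro h3
        refine lt_of_mul_lt_mul_left (a := R') ?_ hR0'.le
        field_simp
        nlinarith
    have hre : ∀ z : ℂ, z ∈ ball ((1 / (2 * R') : ℝ) : ℂ) (1 / (2 * R')) → 0 < z.re :=
      fun z hz => by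
      have := (hball z).1 hz
      have h3 : 0 ≤ R' * (z.re ^ 2 + z.im ^ 2) := by positivity
      linarith
    refine ⟨ball ((1 / (2 * R') : ℝ) : ℂ) (1 / (2 * R')), fun z => z ^ (-(2 * s)) • F' z⁻¹,
      ⟨isOpen_ball, convex_ball _ _, fun w hw => ?_, fun w hw => ?_, fun x hx => ?_⟩, ?_⟩
    · have := (hball w).1 hw
      rw [hball]
      simp only [ofReal_re, ofReal_im]
      nlinarith [sq_nonneg w.im, mul_nonneg hR0'.le (sq_nonneg w.im)]
    · have h0 := hre w hw
      have h3 := (inv_re_gt_iff h0 R').2 ((hball w).1 hw)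
      have h4 := re_gt_subset_sect hR0'.le h3
      refine DifferentiableAt.differentiableWithinAt (DifferentiableAt.smul ?_ ?_)
      · exact differentiableAt_id.cpow_const (Or.inl h0)
      · exact ((hF' _ h4).differentiableAt ((isOpen_sect hR0'.le).mem_nhds h4)).comp w
          (differentiableAt_inv fun h => by simp [h] at h0)
    · have h0 : 0 < x := by simpa using hre x hx
      have h3 := (inv_re_gt_iff (by simpa using h0) R').2 ((hball x).1 hx)
      rw [← ofReal_inv, ofReal_re] at h3
      rw [← ofReal_inv, hFψ' _ h3]
      exact dualFn_dualFn s ψ h0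
    · rw [hball]
      have h3 : z.im ^ 2 ≤ z.re ^ 2 := sq_le_sq' (by linarith [(abs_lt.1 h1).1]) (abs_lt.1 h1).2.le
      have h4 : 2 * R' * z.re < 1 := by
        rw [lt_div_iff₀ (by positivity)] at h2; linarith
      nlinarith [mul_lt_mul_of_pos_left h4 hz]
  set a := 1 / (4 * R') with ha
  have ha0 : 0 < a := by positivity
  have hK : IsCompact ((fun x : ℝ => (x : ℂ)) '' Icc a (R + 1)) :=
    isCompact_Icc.image continuous_ofReal
  obtain ⟨δ, hδ, hsub⟩ := hK.exists_thickening_subset_open hWo (by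
    rintro _ ⟨x, hx, rfl⟩
    exact hpos x (ha0.trans_le hx.1))
  have hδ' : 0 < min 1 (δ / (R + 1)) := by positivity
  have hwW : wedge (min 1 (δ / (R + 1))) ⊆ W := fun z hz => by
    have hre := re_pos_of_mem_wedge hδ' hz
    have h1 : |z.im| < z.re := lt_of_lt_of_le hz (mul_le_of_le_one_left hre.le (min_le_left _ _))
    have h2 : |z.im| < δ / (R + 1) * z.re :=
      lt_of_lt_of_le hz (mul_le_mul_of_nonneg_right (min_le_right _ _) hre.le)
    rcases lt_or_ge R z.re with h3 | h3
    · exact hinf z h3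
    rcases lt_or_ge z.re a with h4 | h4
    · exact hzero z hre h1 (h4.trans_le (one_div_le_one_div_of_le (by positivity) (by linarith)))
    · refine hsub (mem_thickening_iff.2 ⟨z.re, ⟨z.re, ⟨h4, by linarith⟩, rfl⟩, ?_⟩)
      have h5 : z - z.re = z.im * I := by apply Complex.ext <;> simp
      rw [dist_eq, h5, norm_mul, norm_I, mul_one, norm_real, Real.norm_eq_abs]
      refine h2.trans_le ?_
      rw [div_mul_eq_mul_div, div_le_iff₀ (by positivity)]
      exact mul_le_mul_of_nonneg_left (by linarith) hδ.le
  refine ⟨_, hδ', Ψ, fun z hz => ?_, fun x hx => ?_⟩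
  · obtain ⟨D, F, hD, hzD⟩ := hwW hz
    have h1 := (hD.diff z hzD).differentiableAt (hD.isOpen.mem_nhds hzD)
    exact (h1.congr_of_eventuallyEq ((hΨ D F hD).eventuallyEq_of_mem
      (hD.isOpen.mem_nhds hzD))).differentiableWithinAt
  · obtain ⟨D, F, hD, hzD⟩ := hpos x hx
    rw [hΨ D F hD hzD, hD.eq x hzD]

end Glue
end Period

namespace Period
open Set Filter Topology Metric

section Extend
variable {E : Type*} [NormedAddCommGroup E] [NormedSpace ℂ E]

/-- The right-hand side of the three-term relation for functions on the slit plane. -/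
def threeOp (A B : E →L[ℂ] E) (s : ℂ) (f : ℂ → E) (z : ℂ) : E :=
  A (f (z + 1)) + (z + 1) ^ (-(2 * s)) • B (f (z / (z + 1)))

/-- The domains on which iterates of the three-term relation starting from a wedge make sense. -/
def slitDom (δ : ℝ) : ℕ → Set ℂ
  | 0 => wedge δ
  | k + 1 => slitPlane ∩ {z | z + 1 ∈ slitDom δ k ∧ z / (z + 1) ∈ slitDom δ k}

theorem add_one_mem_slitPlane {z : ℂ} (hz : z ∈ slitPlane) : z + 1 ∈ slitPlane := by
  simpa using add_ofReal_mem_slitPlane hz zero_le_one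

theorem slitDom_subset_slitPlane {δ : ℝ} (hδ : 0 < δ) : ∀ k, slitDom δ k ⊆ slitPlane
  | 0 => fun _ hz => Or.inl (re_pos_of_mem_wedge hδ hz)
  | _ + 1 => inter_subset_left

theorem slitDom_subset_succ {δ : ℝ} (hδ : 0 < δ) (k : ℕ) : slitDom δ k ⊆ slitDom δ (k + 1) := by
  induction k with
  | zero => exact fun z hz => ⟨slitDom_subset_slitPlane hδ 0 hz, add_one_mem_wedge hδ hz,
      div_add_one_mem_wedge hδ hz⟩
  | succ k ih => exact fun z hz => ⟨hz.1, ih hz.2.1, ih hz.2.2⟩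

theorem continuousOn_div_add_one : ContinuousOn (fun z : ℂ => z / (z + 1)) slitPlane :=
  ContinuousOn.div continuousOn_id (by fun_prop) fun _ hz =>
    slitPlane_ne_zero (add_one_mem_slitPlane hz)

theorem isOpen_slitDom (δ : ℝ) (k : ℕ) : IsOpen (slitDom δ k) := by
  induction k with
  | zero => exact isOpen_wedge δ
  | succ k ih =>
    have h1 : IsOpen (slitPlane ∩ (fun z : ℂ => z + 1) ⁻¹' slitDom δ k) :=
      isOpen_slitPlane.inter (ih.preimage (by fun_prop))
    have h2 := continuousOn_div_add_one.isOpen_inter_preimage isOpen_slitPlane ih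
    convert h1.inter h2 using 1
    ext z
    exact ⟨fun h => ⟨⟨h.1, h.2.1⟩, h.1, h.2.2⟩, fun h => ⟨h.1.1, h.1.2, h.2.2⟩⟩

theorem le_add_two_mul_add {a b κ L m : ℝ} (h : a * b = κ ^ 2 + 1) (hm : 0 < m) (ha : m ≤ a)
    (hb : m ≤ b) (hκ : -L ≤ κ) (hL : 0 ≤ L) (hmL : m * (2 * L + 2) ≤ 1) : m ≤ a + 2 * κ + b := by
  rcases le_or_gt 0 κ with h0 | h0
  · linarith
  have ha0 : 0 < a := hm.trans_le ha
  have hm1 : m ≤ 1 := by nlinarith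
  have key : (a + 2 * κ + b) * a = (κ + a) ^ 2 + 1 := by linear_combination h
  refine le_of_mul_le_mul_right ?_ ha0
  rw [key]
  rcases le_or_gt a (2 * L + 2) with h1 | h1
  · nlinarith [sq_nonneg (κ + a)]
  · nlinarith

theorem mem_slitDom {δ L m : ℝ} (hδ : 0 < δ) (hm : 0 < m) (hL : 0 ≤ L)
    (hmL : m * (2 * L + 2) ≤ 1) (k : ℕ) : ∀ z : ℂ, z.im ≠ 0 → m ≤ 1 / |z.im| →
      m ≤ normSq z / |z.im| → -L ≤ z.re / |z.im| → 1 / δ < z.re / |z.im| + k * m →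
      z ∈ slitDom δ k := by
  induction k with
  | zero =>
    intro z hz _ _ _ h
    have := abs_pos.2 hz
    rw [Nat.cast_zero, zero_mul, add_zero, div_lt_div_iff₀ hδ this] at h
    simp only [slitDom, wedge, mem_ofPred_eq]
    linarith
  | succ k ih =>
    intro z hz ha hb hκ h
    have hy := abs_pos.2 hz
    have hab : 1 / |z.im| * (normSq z / |z.im|) = (z.re / |z.im|) ^ 2 + 1 := by
      rw [normSq_apply]
      field_simp
      rw [sq_abs]
    have hsum : normSq (z + 1) / |z.im| = 1 / |z.im| + 2 * (z.re / |z.im|) + normSq z / |z.im| := by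
      rw [normSq_apply, normSq_apply]
      field_simp
      simp
      ring
    have hb' := le_add_two_mul_add hab hm ha hb hκ hL hmL
    rw [← hsum] at hb'
    have hn : 0 < normSq (z + 1) := normSq_pos.2 fun h0 => hz (by simpa using congrArg im h0)
    push_cast at h
    refine ⟨Or.inr hz, ih _ (by simpa using hz) ?_ ?_ ?_ ?_, ih _ ?_ ?_ ?_ ?_ ?_⟩
    · simpa using ha
    · simpa using hb'
    · simp only [add_re, add_im, one_re, one_im, add_zero, add_div]
      linarith [hm.trans_le ha]
    · simp only [add_re, add_im, one_re, one_im, add_zero, add_div]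
      linarith
    · rw [div_add_one_im]
      exact div_ne_zero hz hn.ne'
    · rwa [div_add_one_im, abs_div, abs_of_pos hn, one_div_div]
    · rw [div_add_one_im, abs_div, abs_of_pos hn, map_div₀, div_div_div_cancel_right₀ hn.ne']
      exact hb
    · rw [div_add_one_im, div_add_one_re, abs_div, abs_of_pos hn, div_div_div_cancel_right₀ hn.ne',
        add_div]
      linarith
    · rw [div_add_one_im, div_add_one_re, abs_div, abs_of_pos hn, div_div_div_cancel_right₀ hn.ne',
        add_div]
      linarith

theorem exists_mem_slitDom {δ : ℝ} (hδ : 0 < δ) {z : ℂ} (hz : z ∈ slitPlane) :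
    ∃ k, z ∈ slitDom δ k := by
  by_cases h0 : z.im = 0
  · refine ⟨0, ?_⟩
    have h1 : 0 < z.re := by simpa [mem_slitPlane_iff, h0] using hz
    simp only [slitDom, wedge, mem_ofPred_eq, h0, abs_zero]
    positivity
  · have hy := abs_pos.2 h0
    have hn : 0 < normSq z := normSq_pos.2 (slitPlane_ne_zero hz)
    set L := abs (z.re / |z.im|)
    have hL : 0 ≤ L := abs_nonneg _
    set m := min (1 / |z.im|) (min (normSq z / |z.im|) (1 / (2 * L + 2)))
    have hm : 0 < m := by positivity
    obtain ⟨k, hk⟩ := exists_nat_gt ((1 / δ - z.re / |z.im|) / m)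
    rw [div_lt_iff₀ hm] at hk
    refine ⟨k, mem_slitDom hδ hm hL ?_ k z h0 (min_le_left _ _)
      ((min_le_right _ _).trans (min_le_left _ _)) (neg_abs_le _) (by linarith)⟩
    rw [← le_div_iff₀ (by positivity)]
    exact (min_le_right _ _).trans (min_le_right _ _)

variable {A B : E →L[ℂ] E} {N : ℕ} {s : ℂ} {ψ : ℝ → E}

theorem differentiableOn_threeOp {f : ℂ → E} {D D' : Set ℂ} (hD' : IsOpen D')
    (hf : DifferentiableOn ℂ f D') (hD : D ⊆ slitPlane) (h1 : ∀ z ∈ D, z + 1 ∈ D')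
    (h2 : ∀ z ∈ D, z / (z + 1) ∈ D') : DifferentiableOn ℂ (threeOp A B s f) D := fun z hz => by
  have hs := add_one_mem_slitPlane (hD hz)
  have d1 := (hf _ (h1 z hz)).differentiableAt (hD'.mem_nhds (h1 z hz))
  have d2 := (hf _ (h2 z hz)).differentiableAt (hD'.mem_nhds (h2 z hz))
  have e1 : DifferentiableAt ℂ (fun z => f (z + 1)) z :=
    DifferentiableAt.comp (g := f) (f := fun z => z + 1) z d1 (by fun_prop)
  have e2 : DifferentiableAt ℂ (fun z => f (z / (z + 1))) z :=
    DifferentiableAt.comp (g := f) (f := fun z => z / (z + 1)) z d2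
      (differentiableAt_id.div (by fun_prop) (slitPlane_ne_zero hs))
  have e3 : DifferentiableAt ℂ (fun z : ℂ => (z + 1) ^ (-(2 * s))) z :=
    DifferentiableAt.cpow_const (by fun_prop) hs
  exact ((A.differentiableAt.comp z e1).add
    (e3.smul (B.differentiableAt.comp z e2))).differentiableWithinAt

theorem PeriodData.exists_extension [CompleteSpace E] (h : PeriodData A B N s ψ) : ∃ Ψ : ℂ → E,
    DifferentiableOn ℂ Ψ slitPlane ∧ (∀ x : ℝ, 0 < x → Ψ x = ψ x) ∧
      ∀ z ∈ slitPlane, Ψ z = threeOp A B s Ψ z := by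
  obtain ⟨δ, hδ, Ψ₀, hd₀, hψ⟩ := h.exists_wedge
  set Φ : ℕ → ℂ → E := fun k => (threeOp A B s)^[k] Ψ₀ with hΦ
  have hsucc : ∀ k, Φ (k + 1) = threeOp A B s (Φ k) := fun k =>
    Function.iterate_succ_apply' _ _ _
  have hd : ∀ k, DifferentiableOn ℂ (Φ k) (slitDom δ k) := fun k => by
    induction k with
    | zero => exact hd₀
    | succ k ih =>
      rw [hsucc]
      exact differentiableOn_threeOp (isOpen_slitDom δ k) ih inter_subset_left
        (fun z hz => hz.2.1) fun z hz => hz.2.2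
  have hstep : ∀ k, EqOn (Φ (k + 1)) (Φ k) (slitDom δ k) := fun k => by
    induction k with
    | zero =>
      refine eqOn_of_eq_on_pos (x₀ := 1) (isOpen_slitDom δ 0) (convex_wedge δ).isPreconnected
        ((hd 1).mono (slitDom_subset_succ hδ 0)) (hd 0) (ofReal_mem_wedge hδ one_pos) ?_
      filter_upwards [lt_mem_nhds one_pos] with x hx
      have h1 : Φ 1 x = threeOp A B s Ψ₀ x := rfl
      have h2 : Φ 0 x = Ψ₀ x := rfl
      rw [h1, h2, hψ x hx, h.three x hx, threeOp, ← ofReal_one, ← ofReal_add, ← ofReal_div,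
        hψ _ (by positivity), hψ _ (by positivity)]
    | succ k ih =>
      intro z hz
      rw [hsucc (k + 1)]
      conv_rhs => rw [hsucc k]
      simp only [threeOp]
      rw [ih hz.2.1, ih hz.2.2]
  have hmono : ∀ k l, k ≤ l → slitDom δ k ⊆ slitDom δ l ∧ EqOn (Φ l) (Φ k) (slitDom δ k) := by
    intro k l hkl
    induction l, hkl using Nat.le_induction with
    | base => exact ⟨subset_rfl, fun _ _ => rfl⟩
    | succ l _ ih => exact ⟨ih.1.trans (slitDom_subset_succ hδ l),
        fun z hz => (hstep l (ih.1 hz)).trans (ih.2 hz)⟩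
  classical
  set Ψ : ℂ → E := fun z => if hz : ∃ k, z ∈ slitDom δ k then Φ (Nat.find hz) z else 0
  have hΨ : ∀ k, EqOn Ψ (Φ k) (slitDom δ k) := fun k z hz => by
    have hex : ∃ k, z ∈ slitDom δ k := ⟨k, hz⟩
    simp only [Ψ, dif_pos hex]
    exact ((hmono _ _ (Nat.find_min' hex hz)).2 (Nat.find_spec hex)).symm
  refine ⟨Ψ, fun z hz => ?_, fun x hx => ?_, fun z hz => ?_⟩
  · obtain ⟨k, hk⟩ := exists_mem_slitDom hδ hz
    have h1 := (isOpen_slitDom δ k).mem_nhds hk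
    exact (((hd k z hk).differentiableAt h1).congr_of_eventuallyEq
      ((hΨ k).eventuallyEq_of_mem h1)).differentiableWithinAt
  · rw [hΨ 0 (ofReal_mem_wedge hδ hx)]
    exact hψ x hx
  · obtain ⟨k, hk⟩ := exists_mem_slitDom hδ hz
    have hk1 := slitDom_subset_succ hδ k hk
    rw [hΨ (k + 1) hk1, hsucc, threeOp, threeOp, hΨ k hk1.2.1, hΨ k hk1.2.2]

end Extend
end Period

namespace Period
open Set Filter Topology Metric

theorem norm_cpow_le_exp_mul {z : ℂ} (hz : z ≠ 0) (a : ℂ) :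
    ‖z ^ a‖ ≤ Real.exp (Real.pi * |a.im|) * ‖z‖ ^ a.re := by
  rw [norm_cpow_of_ne_zero hz, div_eq_mul_inv, ← Real.exp_neg, mul_comm]
  refine mul_le_mul_of_nonneg_right (Real.exp_le_exp.2 ?_) (by positivity)
  refine (neg_le_abs _).trans ?_
  rw [abs_mul]
  exact mul_le_mul_of_nonneg_right (abs_arg_le_pi z) (abs_nonneg _)

section Bounds
variable {E : Type*} [NormedAddCommGroup E] [NormedSpace ℂ E] [CompleteSpace E]
  {A B : E →L[ℂ] E} {N : ℕ} {s : ℂ} {ψ : ℝ → E}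

theorem inv_mem_slitPlane' {z : ℂ} (hz : z ∈ slitPlane) : z⁻¹ ∈ slitPlane := by
  rw [mem_slitPlane_iff_arg] at *
  refine ⟨?_, inv_ne_zero hz.2⟩
  rw [arg_inv, if_neg hz.1]
  intro h
  linarith [neg_pi_lt_arg z]

theorem PeriodData.norm_le_of_extension (h : PeriodData A B N s ψ) {Ψ : ℂ → E}
    (hd : DifferentiableOn ℂ Ψ slitPlane) (hψ : ∀ x : ℝ, 0 < x → Ψ x = ψ x) :
    ∃ R ≥ 1, ∃ C ≥ 0, ∀ z ∈ sect R, ‖Ψ z‖ ≤ C * ‖z‖ ^ (-(2 * s.re)) := by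
  obtain ⟨R, hR, F, C, hF, hFψ, hb⟩ := h.exists_infty
  have hR0 : 0 < R := by linarith
  refine ⟨R, hR, |C|, abs_nonneg C, fun z hz => ?_⟩
  have h1 : EqOn Ψ F (sect R) := by
    refine eqOn_of_eq_on_pos (x₀ := R + 1) (isOpen_sect hR0.le) (isPreconnected_sect hR0)
      (hd.mono (sect_subset_slitPlane hR0.le)) hF (ofReal_mem_sect hR0.le (by linarith)) ?_
    filter_upwards [lt_mem_nhds (by linarith : R < R + 1)] with x hx
    rw [hψ x (hR0.trans hx), hFψ x hx]
  rw [h1 hz]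
  exact (hb z hz).trans (mul_le_mul_of_nonneg_right (le_abs_self C) (by positivity))

theorem isCompact_annular (a b c : ℝ) : IsCompact (exp '' (Icc a b ×ℂ Icc (-c) c)) :=
  (isCompact_Icc.reProdIm isCompact_Icc).image continuous_exp

/-- The holomorphic extension of period data to the slit plane, with uniform bounds. -/
structure IsSlitExt (A B : E →L[ℂ] E) (s : ℂ) (Ψ : ℂ → E) : Prop where
  diff : DifferentiableOn ℂ Ψ slitPlane
  three : ∀ z ∈ slitPlane, Ψ z = threeOp A B s Ψ z
  bound : ∃ C ≥ 0, ∀ z : ℂ, z ≠ 0 → |arg z| ≤ 3 * Real.pi / 4 →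
    ‖Ψ z‖ ≤ C ∧ ‖Ψ z‖ ≤ C * ‖z‖ ^ (-(2 * s.re))

theorem PeriodData.exists_slitExt (h : PeriodData A B N s ψ) : ∃ Ψ : ℂ → E,
    IsSlitExt A B s Ψ ∧ ∀ x : ℝ, 0 < x → Ψ x = ψ x := by
  obtain ⟨Ψ, hd, hψ, hthree⟩ := h.exists_extension
  refine ⟨Ψ, ⟨hd, hthree, ?_⟩, hψ⟩
  have hσ := h.re_pos
  have hpi := Real.pi_pos
  obtain ⟨R, hR, C, hC, hb⟩ := h.norm_le_of_extension hd hψ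
  have hd' : DifferentiableOn ℂ (fun z : ℂ => z ^ (-(2 * s)) • Ψ z⁻¹) slitPlane := fun z hz => by
    refine DifferentiableAt.differentiableWithinAt (DifferentiableAt.smul ?_ ?_)
    · exact differentiableAt_id.cpow_const hz
    · exact ((hd _ (inv_mem_slitPlane' hz)).differentiableAt
        (isOpen_slitPlane.mem_nhds (inv_mem_slitPlane' hz))).comp z
          (differentiableAt_inv (slitPlane_ne_zero hz))
  obtain ⟨R', hR', C', hC', hb'⟩ := h.dual.norm_le_of_extension hd' fun x hx => by
    rw [← ofReal_inv, hψ _ (inv_pos.2 hx), dualFn]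
  obtain ⟨K, hK⟩ : ∃ K, ∀ z ∈ exp '' (Icc (-Real.log R') (Real.log R) ×ℂ
      Icc (-(3 * Real.pi / 4)) (3 * Real.pi / 4)), ‖Ψ z‖ ≤ K := by
    refine (isCompact_annular _ _ _).exists_bound_of_continuousOn (hd.continuousOn.mono ?_)
    rintro _ ⟨w, hw, rfl⟩
    have hw2 := (mem_reProdIm.1 hw).2
    rw [mem_slitPlane_iff_arg, ← log_im, log_exp (by linarith [hw2.1]) (by linarith [hw2.2])]
    exact ⟨by linarith [hw2.2], exp_ne_zero w⟩
  set M := Real.exp (Real.pi * |(2 * s).im|) with hM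
  have hR0 : 0 < R := by linarith
  have hR0' : 0 < R' := by linarith
  have hlarge : ∀ z : ℂ, R < ‖z‖ → |arg z| ≤ 3 * Real.pi / 4 →
      ‖Ψ z‖ ≤ C ∧ ‖Ψ z‖ ≤ C * ‖z‖ ^ (-(2 * s.re)) := fun z hz ha => by
    have h1 := hb z ⟨hz, by linarith⟩
    refine ⟨h1.trans ?_, h1⟩
    refine mul_le_of_le_one_right hC (Real.rpow_le_one_of_one_le_of_nonpos (by linarith) ?_)
    linarith
  have hsmall : ∀ z : ℂ, z ≠ 0 → ‖z‖ < R'⁻¹ → |arg z| ≤ 3 * Real.pi / 4 →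
      ‖Ψ z‖ ≤ M * C' ∧ ‖Ψ z‖ ≤ M * C' * ‖z‖ ^ (-(2 * s.re)) := fun z hz hzn ha => by
    have hzp := norm_pos_iff.2 hz
    have hpi' : arg z ≠ Real.pi := fun h => by rw [h, abs_of_pos hpi] at ha; linarith
    have hz1 : ‖z‖ ≤ 1 := hzn.le.trans (inv_le_one_of_one_le₀ hR')
    have h1 := hb' z⁻¹ ⟨by rw [norm_inv]; exact (lt_inv_comm₀ hzp hR0').1 hzn, by
      rw [arg_inv, if_neg hpi', abs_neg]; linarith⟩
    simp only [inv_inv, norm_inv, Real.inv_rpow hzp.le] at h1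
    rw [← Real.rpow_neg hzp.le, neg_neg] at h1
    have h2 := norm_cpow_le_exp_mul (inv_ne_zero hz) (2 * s)
    have h3 : ‖Ψ z‖ = ‖(z⁻¹) ^ (2 * s)‖ * ‖(z⁻¹) ^ (-(2 * s)) • Ψ z‖ := by
      rw [norm_smul, ← mul_assoc, ← norm_mul, ← cpow_add _ _ (inv_ne_zero hz), add_neg_cancel,
        cpow_zero, norm_one, one_mul]
    have h4 : (2 * s).re = 2 * s.re := by simp
    have h5 : ‖Ψ z‖ ≤ M * C' := by
      rw [h3]
      refine (mul_le_mul h2 h1 (norm_nonneg _) (by positivity)).trans_eq ?_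
      rw [h4, norm_inv, Real.inv_rpow hzp.le]
      have : ‖z‖ ^ (2 * s.re) ≠ 0 := by positivity
      rw [← hM]
      field_simp
    refine ⟨h5, h5.trans ?_⟩
    refine le_mul_of_one_le_right (by positivity) ?_
    exact Real.one_le_rpow_of_pos_of_le_one_of_nonpos hzp hz1 (by linarith)
  have hmid : ∀ z : ℂ, z ≠ 0 → R'⁻¹ ≤ ‖z‖ → ‖z‖ ≤ R → |arg z| ≤ 3 * Real.pi / 4 →
      ‖Ψ z‖ ≤ |K| ∧ ‖Ψ z‖ ≤ |K| * R ^ (2 * s.re) * ‖z‖ ^ (-(2 * s.re)) := fun z hz h1 h2 ha => by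
    have hzp := norm_pos_iff.2 hz
    have h3 : ‖Ψ z‖ ≤ |K| := by
      refine (hK z ⟨log z, ?_, exp_log hz⟩).trans (le_abs_self K)
      rw [mem_reProdIm, log_re, log_im, ← Real.log_inv]
      exact ⟨⟨Real.log_le_log (by positivity) h1, Real.log_le_log hzp h2⟩, abs_le.1 ha⟩
    refine ⟨h3, h3.trans ?_⟩
    rw [mul_assoc]
    refine le_mul_of_one_le_right (abs_nonneg _) ?_
    rw [Real.rpow_neg hzp.le, ← div_eq_mul_inv, one_le_div (by positivity)]
    exact Real.rpow_le_rpow hzp.le h2 (by positivity)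
  have hRp : 1 ≤ R ^ (2 * s.re) := Real.one_le_rpow hR (by positivity)
  set C₀ := C + M * C' + |K| * R ^ (2 * s.re)
  have hKR : 0 ≤ |K| * R ^ (2 * s.re) := by positivity
  have hMC : 0 ≤ M * C' := by positivity
  refine ⟨C₀, by positivity, fun z hz ha => ?_⟩
  have hp : 0 ≤ ‖z‖ ^ (-(2 * s.re)) := by positivity
  have hKK : |K| ≤ |K| * R ^ (2 * s.re) := le_mul_of_one_le_right (abs_nonneg _) hRp
  have fin : ∀ c ≤ C₀, ‖Ψ z‖ ≤ c * ‖z‖ ^ (-(2 * s.re)) → ‖Ψ z‖ ≤ C₀ * ‖z‖ ^ (-(2 * s.re)) :=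
    fun c hc h => h.trans (mul_le_mul_of_nonneg_right hc hp)
  rcases lt_or_ge R ‖z‖ with h1 | h1
  · have h2 := hlarge z h1 ha
    have h3 : C ≤ C₀ := by linarith
    exact ⟨h2.1.trans h3, fin _ h3 h2.2⟩
  rcases lt_or_ge ‖z‖ R'⁻¹ with h4 | h4
  · have h2 := hsmall z hz h4 ha
    have h3 : M * C' ≤ C₀ := by linarith
    exact ⟨h2.1.trans h3, fin _ h3 h2.2⟩
  · have h2 := hmid z hz h4 h1 ha
    have h3 : |K| * R ^ (2 * s.re) ≤ C₀ := by linarith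
    exact ⟨h2.1.trans (hKK.trans h3), fin _ h3 h2.2⟩

end Bounds
end Period

namespace Period
open Set Filter Topology Metric

theorem abs_arg_le_of_abs_re_le {z : ℂ} (hz : z ≠ 0) (h : |z.re| ≤ |z.im|) :
    |arg z| ≤ 3 * Real.pi / 4 := by
  by_contra! hlt
  have hn := norm_pos_iff.2 hz
  have h1 : Real.cos |arg z| < Real.cos (3 * Real.pi / 4) :=
    Real.cos_lt_cos_of_nonneg_of_le_pi (by positivity) (abs_arg_le_pi z) hlt
  have h2 : Real.cos (3 * Real.pi / 4) = -(√2 / 2) := by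
    rw [show 3 * Real.pi / 4 = Real.pi - Real.pi / 4 by ring, Real.cos_pi_sub, Real.cos_pi_div_four]
  rw [Real.cos_abs, h2] at h1
  have h3 := norm_mul_cos_arg z
  have h4 : z.re < -(√2 / 2) * ‖z‖ := by
    rw [← h3, mul_comm]; exact mul_lt_mul_of_pos_right h1 hn
  have h5 : ‖z‖ ^ 2 = z.re ^ 2 + z.im ^ 2 := by
    rw [← normSq_eq_norm_sq, normSq_apply]; ring
  have h6 := sq_le_sq.2 h
  have h7 : (√2 / 2 * ‖z‖) ^ 2 < z.re ^ 2 := by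
    refine sq_lt_sq.2 ?_
    rw [abs_of_nonneg (by positivity), abs_of_neg (by nlinarith [Real.sqrt_nonneg 2])]
    linarith
  have h8 : (√2 / 2 * ‖z‖) ^ 2 = ‖z‖ ^ 2 / 2 := by
    rw [mul_pow, div_pow, Real.sq_sqrt (by norm_num)]; ring
  linarith

theorem neg_inv_im_ne_zero {z : ℂ} (hz : z.im ≠ 0) : (-z⁻¹).im ≠ 0 := by
  have : normSq z ≠ 0 := (normSq_pos.2 fun h => hz (by simp [h])).ne'
  rw [neg_im, inv_im, neg_div, neg_neg]
  exact div_ne_zero hz this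

theorem cpow_add_one_mul_cpow_div {z : ℂ} (hz : z.im ≠ 0) (a : ℂ) :
    (z + 1) ^ a * (z / (z + 1)) ^ a = z ^ a := by
  have hz0 : z ≠ 0 := fun h => hz (by simp [h])
  have hz1 : z + 1 ≠ 0 := fun h => hz (by simpa using congrArg im h)
  have hn : 0 < normSq (z + 1) := normSq_pos.2 hz1
  have hq : z / (z + 1) ≠ 0 := div_ne_zero hz0 hz1
  have hprod : (z + 1) * (z / (z + 1)) = z := mul_div_cancel₀ z hz1
  obtain ⟨k, hk⟩ := exp_eq_exp_iff_exists_int.1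
    (show exp (log (z + 1) + log (z / (z + 1))) = exp (log z) by
      rw [exp_add, exp_log hz1, exp_log hq, exp_log hz0, hprod])
  have him := congrArg im hk
  simp only [add_im, log_im, mul_im, mul_re, intCast_re, intCast_im, I_re, I_im, ofReal_re,
    ofReal_im, re_ofNat, im_ofNat] at him
  have hpi := Real.pi_pos
  have him1 : (z + 1).im = z.im := by simp
  have him2 := div_add_one_im (z := z)
  have key : -1 < (k : ℝ) ∧ (k : ℝ) < 1 := by
    rcases lt_or_gt_of_ne hz with h | h
    · have a1 := arg_neg_iff.2 h
      have a2 := arg_neg_iff.2 (him1 ▸ h)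
      have a3 := arg_neg_iff.2 (show (z /
        (z + 1)).im < 0 by rw [him2]; exact div_neg_of_neg_of_pos h hn)
      have b1 := neg_pi_lt_arg z
      have b2 := neg_pi_lt_arg (z + 1)
      have b3 := neg_pi_lt_arg (z / (z + 1))
      constructor <;> nlinarith
    · have a1 := arg_nonneg_iff.2 h.le
      have a2 := arg_nonneg_iff.2 (him1 ▸ h.le)
      have a3 := arg_nonneg_iff.2 (show 0 ≤ (z / (z + 1)).im by rw [him2]; positivity)
      have b1 := (arg_le_pi z).lt_of_ne fun h' => h.ne' (arg_eq_pi_iff.1 h').2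
      have b2 := arg_le_pi (z + 1)
      have b3 := (arg_le_pi (z / (z + 1))).lt_of_ne fun h' => by
        have := (arg_eq_pi_iff.1 h').2
        rw [him2] at this
        exact (div_pos h hn).ne' this
      constructor <;> nlinarith
  have hk0 : k = 0 := by
    have h1 : -1 < k := by exact_mod_cast key.1
    have h2 : k < 1 := by exact_mod_cast key.2
    omega
  rw [hk0, Int.cast_zero, zero_mul, add_zero] at hk
  rw [cpow_def_of_ne_zero hz1, cpow_def_of_ne_zero hq, cpow_def_of_ne_zero hz0, ← exp_add,
    ← add_mul, hk]

section Boundary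
variable {E : Type*} [NormedAddCommGroup E] [NormedSpace ℂ E] {A B S : E →L[ℂ] E} {N : ℕ} {s : ℂ}
  {Ψ : ℂ → E}

/-- The operators representing `T⁻¹`, `T'⁻¹` and `S` satisfy these relations. -/
structure OpRel (A B S : E →L[ℂ] E) : Prop where
  S_S : ∀ v, S (S v) = v
  A_S_A : ∀ v, A (S (A v)) = B v
  A_S_B : ∀ v, A (S (B v)) = S v

/-- The periodic function on `ℂ ∖ ℝ` attached to a solution of the three-term relation. -/
def boundaryFn (S : E →L[ℂ] E) (s : ℂ) (Ψ : ℂ → E) (z : ℂ) : E :=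
  Ψ z + z ^ (-(2 * s)) • S (Ψ (-z⁻¹))

theorem boundaryFn_eq (hr : OpRel A B S) (h : IsSlitExt A B s Ψ) {z : ℂ} (hz : z.im ≠ 0) :
    boundaryFn S s Ψ z = A (boundaryFn S s Ψ (z + 1)) := by
  have hz1 : (z + 1).im ≠ 0 := by simpa using hz
  have hz0 : z ≠ 0 := fun h => hz (by simp [h])
  have hz10 : z + 1 ≠ 0 := fun h => hz1 (by simp [h])
  have h1 := h.three z (Or.inr hz)
  have h2 := h.three (-(z + 1)⁻¹) (Or.inr (neg_inv_im_ne_zero hz1))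
  have e1 : -(z + 1)⁻¹ + 1 = z / (z + 1) := by field_simp; ring
  have e2 : -(z + 1)⁻¹ / (z / (z + 1)) = -z⁻¹ := by field_simp
  rw [threeOp, e1, e2] at h2
  simp only [boundaryFn]
  rw [h2, h1, threeOp]
  simp only [map_add, map_smul, smul_add, smul_smul, hr.A_S_A, hr.A_S_B]
  rw [cpow_add_one_mul_cpow_div hz, add_assoc]

theorem boundaryFn_add_nat (hr : OpRel A B S) (h : IsSlitExt A B s Ψ) (hA : A ^ N = 1) {z : ℂ}
    (hz : z.im ≠ 0) : boundaryFn S s Ψ (z + N) = boundaryFn S s Ψ z := by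
  have : ∀ m : ℕ, boundaryFn S s Ψ z = (A ^ m) (boundaryFn S s Ψ (z + m)) := fun m => by
    induction m with
    | zero => simp
    | succ m ih =>
      have h1 : (z + m).im ≠ 0 := by simpa using hz
      rw [ih, boundaryFn_eq hr h h1, pow_succ, mul_apply_eq_comp]
      push_cast
      rw [add_assoc]
  rw [this N, hA, one_apply_eq_self]

theorem differentiableOn_boundaryFn (h : IsSlitExt A B s Ψ) :
    DifferentiableOn ℂ (boundaryFn S s Ψ) {z | z.im ≠ 0} := fun z hz => by
  have hz' : z ∈ slitPlane := Or.inr hz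
  have hi : -z⁻¹ ∈ slitPlane := Or.inr (neg_inv_im_ne_zero hz)
  have d1 := (h.diff z hz').differentiableAt (isOpen_slitPlane.mem_nhds hz')
  have d2 := (h.diff _ hi).differentiableAt (isOpen_slitPlane.mem_nhds hi)
  have d3 : DifferentiableAt ℂ (fun z : ℂ => Ψ (-z⁻¹)) z :=
    DifferentiableAt.comp (g := Ψ) (f := fun z : ℂ => -z⁻¹) z d2
      (differentiableAt_inv (slitPlane_ne_zero hz')).neg
  have d4 : DifferentiableAt ℂ (fun z : ℂ => z ^ (-(2 * s))) z :=
    differentiableAt_id.cpow_const hz'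
  exact (d1.add (d4.smul (S.differentiableAt.comp z d3))).differentiableWithinAt

theorem boundaryFn_bound (h : IsSlitExt A B s Ψ) : ∃ C ≥ 0, ∀ z : ℂ, z ≠ 0 →
    |z.re| ≤ |z.im| → ‖boundaryFn S s Ψ z‖ ≤ C ∧
      ‖boundaryFn S s Ψ z‖ ≤ C * ‖z‖ ^ (-(2 * s.re)) := by
  obtain ⟨C, hC, hb⟩ := h.bound
  set M := Real.exp (Real.pi * |(-(2 * s)).im|) with hM
  refine ⟨C + M * ‖S‖ * C, by positivity, fun z hz hre => ?_⟩
  have hn := norm_pos_iff.2 hz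
  have hnsq := normSq_pos.2 hz
  have h1 := hb z hz (abs_arg_le_of_abs_re_le hz hre)
  have h2 := hb (-z⁻¹) (neg_ne_zero.2 (inv_ne_zero hz)) (abs_arg_le_of_abs_re_le
    (neg_ne_zero.2 (inv_ne_zero hz)) (by
      rw [neg_re, neg_im, abs_neg, abs_neg, inv_re, inv_im, abs_div, abs_div, abs_neg]
      exact div_le_div_of_nonneg_right hre (abs_nonneg _)))
  rw [norm_neg, norm_inv, Real.inv_rpow hn.le, ← Real.rpow_neg hn.le, neg_neg] at h2
  have h3 := norm_cpow_le_exp_mul hz (-(2 * s))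
  have h4 : (-(2 * s)).re = -(2 * s.re) := by simp
  rw [h4, ← hM] at h3
  set q := 2 * s.re with hq
  have hp : 0 < ‖z‖ ^ (-q) := Real.rpow_pos_of_pos hn _
  have h5 : ‖z ^ (-(2 * s)) • S (Ψ (-z⁻¹))‖ ≤ M * ‖z‖ ^ (-q) * (‖S‖ * ‖Ψ (-z⁻¹)‖) := by
    rw [norm_smul]
    exact mul_le_mul h3 (S.le_opNorm _) (norm_nonneg _) (by positivity)
  have h6 : ‖z ^ (-(2 * s)) • S (Ψ (-z⁻¹))‖ ≤ M * ‖S‖ * C := by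
    refine h5.trans ?_
    have h7 : ‖z‖ ^ (-q) * ‖z‖ ^ q = 1 := by rw [← Real.rpow_add hn]; simp
    calc M * ‖z‖ ^ (-q) * (‖S‖ * ‖Ψ (-z⁻¹)‖)
        ≤ M * ‖z‖ ^ (-q) * (‖S‖ * (C * ‖z‖ ^ q)) := by gcongr; exact h2.2
      _ = M * ‖S‖ * C * (‖z‖ ^ (-q) * ‖z‖ ^ q) := by ring
      _ = M * ‖S‖ * C := by rw [h7, mul_one]
  have h8 : ‖z ^ (-(2 * s)) • S (Ψ (-z⁻¹))‖ ≤ M * ‖S‖ * C * ‖z‖ ^ (-q) := by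
    refine h5.trans ?_
    calc M * ‖z‖ ^ (-q) * (‖S‖ * ‖Ψ (-z⁻¹)‖)
        ≤ M * ‖z‖ ^ (-q) * (‖S‖ * C) := by gcongr; exact h2.1
      _ = M * ‖S‖ * C * ‖z‖ ^ (-q) := by ring
  constructor
  · exact (norm_add_le _ _).trans (add_le_add h1.1 h6)
  · rw [add_mul]
    exact (norm_add_le _ _).trans (add_le_add h1.2 h8)

end Boundary

theorem exists_int_re_add_mem {N : ℕ} (hN : 0 < N) (z : ℂ) :
    ∃ m : ℤ, (z + ((m * N : ℤ) : ℂ)).re ∈ Ico (0 : ℝ) N := by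
  have hN' : (0 : ℝ) < N := by exact_mod_cast hN
  refine ⟨-⌊z.re / N⌋, ?_⟩
  have h1 := Int.floor_le (z.re / N)
  have h2 := Int.lt_floor_add_one (z.re / N)
  rw [le_div_iff₀ hN'] at h1
  rw [div_lt_iff₀ hN'] at h2
  simp only [add_re, intCast_re]
  push_cast
  constructor <;> linarith

theorem periodic_exp_decay {f : ℂ → ℂ} {N : ℕ} (hN : 0 < N) (hd : DifferentiableOn ℂ f UH)
    (hp : ∀ z ∈ UH, f (z + N) = f z) {C q : ℝ} (hq : 0 < q)
    (hb : ∀ z ∈ UH, |z.re| ≤ |z.im| → ‖f z‖ ≤ C * ‖z‖ ^ (-q)) :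
    ∃ c > 0, ∀ δ > 0, ∃ K, ∀ z : ℂ, δ ≤ z.im → ‖f z‖ ≤ K * Real.exp (-(c * z.im)) := by
  classical
  have hN' : (0 : ℝ) < N := by exact_mod_cast hN
  have hUH : ∀ {z : ℂ}, z ∈ UH ↔ 0 < z.im := Iff.rfl
  set F : ℂ → ℂ := fun z => if 0 < z.im then f z else 0 with hF
  have hFp : Function.Periodic F (N : ℝ) := fun z => by
    simp only [hF, add_im, add_zero, ofReal_natCast, natCast_im]
    split_ifs with h
    · exact hp z h
    · rfl
  have hFi : ∀ (m : ℤ) z, F (z + ((m * N : ℤ) : ℂ)) = F z := fun m z => by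
    have := hFp.int_mul m z
    push_cast at this ⊢
    exact this
  have hFf : ∀ z ∈ UH, F z = f z := fun z hz => if_pos hz
  have hev : ∀ a : ℝ, ∀ᶠ z in comap im atTop, a < z.im := fun a =>
    (eventually_gt_atTop a).comap im
  have hFd : ∀ z ∈ UH, DifferentiableAt ℂ F z := fun z hz =>
    ((hd z hz).differentiableAt (isOpen_UH.mem_nhds hz)).congr_of_eventuallyEq
      (Filter.eventuallyEq_of_mem (isOpen_UH.mem_nhds hz) hFf)
  have hzero : ZeroAtFilter (comap im atTop) F := by
    have h1 : Tendsto (fun z : ℂ => |C| * z.im ^ (-q)) (comap im atTop) (𝓝 0) := by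
      have := ((tendsto_rpow_neg_atTop hq).const_mul |C|).comp
        (tendsto_comap : Tendsto im (comap im atTop) atTop)
      rw [mul_zero] at this
      exact this
    refine squeeze_zero_norm' ?_ h1
    filter_upwards [hev N] with z hz
    have hz0 : 0 < z.im := hN'.trans hz
    obtain ⟨m, hm⟩ := exists_int_re_add_mem hN z
    set w := z + ((m * N : ℤ) : ℂ) with hw
    have hwim : w.im = z.im := by rw [hw, add_im, intCast_im, add_zero]
    have hwU : w ∈ UH := hUH.2 (hwim ▸ hz0)
    rw [← hFi m z, hFf _ hwU]
    refine (hb _ hwU ?_).trans ?_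
    · rw [hwim, abs_of_nonneg hm.1, abs_of_pos hz0]
      linarith [hm.2]
    · refine mul_le_mul (le_abs_self C) ?_ (by positivity) (abs_nonneg _)
      refine Real.rpow_le_rpow_of_nonpos hz0 ?_ (by linarith)
      rw [← hwim, ← abs_of_pos (hwim ▸ hz0 : 0 < w.im)]
      exact abs_im_le_norm w
  have hO := hFp.exp_decay_of_zero_at_inf hN' (by
    filter_upwards [hev 0] with z hz using hFd z hz) hzero
  obtain ⟨K, hK⟩ := hO.bound
  rw [eventually_comap] at hK
  obtain ⟨Y, hY⟩ := eventually_atTop.1 hK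
  set c := 2 * Real.pi / N with hc
  have hc0 : 0 < c := by positivity
  refine ⟨c, hc0, fun δ hδ => ?_⟩
  have hcomp : IsCompact (Icc (0 : ℝ) N ×ℂ Icc δ (max Y δ)) := isCompact_Icc.reProdIm isCompact_Icc
  obtain ⟨K', hK'⟩ := hcomp.exists_bound_of_continuousOn (f := f) (hd.continuousOn.mono fun z hz =>
    hUH.2 (hδ.trans_le (mem_reProdIm.1 hz).2.1))
  have hexp : ∀ z : ℂ, Real.exp (-2 * Real.pi * z.im / N) = Real.exp (-(c * z.im)) := fun z => by
    rw [hc]; congr 1; ring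
  refine ⟨|K| + |K'| * Real.exp (c * (max Y δ)), fun z hz => ?_⟩
  have hzU : z ∈ UH := hUH.2 (hδ.trans_le hz)
  rw [add_mul]
  rcases le_or_gt Y z.im with h | h
  · have h1 := hY z.im h z rfl
    rw [hFf z hzU, hexp, Real.norm_of_nonneg (Real.exp_pos _).le] at h1
    refine h1.trans ((mul_le_mul_of_nonneg_right (le_abs_self K) (Real.exp_pos _).le).trans ?_)
    exact le_add_of_nonneg_right (by positivity)
  · obtain ⟨m, hm⟩ := exists_int_re_add_mem hN z
    set w := z + ((m * N : ℤ) : ℂ) with hw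
    have hwim : w.im = z.im := by rw [hw, add_im, intCast_im, add_zero]
    have hwU : w ∈ UH := hUH.2 (hwim ▸ hδ.trans_le hz)
    rw [← hFf z hzU, ← hFi m z, hFf _ hwU]
    have h1 := hK' w (mem_reProdIm.2 ⟨⟨hm.1, hm.2.le⟩, by
      rw [hwim]; exact ⟨hz, h.le.trans (le_max_left _ _)⟩⟩)
    refine (h1.trans (le_abs_self _)).trans (le_add_of_nonneg_of_le (by positivity) ?_)
    rw [mul_assoc, ← Real.exp_add]
    refine le_mul_of_one_le_right (abs_nonneg _) (Real.one_le_exp ?_)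
    have : z.im ≤ max Y δ := h.le.trans (le_max_left _ _)
    nlinarith

/-- Holomorphic functions on `ℂ ∖ ℝ` decaying exponentially in the imaginary direction. -/
structure StripDecay (h : ℂ → ℂ) : Prop where
  diff : DifferentiableOn ℂ h {z | z.im ≠ 0}
  decay : ∃ c > 0, ∀ δ > 0, ∃ K, ∀ z : ℂ, δ ≤ |z.im| → ‖h z‖ ≤ K * Real.exp (-(c * |z.im|))

theorem isOpen_im_ne_zero : IsOpen {z : ℂ | z.im ≠ 0} :=
  isOpen_ne_fun continuous_im continuous_const

theorem StripDecay.deriv {h : ℂ → ℂ} (hh : StripDecay h) : StripDecay (deriv h) where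
  diff := hh.diff.deriv isOpen_im_ne_zero
  decay := by
    obtain ⟨c, hc, hd⟩ := hh.decay
    refine ⟨c, hc, fun δ hδ => ?_⟩
    obtain ⟨K, hK⟩ := hd (δ / 2) (by positivity)
    refine ⟨|K| * Real.exp (c * (δ / 2)) / (δ / 2), fun z hz => ?_⟩
    have him : ∀ w ∈ closedBall z (δ / 2), |z.im| - δ / 2 ≤ |w.im| := fun w hw => by
      have h1 : |z.im - w.im| ≤ ‖z - w‖ := by simpa using abs_im_le_norm (z - w)
      have h2 := abs_sub_abs_le_abs_sub z.im w.im
      have h3 : ‖z - w‖ ≤ δ / 2 := by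
        rw [← dist_eq, dist_comm]; exact mem_closedBall.1 hw
      linarith
    have hsub : closedBall z (δ / 2) ⊆ {z | z.im ≠ 0} := fun w hw =>
      abs_pos.1 (by linarith [him w hw])
    have hcl : DiffContOnCl ℂ h (ball z (δ / 2)) :=
      (hh.diff.mono (closure_ball_subset_closedBall.trans hsub)).diffContOnCl
    refine (norm_deriv_le_of_forall_mem_sphere_norm_le (by positivity) hcl
      (C := |K| * Real.exp (c * (δ / 2)) * Real.exp (-(c * |z.im|))) fun w hw =>
        ?_).trans_eq (by ring)
    have h1 := him w (sphere_subset_closedBall hw)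
    refine (hK w (by linarith)).trans ?_
    rw [mul_assoc, ← Real.exp_add]
    refine mul_le_mul (le_abs_self K) (Real.exp_le_exp.2 ?_) (Real.exp_pos _).le (abs_nonneg _)
    nlinarith

theorem stripDecay_of_periodic {f : ℂ → ℂ} {N : ℕ} (hN : 0 < N)
    (hd : DifferentiableOn ℂ f {z | z.im ≠ 0}) (hp : ∀ z : ℂ, z.im ≠ 0 → f (z + N) = f z)
    {C q : ℝ} (hq : 0 < q) (hb : ∀ z : ℂ, z ≠ 0 → |z.re| ≤ |z.im| → ‖f z‖ ≤ C * ‖z‖ ^ (-q)) :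
    StripDecay f where
  diff := hd
  decay := by
    have hne : ∀ z ∈ UH, z ≠ 0 := fun z hz h => by simp [h] at hz
    obtain ⟨c₁, hc₁, h₁⟩ := periodic_exp_decay hN (hd.mono fun z hz => ne_of_gt hz)
      (fun z hz => hp z (ne_of_gt hz)) hq fun z hz => hb z (hne z hz)
    obtain ⟨c₂, hc₂, h₂⟩ := periodic_exp_decay (f := fun z => f (-z)) hN
      (hd.comp (by fun_prop) fun z hz => by simpa using ne_of_gt hz)
      (fun z hz => by
        have := hp (-(z + N)) (by simpa using ne_of_gt hz)
        rw [← this]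
        congr 1; ring) hq fun z hz hre => by
          simpa using hb (-z) (neg_ne_zero.2 (hne z hz)) (by simpa using hre)
    refine ⟨min c₁ c₂, by positivity, fun δ hδ => ?_⟩
    obtain ⟨K₁, hK₁⟩ := h₁ δ hδ
    obtain ⟨K₂, hK₂⟩ := h₂ δ hδ
    refine ⟨max |K₁| |K₂|, fun z hz => ?_⟩
    have hle : ∀ {K c : ℝ}, |K| ≤ max |K₁| |K₂| → min c₁ c₂ ≤ c →
        K * Real.exp (-(c * |z.im|)) ≤ max |K₁| |K₂| * Real.exp (-(min c₁ c₂ * |z.im|)) :=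
      fun hK hc => mul_le_mul ((le_abs_self _).trans hK)
        (Real.exp_le_exp.2 (neg_le_neg (mul_le_mul_of_nonneg_right hc (abs_nonneg _))))
        (Real.exp_pos _).le (le_max_of_le_left (abs_nonneg _))
    rcases le_total 0 z.im with h | h
    · rw [abs_of_nonneg h] at hz
      refine (hK₁ z hz).trans ?_
      rw [← abs_of_nonneg h]
      rw [abs_abs]
      exact hle (le_max_left _ _) (min_le_left _ _)
    · rw [abs_of_nonpos h] at hz
      have := hK₂ (-z) (by simpa using hz)
      rw [neg_neg, neg_im, ← abs_of_nonpos h] at this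
      exact this.trans (hle (le_max_right _ _) (min_le_right _ _))

end Period

namespace Period

open Set Filter Topology Metric
open scoped BoundedContinuousFunction Real

theorem analyticAt_integral_geometric {X : Type*} [TopologicalSpace X] [MeasurableSpace X]
    [OpensMeasurableSpace X] [SecondCountableTopology X] {ν : Measure X} {m : X → ℂ}
    (hm : Integrable m ν) (a b : X →ᵇ ℂ) :
    AnalyticAt ℝ (fun v : ℂ => ∫ x, m x * (1 - (v.re * a x + v.im * b x))⁻¹ ∂ν) 0 := by
  have hInt : ∀ f : X →ᵇ ℂ, Integrable (fun x => m x * f x) ν := fun f =>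
    hm.mul_bdd (c := ‖f‖) f.continuous.aestronglyMeasurable
      (Eventually.of_forall fun x => f.norm_coe_le_norm x)
  let Λ₀ : (X →ᵇ ℂ) →ₗ[ℝ] ℂ :=
    { toFun := fun f => ∫ x, m x * f x ∂ν
      map_add' := fun f g => by
        simp only [BoundedContinuousFunction.coe_add, Pi.add_apply, mul_add]
        exact integral_add (hInt f) (hInt g)
      map_smul' := fun c f => by
        simp only [BoundedContinuousFunction.coe_smul, RingHom.id_apply]
        rw [← integral_smul]
        congr 1 with x
        simp only [real_smul]; ring }
  let Λ : (X →ᵇ ℂ) →L[ℝ] ℂ := Λ₀.mkContinuous (∫ x, ‖m x‖ ∂ν) fun f => by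
    rw [← integral_mul_const]
    refine norm_integral_le_of_norm_le (hm.norm.mul_const _) (Eventually.of_forall fun x => ?_)
    rw [norm_mul]
    exact mul_le_mul_of_nonneg_left (f.norm_coe_le_norm x) (norm_nonneg _)
  let ℓ : ℂ →L[ℝ] (X →ᵇ ℂ) := reCLM.smulRight a + imCLM.smulRight b
  have hℓ : ∀ v x, ℓ v x = v.re * a x + v.im * b x := fun v x => by
    simp [ℓ]
  have hinner : AnalyticAt ℝ (fun v => 1 - ℓ v) 0 := analyticAt_const.sub (ℓ.analyticAt 0)
  have hinv : AnalyticAt ℝ (fun v => Ring.inverse (1 - ℓ v)) 0 := by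
    have h1 : AnalyticAt ℝ (Ring.inverse : (X →ᵇ ℂ) → (X →ᵇ ℂ)) ((fun v => 1 - ℓ v) 0) := by
      simpa using analyticAt_inverse (𝕜 := ℝ) (1 : (X →ᵇ ℂ)ˣ)
    exact AnalyticAt.fun_comp (g := (Ring.inverse : (X →ᵇ ℂ) → (X →ᵇ ℂ)))
      (f := fun v => 1 - ℓ v) h1 hinner
  have hΛ : AnalyticAt ℝ (fun v => Λ (Ring.inverse (1 - ℓ v))) 0 :=
    (Λ.analyticAt _).fun_comp hinv
  refine hΛ.congr ?_
  have hev : ∀ᶠ v in 𝓝 (0 : ℂ), IsUnit (1 - ℓ v) := by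
    have h1 : {f : X →ᵇ ℂ | IsUnit f} ∈ 𝓝 (1 - ℓ 0) := by
      simpa using Units.isOpen.mem_nhds (show (1 : X →ᵇ ℂ) ∈ {f | IsUnit f} from isUnit_one)
    exact hinner.continuousAt.eventually h1
  filter_upwards [hev] with v hv
  change ∫ x, m x * Ring.inverse (1 - ℓ v) x ∂ν = _
  congr 1 with x
  congr 1
  have h1 := congrArg (fun f : X →ᵇ ℂ => f x) (Ring.mul_inverse_cancel _ hv)
  simp only [BoundedContinuousFunction.coe_mul, Pi.mul_apply, BoundedContinuousFunction.coe_sub,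
    BoundedContinuousFunction.coe_one, Pi.sub_apply, Pi.one_apply, hℓ] at h1
  exact eq_inv_of_mul_eq_one_right h1

theorem eq_integral_circle {h : ℂ → ℂ} {c u : ℂ} {R : ℝ}
    (hd : DifferentiableOn ℂ h (closedBall c R)) (hu : ‖u‖ < R) :
    h (c + u) = (2 * π : ℂ)⁻¹ * ∫ θ in Ioc 0 (2 * π),
      h (c + R * exp (θ * I)) * (1 - u * (exp (-(θ * I)) / R))⁻¹ := by
  have hR : 0 < R := (norm_nonneg u).trans_lt hu
  have hRc : (R : ℂ) ≠ 0 := by exact_mod_cast hR.ne'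
  have h1 := (hd.diffContOnCl_ball subset_rfl).circleIntegral_sub_inv_smul
    (w := c + u) (by simpa [mem_ball, dist_eq] using hu)
  have hpi : (2 * π : ℂ) ≠ 0 := by exact_mod_cast Real.two_pi_pos.ne'
  rw [circleIntegral, intervalIntegral.integral_of_le Real.two_pi_pos.le] at h1
  rw [eq_inv_mul_iff_mul_eq₀ hpi]
  have h2 : ∫ θ in Ioc 0 (2 * π), deriv (circleMap c R) θ •
      (circleMap c R θ - (c + u))⁻¹ • h (circleMap c R θ) =
      I * ∫ θ in Ioc 0 (2 * π), h (c + R * exp (θ * I)) *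
        (1 - u * (exp (-(θ * I)) / R))⁻¹ := by
    rw [← integral_const_mul]
    congr 1 with θ
    have h3 : exp (θ * I) ≠ 0 := exp_ne_zero _
    have h4 : R * exp (θ * I) - u ≠ 0 := fun h => by
      have h5 : ‖u‖ = R := by
        rw [← sub_eq_zero.1 h, norm_mul, norm_exp_ofReal_mul_I, norm_real, Real.norm_eq_abs,
          abs_of_pos hR, mul_one]
      linarith
    have h6 : 1 - u * (exp (-(θ * I)) / R) = (R * exp (θ * I) - u) / (R * exp (θ * I)) := by
      rw [exp_neg]; field_simp
    rw [h6, deriv_circleMap, circleMap, inv_div, smul_eq_mul, smul_eq_mul,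
      show circleMap c R θ - (c + u) = R * exp (θ * I) - u by simp [circleMap]]
    simp only [circleMap, zero_add]
    field_simp
  rw [h2, smul_eq_mul] at h1
  have h7 : I * (∫ θ in Ioc 0 (2 * π), h (c + R * exp (θ * I)) *
        (1 - u * (exp (-(θ * I)) / R))⁻¹) = I * ((2 * π : ℂ) * h (c + u)) := by
    rw [h1]; ring
  exact (mul_left_cancel₀ I_ne_zero h7).symm

structure ExpWeight (w : ℝ → ℂ) : Prop where
  meas : AEStronglyMeasurable w (volume.restrict (Ioi 1))
  integ : ∀ ε > 0, IntegrableOn (fun r => ‖w r‖ * Real.exp (-(ε * r))) (Ioi 1)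

theorem ExpWeight.mul_id {w : ℝ → ℂ} (hw : ExpWeight w) (κ : ℂ) :
    ExpWeight fun r => κ * r * w r where
  meas := (Continuous.aestronglyMeasurable (by fun_prop)).mul hw.meas
  integ ε hε := by
    refine ((hw.integ (ε / 2) (by positivity)).const_mul (‖κ‖ * (2 / ε))).mono'
      ((((Continuous.aestronglyMeasurable (by fun_prop)).mul hw.meas).norm).mul
        (Continuous.aestronglyMeasurable (by fun_prop))) ?_
    refine (ae_restrict_iff' measurableSet_Ioi).2 (Eventually.of_forall fun r hr => ?_)
    have hr1 : (1 : ℝ) < r := hr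
    rw [Real.norm_of_nonneg (by positivity), norm_mul, norm_mul, norm_real, Real.norm_eq_abs,
      abs_of_pos (by linarith)]
    have h1 : r ≤ 2 / ε * Real.exp (ε / 2 * r) := by
      have := Real.add_one_le_exp (ε / 2 * r)
      calc r = 2 / ε * (ε / 2 * r) := by field_simp
        _ ≤ _ := by gcongr; linarith
    calc ‖κ‖ * r * ‖w r‖ * Real.exp (-(ε * r))
        ≤ ‖κ‖ * (2 / ε * Real.exp (ε / 2 * r)) * ‖w r‖ * Real.exp (-(ε * r)) := by gcongr
      _ = ‖κ‖ * (2 / ε) * (‖w r‖ * (Real.exp (ε / 2 * r) * Real.exp (-(ε * r)))) := by ring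
      _ = _ := by rw [← Real.exp_add]; ring_nf

/-- The integral of a holomorphic function against a weight along a vertical ray. -/
def weightInt (w : ℝ → ℂ) (κ : ℂ) (h : ℂ → ℂ) (z : ℂ) : ℂ :=
  ∫ r in Ioi (1 : ℝ), w r * h (z.re + κ * z.im * r)

theorem abs_im_ray {κ : ℂ} (hκ : κ = I ∨ κ = -I) (x y : ℝ) {r : ℝ} (hr : 0 < r) :
    |((x : ℂ) + κ * y * r).im| = |y| * r := by
  rcases hκ with rfl | rfl <;> simp [abs_mul, abs_of_pos hr]

theorem norm_kappa {κ : ℂ} (hκ : κ = I ∨ κ = -I) : ‖κ‖ = 1 := by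
  rcases hκ with rfl | rfl <;> simp

theorem ray_add_im {κ : ℂ} (hκ : κ = I ∨ κ = -I) (x y : ℝ) {r : ℝ} (hr : 0 < r) {u : ℂ}
    (hu : ‖u‖ ≤ |y| / 2 * r) : |y| / 2 * r ≤ |((x : ℂ) + κ * y * r + u).im| := by
  have h1 := abs_im_ray hκ x y hr
  have h2 := abs_im_le_norm u
  have h3 := abs_add_le (((x : ℂ) + κ * y * r + u).im) (-u.im)
  rw [add_im _ u, add_neg_cancel_right, h1, abs_neg] at h3
  rw [add_im _ u]
  linarith

theorem StripDecay.ray_bound {h : ℂ → ℂ} (hh : StripDecay h) {κ : ℂ} (hκ : κ = I ∨ κ = -I)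
    {δ : ℝ} (hδ : 0 < δ) : ∃ K ≥ 0, ∃ ε > 0, ∀ x y : ℝ, δ ≤ |y| → ∀ r > 1, ∀ u : ℂ,
      ‖u‖ ≤ |y| / 2 * r → ‖h (x + κ * y * r + u)‖ ≤ K * Real.exp (-(ε * |y| * r)) := by
  obtain ⟨c, hc, hd⟩ := hh.decay
  obtain ⟨K, hK⟩ := hd (δ / 2) (by positivity)
  refine ⟨|K|, abs_nonneg K, c / 2, by positivity, fun x y hy r hr u hu => ?_⟩
  have h1 := ray_add_im hκ x y (by linarith) hu
  have h2 : δ / 2 ≤ |y| / 2 * r := by nlinarith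
  refine (hK _ (h2.trans h1)).trans ?_
  have h3 : c / 2 * |y| * r ≤ c * |(x + κ * y * r + u).im| := by
    calc c / 2 * |y| * r = c * (|y| / 2 * r) := by ring
      _ ≤ _ := by gcongr
  have h4 := le_abs_self K
  gcongr

theorem continuousOn_ray {h : ℂ → ℂ} (hh : StripDecay h) {κ : ℂ} (hκ : κ = I ∨ κ = -I) {x y : ℝ}
    (hy : y ≠ 0) {p q : ℂ} (hp : ∀ r > (1 : ℝ), ‖p + q * r‖ ≤ |y| / 2 * r) :
    ContinuousOn (fun r : ℝ => h (x + κ * y * r + (p + q * r))) (Ioi 1) := by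
  refine hh.diff.continuousOn.comp (by fun_prop) fun r hr => ?_
  have hr1 : (1 : ℝ) < r := hr
  have h1 := ray_add_im hκ x y (by linarith) (hp r hr)
  have h2 : 0 < |y| / 2 * r := by have := abs_pos.2 hy; positivity
  exact abs_pos.1 (h2.trans_le h1)

theorem integrableOn_weightInt {w : ℝ → ℂ} (hw : ExpWeight w) {h : ℂ → ℂ} (hh : StripDecay h)
    {κ : ℂ} (hκ : κ = I ∨ κ = -I) (x : ℝ) {y : ℝ} (hy : y ≠ 0) :
    IntegrableOn (fun r : ℝ => w r * h (x + κ * y * r)) (Ioi 1) := by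
  have hy' : 0 < |y| := abs_pos.2 hy
  obtain ⟨K, hK0, ε, hε, hK⟩ := hh.ray_bound hκ hy'
  have h0 := continuousOn_ray hh hκ (x := x) hy (p := 0) (q := 0)
    (fun r hr => by simp only [zero_mul, add_zero, norm_zero]; positivity)
  simp only [zero_mul, add_zero] at h0
  refine ((hw.integ (ε * |y|) (by positivity)).const_mul K).mono'
    (hw.meas.mul (h0.aestronglyMeasurable measurableSet_Ioi)) ?_
  refine (ae_restrict_iff' measurableSet_Ioi).2 (Eventually.of_forall fun r hr => ?_)
  have hr1 : (1 : ℝ) < r := hr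
  have := hK x y le_rfl r hr 0 (by simp only [norm_zero]; positivity)
  rw [add_zero] at this
  rw [norm_mul]
  calc _ ≤ ‖w r‖ * (K * Real.exp (-(ε * |y| * r))) := by gcongr
    _ = _ := by ring

theorem norm_weightInt_le {w : ℝ → ℂ} (hw : ExpWeight w) {h : ℂ → ℂ} (hh : StripDecay h)
    {κ : ℂ} (hκ : κ = I ∨ κ = -I) : ∃ K, ∃ c > 0, ∀ z : ℂ, 1 ≤ z.im →
      ‖weightInt w κ h z‖ ≤ K * Real.exp (-(c * z.im)) := by
  obtain ⟨K, hK0, ε, hε, hK⟩ := hh.ray_bound hκ one_pos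
  refine ⟨K * ∫ r in Ioi (1 : ℝ), ‖w r‖ * Real.exp (-(ε / 2 * r)), ε / 2, by positivity,
    fun z hz => ?_⟩
  have hz' : |z.im| = z.im := abs_of_pos (by linarith)
  rw [mul_right_comm, ← integral_const_mul]
  refine norm_integral_le_of_norm_le
    ((hw.integ (ε / 2) (by positivity)).const_mul _) ?_
  refine (ae_restrict_iff' measurableSet_Ioi).2 (Eventually.of_forall fun r hr => ?_)
  have hr1 : (1 : ℝ) < r := hr
  have := hK z.re z.im (hz'.symm ▸ hz) r hr 0 (by simp only [norm_zero]; positivity)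
  rw [add_zero, hz'] at this
  rw [norm_mul]
  have h2 : Real.exp (-(ε * z.im * r)) ≤
      Real.exp (-(ε / 2 * z.im)) * Real.exp (-(ε / 2 * r)) := by
    rw [← Real.exp_add]
    gcongr
    have h3 : z.im + r ≤ 2 * (z.im * r) := by nlinarith
    nlinarith
  calc _ ≤ ‖w r‖ * (K * (Real.exp (-(ε / 2 * z.im)) * Real.exp (-(ε / 2 * r)))) := by
        gcongr
        exact this.trans (by gcongr)
    _ = _ := by ring

theorem hasDerivAt_weightInt {w : ℝ → ℂ} (hw : ExpWeight w) {h : ℂ → ℂ} (hh : StripDecay h)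
    {κ : ℂ} (hκ : κ = I ∨ κ = -I) (x : ℝ) {y : ℝ} (hy : y ≠ 0) {p q : ℂ}
    (hp : ∀ r > (1 : ℝ), ‖p + q * r‖ ≤ r) :
    HasDerivAt (fun ξ : ℂ => ∫ r in Ioi (1 : ℝ), w r * h (x + κ * y * r + ξ * (p + q * r)))
      (∫ r in Ioi (1 : ℝ), w r * ((p + q * r) * deriv h (x + κ * y * r))) 0 := by
  have hy' : 0 < |y| := abs_pos.2 hy
  obtain ⟨K, hK0, ε, hε, hK⟩ := hh.ray_bound hκ hy'
  have hle : ∀ ξ ∈ ball (0 : ℂ) (|y| / 2), ∀ r > (1 : ℝ), ‖ξ * (p + q * r)‖ ≤ |y| / 2 * r :=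
    fun ξ hξ r hr => by
      rw [norm_mul]
      have h1 : ‖ξ‖ < |y| / 2 := by simpa using hξ
      exact mul_le_mul h1.le (hp r hr) (norm_nonneg _) (by positivity)
  have hdr : ∀ ξ ∈ ball (0 : ℂ) (|y| / 2), ∀ r > (1 : ℝ),
      HasDerivAt (fun ξ : ℂ => w r * h (x + κ * y * r + ξ * (p + q * r)))
        (w r * ((p + q * r) * deriv h (x + κ * y * r + ξ * (p + q * r)))) ξ := fun ξ hξ r hr => by
    have h1 := ray_add_im hκ x y (by linarith) (hle ξ hξ r hr)
    have h2 : 0 < |y| / 2 * r := by positivity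
    have h3 : DifferentiableAt ℂ h (x + κ * y * r + ξ * (p + q * r)) :=
      hh.diff.differentiableAt (isOpen_im_ne_zero.mem_nhds (abs_pos.1 (h2.trans_le h1)))
    have h4 : HasDerivAt (fun ξ : ℂ => x + κ * y * r + ξ * (p + q * r)) (p + q * r) ξ := by
      simpa using ((hasDerivAt_id ξ).mul_const (p + q * r)).const_add ((x : ℂ) + κ * y * r)
    have h5 := (h3.hasDerivAt.comp ξ h4).const_mul (w r)
    exact h5.congr_deriv (by ring)
  have hmain := (hasDerivAt_integral_of_holomorphic (ν := volume.restrict (Ioi (1 : ℝ)))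
    (f := fun ξ r => w r * h (x + κ * y * r + ξ * (p + q * r))) (z₀ := 0) (r := |y| / 2)
    (by positivity) (fun ξ hξ => ?_) ?_
    ((hw.integ (ε * |y|) (by positivity)).const_mul K) ?_).2
  · refine hmain.congr_deriv (setIntegral_congr_fun measurableSet_Ioi fun r hr => ?_)
    have := (hdr 0 (mem_ball_self (by positivity)) r hr).deriv
    simpa using this
  · refine hw.meas.mul (ContinuousOn.aestronglyMeasurable ?_ measurableSet_Ioi)
    have := continuousOn_ray hh hκ (x := x) hy (p := ξ * p) (q := ξ * q) (fun r hr => by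
      have := hle ξ hξ r hr
      rwa [show ξ * p + ξ * q * r = ξ * (p + q * r) by ring])
    refine this.congr fun r _ => ?_
    simp only [mul_add, mul_assoc]
  · refine (ae_restrict_iff' measurableSet_Ioi).2 (Eventually.of_forall fun r hr ξ hξ => ?_)
    exact (hdr ξ hξ r hr).differentiableAt.differentiableWithinAt
  · refine (ae_restrict_iff' measurableSet_Ioi).2 (Eventually.of_forall fun r hr ξ hξ => ?_)
    have := hK x y le_rfl r hr _ (hle ξ hξ r hr)
    rw [norm_mul]
    calc _ ≤ ‖w r‖ * (K * Real.exp (-(ε * |y| * r))) := by gcongr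
      _ = _ := by ring

theorem pdx_weightInt {w : ℝ → ℂ} (hw : ExpWeight w) {h : ℂ → ℂ} (hh : StripDecay h)
    {κ : ℂ} (hκ : κ = I ∨ κ = -I) {z : ℂ} (hz : z ∈ UH) :
    pdx (weightInt w κ h) z = weightInt w κ (deriv h) z := by
  have hy : z.im ≠ 0 := ne_of_gt hz
  have h1 := hasDerivAt_weightInt hw hh hκ z.re hy (p := 1) (q := 0)
    (fun r hr => by simpa using hr.le)
  have h2 : HasDerivAt (fun x : ℝ => ((x : ℂ) - z.re)) 1 z.re :=
    (ofRealCLM.hasDerivAt (x := z.re)).sub_const (z.re : ℂ)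
  have h3 := HasDerivAt.comp_of_eq z.re h1 h2 (by simp)
  have h4 : (fun x : ℝ => weightInt w κ h (x + z.im * I)) =
      (fun ξ : ℂ => ∫ r in Ioi (1 : ℝ), w r * h (z.re + κ * z.im * r + ξ * (1 + 0 * r))) ∘
        fun x : ℝ => ((x : ℂ) - z.re) := by
    funext x
    simp only [weightInt, Function.comp]
    congr 1 with r
    congr 2
    simp; ring
  rw [pdx, h4, h3.deriv, weightInt]
  simp

theorem pdy_weightInt {w : ℝ → ℂ} (hw : ExpWeight w) {h : ℂ → ℂ} (hh : StripDecay h)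
    {κ : ℂ} (hκ : κ = I ∨ κ = -I) {z : ℂ} (hz : z ∈ UH) :
    pdy (weightInt w κ h) z = weightInt (fun r => κ * r * w r) κ (deriv h) z := by
  have hy : z.im ≠ 0 := ne_of_gt hz
  have h1 := hasDerivAt_weightInt hw hh hκ z.re hy (p := 0) (q := κ)
    (fun r hr => by
      simp only [zero_add, norm_mul, norm_kappa hκ, norm_real, Real.norm_eq_abs, one_mul]
      rw [abs_of_pos (by linarith)])
  have h2 : HasDerivAt (fun x : ℝ => ((x : ℂ) - z.im)) 1 z.im :=
    (ofRealCLM.hasDerivAt (x := z.im)).sub_const (z.im : ℂ)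
  have h3 := HasDerivAt.comp_of_eq z.im h1 h2 (by simp)
  have h4 : (fun y : ℝ => weightInt w κ h (z.re + y * I)) =
      (fun ξ : ℂ => ∫ r in Ioi (1 : ℝ), w r * h (z.re + κ * z.im * r + ξ * (0 + κ * r))) ∘
        fun x : ℝ => ((x : ℂ) - z.im) := by
    funext x
    simp only [weightInt, Function.comp]
    congr 1 with r
    congr 2
    simp; ring
  rw [pdy, h4, h3.deriv, weightInt, mul_one]
  congr 1 with r
  ring

theorem analyticOnNhd_weightInt {w : ℝ → ℂ} (hw : ExpWeight w) {h : ℂ → ℂ} (hh : StripDecay h)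
    {κ : ℂ} (hκ : κ = I ∨ κ = -I) : AnalyticOnNhd ℝ (weightInt w κ h) UH := by
  intro z hz
  have hy : 0 < z.im := hz
  have hya : |z.im| = z.im := abs_of_pos hy
  set ρ := z.im / 2 with hρ
  have hρ0 : 0 < ρ := by positivity
  have hρc : (ρ : ℂ) ≠ 0 := by exact_mod_cast hρ0.ne'
  obtain ⟨K, hK0, ε, hε, hK⟩ := hh.ray_bound hκ hy
  let a : (ℝ × ℝ) →ᵇ ℂ := BoundedContinuousFunction.ofNormedAddCommGroup
    (fun x => exp (-(x.2 * I)) / (ρ * (max x.1 1 : ℝ)))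
    (by
      refine Continuous.div (by fun_prop) (by fun_prop) fun x => ?_
      have : (0 : ℝ) < max x.1 1 := lt_max_of_lt_right one_pos
      exact mul_ne_zero hρc (by exact_mod_cast this.ne')) (1 / ρ)
    (fun x => by
      have h1 : (1 : ℝ) ≤ max x.1 1 := le_max_right _ _
      rw [norm_div, ← neg_mul, ← ofReal_neg, norm_exp_ofReal_mul_I, norm_mul, norm_real, norm_real,
        Real.norm_of_nonneg hρ0.le, Real.norm_of_nonneg (by linarith)]
      gcongr
      nlinarith)
  let b : (ℝ × ℝ) →ᵇ ℂ := BoundedContinuousFunction.ofNormedAddCommGroup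
    (fun x => κ * exp (-(x.2 * I)) / ρ) (by fun_prop) (1 / ρ)
    (fun x => by
      rw [norm_div, norm_mul, norm_kappa hκ, ← neg_mul, ← ofReal_neg, norm_exp_ofReal_mul_I,
        norm_real, Real.norm_of_nonneg hρ0.le, one_mul])
  set ν : Measure (ℝ × ℝ) :=
    (volume.restrict (Ioi (1 : ℝ))).prod (volume.restrict (Ioc 0 (2 * π))) with hν
  let m : ℝ × ℝ → ℂ := fun x =>
    w x.1 * h (z.re + κ * z.im * x.1 + (ρ * x.1 : ℝ) * exp (x.2 * I))
  have hnorm : ∀ r > (1 : ℝ), ∀ θ : ℝ, ‖((ρ * r : ℝ) : ℂ) * exp (θ * I)‖ = |z.im| / 2 * r :=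
    fun r hr θ => by
      rw [norm_mul, norm_exp_ofReal_mul_I, norm_real, Real.norm_of_nonneg (by positivity), hya,
        mul_one]
  have hν' : ν = (volume : Measure (ℝ × ℝ)).restrict (Ioi 1 ×ˢ Ioc 0 (2 * π)) := by
    rw [hν, Measure.prod_restrict, Measure.volume_eq_prod]
  have hm : Integrable m ν := by
    have hb : Integrable (fun x : ℝ × ℝ => K * (‖w x.1‖ * Real.exp (-(ε * |z.im| * x.1))) * 1)
        ν := by
      refine Integrable.mul_prod (f := fun r => K * (‖w r‖ * Real.exp (-(ε * |z.im| * r))))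
        (g := fun _ : ℝ => (1 : ℝ)) ((hw.integ (ε * |z.im|) (by positivity)).const_mul K) ?_
      exact integrable_const _
    refine hb.mono' ?_ ?_
    · refine AEStronglyMeasurable.mul hw.meas.comp_fst ?_
      rw [hν']
      refine ContinuousOn.aestronglyMeasurable ?_ (measurableSet_Ioi.prod measurableSet_Ioc)
      refine hh.diff.continuousOn.comp (by fun_prop) fun x hx => ?_
      have hr : (1 : ℝ) < x.1 := hx.1
      have h1 := ray_add_im hκ z.re z.im (by linarith) (hnorm x.1 hr x.2).le
      have h2 : 0 < |z.im| / 2 * x.1 := by rw [hya]; positivity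
      exact abs_pos.1 (h2.trans_le h1)
    · rw [hν']
      refine (ae_restrict_iff' (measurableSet_Ioi.prod measurableSet_Ioc)).2
        (Eventually.of_forall fun x hx => ?_)
      have hr : (1 : ℝ) < x.1 := hx.1
      have h1 := hK z.re z.im hya.ge x.1 hr _ (hnorm x.1 hr x.2).le
      simp only [m, norm_mul]
      calc _ ≤ ‖w x.1‖ * (K * Real.exp (-(ε * |z.im| * x.1))) := by gcongr
        _ = _ := by ring
  have hmain := analyticAt_integral_geometric hm a b
  have hshift : AnalyticAt ℝ (fun v : ℂ => v - z) z := analyticAt_id.sub analyticAt_const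
  have h1 : AnalyticAt ℝ (fun v : ℂ => (2 * π : ℂ)⁻¹ *
      ∫ x, m x * (1 - ((v - z).re * a x + (v - z).im * b x))⁻¹ ∂ν) z := by
    refine analyticAt_const.mul (AnalyticAt.fun_comp
      (g := fun v : ℂ => ∫ x, m x * (1 - (v.re * a x + v.im * b x))⁻¹ ∂ν) ?_ hshift)
    simpa using hmain
  refine h1.congr ?_
  filter_upwards [ball_mem_nhds z (show 0 < ρ / 4 by positivity)] with v hv
  have hv' : ‖v - z‖ < ρ / 4 := by simpa [dist_eq] using hv
  have hre := (abs_re_le_norm (v - z)).trans_lt hv'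
  have him := (abs_im_le_norm (v - z)).trans_lt hv'
  have hInt : Integrable (fun x => m x * (1 - ((v - z).re * a x + (v - z).im * b x))⁻¹) ν := by
    have hs : ∀ x, 1 / 2 ≤ ‖1 - ((v - z).re * a x + (v - z).im * b x)‖ := fun x => by
      have ha : ‖a x‖ ≤ 1 / ρ := (a.norm_coe_le_norm x).trans
        (BoundedContinuousFunction.norm_ofNormedAddCommGroup_le _ (by positivity) _)
      have hb : ‖b x‖ ≤ 1 / ρ := (b.norm_coe_le_norm x).trans
        (BoundedContinuousFunction.norm_ofNormedAddCommGroup_le _ (by positivity) _)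
      have h2 : ‖((v - z).re : ℂ) * a x + (v - z).im * b x‖ ≤ 1 / 2 := by
        refine (norm_add_le _ _).trans ?_
        rw [norm_mul, norm_mul, norm_real, norm_real, Real.norm_eq_abs, Real.norm_eq_abs]
        calc _ ≤ ρ / 4 * (1 / ρ) + ρ / 4 * (1 / ρ) := by gcongr
          _ = 1 / 2 := by field_simp; norm_num
      have h3 := norm_sub_norm_le (1 : ℂ) (((v - z).re : ℂ) * a x + (v - z).im * b x)
      rw [norm_one] at h3
      linarith
    refine hm.mul_bdd (c := 2) (Continuous.aestronglyMeasurable ?_)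
      (Eventually.of_forall fun x => ?_)
    · refine Continuous.inv₀ (by fun_prop) fun x hx => ?_
      have := hs x
      rw [hx, norm_zero] at this
      norm_num at this
    · rw [norm_inv]
      calc _ ≤ (1 / 2 : ℝ)⁻¹ := by gcongr; exact hs x
        _ = 2 := by norm_num
  rw [integral_prod _ hInt, ← integral_const_mul, weightInt]
  refine setIntegral_congr_fun measurableSet_Ioi fun r hr => ?_
  have hr1 : (1 : ℝ) < r := hr
  have hrc : (r : ℂ) ≠ 0 := by exact_mod_cast (by linarith : r ≠ 0)
  set u : ℂ := (v - z).re + κ * (v - z).im * r with hu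
  have hule : ‖u‖ < ρ * r := by
    refine (norm_add_le _ _).trans_lt ?_
    rw [norm_mul, norm_mul, norm_kappa hκ, norm_real, norm_real, norm_real, Real.norm_eq_abs,
      Real.norm_eq_abs, Real.norm_of_nonneg (by linarith), one_mul]
    have : |(v - z).im| * r < ρ / 4 * r := by gcongr
    nlinarith
  have hcir := eq_integral_circle (h := h) (c := z.re + κ * z.im * r) (u := u) (R := ρ * r)
    (hh.diff.mono fun ξ hξ => ?_) hule
  · have h2 : (v.re : ℂ) + κ * v.im * r = z.re + κ * z.im * r + u := by
      rw [hu]; simp only [sub_re, sub_im, ofReal_sub]; ring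
    simp only [h2]
    rw [hcir, mul_left_comm, ← integral_const_mul (w r)]
    refine congrArg _ (setIntegral_congr_fun measurableSet_Ioc fun θ _ => ?_)
    have h3 : u * (exp (-(θ * I)) / (ρ * r : ℝ)) =
        (v - z).re * a (r, θ) + (v - z).im * b (r, θ) := by
      have e1 : a (r, θ) = exp (-(θ * I)) / (ρ * (max r 1 : ℝ)) := rfl
      have e2 : b (r, θ) = κ * exp (-(θ * I)) / ρ := rfl
      rw [e1, e2, max_eq_left hr1.le, hu]
      push_cast
      field_simp
    simp only [m, h3]
    ring
  · have h4 : ‖ξ - (z.re + κ * z.im * r)‖ ≤ |z.im| / 2 * r := by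
      rw [hya]; simpa [dist_eq, hρ] using hξ
    have h5 := ray_add_im hκ z.re z.im (by linarith) h4
    rw [add_sub_cancel] at h5
    have h6 : 0 < |z.im| / 2 * r := by rw [hya]; positivity
    exact abs_pos.1 (h6.trans_le h5)

end Period

namespace Period

open Set Filter Topology Metric
open scoped Real

/-- The weight `(r² - 1)^(s-1)`. -/
def besselWeight (s : ℂ) (r : ℝ) : ℂ := ((r ^ 2 - 1 : ℝ) : ℂ) ^ (s - 1)

theorem sq_sub_one_pos {r : ℝ} (hr : 1 < r) : 0 < r ^ 2 - 1 := by nlinarith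

theorem norm_besselWeight (s : ℂ) {r : ℝ} (hr : 1 < r) :
    ‖besselWeight s r‖ = (r ^ 2 - 1) ^ (s.re - 1) := by
  rw [besselWeight, norm_cpow_eq_rpow_re_of_pos (sq_sub_one_pos hr), sub_re, one_re]

theorem continuousOn_besselWeight (s : ℂ) : ContinuousOn (besselWeight s) (Ioi 1) := by
  intro r hr
  exact ((continuousAt_ofReal_cpow_const _ _ (Or.inr (sq_sub_one_pos hr).ne')).comp
    (f := fun r : ℝ => r ^ 2 - 1) (by fun_prop)).continuousWithinAt

theorem expWeight_bessel {s : ℂ} (hs : 0 < s.re) : ExpWeight (besselWeight s) where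
  meas := (continuousOn_besselWeight s).aestronglyMeasurable measurableSet_Ioi
  integ ε hε := by
    set σ := s.re with hσ
    obtain ⟨C, hC⟩ : ∃ C, ∀ t > (0 : ℝ), (t + 2) ^ (σ - 1) ≤ C * Real.exp (ε / 2 * t) := by
      have h1 : Tendsto (fun t : ℝ => t ^ |σ - 1| * Real.exp (-(ε / 2) * t)) atTop (𝓝 0) :=
        tendsto_rpow_mul_exp_neg_mul_atTop_nhds_zero _ _ (by positivity)
      obtain ⟨T, hT⟩ := eventually_atTop.1 (h1.eventually (gt_mem_nhds one_pos))
      refine ⟨max (Real.exp (ε / 2 * 2)) ((|T| + 2) ^ |σ - 1|), fun t ht => ?_⟩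
      have h2 : (t + 2) ^ (σ - 1) ≤ (t + 2) ^ |σ - 1| :=
        Real.rpow_le_rpow_of_exponent_le (by linarith) (le_abs_self _)
      have h5 : 1 ≤ Real.exp (ε / 2 * t) := Real.one_le_exp (by positivity)
      rcases le_total T (t + 2) with h | h
      · have h3 := (hT (t + 2) h).le
        have h4 : (t + 2) ^ |σ - 1| ≤ Real.exp (ε / 2 * (t + 2)) := by
          rwa [neg_mul, Real.exp_neg, ← div_eq_mul_inv, div_le_one (Real.exp_pos _)] at h3
        calc _ ≤ Real.exp (ε / 2 * (t + 2)) := h2.trans h4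
          _ = Real.exp (ε / 2 * 2) * Real.exp (ε / 2 * t) := by rw [← Real.exp_add]; ring_nf
          _ ≤ _ := by gcongr; exact le_max_left _ _
      · have h3 : (t + 2) ^ |σ - 1| ≤ (|T| + 2) ^ |σ - 1| := by
          have := le_abs_self T
          gcongr
          linarith
        calc _ ≤ (|T| + 2) ^ |σ - 1| * 1 := by rw [mul_one]; exact h2.trans h3
          _ ≤ _ := by gcongr; exact le_max_right _ _
    have h0 : IntegrableOn (fun t : ℝ => C * (t ^ (σ - 1) * Real.exp (-(ε / 2) * t ^ (1 : ℝ))))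
        (Ioi 0) := (integrableOn_rpow_mul_exp_neg_mul_rpow (s := σ - 1) (by linarith) one_pos
        (by positivity)).const_mul C
    have h1 := ((measurePreserving_sub_right volume (1 : ℝ)).integrableOn_comp_preimage
      (MeasurableEquiv.subRight (1 : ℝ)).measurableEmbedding).2 h0
    have h2 : (fun x : ℝ => x - 1) ⁻¹' Ioi 0 = Ioi 1 := by ext; simp
    rw [h2] at h1
    refine h1.mono' ?_ ?_
    · refine ContinuousOn.aestronglyMeasurable ?_ measurableSet_Ioi
      exact (continuousOn_besselWeight s).norm.mul (by fun_prop)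
    · refine (ae_restrict_iff' measurableSet_Ioi).2 (Eventually.of_forall fun r hr => ?_)
      have hr1 : 0 < r - 1 := sub_pos.2 hr
      rw [Real.norm_of_nonneg (by positivity), norm_besselWeight s hr,
        show r ^ 2 - 1 = (r - 1) * ((r - 1) + 2) by ring,
        Real.mul_rpow hr1.le (by linarith)]
      simp only [Function.comp, Real.rpow_one]
      have h3 := hC (r - 1) hr1
      have h4 : Real.exp (ε / 2 * (r - 1)) * Real.exp (-(ε * r)) ≤
          Real.exp (-(ε / 2) * (r - 1)) := by
        rw [← Real.exp_add]
        gcongr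
        nlinarith
      have hC0 : 0 ≤ C := by
        have h5 : 0 ≤ C * Real.exp (ε / 2 * (r - 1)) := le_trans (by positivity) h3
        exact nonneg_of_mul_nonneg_left h5 (Real.exp_pos _)
      calc _ ≤ (r - 1) ^ (σ - 1) * (C * Real.exp (ε / 2 * (r - 1))) * Real.exp (-(ε * r)) := by
            gcongr
        _ = C * ((r - 1) ^ (σ - 1) * (Real.exp (ε / 2 * (r - 1)) * Real.exp (-(ε * r)))) := by
            ring
        _ ≤ _ := by gcongr

theorem hasDerivAt_sq_sub_one_cpow (s : ℂ) {r : ℝ} (hr : 1 < r) :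
    HasDerivAt (fun r : ℝ => ((r ^ 2 - 1 : ℝ) : ℂ) ^ s) (2 * s * r * besselWeight s r) r := by
  have h1 : HasDerivAt (fun r : ℝ => ((r ^ 2 - 1 : ℝ) : ℂ)) (2 * r) r := by
    have := (((hasDerivAt_id r).pow 2).sub_const 1).ofReal_comp
    simpa using this
  have h2 : ((r ^ 2 - 1 : ℝ) : ℂ) ∈ slitPlane := ofReal_mem_slitPlane.2 (sq_sub_one_pos hr)
  have h3 : HasDerivAt (fun w : ℂ => w ^ s) (s * ((r ^ 2 - 1 : ℝ) : ℂ) ^ (s - 1))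
      ((r ^ 2 - 1 : ℝ) : ℂ) := by
    simpa using (hasDerivAt_id (((r ^ 2 - 1 : ℝ) : ℂ))).cpow_const (c := s) h2
  refine (h3.scomp r h1).congr_deriv ?_
  rw [besselWeight, smul_eq_mul]; ring

theorem bessel_ode {s : ℂ} (hs : 0 < s.re) {h : ℂ → ℂ} (hh : StripDecay h) {κ : ℂ}
    (hκ : κ = I ∨ κ = -I) (x : ℝ) {y : ℝ} (hy : 0 < y) :
    ∫ r in Ioi (1 : ℝ), (2 * s * r * besselWeight s r * h (x + κ * y * r) +
      ((r ^ 2 - 1 : ℝ) : ℂ) ^ s * (κ * y * deriv h (x + κ * y * r))) = 0 := by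
  have hya : |y| = y := abs_of_pos hy
  have hw := expWeight_bessel hs
  have hs0 : s ≠ 0 := fun h => by simp [h] at hs
  have hw1 := (hw.mul_id 1).mul_id 1
  have hi1 := (integrableOn_weightInt (hw.mul_id 1) hh hκ x hy.ne').const_mul (2 * s)
  have hi2 := ((integrableOn_weightInt hw1 hh.deriv hκ x hy.ne').sub
    (integrableOn_weightInt hw hh.deriv hκ x hy.ne')).const_mul (κ * y)
  obtain ⟨K, hK0, ε, hε, hK⟩ := hh.ray_bound hκ hy
  have hKr : ∀ r > (1 : ℝ), ‖h (x + κ * y * r)‖ ≤ K * Real.exp (-(ε * y * r)) := fun r hr => by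
    simpa [hya] using hK x y hya.ge r hr 0 (by simp only [norm_zero]; positivity)
  have hcs : ContinuousAt (fun r : ℝ => ((r ^ 2 - 1 : ℝ) : ℂ) ^ s) 1 :=
    (continuousAt_ofReal_cpow_const _ s (Or.inl hs)).comp
      (f := fun r : ℝ => r ^ 2 - 1) (by fun_prop)
  have hdiff : ∀ r : ℝ, 1 ≤ r → DifferentiableAt ℂ h (x + κ * y * r) := fun r hr => by
    refine hh.diff.differentiableAt (isOpen_im_ne_zero.mem_nhds ?_)
    have h1 := abs_im_ray hκ x y (r := r) (by linarith)
    exact abs_pos.1 (by rw [h1, hya]; positivity)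
  have hlin : ∀ r : ℝ, HasDerivAt (fun r : ℝ => (x : ℂ) + κ * y * r) (κ * y) r := fun r => by
    simpa using (ofRealCLM.hasDerivAt.const_mul (κ * y)).const_add (x : ℂ)
  have hder : ∀ r : ℝ, 1 ≤ r → HasDerivAt (fun r : ℝ => h (x + κ * y * r))
      (κ * y * deriv h (x + κ * y * r)) r := fun r hr => by
    exact ((hdiff r hr).hasDerivAt.scomp r (hlin r))
  have hmain := integral_Ioi_of_hasDerivAt_of_tendsto (a := 1) (m := 0)
    (f := fun r : ℝ => ((r ^ 2 - 1 : ℝ) : ℂ) ^ s * h (x + κ * y * r))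
    (f' := fun r : ℝ => 2 * s * r * besselWeight s r * h (x + κ * y * r) +
      ((r ^ 2 - 1 : ℝ) : ℂ) ^ s * (κ * y * deriv h (x + κ * y * r)))
    (hcs.mul (hder 1 le_rfl).continuousAt).continuousWithinAt
    (fun r hr => (hasDerivAt_sq_sub_one_cpow s hr).fun_mul (hder r (le_of_lt hr))) ?_ ?_
  · rw [hmain]; simp [zero_cpow hs0]
  · refine IntegrableOn.congr_fun (hi1.add hi2) (fun r hr => ?_) measurableSet_Ioi
    have hp : ((r ^ 2 - 1 : ℝ) : ℂ) ≠ 0 := by exact_mod_cast (sq_sub_one_pos hr).ne'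
    have h1 : ((r ^ 2 - 1 : ℝ) : ℂ) ^ s = (r ^ 2 - 1) * besselWeight s r := by
      rw [besselWeight, cpow_sub _ _ hp, cpow_one]
      push_cast at hp ⊢
      field_simp
    simp only [Pi.add_apply, Pi.sub_apply, h1]
    ring
  · rw [tendsto_zero_iff_norm_tendsto_zero]
    have h1 : Tendsto (fun r : ℝ => K * (r ^ (2 * s.re) * Real.exp (-(ε * y) * r))) atTop
        (𝓝 (K * 0)) :=
      (tendsto_rpow_mul_exp_neg_mul_atTop_nhds_zero _ _ (by positivity)).const_mul K
    rw [mul_zero] at h1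
    refine squeeze_zero' (Eventually.of_forall fun _ => norm_nonneg _) ?_ h1
    filter_upwards [eventually_gt_atTop 1] with r hr
    rw [norm_mul, norm_cpow_eq_rpow_re_of_pos (sq_sub_one_pos hr)]
    have h2 : (r ^ 2 - 1) ^ s.re ≤ r ^ (2 * s.re) := by
      rw [Real.rpow_mul (by linarith), Real.rpow_two]
      exact Real.rpow_le_rpow (sq_sub_one_pos hr).le (by linarith) hs.le
    calc _ ≤ r ^ (2 * s.re) * (K * Real.exp (-(ε * y * r))) := by
          gcongr
          exact hKr r hr
      _ = _ := by ring_nf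

/-- The wave `y^s ∫ (r²-1)^(s-1) h(x + κ y r) dr`. -/
def besselWave (s κ : ℂ) (h : ℂ → ℂ) (z : ℂ) : ℂ :=
  (z.im : ℂ) ^ s * weightInt (besselWeight s) κ h z

theorem analyticOnNhd_im_cpow (s : ℂ) : AnalyticOnNhd ℝ (fun z : ℂ => (z.im : ℂ) ^ s) UH := by
  intro z hz
  have h1 : AnalyticAt ℝ (fun z : ℂ => (z.im : ℂ)) z :=
    (ofRealCLM.comp imCLM).analyticAt z
  have h2 : AnalyticAt ℂ (fun w : ℂ => w ^ s) (z.im : ℂ) :=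
    analyticAt_id.cpow analyticAt_const (ofReal_mem_slitPlane.2 hz)
  exact AnalyticAt.fun_comp (g := fun w : ℂ => w ^ s) h2.restrictScalars h1

theorem hasFDerivAt_im_cpow (s : ℂ) {z : ℂ} (hz : z ∈ UH) :
    HasFDerivAt (fun z : ℂ => (z.im : ℂ) ^ s)
      ((s * (z.im : ℂ) ^ (s - 1)) • (ofRealCLM.comp imCLM : ℂ →L[ℝ] ℂ)) z := by
  have h1 : HasFDerivAt (fun z : ℂ => (z.im : ℂ)) (ofRealCLM.comp imCLM : ℂ →L[ℝ] ℂ) z :=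
    (ofRealCLM.comp imCLM).hasFDerivAt
  have h2 : HasDerivAt (fun w : ℂ => w ^ s) (s * (z.im : ℂ) ^ (s - 1)) (z.im : ℂ) := by
    have := (hasDerivAt_id ((z.im : ℂ))).cpow_const (c := s) (ofReal_mem_slitPlane.2 hz)
    simpa using this
  exact h2.comp_hasFDerivAt z h1

theorem pdx_im_cpow_mul (s : ℂ) {v : ℂ → ℂ} (hv : AnalyticOnNhd ℝ v UH) {z : ℂ} (hz : z ∈ UH) :
    pdx (fun z => (z.im : ℂ) ^ s * v z) z = (z.im : ℂ) ^ s * pdx v z := by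
  have h1 := (hasFDerivAt_im_cpow s hz).mul (hv z hz).differentiableAt.hasFDerivAt
  rw [pdx_of_hasFDerivAt (f := fun z => (z.im : ℂ) ^ s * v z) h1,
    pdx_eq_fderiv (hv z hz).differentiableAt]
  simp

theorem pdy_im_cpow_mul (s : ℂ) {v : ℂ → ℂ} (hv : AnalyticOnNhd ℝ v UH) {z : ℂ} (hz : z ∈ UH) :
    pdy (fun z => (z.im : ℂ) ^ s * v z) z =
      (z.im : ℂ) ^ s * pdy v z + s * ((z.im : ℂ) ^ (s - 1) * v z) := by
  have h1 := (hasFDerivAt_im_cpow s hz).mul (hv z hz).differentiableAt.hasFDerivAt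
  rw [pdy_of_hasFDerivAt (f := fun z => (z.im : ℂ) ^ s * v z) h1,
    pdy_eq_fderiv (hv z hz).differentiableAt]
  simp
  ring

theorem isEigen_im_cpow_mul (s : ℂ) {v : ℂ → ℂ} (hv : AnalyticOnNhd ℝ v UH)
    (he : ∀ z ∈ UH, (z.im : ℂ) * (pdx (pdx v) z + pdy (pdy v) z) + 2 * s * pdy v z = 0) :
    IsEigen (s * (1 - s)) (fun z => (z.im : ℂ) ^ s * v z) := by
  refine ⟨(analyticOnNhd_im_cpow s).mul hv, fun z hz => ?_⟩
  have hy : (z.im : ℂ) ≠ 0 := by exact_mod_cast (ne_of_gt hz)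
  rw [pdx_congr hz fun w hw => pdx_im_cpow_mul s hv hw,
    pdx_im_cpow_mul s (analyticOnNhd_pdx hv) hz,
    pdy_congr hz fun w hw => pdy_im_cpow_mul s hv hw]
  have hA := (analyticOnNhd_im_cpow s).mul (analyticOnNhd_pdy hv) z hz
  have hB := (analyticOnNhd_im_cpow (s - 1)).mul hv z hz
  have h1 : pdy (fun z => (z.im : ℂ) ^ s * pdy v z + s * ((z.im : ℂ) ^ (s - 1) * v z)) z =
      pdy (fun z => (z.im : ℂ) ^ s * pdy v z) z +
        s * pdy (fun z => (z.im : ℂ) ^ (s - 1) * v z) z := by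
    rw [pdy_eq_fderiv hA.differentiableAt, pdy_eq_fderiv hB.differentiableAt]
    exact pdy_of_hasFDerivAt (hA.differentiableAt.hasFDerivAt.fun_add
      (hB.differentiableAt.hasFDerivAt.const_mul s))
  rw [h1, pdy_im_cpow_mul s (analyticOnNhd_pdy hv) hz, pdy_im_cpow_mul (s - 1) hv hz]
  have e1 : (z.im : ℂ) ^ s = (z.im : ℂ) ^ (s - 1 - 1) * z.im ^ 2 := by
    rw [← cpow_ofNat, ← cpow_add _ _ hy]; ring_nf
  have e2 : (z.im : ℂ) ^ (s - 1) = (z.im : ℂ) ^ (s - 1 - 1) * z.im := by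
    rw [cpow_sub (s - 1) 1 hy, cpow_one, div_mul_cancel₀ _ hy]
  have e3 : s * (1 - s) / (z.im : ℂ) ^ 2 * ((z.im : ℂ) ^ s * v z) =
      s * (1 - s) * ((z.im : ℂ) ^ (s - 1 - 1) * v z) := by
    rw [e1]; field_simp
  rw [e3, e1, e2]
  linear_combination (z.im : ℂ) ^ (s - 1 - 1) * (z.im : ℂ) * he z hz

theorem isEigen_besselWave {s : ℂ} (hs : 0 < s.re) {h : ℂ → ℂ} (hh : StripDecay h) {κ : ℂ}
    (hκ : κ = I ∨ κ = -I) : IsEigen (s * (1 - s)) (besselWave s κ h) := by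
  have hw := expWeight_bessel hs
  refine isEigen_im_cpow_mul s (analyticOnNhd_weightInt hw hh hκ) fun z hz => ?_
  have hy : z.im ≠ 0 := ne_of_gt hz
  have hκ2 : κ * κ = -1 := by rcases hκ with rfl | rfl <;> simp
  rw [pdx_congr hz fun w hw' => pdx_weightInt hw hh hκ hw', pdx_weightInt hw hh.deriv hκ hz,
    pdy_congr hz fun w hw' => pdy_weightInt hw hh hκ hw',
    pdy_weightInt (hw.mul_id κ) hh.deriv hκ hz, pdy_weightInt hw hh hκ hz]
  have h0 := bessel_ode hs hh.deriv hκ z.re hz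
  have i1 := integrableOn_weightInt hw hh.deriv.deriv hκ z.re hy
  have i2 := integrableOn_weightInt ((hw.mul_id κ).mul_id κ) hh.deriv.deriv hκ z.re hy
  have i3 := integrableOn_weightInt (hw.mul_id κ) hh.deriv hκ z.re hy
  have i4 : Integrable (fun r : ℝ => (z.im : ℂ) *
      (besselWeight s r * deriv (deriv h) (z.re + κ * z.im * r) +
        κ * r * (κ * r * besselWeight s r) * deriv (deriv h) (z.re + κ * z.im * r)))
      (volume.restrict (Ioi 1)) := (i1.add i2).const_mul (z.im : ℂ)
  simp only [weightInt]
  rw [← integral_add i1 i2, ← integral_const_mul, ← integral_const_mul,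
    ← integral_add i4 (i3.const_mul _)]
  rw [← mul_zero κ, ← h0, ← integral_const_mul]
  refine setIntegral_congr_fun measurableSet_Ioi fun r hr => ?_
  have hp : ((r ^ 2 - 1 : ℝ) : ℂ) ≠ 0 := by exact_mod_cast (sq_sub_one_pos hr).ne'
  have h1 : ((r ^ 2 - 1 : ℝ) : ℂ) ^ s = (r ^ 2 - 1) * besselWeight s r := by
    rw [besselWeight, cpow_sub _ _ hp, cpow_one]
    push_cast at hp ⊢
    field_simp
  simp only [h1]
  linear_combination (z.im * besselWeight s r * deriv (deriv h) (z.re + κ * z.im * r)) * hκ2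

theorem cuspDecay_besselWave {s : ℂ} (hs : 0 < s.re) {h : ℂ → ℂ} (hh : StripDecay h) {κ : ℂ}
    (hκ : κ = I ∨ κ = -I) : ∃ K, ∃ c > 0, ∀ z : ℂ, 1 ≤ z.im →
      ‖besselWave s κ h z‖ ≤ K * z.im ^ s.re * Real.exp (-(c * z.im)) := by
  obtain ⟨K, c, hc, hK⟩ := norm_weightInt_le (expWeight_bessel hs) hh hκ
  refine ⟨K, c, hc, fun z hz => ?_⟩
  rw [besselWave, norm_mul, norm_cpow_eq_rpow_re_of_pos (by linarith)]
  calc _ ≤ z.im ^ s.re * (K * Real.exp (-(c * z.im))) := by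
        gcongr
        exact hK z hz
    _ = _ := by ring

end Period

namespace Period

open Set Filter Topology Metric
open scoped Real

/-- The kernel `y (τ² - y²)^(s-1) (ζ² + y²)^(-s-1)`. -/
def betaKernel (s : ℂ) (ζ τ y : ℝ) : ℂ :=
  y * ((τ ^ 2 - y ^ 2 : ℝ) : ℂ) ^ (s - 1) * ((ζ ^ 2 + y ^ 2 : ℝ) : ℂ) ^ (-(s + 1))

theorem sq_sub_sq_pos {y τ : ℝ} (hy : 0 ≤ y) (h : y < τ) : 0 < τ ^ 2 - y ^ 2 := by nlinarith

theorem norm_betaKernel (s : ℂ) {ζ τ y : ℝ} (hζ : 0 < ζ) (hy : 0 < y) (h : y < τ) :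
    (‖betaKernel s ζ τ y‖ : ℂ) = betaKernel s.re ζ τ y := by
  have h1 := sq_sub_sq_pos hy.le h
  rw [betaKernel, betaKernel, norm_mul, norm_mul, norm_cpow_eq_rpow_re_of_pos h1,
    norm_cpow_eq_rpow_re_of_pos (by positivity), norm_real, Real.norm_of_nonneg hy.le]
  push_cast [ofReal_cpow h1.le, ofReal_cpow (show 0 ≤ ζ ^ 2 + y ^ 2 by positivity)]
  simp

theorem hasDerivAt_betaKernel {s : ℂ} (hs : 0 < s.re) {ζ τ y : ℝ} (hζ : 0 < ζ) (hy : 0 < y)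
    (h : y < τ) :
    HasDerivAt (fun y : ℝ => -(((τ ^ 2 - y ^ 2) / (ζ ^ 2 + y ^ 2) : ℝ) : ℂ) ^ s /
      (2 * s * (τ ^ 2 + ζ ^ 2))) (betaKernel s ζ τ y) y := by
  have hp := sq_sub_sq_pos hy.le h
  have hq : 0 < ζ ^ 2 + y ^ 2 := by positivity
  have hτ : 0 < τ := hy.trans h
  have hs0 : s ≠ 0 := fun h => by simp [h] at hs
  have h1 : HasDerivAt (fun y : ℝ => (τ ^ 2 - y ^ 2) / (ζ ^ 2 + y ^ 2))
      (-(2 * y * (τ ^ 2 + ζ ^ 2)) / (ζ ^ 2 + y ^ 2) ^ 2) y := by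
    refine (((hasDerivAt_pow 2 y).const_sub (τ ^ 2)).fun_div
      ((hasDerivAt_pow 2 y).const_add (ζ ^ 2)) hq.ne').congr_deriv ?_
    push_cast
    ring
  have h2 := (((hasDerivAt_id ((((τ ^ 2 - y ^ 2) / (ζ ^ 2 + y ^ 2) : ℝ) : ℂ))).cpow_const
    (c := s) (ofReal_mem_slitPlane.2 (div_pos hp hq))).scomp y h1.ofReal_comp).neg.div_const
      (2 * s * (τ ^ 2 + ζ ^ 2))
  refine h2.congr_deriv ?_
  have hτζ : (τ : ℂ) ^ 2 + ζ ^ 2 ≠ 0 := by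
    have : (τ ^ 2 + ζ ^ 2 : ℝ) ≠ 0 := by positivity
    exact_mod_cast this
  have hqC : ((ζ ^ 2 + y ^ 2 : ℝ) : ℂ) ≠ 0 := by exact_mod_cast hq.ne'
  have h3 : ((ζ ^ 2 + y ^ 2 : ℝ) : ℂ) ^ (-(s + 1)) =
      ((ζ ^ 2 + y ^ 2 : ℝ) : ℂ) ^ (-(s - 1)) * (((ζ ^ 2 + y ^ 2 : ℝ) : ℂ) ^ 2)⁻¹ := by
    rw [show -(s + 1) = -(s - 1) - 2 by ring, cpow_sub _ _ hqC, div_eq_mul_inv]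
    norm_cast
  rw [betaKernel, h3, div_eq_mul_inv (τ ^ 2 - y ^ 2), ofReal_mul,
    id_eq, mul_cpow_ofReal_nonneg hp.le (inv_nonneg.2 hq.le), ofReal_inv,
    inv_cpow _ _ (by rw [arg_ofReal_of_nonneg hq.le]; exact Real.pi_pos.ne), ← cpow_neg]
  simp only [smul_eq_mul]
  push_cast at hqC ⊢
  field_simp

theorem continuousOn_betaKernel_primitive {s : ℂ} (hs : 0 < s.re) {ζ τ : ℝ} (hζ : 0 < ζ) :
    ContinuousOn (fun y : ℝ => -(((τ ^ 2 - y ^ 2) / (ζ ^ 2 + y ^ 2) : ℝ) : ℂ) ^ s /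
      (2 * s * (τ ^ 2 + ζ ^ 2))) (Icc 0 τ) := by
  intro y _
  have hq : ζ ^ 2 + y ^ 2 ≠ 0 := by positivity
  have h1 : ContinuousAt (fun y : ℝ => (((τ ^ 2 - y ^ 2) / (ζ ^ 2 + y ^ 2) : ℝ) : ℂ) ^ s) y :=
    (continuousAt_ofReal_cpow_const _ s (Or.inl hs)).comp
      (f := fun y : ℝ => (τ ^ 2 - y ^ 2) / (ζ ^ 2 + y ^ 2)) (by fun_prop (disch := assumption))
  exact (h1.neg.div_const _).continuousWithinAt

theorem measurable_betaKernel (s : ℂ) (ζ : ℝ) :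
    Measurable fun p : ℝ × ℝ => betaKernel s ζ p.2 p.1 := by
  unfold betaKernel
  fun_prop

theorem integrableOn_betaKernel {s : ℂ} (hs : 0 < s.re) {ζ τ : ℝ} (hζ : 0 < ζ) :
    IntegrableOn (betaKernel s ζ τ) (Ioc 0 τ) := by
  have hs' : 0 < (s.re : ℂ).re := hs
  have h1 : IntegrableOn (fun y => (betaKernel s.re ζ τ y).re) (Ioc 0 τ) := by
    refine intervalIntegral.integrableOn_deriv_of_nonneg
      (reCLM.continuous.comp_continuousOn (continuousOn_betaKernel_primitive hs' hζ))
      (fun y hy => reCLM.hasFDerivAt.comp_hasDerivAt y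
        (hasDerivAt_betaKernel hs' hζ hy.1 hy.2)) fun y hy => ?_
    rw [← norm_betaKernel s hζ hy.1 hy.2, ofReal_re]
    positivity
  rw [integrableOn_Ioc_iff_integrableOn_Ioo] at h1 ⊢
  refine h1.mono' ?_ ((ae_restrict_iff' measurableSet_Ioo).2
    (Eventually.of_forall fun y hy => ?_))
  · exact ((measurable_betaKernel s ζ).comp
      (measurable_id.prodMk measurable_const)).aestronglyMeasurable
  · rw [← norm_betaKernel s hζ hy.1 hy.2, ofReal_re]

theorem integral_betaKernel {s : ℂ} (hs : 0 < s.re) {ζ τ : ℝ} (hζ : 0 < ζ) (hτ : 0 < τ) :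
    ∫ y in Ioc 0 τ, betaKernel s ζ τ y =
      (ζ : ℂ) ^ (-(2 * s)) / (2 * s) * ((τ : ℂ) ^ (2 * s) / (τ ^ 2 + ζ ^ 2)) := by
  have hs0 : s ≠ 0 := fun h => by simp [h] at hs
  rw [← intervalIntegral.integral_of_le hτ.le,
    intervalIntegral.integral_eq_sub_of_hasDerivAt_of_le hτ.le
      (continuousOn_betaKernel_primitive hs hζ)
      (fun y hy => hasDerivAt_betaKernel hs hζ hy.1 hy.2)
      ((intervalIntegrable_iff_integrableOn_Ioc_of_le hτ.le).2 (integrableOn_betaKernel hs hζ))]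
  have h1 : (((τ ^ 2 - 0 ^ 2) / (ζ ^ 2 + 0 ^ 2) : ℝ) : ℂ) ^ s =
      (ζ : ℂ) ^ (-(2 * s)) * (τ : ℂ) ^ (2 * s) := by
    have h2 : ∀ x : ℝ, 0 < x → ((x ^ 2 : ℝ) : ℂ) ^ s = (x : ℂ) ^ (2 * s) := fun x hx => by
      rw [cpow_def_of_ne_zero (by exact_mod_cast (by positivity : x ^ 2 ≠ 0)),
        cpow_def_of_ne_zero (by exact_mod_cast hx.ne'), ← ofReal_log (by positivity),
        ← ofReal_log hx.le, Real.log_pow]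
      push_cast
      ring_nf
    rw [show (τ ^ 2 - 0 ^ 2) / (ζ ^ 2 + 0 ^ 2) = τ ^ 2 * (ζ ^ 2)⁻¹ by field_simp; ring,
      ofReal_mul, mul_cpow_ofReal_nonneg (by positivity) (by positivity), h2 τ hτ, ofReal_inv,
      inv_cpow _ _ (by rw [arg_ofReal_of_nonneg (by positivity)]; exact Real.pi_pos.ne), h2 ζ hζ,
      cpow_neg, mul_comm]
  have hτζ : (τ : ℂ) ^ 2 + ζ ^ 2 ≠ 0 := by
    have : (τ ^ 2 + ζ ^ 2 : ℝ) ≠ 0 := by positivity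
    exact_mod_cast this
  rw [h1]
  simp only [sub_self, zero_div, ofReal_zero, zero_cpow hs0]
  field_simp
  ring

/-- The norm of the kernel integrates to the same expression at `Re s`. -/
theorem integral_norm_betaKernel {s : ℂ} (hs : 0 < s.re) {ζ τ : ℝ} (hζ : 0 < ζ) (hτ : 0 < τ) :
    ∫ y in Ioc 0 τ, ‖betaKernel s ζ τ y‖ =
      ζ ^ (-(2 * s.re)) / (2 * s.re) * (τ ^ (2 * s.re) / (τ ^ 2 + ζ ^ 2)) := by
  have h1 := integral_betaKernel (s := (s.re : ℂ)) hs hζ hτ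
  have h2 : ∫ y in Ioc 0 τ, (‖betaKernel s ζ τ y‖ : ℂ) = ∫ y in Ioc 0 τ, betaKernel s.re ζ τ y := by
    rw [integral_Ioc_eq_integral_Ioo, integral_Ioc_eq_integral_Ioo]
    exact setIntegral_congr_fun measurableSet_Ioo fun y hy => norm_betaKernel s hζ hy.1 hy.2
  rw [← h2, integral_complex_ofReal] at h1
  have h3 : (ζ : ℂ) ^ (-(2 * (s.re : ℂ))) = ((ζ ^ (-(2 * s.re)) : ℝ) : ℂ) := by
    rw [ofReal_cpow hζ.le]; simp
  have h4 : (τ : ℂ) ^ (2 * (s.re : ℂ)) = ((τ ^ (2 * s.re) : ℝ) : ℂ) := by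
    rw [ofReal_cpow hτ.le]; simp
  rw [h3, h4] at h1
  exact_mod_cast h1

theorem bessel_inner_eq (s : ℂ) (ζ : ℝ) (G : ℝ → ℂ) {y : ℝ} (hy : 0 < y) :
    (y : ℂ) ^ (2 * s) * ((ζ ^ 2 + y ^ 2 : ℝ) : ℂ) ^ (-(s + 1)) *
      ∫ r in Ioi (1 : ℝ), G (y * r) * besselWeight s r =
    ∫ τ in Ioi (0 : ℝ), (if y < τ then betaKernel s ζ τ y else 0) * G τ := by
  have hyC : (y : ℂ) ≠ 0 := by exact_mod_cast hy.ne'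
  have h1 := integral_comp_mul_left_Ioi
    (fun τ => G τ * ((τ ^ 2 / y ^ 2 - 1 : ℝ) : ℂ) ^ (s - 1)) 1 hy
  have h2 : ∫ r in Ioi (1 : ℝ), G (y * r) * besselWeight s r =
      ∫ r in Ioi (1 : ℝ), G (y * r) * (((y * r) ^ 2 / y ^ 2 - 1 : ℝ) : ℂ) ^ (s - 1) := by
    refine setIntegral_congr_fun measurableSet_Ioi fun r _ => ?_
    simp only [besselWeight]
    rw [show (y * r) ^ 2 / y ^ 2 - 1 = r ^ 2 - 1 by field_simp]
  rw [h2, h1, mul_one, real_smul, ← mul_assoc, ← integral_const_mul]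
  have h3 : Ioi y = {τ ∈ Ioi (0 : ℝ) | y < τ} := by
    ext τ
    simp only [mem_Ioi]
    exact ⟨fun h => ⟨hy.trans h, h⟩, fun h => h.2⟩
  rw [h3, ← integral_indicator (by rw [← h3]; exact measurableSet_Ioi),
    ← integral_indicator measurableSet_Ioi]
  congr 1 with τ
  by_cases hτ : y < τ
  · have hτ0 : 0 < τ := hy.trans hτ
    have hp := sq_sub_sq_pos hy.le hτ
    have hm : τ ∈ {τ ∈ Ioi (0 : ℝ) | y < τ} := ⟨hτ0, hτ⟩
    rw [indicator_of_mem hm, indicator_of_mem (mem_Ioi.2 hτ0), if_pos hτ]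
    have h4 : ((τ ^ 2 / y ^ 2 - 1 : ℝ) : ℂ) ^ (s - 1) =
        ((τ ^ 2 - y ^ 2 : ℝ) : ℂ) ^ (s - 1) * ((y : ℂ) ^ (2 * s) * (y : ℂ) ^ (-2 : ℂ))⁻¹ := by
      rw [show τ ^ 2 / y ^ 2 - 1 = (τ ^ 2 - y ^ 2) * (y⁻¹ * y⁻¹) by field_simp, ofReal_mul,
        mul_cpow_ofReal_nonneg hp.le (by positivity), ofReal_mul,
        mul_cpow_ofReal_nonneg (by positivity) (by positivity), ofReal_inv,
        inv_cpow _ _ (by rw [arg_ofReal_of_nonneg hy.le]; exact Real.pi_pos.ne),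
        ← mul_inv, ← cpow_add _ _ hyC, ← cpow_add _ _ hyC]
      ring_nf
    have h5 : (y : ℂ) ^ (-2 : ℂ) = ((y : ℂ) ^ 2)⁻¹ := by
      rw [cpow_neg]; norm_cast
    rw [h4, betaKernel, h5]
    have h6 : (y : ℂ) ^ (2 * s) ≠ 0 := by simp [cpow_eq_zero_iff, hyC]
    push_cast
    field_simp
  · simp [indicator, hτ]

theorem integrable_bessel_fubini {s : ℂ} (hs : 0 < s.re) {ζ : ℝ} (hζ : 0 < ζ) {G : ℝ → ℂ}
    (hG : ContinuousOn G (Ioi 0))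
    (hi : IntegrableOn (fun τ => ‖G τ‖ * (τ ^ (2 * s.re) / (τ ^ 2 + ζ ^ 2))) (Ioi 0)) :
    Integrable (fun p : ℝ × ℝ => (if p.1 < p.2 then betaKernel s ζ p.2 p.1 else 0) * G p.2)
      ((volume.restrict (Ioi 0)).prod (volume.restrict (Ioi 0))) ∧
    ∀ τ > 0, ∫ y in Ioi (0 : ℝ), (if y < τ then betaKernel s ζ τ y else 0) * G τ =
      (ζ : ℂ) ^ (-(2 * s)) / (2 * s) * (G τ * (τ : ℂ) ^ (2 * s) / (τ ^ 2 + ζ ^ 2)) := by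
  have hset : ∀ τ : ℝ, Ioi 0 ∩ {y | y < τ} = Ioo 0 τ := fun τ => by ext; simp
  have hkey : ∀ (τ : ℝ) (f : ℝ → ℂ), ∫ y in Ioi (0 : ℝ), (if y < τ then f y else 0) =
      ∫ y in Ioc 0 τ, f y := fun τ f => by
    rw [integral_Ioc_eq_integral_Ioo, ← hset,
      ← setIntegral_indicator (t := {y | y < τ}) measurableSet_Iio]
    rfl
  have hkeyR : ∀ (τ : ℝ) (f : ℝ → ℝ), ∫ y in Ioi (0 : ℝ), (if y < τ then f y else 0) =
      ∫ y in Ioc 0 τ, f y := fun τ f => by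
    rw [integral_Ioc_eq_integral_Ioo, ← hset,
      ← setIntegral_indicator (t := {y | y < τ}) measurableSet_Iio]
    rfl
  have hInt : ∀ τ > (0 : ℝ), IntegrableOn (fun y => if y < τ then betaKernel s ζ τ y else 0)
      (Ioi 0) := fun τ hτ => by
    have h1 := integrableOn_betaKernel hs hζ (τ := τ)
    rw [integrableOn_Ioc_iff_integrableOn_Ioo, ← hset] at h1
    rw [← integrable_indicator_iff measurableSet_Ioi]
    rw [← integrable_indicator_iff (by rw [hset]; exact measurableSet_Ioo)] at h1
    refine h1.congr (Eventually.of_forall fun y => ?_)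
    by_cases h0 : y ∈ Ioi (0 : ℝ) <;> by_cases h2 : y < τ <;> simp [indicator, h2] at h0 ⊢
  refine ⟨?_, fun τ hτ => ?_⟩
  · have hmeas : AEStronglyMeasurable
        (fun p : ℝ × ℝ => (if p.1 < p.2 then betaKernel s ζ p.2 p.1 else 0) * G p.2)
        ((volume.restrict (Ioi 0)).prod (volume.restrict (Ioi 0))) :=
      (Measurable.ite (measurableSet_lt measurable_fst measurable_snd)
        (measurable_betaKernel s ζ) measurable_const).aestronglyMeasurable.mul
        (hG.aestronglyMeasurable measurableSet_Ioi).comp_snd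
    refine (integrable_prod_iff' hmeas).2 ⟨?_, ?_⟩
    · refine (ae_restrict_iff' measurableSet_Ioi).2 (Eventually.of_forall fun τ hτ => ?_)
      exact Integrable.mul_const (hInt τ hτ) (G τ)
    · refine (IntegrableOn.congr_fun (hi.const_mul (ζ ^ (-(2 * s.re)) / (2 * s.re)))
        (fun τ hτ => ?_) measurableSet_Ioi)
      have h1 : ∀ y : ℝ, ‖(if y < τ then betaKernel s ζ τ y else 0) * G τ‖ =
          (if y < τ then ‖betaKernel s ζ τ y‖ else 0) * ‖G τ‖ := fun y => by
        split_ifs <;> simp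
      simp only [h1]
      rw [integral_mul_const, hkeyR, integral_norm_betaKernel hs hζ hτ]
      ring
  · rw [integral_mul_const, hkey, integral_betaKernel hs hζ hτ]
    ring

/-- The `K`-Bessel type integral has an elementary Stieltjes transform. -/
theorem stieltjes_bessel {s : ℂ} (hs : 0 < s.re) {ζ : ℝ} (hζ : 0 < ζ) {G : ℝ → ℂ}
    (hG : ContinuousOn G (Ioi 0))
    (hi : IntegrableOn (fun τ => ‖G τ‖ * (τ ^ (2 * s.re) / (τ ^ 2 + ζ ^ 2))) (Ioi 0)) :
    ∫ y in Ioi (0 : ℝ), (y : ℂ) ^ (2 * s) * ((ζ ^ 2 + y ^ 2 : ℝ) : ℂ) ^ (-(s + 1)) *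
        ∫ r in Ioi (1 : ℝ), G (y * r) * besselWeight s r =
      (ζ : ℂ) ^ (-(2 * s)) / (2 * s) *
        ∫ τ in Ioi (0 : ℝ), G τ * (τ : ℂ) ^ (2 * s) / (τ ^ 2 + ζ ^ 2) := by
  obtain ⟨h1, h2⟩ := integrable_bessel_fubini hs hζ hG hi
  rw [setIntegral_congr_fun measurableSet_Ioi fun y hy => bessel_inner_eq s ζ G hy,
    integral_integral_swap h1, ← integral_const_mul]
  exact setIntegral_congr_fun measurableSet_Ioi h2

end Period

namespace Period

open Set Filter Topology Metric
open scoped Real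

theorem integrableOn_rpow_mul_sq_sub_one {σ p : ℝ} (hσ : 0 < σ) (hp : 2 * σ - 1 < p) :
    IntegrableOn (fun r : ℝ => r ^ (-p) * (r ^ 2 - 1) ^ (σ - 1)) (Ioi 1) := by
  rw [← Ioc_union_Ioi_eq_Ioi one_le_two]
  refine IntegrableOn.union ?_ ?_
  · have h1 := ((expWeight_bessel (s := σ) hσ).integ 1 one_pos).mono_set
      (Ioc_subset_Ioi_self : Ioc (1 : ℝ) 2 ⊆ Ioi 1)
    rw [← integrableOn_Icc_iff_integrableOn_Ioc] at h1
    have h2 : ContinuousOn (fun r : ℝ => r ^ (-p) * Real.exp r) (Icc 1 2) := by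
      refine ContinuousOn.mul (ContinuousOn.rpow_const continuousOn_id fun r hr =>
        Or.inl (one_pos.trans_le hr.1).ne') (by fun_prop)
    have h3 := (h1.mul_continuousOn h2 isCompact_Icc).mono_set Ioc_subset_Icc_self
    refine IntegrableOn.congr_fun h3 (fun r hr => ?_) measurableSet_Ioc
    rw [norm_besselWeight _ hr.1, ofReal_re, one_mul, Real.exp_neg]
    field_simp
  · obtain ⟨C, hC⟩ := (isCompact_Icc (a := (3 / 4 : ℝ)) (b := 1)).exists_bound_of_continuousOn
      (f := fun t : ℝ => t ^ (σ - 1)) (ContinuousOn.rpow_const continuousOn_id fun r hr =>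
        Or.inl (LT.lt.trans_le (by norm_num) hr.1).ne')
    refine ((integrableOn_Ioi_rpow_of_lt (a := -p + 2 * (σ - 1)) (by linarith)
      (two_pos)).const_mul C).mono' ?_ ?_
    · refine ContinuousOn.aestronglyMeasurable ?_ measurableSet_Ioi
      intro r hr
      have hr2 : (2 : ℝ) < r := hr
      exact ((Real.continuousAt_rpow_const _ _ (Or.inl (by linarith))).mul
        ((by fun_prop : ContinuousAt (fun r : ℝ => r ^ 2 - 1) r).rpow_const
          (Or.inl (by nlinarith)))).continuousWithinAt
    · refine (ae_restrict_iff' measurableSet_Ioi).2 (Eventually.of_forall fun r hr => ?_)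
      have hr2 : (2 : ℝ) < r := hr
      have hr0 : 0 < r := by linarith
      have h1 : 0 < r ^ 2 - 1 := by nlinarith
      have h2 := hC ((r ^ 2 - 1) / r ^ 2) ⟨by rw [le_div_iff₀ (by positivity)]; nlinarith,
        by rw [div_le_one (by positivity)]; linarith⟩
      rw [Real.norm_of_nonneg (by positivity)] at h2 ⊢
      rw [show r ^ 2 - 1 = (r ^ 2 - 1) / r ^ 2 * r ^ 2 by field_simp,
        Real.mul_rpow (by positivity) (by positivity), Real.rpow_add hr0, Real.rpow_mul hr0.le,
        Real.rpow_two]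
      calc _ = ((r ^ 2 - 1) / r ^ 2) ^ (σ - 1) * (r ^ (-p) * (r ^ 2) ^ (σ - 1)) := by ring
        _ ≤ _ := by gcongr

/-- Holomorphic functions off the real line with the decay of a boundary function. -/
structure BoundaryDecay (s : ℂ) (g : ℂ → ℂ) : Prop where
  strip : StripDecay g
  bound : ∃ C ≥ 0, ∀ z : ℂ, z ≠ 0 → |z.re| ≤ |z.im| →
    ‖g z‖ ≤ C ∧ ‖g z‖ ≤ C * ‖z‖ ^ (-(2 * s.re))

theorem BoundaryDecay.interp {s : ℂ} {g : ℂ → ℂ} (h : BoundaryDecay s g) :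
    ∃ C ≥ 0, ∀ z : ℂ, z ≠ 0 → |z.re| ≤ |z.im| → ∀ β, 0 ≤ β → β ≤ 2 * s.re →
      ‖g z‖ ≤ C * ‖z‖ ^ (-β) := by
  obtain ⟨C, hC0, hC⟩ := h.bound
  refine ⟨C, hC0, fun z hz hzr β hβ hβ' => ?_⟩
  have hz0 : 0 < ‖z‖ := norm_pos_iff.2 hz
  rcases le_total ‖z‖ 1 with h1 | h1
  · refine (hC z hz hzr).1.trans (le_mul_of_one_le_right hC0 ?_)
    exact Real.one_le_rpow_of_pos_of_le_one_of_nonpos hz0 h1 (by linarith)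
  · refine (hC z hz hzr).2.trans ?_
    gcongr

theorem norm_kappa_mul {κ : ℂ} (hκ : κ = I ∨ κ = -I) {τ : ℝ} (hτ : 0 < τ) : ‖κ * τ‖ = τ := by
  rw [norm_mul, norm_kappa hκ, norm_real, Real.norm_of_nonneg hτ.le, one_mul]

theorem kappa_mul_cone {κ : ℂ} (hκ : κ = I ∨ κ = -I) {τ : ℝ} (hτ : 0 < τ) :
    κ * τ ≠ 0 ∧ |(κ * τ).re| ≤ |(κ * τ).im| := by
  refine ⟨norm_pos_iff.1 (by rwa [norm_kappa_mul hκ hτ]), ?_⟩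
  rcases hκ with rfl | rfl <;> simp

theorem BoundaryDecay.axis {s : ℂ} {g : ℂ → ℂ} (h : BoundaryDecay s g) {κ : ℂ}
    (hκ : κ = I ∨ κ = -I) {β : ℝ} (hβ : 0 ≤ β) (hβ' : β ≤ 2 * s.re) :
    ∃ C ≥ 0, ∀ τ : ℝ, 0 < τ → ‖g (κ * τ)‖ ≤ C * τ ^ (-β) ∧
      ‖deriv g (κ * τ)‖ ≤ C * τ ^ (-(1 + β)) := by
  obtain ⟨C, hC0, hC⟩ := h.interp
  refine ⟨max C (C * 2 ^ (1 + β)), le_max_of_le_left hC0, fun τ hτ => ⟨?_, ?_⟩⟩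
  · obtain ⟨h1, h2⟩ := kappa_mul_cone hκ hτ
    have h3 := hC _ h1 h2 β hβ hβ'
    rw [norm_kappa_mul hκ hτ] at h3
    exact h3.trans (by gcongr; exact le_max_left _ _)
  · have hcone : ∀ z ∈ closedBall (κ * τ) (τ / 2), τ / 2 ≤ |z.im| ∧ |z.re| ≤ τ / 2 := by
      intro z hz
      rw [mem_closedBall, dist_eq_norm] at hz
      have h1 := (abs_re_le_norm (z - κ * τ)).trans hz
      have h2 := (abs_im_le_norm (z - κ * τ)).trans hz
      rcases hκ with rfl | rfl
      · simp only [sub_re, mul_re, I_re, ofReal_re, zero_mul, I_im, ofReal_im, mul_zero, sub_self,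
          sub_zero, sub_im, mul_im, one_mul, zero_add] at h1 h2
        rw [abs_le] at h2
        exact ⟨le_abs.2 (Or.inl (by linarith)), h1⟩
      · simp only [sub_re, mul_re, neg_re, I_re, ofReal_re, neg_zero, zero_mul, neg_im, I_im,
          ofReal_im, mul_zero, sub_self, sub_zero, sub_im, mul_im, zero_add, neg_mul,
          one_mul] at h1 h2
        rw [abs_le] at h2
        exact ⟨le_abs.2 (Or.inr (by linarith)), h1⟩
    have h3 : ∀ z ∈ sphere (κ * (τ : ℂ)) (τ / 2), ‖g z‖ ≤ C * (τ / 2) ^ (-β) := by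
      intro z hz
      obtain ⟨h1, h2⟩ := hcone z (sphere_subset_closedBall hz)
      have h4 : τ / 2 ≤ ‖z‖ := h1.trans (abs_im_le_norm z)
      refine (hC z (norm_pos_iff.1 (by linarith)) (h2.trans h1) β hβ hβ').trans ?_
      gcongr C * ?_
      exact Real.rpow_le_rpow_of_nonpos (by positivity) h4 (by linarith)
    have h5 : DiffContOnCl ℂ g (ball (κ * (τ : ℂ)) (τ / 2)) := by
      refine DifferentiableOn.diffContOnCl (h.strip.diff.mono fun z hz => ?_)
      obtain ⟨h1, -⟩ := hcone z (closure_ball_subset_closedBall hz)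
      exact abs_pos.1 ((by positivity : 0 < τ / 2).trans_le h1)
    refine (norm_deriv_le_of_forall_mem_sphere_norm_le (by positivity) h5 h3).trans ?_
    have h6 : C * (τ / 2) ^ (-β) / (τ / 2) = C * 2 ^ (1 + β) * τ ^ (-(1 + β)) := by
      rw [mul_div_assoc, ← Real.rpow_sub_one (by positivity), Real.div_rpow hτ.le zero_le_two,
        show -(1 + β) = -β - 1 by ring, div_eq_mul_inv, ← Real.rpow_neg zero_le_two]
      ring_nf
    rw [h6]
    gcongr
    exact le_max_right _ _

/-- Bound near the cusp `0` for weighted ray integrals. -/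
theorem norm_bessel_axis_le {s : ℂ} (hs : 0 < s.re) {p C : ℝ} (hp : 2 * s.re - 1 < p)
    {f : ℝ → ℂ} (hf : ∀ τ > 0, ‖f τ‖ ≤ C * τ ^ (-p)) {y : ℝ} (hy : 0 < y) :
    ‖∫ r in Ioi (1 : ℝ), besselWeight s r * f (y * r)‖ ≤
      (C * ∫ r in Ioi (1 : ℝ), r ^ (-p) * (r ^ 2 - 1) ^ (s.re - 1)) * y ^ (-p) := by
  rw [mul_right_comm, ← integral_const_mul]
  refine norm_integral_le_of_norm_le ((integrableOn_rpow_mul_sq_sub_one hs hp).const_mul _) ?_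
  refine (ae_restrict_iff' measurableSet_Ioi).2 (Eventually.of_forall fun r hr => ?_)
  have hr1 : (1 : ℝ) < r := hr
  have hr0 : 0 < r := by linarith
  have h1 := sq_sub_one_pos hr1
  rw [norm_mul, norm_besselWeight s hr1]
  calc _ ≤ (r ^ 2 - 1) ^ (s.re - 1) * (C * (y * r) ^ (-p)) := by
        gcongr
        exact hf _ (by positivity)
    _ = _ := by rw [Real.mul_rpow hy.le hr0.le]; ring

theorem integrableOn_inv_sq_add_sq {ζ : ℝ} (hζ : 0 < ζ) :
    IntegrableOn (fun τ : ℝ => (τ ^ 2 + ζ ^ 2)⁻¹) (Ioi 0) ∧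
      ∫ τ in Ioi (0 : ℝ), (τ ^ 2 + ζ ^ 2)⁻¹ = π / (2 * ζ) := by
  have h1 : ∀ τ : ℝ, (τ ^ 2 + ζ ^ 2)⁻¹ = (ζ ^ 2)⁻¹ * (1 + (ζ⁻¹ * τ) ^ 2)⁻¹ := fun τ => by
    rw [← mul_inv]
    congr 1
    field_simp
    ring
  have h2 := integral_comp_mul_left_Ioi (fun x : ℝ => (1 + x ^ 2)⁻¹) 0 (inv_pos.2 hζ)
  have h3 := (integrableOn_Ioi_comp_mul_left_iff (fun x : ℝ => (1 + x ^ 2)⁻¹) 0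
    (inv_pos.2 hζ)).2 integrable_inv_one_add_sq.integrableOn
  simp only [h1]
  refine ⟨h3.const_mul _, ?_⟩
  rw [integral_const_mul, h2, mul_zero, integral_Ioi_inv_one_add_sq, Real.arctan_zero]
  simp only [inv_inv, smul_eq_mul, sub_zero]
  field_simp

/-- Functions on `(0, ∞)` of power growth at `0` and exponential decay at infinity. -/
structure CuspProfile (q : ℝ) (φ : ℝ → ℂ) : Prop where
  cont : ContinuousOn φ (Ioi 0)
  zero : ∃ C ≥ 0, ∀ y : ℝ, 0 < y → y ≤ 1 → ‖φ y‖ ≤ C * y ^ q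
  infty : ∃ K ≥ 0, ∃ c > 0, ∀ y : ℝ, 1 ≤ y → ‖φ y‖ ≤ K * Real.exp (-(c * y))

theorem exists_rpow_le_exp (r : ℝ) {c : ℝ} (hc : 0 < c) :
    ∃ K ≥ 0, ∀ y : ℝ, 1 ≤ y → y ^ r ≤ K * Real.exp (c * y) := by
  obtain ⟨T, hT⟩ := eventually_atTop.1
    ((tendsto_rpow_mul_exp_neg_mul_atTop_nhds_zero |r| _ hc).eventually (gt_mem_nhds one_pos))
  refine ⟨max 1 (|T| ^ |r|), by positivity, fun y hy => ?_⟩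
  have h2 : y ^ r ≤ y ^ |r| := Real.rpow_le_rpow_of_exponent_le hy (le_abs_self _)
  have h5 : 1 ≤ Real.exp (c * y) := Real.one_le_exp (by positivity)
  rcases le_total T y with h | h
  · have h3 := (hT y h).le
    rw [neg_mul, Real.exp_neg, ← div_eq_mul_inv, div_le_one (Real.exp_pos _)] at h3
    exact (h2.trans h3).trans (le_mul_of_one_le_left (Real.exp_pos _).le (le_max_left _ _))
  · have h3 : y ^ |r| ≤ |T| ^ |r| := by
      have := le_abs_self T
      gcongr
      linarith
    calc _ ≤ |T| ^ |r| * 1 := by rw [mul_one]; exact h2.trans h3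
      _ ≤ _ := by gcongr; exact le_max_right _ _

namespace CuspProfile

variable {q : ℝ} {φ : ℝ → ℂ}

theorem mul (h : CuspProfile q φ) {m : ℝ → ℂ} (hm : ContinuousOn m (Ioi 0)) {r : ℝ}
    (hb : ∃ C, ∀ y : ℝ, 0 < y → ‖m y‖ ≤ C * y ^ r) : CuspProfile (q + r) fun y => φ y * m y := by
  obtain ⟨C, hC0, hC⟩ := h.zero
  obtain ⟨K, hK0, c, hc, hK⟩ := h.infty
  obtain ⟨B, hB⟩ := hb
  have hB0 : 0 ≤ B := by simpa using (norm_nonneg _).trans (hB 1 one_pos)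
  obtain ⟨L, hL0, hL⟩ := exists_rpow_le_exp r (half_pos hc)
  refine ⟨h.cont.mul hm, ⟨C * B, by positivity, fun y hy hy1 => ?_⟩,
    ⟨K * B * L, by positivity, c / 2, half_pos hc, fun y hy => ?_⟩⟩
  · rw [norm_mul, Real.rpow_add hy]
    calc _ ≤ C * y ^ q * (B * y ^ r) := mul_le_mul (hC y hy hy1) (hB y hy) (norm_nonneg _)
          (by positivity)
      _ = _ := by ring
  · have hy0 : 0 < y := by linarith
    rw [norm_mul]
    calc _ ≤ K * Real.exp (-(c * y)) * (B * (L * Real.exp (c / 2 * y))) := by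
          refine mul_le_mul (hK y hy) ((hB y hy0).trans ?_) (norm_nonneg _) (by positivity)
          gcongr
          exact hL y hy
      _ = K * B * L * (Real.exp (-(c * y)) * Real.exp (c / 2 * y)) := by ring
      _ = _ := by rw [← Real.exp_add]; ring_nf

theorem integrableOn (h : CuspProfile q φ) (hq : -1 < q) : IntegrableOn φ (Ioi 0) := by
  obtain ⟨C, hC0, hC⟩ := h.zero
  obtain ⟨K, hK0, c, hc, hK⟩ := h.infty
  have hmeas := h.cont.aestronglyMeasurable (μ := volume) measurableSet_Ioi
  rw [← Ioc_union_Ioi_eq_Ioi zero_le_one]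
  refine IntegrableOn.union ?_ ?_
  · refine ((((intervalIntegrable_iff_integrableOn_Ioc_of_le zero_le_one).1
      (intervalIntegral.intervalIntegrable_rpow' hq)).const_mul C)).mono'
      (hmeas.mono_set Ioc_subset_Ioi_self) ?_
    exact (ae_restrict_iff' measurableSet_Ioc).2 (Eventually.of_forall fun y hy => hC y hy.1 hy.2)
  · refine ((integrableOn_exp_mul_Ioi (neg_lt_zero.2 hc) 1).const_mul K).mono'
      (hmeas.mono_set (Ioi_subset_Ioi zero_le_one)) ?_
    refine (ae_restrict_iff' measurableSet_Ioi).2 (Eventually.of_forall fun y hy => ?_)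
    simpa [neg_mul] using hK y (le_of_lt hy)

theorem tendsto_zero (h : CuspProfile q φ) (hq : 0 < q) : Tendsto φ (𝓝[>] 0) (𝓝 0) := by
  obtain ⟨C, hC0, hC⟩ := h.zero
  refine squeeze_zero_norm' (a := fun y => C * y ^ q) ?_ ?_
  · filter_upwards [Ioc_mem_nhdsGT one_pos] with y hy using hC y hy.1 hy.2
  · have h1 : Tendsto (fun y : ℝ => C * y ^ q) (𝓝 0) (𝓝 (C * 0 ^ q)) :=
      ((Real.continuousAt_rpow_const 0 q (Or.inr hq.le)).const_mul C :)
    rw [Real.zero_rpow hq.ne', mul_zero] at h1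
    exact h1.mono_left nhdsWithin_le_nhds

theorem tendsto_atTop (h : CuspProfile q φ) : Tendsto φ atTop (𝓝 0) := by
  obtain ⟨K, hK0, c, hc, hK⟩ := h.infty
  refine squeeze_zero_norm' (a := fun y => K * Real.exp (-(c * y))) ?_ ?_
  · filter_upwards [eventually_ge_atTop 1] with y hy using hK y hy
  · have h1 := (Real.tendsto_exp_neg_atTop_nhds_zero.comp
      (tendsto_id.const_mul_atTop hc)).const_mul K
    simpa using h1

end CuspProfile

end Period

namespace Period

open Set Filter Topology Metric
open scoped Real

theorem axis_mem_UH {y : ℝ} (hy : 0 < y) : (y : ℂ) * I ∈ UH := by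
  simpa using hy

theorem weightInt_axis (w : ℝ → ℂ) (κ : ℂ) (h : ℂ → ℂ) (y : ℝ) :
    weightInt w κ h (y * I) = ∫ r in Ioi (1 : ℝ), w r * h (κ * ((y * r : ℝ) : ℂ)) := by
  simp [weightInt, mul_assoc]

theorem ExpWeight.inv_mul {w : ℝ → ℂ} (hw : ExpWeight w) :
    ExpWeight fun r => (r : ℂ)⁻¹ * w r where
  meas := (by fun_prop : Measurable fun r : ℝ => (r : ℂ)⁻¹).aestronglyMeasurable.mul hw.meas
  integ ε hε := by
    refine (hw.integ ε hε).mono' ((((by fun_prop : Measurable fun r : ℝ =>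
      (r : ℂ)⁻¹).aestronglyMeasurable.mul hw.meas).norm).mul
        (Continuous.aestronglyMeasurable (by fun_prop))) ?_
    refine (ae_restrict_iff' measurableSet_Ioi).2 (Eventually.of_forall fun r hr => ?_)
    have hr1 : (1 : ℝ) < r := hr
    rw [Real.norm_of_nonneg (by positivity), norm_mul, norm_inv, norm_real,
      Real.norm_of_nonneg (by linarith)]
    have : r⁻¹ ≤ 1 := inv_le_one_of_one_le₀ hr1.le
    gcongr
    exact mul_le_of_le_one_left (norm_nonneg _) this

theorem CuspProfile.of_weightInt {w : ℝ → ℂ} (hw : ExpWeight w) {h : ℂ → ℂ} (hh : StripDecay h)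
    {κ : ℂ} (hκ : κ = I ∨ κ = -I) {q : ℝ}
    (hb : ∃ C, ∀ y : ℝ, 0 < y → ‖weightInt w κ h (y * I)‖ ≤ C * y ^ q) :
    CuspProfile q fun y => weightInt w κ h (y * I) := by
  obtain ⟨C, hC⟩ := hb
  obtain ⟨K, c, hc, hK⟩ := norm_weightInt_le hw hh hκ
  refine ⟨continuousOn_axis (analyticOnNhd_weightInt hw hh hκ),
    ⟨C, by simpa using (norm_nonneg _).trans (hC 1 one_pos), fun y hy _ => hC y hy⟩,
    ⟨K, ?_, c, hc, fun y hy => by simpa using hK (y * I) (by simpa using hy)⟩⟩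
  have h1 := (norm_nonneg _).trans (hK I (by simp))
  exact nonneg_of_mul_nonneg_left h1 (Real.exp_pos _)

section

variable {s : ℂ} {g : ℂ → ℂ} {κ : ℂ}

theorem profile_bessel (hs : 0 < s.re) (hg : BoundaryDecay s g) (hκ : κ = I ∨ κ = -I) :
    CuspProfile (-(2 * s.re)) fun y => weightInt (besselWeight s) κ g (y * I) := by
  obtain ⟨C, hC0, hC⟩ := hg.axis hκ (β := 2 * s.re) (by positivity) le_rfl
  refine CuspProfile.of_weightInt (expWeight_bessel hs) hg.strip hκ
    ⟨C * ∫ r in Ioi (1 : ℝ), r ^ (-(2 * s.re)) * (r ^ 2 - 1) ^ (s.re - 1), fun y hy => ?_⟩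
  rw [weightInt_axis]
  exact norm_bessel_axis_le hs (p := 2 * s.re) (by linarith)
    (f := fun τ => g (κ * (τ : ℂ))) (fun τ hτ => (hC τ hτ).1) hy

theorem profile_bessel_deriv (hs : 0 < s.re) (hg : BoundaryDecay s g) (hκ : κ = I ∨ κ = -I) :
    CuspProfile (-(1 + max 0 (2 * s.re - 1)))
      fun y => weightInt (besselWeight s) κ (deriv g) (y * I) := by
  obtain ⟨C, hC0, hC⟩ := hg.axis hκ (β := max 0 (2 * s.re - 1)) (le_max_left _ _)
    (max_le (by positivity) (by linarith))
  refine CuspProfile.of_weightInt (expWeight_bessel hs) hg.strip.deriv hκ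
    ⟨C * ∫ r in Ioi (1 : ℝ), r ^ (-(1 + max 0 (2 * s.re - 1))) * (r ^ 2 - 1) ^ (s.re - 1),
      fun y hy => ?_⟩
  rw [weightInt_axis]
  have := le_max_right 0 (2 * s.re - 1)
  exact norm_bessel_axis_le hs (p := 1 + max 0 (2 * s.re - 1)) (by linarith)
    (f := fun τ => deriv g (κ * (τ : ℂ))) (fun τ hτ => (hC τ hτ).2) hy

theorem weightInt_inv_mul_eq (s : ℂ) (κ : ℂ) (g : ℂ → ℂ) {y : ℝ} (hy : 0 < y) :
    weightInt (fun r => (r : ℂ)⁻¹ * besselWeight s r) κ g (y * I) =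
      y * ∫ r in Ioi (1 : ℝ), besselWeight s r * (g (κ * ((y * r : ℝ) : ℂ)) / (y * r : ℝ)) := by
  rw [weightInt_axis, ← integral_const_mul]
  refine setIntegral_congr_fun measurableSet_Ioi fun r hr => ?_
  have hr : (r : ℂ) ≠ 0 := by exact_mod_cast (one_pos.trans hr).ne'
  have hy' : (y : ℂ) ≠ 0 := by exact_mod_cast hy.ne'
  push_cast
  field_simp

theorem profile_bessel_primitive (hs : 0 < s.re) (hg : BoundaryDecay s g)
    (hκ : κ = I ∨ κ = -I) :
    CuspProfile (-max 0 (2 * s.re - 1))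
      fun y => weightInt (fun r => (r : ℂ)⁻¹ * besselWeight s r) κ g (y * I) := by
  set β := max 0 (2 * s.re - 1) with hβ
  obtain ⟨C, hC0, hC⟩ := hg.axis hκ (β := β) (le_max_left _ _)
    (max_le (by positivity) (by linarith))
  have hβ1 : 2 * s.re - 1 ≤ β := le_max_right _ _
  refine CuspProfile.of_weightInt (expWeight_bessel hs).inv_mul hg.strip hκ
    ⟨C * ∫ r in Ioi (1 : ℝ), r ^ (-(1 + β)) * (r ^ 2 - 1) ^ (s.re - 1), fun y hy => ?_⟩
  rw [weightInt_inv_mul_eq s κ g hy, norm_mul, norm_real, Real.norm_of_nonneg hy.le]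
  have h1 := norm_bessel_axis_le hs (p := 1 + β) (C := C) (by linarith)
    (f := fun τ => g (κ * (τ : ℂ)) / τ) (fun τ hτ => by
      rw [norm_div, norm_real, Real.norm_of_nonneg hτ.le, div_le_iff₀ hτ, mul_assoc,
        show -(1 + β) = -β - 1 by ring, Real.rpow_sub_one hτ.ne', div_mul_cancel₀ _ hτ.ne']
      exact (hC τ hτ).1) hy
  calc _ ≤ y * _ := mul_le_mul_of_nonneg_left h1 hy.le
    _ = _ := by
      rw [show -(1 + β) = -β - 1 by ring, Real.rpow_sub_one hy.ne']
      field_simp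

theorem hasDerivAt_bessel_primitive (hs : 0 < s.re) (hg : BoundaryDecay s g)
    (hκ : κ = I ∨ κ = -I) {y : ℝ} (hy : 0 < y) :
    HasDerivAt (fun y : ℝ => weightInt (fun r => (r : ℂ)⁻¹ * besselWeight s r) κ g (y * I))
      (κ * weightInt (besselWeight s) κ (deriv g) (y * I)) y := by
  have hw := (expWeight_bessel hs).inv_mul
  have h0 := (analyticOnNhd_weightInt hw hg.strip hκ _ (axis_mem_UH hy)).differentiableAt
  have h1 := hasDerivAt_pdy (x := 0) (y := y) (by simpa using h0)
  simp only [ofReal_zero, zero_add] at h1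
  rw [pdy_weightInt hw hg.strip hκ (axis_mem_UH hy)] at h1
  refine h1.congr_deriv ?_
  rw [weightInt, weightInt, ← integral_const_mul]
  refine setIntegral_congr_fun measurableSet_Ioi fun r hr => ?_
  have hr : (r : ℂ) ≠ 0 := by exact_mod_cast (one_pos.trans hr).ne'
  field_simp

theorem norm_cpow_mul_cpow_le (a : ℂ) {b : ℂ} (hb : 0 ≤ b.re) {ζ : ℝ} (hζ : 0 < ζ) {y : ℝ}
    (hy : 0 < y) :
    ‖(y : ℂ) ^ a * ((ζ ^ 2 + y ^ 2 : ℝ) : ℂ) ^ (-b)‖ ≤ (ζ ^ 2) ^ (-b.re) * y ^ a.re := by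
  rw [norm_mul, norm_cpow_eq_rpow_re_of_pos hy, norm_cpow_eq_rpow_re_of_pos (by positivity),
    neg_re, mul_comm]
  gcongr ?_ * _
  exact Real.rpow_le_rpow_of_nonpos (by positivity) (by nlinarith) (by linarith)

theorem continuousOn_cpow_mul_cpow (a b : ℂ) (ζ : ℝ) :
    ContinuousOn (fun y : ℝ => (y : ℂ) ^ a * ((ζ ^ 2 + y ^ 2 : ℝ) : ℂ) ^ (-b)) (Ioi 0) := by
  intro y hy
  have hy0 : (0 : ℝ) < y := hy
  exact ((continuousAt_ofReal_cpow_const _ _ (Or.inr hy0.ne')).mul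
    ((continuousAt_ofReal_cpow_const _ _ (Or.inr (by positivity))).comp
      (f := fun y : ℝ => ζ ^ 2 + y ^ 2) (by fun_prop))).continuousWithinAt

theorem CuspProfile.mul_cpow {q : ℝ} {φ : ℝ → ℂ} (h : CuspProfile q φ) (a : ℂ) {b : ℂ}
    (hb : 0 ≤ b.re) {ζ : ℝ} (hζ : 0 < ζ) :
    CuspProfile (q + a.re)
      fun y => φ y * ((y : ℂ) ^ a * ((ζ ^ 2 + y ^ 2 : ℝ) : ℂ) ^ (-b)) :=
  h.mul (continuousOn_cpow_mul_cpow a b ζ) ⟨_, fun _ hy => norm_cpow_mul_cpow_le a hb hζ hy⟩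

theorem hasDerivAt_cpow_mul_cpow (s : ℂ) {ζ : ℝ} {y : ℝ} (hy : 0 < y) :
    HasDerivAt (fun y : ℝ => (y : ℂ) ^ (2 * s) * ((ζ ^ 2 + y ^ 2 : ℝ) : ℂ) ^ (-s))
      (2 * s * ζ ^ 2 * ((y : ℂ) ^ (2 * s - 1) * ((ζ ^ 2 + y ^ 2 : ℝ) : ℂ) ^ (-(s + 1)))) y := by
  have hq : 0 < ζ ^ 2 + y ^ 2 := by positivity
  have hyC : (y : ℂ) ≠ 0 := by exact_mod_cast hy.ne'
  have hqC : ((ζ ^ 2 + y ^ 2 : ℝ) : ℂ) ≠ 0 := by exact_mod_cast hq.ne'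
  have h1 := ((hasDerivAt_id (y : ℂ)).cpow_const (c := 2 * s)
    (ofReal_mem_slitPlane.2 hy)).comp_ofReal
  have h2 := ((hasDerivAt_id (((ζ ^ 2 + y ^ 2 : ℝ) : ℂ))).cpow_const (c := -s)
    (ofReal_mem_slitPlane.2 hq)).scomp y ((hasDerivAt_pow 2 y).const_add (ζ ^ 2)).ofReal_comp
  refine (h1.mul h2).congr_deriv ?_
  rw [show -(s + 1) = -s - 1 by ring, cpow_sub _ _ hyC, cpow_sub _ _ hqC, cpow_one, cpow_one]
  simp only [id_eq, smul_eq_mul, Function.comp]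
  rw [cpow_sub _ _ hqC, cpow_one, cpow_sub _ _ hyC, cpow_one]
  push_cast at hqC ⊢
  field_simp
  ring

theorem pdx_besselWave_axis (hs : 0 < s.re) (hg : BoundaryDecay s g) (hκ : κ = I ∨ κ = -I)
    {y : ℝ} (hy : 0 < y) :
    pdx (besselWave s κ g) (y * I) =
      (y : ℂ) ^ s * weightInt (besselWeight s) κ (deriv g) (y * I) := by
  have h1 := pdx_im_cpow_mul s (analyticOnNhd_weightInt (expWeight_bessel hs) hg.strip hκ)
    (axis_mem_UH hy)
  rw [pdx_weightInt (expWeight_bessel hs) hg.strip hκ (axis_mem_UH hy)] at h1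
  simp only [mul_I_im, ofReal_re] at h1
  exact h1

theorem continuousOn_axis_ray (hg : BoundaryDecay s g) (hκ : κ = I ∨ κ = -I) :
    ContinuousOn (fun τ : ℝ => g (κ * τ)) (Ioi 0) := by
  refine hg.strip.diff.continuousOn.comp (by fun_prop) fun τ hτ => ?_
  have hτ0 : τ ≠ 0 := ne_of_gt hτ
  rcases hκ with rfl | rfl <;> simpa using hτ0

theorem profile_ray (hs : 0 < s.re) (hg : BoundaryDecay s g) (hκ : κ = I ∨ κ = -I) :
    CuspProfile 0 fun τ => g (κ * τ) := by
  obtain ⟨C, hC0, hC⟩ := hg.axis hκ (β := 0) le_rfl (by positivity)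
  obtain ⟨c, hc, hK⟩ := hg.strip.decay
  obtain ⟨K, hK⟩ := hK 1 one_pos
  have him : ∀ τ : ℝ, 1 ≤ τ → |(κ * τ).im| = τ := fun τ hτ => by
    rcases hκ with rfl | rfl <;> simp [abs_of_pos (one_pos.trans_le hτ)]
  have hK' : ∀ τ : ℝ, 1 ≤ τ → ‖g (κ * τ)‖ ≤ K * Real.exp (-(c * τ)) := fun τ hτ => by
    have := hK (κ * τ) (by rw [him τ hτ]; exact hτ)
    rwa [him τ hτ] at this
  refine ⟨continuousOn_axis_ray hg hκ, ⟨C, hC0, fun y hy _ => by simpa using (hC y hy).1⟩,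
    ⟨K, ?_, c, hc, hK'⟩⟩
  exact nonneg_of_mul_nonneg_left ((norm_nonneg _).trans (hK' 1 le_rfl)) (Real.exp_pos _)

theorem integrableOn_ray_div (hs : 0 < s.re) (hg : BoundaryDecay s g) (hκ : κ = I ∨ κ = -I)
    {ζ : ℝ} (hζ : 0 < ζ) :
    IntegrableOn (fun τ : ℝ => g (κ * τ) * (τ : ℂ) ^ (2 * s) / (τ ^ 2 + ζ ^ 2)) (Ioi 0) ∧
    IntegrableOn (fun τ : ℝ => g (κ * τ) / τ * (τ : ℂ) ^ (2 * s) / (τ ^ 2 + ζ ^ 2))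
      (Ioi 0) := by
  have h0 := profile_ray hs hg hκ
  constructor
  · refine ((h0.mul_cpow (2 * s) (b := 1) (by simp) hζ).integrableOn (by
      simp only [mul_re, re_ofNat, im_ofNat, zero_mul, sub_zero]; linarith)).congr_fun
      (fun τ _ => ?_) measurableSet_Ioi
    beta_reduce
    rw [cpow_neg_one]
    push_cast
    rw [add_comm ((ζ : ℂ) ^ 2)]
    ring
  · refine ((h0.mul_cpow (2 * s - 1) (b := 1) (by simp) hζ).integrableOn (by
      simp only [sub_re, one_re, mul_re, re_ofNat, im_ofNat, zero_mul, sub_zero];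
      linarith)).congr_fun (fun τ hτ => ?_) measurableSet_Ioi
    have hτC : (τ : ℂ) ≠ 0 := by exact_mod_cast (ne_of_gt hτ)
    simp only
    rw [cpow_neg_one, cpow_sub _ _ hτC, cpow_one]
    push_cast
    rw [add_comm ((ζ : ℂ) ^ 2)]
    ring

theorem integrableOn_norm_div {G : ℝ → ℂ} {ζ : ℝ} (s : ℂ)
    (h : IntegrableOn (fun τ : ℝ => G τ * (τ : ℂ) ^ (2 * s) / (τ ^ 2 + ζ ^ 2)) (Ioi 0)) :
    IntegrableOn (fun τ : ℝ => ‖G τ‖ * (τ ^ (2 * s.re) / (τ ^ 2 + ζ ^ 2))) (Ioi 0) := by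
  refine IntegrableOn.congr_fun h.norm (fun τ hτ => ?_) measurableSet_Ioi
  have h1 : ((τ : ℂ) ^ 2 + ζ ^ 2) = ((τ ^ 2 + ζ ^ 2 : ℝ) : ℂ) := by push_cast; rfl
  rw [norm_div, norm_mul, norm_cpow_eq_rpow_re_of_pos hτ, h1, norm_real,
    Real.norm_of_nonneg (by positivity)]
  simp [mul_div_assoc]

theorem stieltjes_besselWave (hs : 0 < s.re) (hg : BoundaryDecay s g) (hκ : κ = I ∨ κ = -I)
    {ζ : ℝ} (hζ : 0 < ζ) :
    stieltjes (s + 1) s (fun y => besselWave s κ g (y * I)) ζ =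
      (ζ : ℂ) ^ (-(2 * s)) / (2 * s) *
        ∫ τ in Ioi (0 : ℝ), g (κ * τ) * (τ : ℂ) ^ (2 * s) / (τ ^ 2 + ζ ^ 2) := by
  rw [← stieltjes_bessel hs hζ (continuousOn_axis_ray hg hκ) 
    (integrableOn_norm_div s (integrableOn_ray_div hs hg hκ hζ).1),
    stieltjes]
  refine setIntegral_congr_fun measurableSet_Ioi fun y hy => ?_
  have hyC : (y : ℂ) ≠ 0 := by exact_mod_cast (ne_of_gt hy)
  simp only [besselWave, weightInt_axis]
  rw [two_mul, cpow_add _ _ hyC]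
  simp only [mul_comm (g _)]
  simp
  ring

theorem stieltjes_pdx_besselWave (hs : 0 < s.re) (hg : BoundaryDecay s g)
    (hκ : κ = I ∨ κ = -I) {ζ : ℝ} (hζ : 0 < ζ) :
    stieltjes s s (fun y => pdx (besselWave s κ g) (y * I)) ζ =
      κ * (ζ ^ 2 * (ζ : ℂ) ^ (-(2 * s))) *
        ∫ τ in Ioi (0 : ℝ), g (κ * τ) / τ * (τ : ℂ) ^ (2 * s) / (τ ^ 2 + ζ ^ 2) := by
  have hs0 : s ≠ 0 := fun h => by simp [h] at hs
  have hκ2 : κ * κ = -1 := by rcases hκ with rfl | rfl <;> simp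
  set β := max 0 (2 * s.re - 1) with hβ
  have hβ' : β < 2 * s.re := max_lt (by positivity) (by linarith)
  have hM := profile_bessel_primitive hs hg hκ
  have hM' := profile_bessel_deriv hs hg hκ
  have hibp := integral_Ioi_mul_deriv_eq_deriv_mul (a := (0 : ℝ)) (a' := (0 : ℂ)) (b' := (0 : ℂ))
    (u := fun y : ℝ => (y : ℂ) ^ (2 * s) * ((ζ ^ 2 + y ^ 2 : ℝ) : ℂ) ^ (-s))
    (fun y hy => hasDerivAt_cpow_mul_cpow s (ζ := ζ) hy)
    (fun y hy => hasDerivAt_bessel_primitive hs hg hκ hy) ?_ ?_ ?_ ?_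
  · have hF := stieltjes_bessel hs hζ (G := fun τ => g (κ * τ) / τ)
      ((continuousOn_axis_ray hg hκ).div (by fun_prop) fun τ hτ => by
        exact_mod_cast (ne_of_gt hτ)) (integrableOn_norm_div s (integrableOn_ray_div hs hg hκ hζ).2)
    have h1 : ∫ y in Ioi (0 : ℝ), 2 * s * (ζ : ℂ) ^ 2 * ((y : ℂ) ^ (2 * s - 1) *
        ((ζ ^ 2 + y ^ 2 : ℝ) : ℂ) ^ (-(s + 1))) *
        weightInt (fun r => (r : ℂ)⁻¹ * besselWeight s r) κ g (y * I) =
        ζ ^ 2 * (ζ : ℂ) ^ (-(2 * s)) *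
        ∫ τ in Ioi (0 : ℝ), g (κ * τ) / τ * (τ : ℂ) ^ (2 * s) / (τ ^ 2 + ζ ^ 2) := by
      rw [show (ζ : ℂ) ^ 2 * (ζ : ℂ) ^ (-(2 * s)) =
        (2 * s * ζ ^ 2) * ((ζ : ℂ) ^ (-(2 * s)) /
          (2 * s)) by field_simp, mul_assoc (2 * s * (ζ : ℂ) ^ 2), ← hF,
        ← integral_const_mul]
      refine setIntegral_congr_fun measurableSet_Ioi fun y hy => ?_
      have hyC : (y : ℂ) ≠ 0 := by exact_mod_cast (ne_of_gt hy)
      rw [weightInt_inv_mul_eq s κ g hy, cpow_sub _ _ hyC, cpow_one]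
      simp only [mul_comm (besselWeight s _)]
      field_simp
    have h2 : ∫ y in Ioi (0 : ℝ), (y : ℂ) ^ (2 * s) * ((ζ ^ 2 + y ^ 2 : ℝ) : ℂ) ^ (-s) *
        (κ * weightInt (besselWeight s) κ (deriv g) (y * I)) =
        κ * stieltjes s s (fun y => pdx (besselWave s κ g) (y * I)) ζ := by
      rw [stieltjes, ← integral_const_mul]
      refine setIntegral_congr_fun measurableSet_Ioi fun y hy => ?_
      have hyC : (y : ℂ) ≠ 0 := by exact_mod_cast (ne_of_gt hy)
      rw [pdx_besselWave_axis hs hg hκ hy, two_mul, cpow_add _ _ hyC]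
      push_cast
      ring
    rw [h1, h2] at hibp
    linear_combination (-κ) * hibp + stieltjes s s (fun y => pdx (besselWave s κ g) (y * I)) ζ * hκ2
  · have h1 := (hM'.mul_cpow (2 * s) hs.le hζ).integrableOn (by
      simp only [mul_re, re_ofNat, im_ofNat, zero_mul, sub_zero]; linarith)
    refine (h1.const_mul κ).congr (Eventually.of_forall fun y => ?_)
    simp only [Pi.mul_apply]
    ring
  · have h1 := (hM.mul_cpow (2 * s - 1) (b := s + 1) (by simp; linarith) hζ).integrableOn (by
      simp only [sub_re, one_re, mul_re, re_ofNat, im_ofNat, zero_mul, sub_zero]; linarith)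
    refine (h1.const_mul (2 * s * ζ ^ 2)).congr (Eventually.of_forall fun y => ?_)
    simp only [Pi.mul_apply]
    ring
  · have h1 := (hM.mul_cpow (2 * s) hs.le hζ).tendsto_zero (by
      simp only [mul_re, re_ofNat, im_ofNat, zero_mul, sub_zero]; linarith)
    refine h1.congr fun y => ?_
    simp only [Pi.mul_apply]
    ring
  · have h1 := (hM.mul_cpow (2 * s) hs.le hζ).tendsto_atTop
    refine h1.congr fun y => ?_
    simp only [Pi.mul_apply]
    ring

end

end Period

namespace Period
open Set Filter Topology Metric
open scoped Real

theorem neg_I_mul_mem_slitPlane {κ : ℂ} (hκ : κ = I ∨ κ = -I) {τ : ℝ} (hτ : 0 < τ) :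
    κ * τ ∈ slitPlane := by
  refine Or.inr ?_
  rcases hκ with rfl | rfl <;> simp [hτ.ne']

theorem continuousOn_comp_axis {F : ℂ → ℂ} (hF : DifferentiableOn ℂ F slitPlane) {κ : ℂ}
    (hκ : κ = I ∨ κ = -I) : ContinuousOn (fun τ : ℝ => F (κ * τ)) (Ioi 0) :=
  hF.continuousOn.comp (by fun_prop) fun _ hτ => neg_I_mul_mem_slitPlane hκ hτ

theorem norm_axis {κ : ℂ} (hκ : κ = I ∨ κ = -I) {τ : ℝ} (hτ : 0 < τ) : ‖κ * τ‖ = τ := by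
  rw [norm_mul, norm_kappa hκ, one_mul, norm_real, Real.norm_of_nonneg hτ.le]

theorem re_axis {κ : ℂ} (hκ : κ = I ∨ κ = -I) (τ : ℝ) : (κ * τ).re = 0 := by
  rcases hκ with rfl | rfl <;> simp

/-- The sizes of a holomorphic function at the two ends of the closed right half plane that make
its integral along the imaginary axis converge. -/
structure AxisBound (F : ℂ → ℂ) (a b : ℝ) : Prop where
  pos_zero : 0 < a
  pos_infty : 0 < b
  diff : DifferentiableOn ℂ F slitPlane
  zero : ∃ r > 0, ∃ C, ∀ w : ℂ, w ≠ 0 → 0 ≤ w.re → ‖w‖ ≤ r → ‖F w‖ ≤ C * ‖w‖ ^ (a - 1)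
  infty : ∃ R C : ℝ, ∀ w : ℂ, w ≠ 0 → 0 ≤ w.re → R ≤ ‖w‖ → ‖F w‖ ≤ C * ‖w‖ ^ (-1 - b)

variable {F : ℂ → ℂ} {a b : ℝ}

theorem AxisBound.integrableOn (h : AxisBound F a b) {κ : ℂ} (hκ : κ = I ∨ κ = -I) :
    IntegrableOn (fun τ : ℝ => F (κ * τ)) (Ioi 0) := by
  obtain ⟨r, hr, C, hC⟩ := h.zero
  obtain ⟨R, D, hD⟩ := h.infty
  have hne : ∀ {τ : ℝ}, 0 < τ → κ * τ ≠ 0 := fun hτ =>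
    slitPlane_ne_zero (neg_I_mul_mem_slitPlane hκ hτ)
  have := mellinConvergent_of_isBigO_rpow (s := 1) (a := 1 + b) (b := 1 - a)
    ((continuousOn_comp_axis h.diff hκ).locallyIntegrableOn measurableSet_Ioi)
    (Asymptotics.IsBigO.of_bound D ?_) (by simpa using h.pos_infty)
    (Asymptotics.IsBigO.of_bound C ?_) (by simpa using h.pos_zero)
  · simpa [MellinConvergent] using this
  · filter_upwards [eventually_gt_atTop 0, eventually_ge_atTop R] with τ hτ hR
    have := hD (κ * τ) (hne hτ) (re_axis hκ τ).ge (by rwa [norm_axis hκ hτ])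
    rw [norm_axis hκ hτ] at this
    rwa [Real.norm_of_nonneg (by positivity), show -(1 + b) = -1 - b by ring]
  · filter_upwards [Ioo_mem_nhdsGT hr] with τ hτ
    have := hC (κ * τ) (hne hτ.1) (re_axis hκ τ).ge (by rw [norm_axis hκ hτ.1]; exact hτ.2.le)
    rw [norm_axis hκ hτ.1] at this
    have h0 := hτ.1
    rwa [Real.norm_of_nonneg (by positivity), show -(1 - a) = a - 1 by ring]

theorem integral_Ioi_comp_exp (f : ℝ → ℂ) :
    ∫ τ in Ioi (0 : ℝ), f τ = ∫ x : ℝ, Real.exp x * f (Real.exp x) := by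
  have := integral_image_eq_integral_abs_deriv_smul (s := univ) (f := Real.exp)
    (f' := Real.exp) MeasurableSet.univ
    (fun x _ => (Real.hasDerivAt_exp x).hasDerivWithinAt) Real.exp_injective.injOn f
  rw [image_univ, Real.range_exp, Measure.restrict_univ] at this
  rw [this]
  exact integral_congr_ae (Eventually.of_forall fun x => by
    simp [abs_of_pos (Real.exp_pos x)])

theorem integrable_comp_exp {f : ℝ → ℂ} (h : IntegrableOn f (Ioi 0)) :
    Integrable (fun x : ℝ => Real.exp x * f (Real.exp x)) := by
  have := integrableOn_image_iff_integrableOn_abs_deriv_smul (s := univ) (f := Real.exp)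
    (f' := Real.exp) MeasurableSet.univ
    (fun x _ => (Real.hasDerivAt_exp x).hasDerivWithinAt) Real.exp_injective.injOn f
  rw [image_univ, Real.range_exp, integrableOn_univ] at this
  exact (this.1 h).congr (Eventually.of_forall fun x => by
    simp [abs_of_pos (Real.exp_pos x)])

theorem exp_strip_mem_slitPlane {v : ℂ} (h : |v.im| ≤ π / 2) : exp v ∈ slitPlane := by
  have := abs_le.1 h
  refine mem_slitPlane_iff_arg.2 ⟨?_, exp_ne_zero v⟩
  rw [← log_im, log_exp (by linarith [Real.pi_pos]) (by linarith [Real.pi_pos])]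
  linarith [Real.pi_pos]

theorem exp_strip_re_nonneg {v : ℂ} (h : |v.im| ≤ π / 2) : 0 ≤ (exp v).re := by
  have := abs_le.1 h
  rw [exp_re]
  exact mul_nonneg (Real.exp_pos _).le
    (Real.cos_nonneg_of_mem_Icc ⟨by linarith, by linarith⟩)

theorem norm_exp_strip_le {C c x : ℝ} {v : ℂ} (hx : v.re = x)
    (hF : ‖F (exp v)‖ ≤ C * ‖exp v‖ ^ (c - 1)) : ‖F (exp v) * exp v‖ ≤ C * Real.exp (c * x) := by
  rw [norm_mul]
  have h0 : ‖exp v‖ = Real.exp x := by rw [norm_exp, hx]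
  rw [h0] at hF ⊢
  calc _ ≤ C * Real.exp x ^ (c - 1) * Real.exp x := by gcongr
    _ = C * Real.exp (c * x) := by
      rw [← Real.exp_mul, mul_assoc, ← Real.exp_add]; ring_nf

theorem AxisBound.integral_eq_zero (h : AxisBound F a b) :
    ∫ τ in Ioi (0 : ℝ), (F (I * τ) + F (-I * τ)) = 0 := by
  obtain ⟨r, hr, C, hC⟩ := h.zero
  obtain ⟨R, D, hD⟩ := h.infty
  have hi : IntegrableOn (fun τ : ℝ => F (I * τ) + F (-I * τ)) (Ioi 0) :=
    Integrable.add (h.integrableOn (Or.inl rfl)) (h.integrableOn (Or.inr rfl))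
  set G : ℂ → ℂ := fun v => F (exp v) * exp v with hG
  have hdiff : ∀ v : ℂ, |v.im| ≤ π / 2 → DifferentiableAt ℂ G v := fun v hv =>
    ((h.diff.differentiableAt (isOpen_slitPlane.mem_nhds (exp_strip_mem_slitPlane hv))).comp v
      differentiable_exp.differentiableAt).mul differentiable_exp.differentiableAt
  have hup : ∀ x : ℝ, G (x + (π / 2 : ℝ) * I) = I * (Real.exp x * F (I * Real.exp x)) := by
    intro x
    simp only [hG, exp_add]
    push_cast
    rw [exp_pi_div_two_mul_I, mul_comm (exp _) I]
    ring
  have hlow : ∀ x : ℝ, G (x + (-(π / 2) : ℝ) * I) =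
      -I * (Real.exp x * F (-I * Real.exp x)) := by
    intro x
    simp only [hG, exp_add]
    push_cast
    rw [show -((π : ℂ) / 2) * I = -(π / 2 * I) by ring, Complex.exp_neg, exp_pi_div_two_mul_I, inv_I,
      mul_comm (exp _) (-I)]
    ring
  have hrect : ∀ T : ℝ, I * ∫ x in (-T)..T,
      Real.exp x * (F (I * Real.exp x) + F (-I * Real.exp x)) =
      I * (∫ y in (-(π / 2))..(π / 2), G (T + y * I)) -
      I * ∫ y in (-(π / 2))..(π / 2), G ((-T : ℝ) + y * I) := by
    intro T
    have := integral_boundary_rect_eq_zero_of_differentiableOn G (⟨-T, -(π / 2)⟩) (⟨T, π / 2⟩)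
      fun v hv => (hdiff v ?_).differentiableWithinAt
    · simp only [smul_eq_mul] at this
      rw [sub_add_eq_add_sub, sub_sub] at this
      have hc : ∀ {κ : ℂ}, κ = I ∨ κ = -I → Continuous fun x : ℝ =>
        Real.exp x * F (κ * Real.exp x) :=
        fun hκ => (continuous_ofReal.comp Real.continuous_exp).mul
          ((continuousOn_comp_axis h.diff hκ).comp_continuous Real.continuous_exp Real.exp_pos)
      simp only [hup, hlow] at this
      rw [intervalIntegral.integral_const_mul, intervalIntegral.integral_const_mul] at this
      simp only [mul_add]
      rw [intervalIntegral.integral_add ((hc (Or.inl rfl)).intervalIntegrable _ _)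
        ((hc (Or.inr rfl)).intervalIntegrable _ _)]
      linear_combination -this
    · have := hv.2
      rw [mem_preimage, uIcc_of_le (by linarith [Real.pi_pos])] at this
      exact abs_le.2 this
  have hside : ∀ {x K : ℝ}, (∀ v : ℂ, v.re = x → |v.im| ≤ π / 2 → ‖G v‖ ≤ K) →
      ‖∫ y in (-(π / 2))..(π / 2), G (x + y * I)‖ ≤ K * π := by
    intro x K hK
    have := intervalIntegral.norm_integral_le_of_norm_le_const (a := -(π / 2)) (b := π / 2) (C := K)
      (f := fun y : ℝ => G (x + y * I)) fun y hy => hK _ (by simp) (by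
        rw [uIoc_of_le (by linarith [Real.pi_pos])] at hy
        simpa using abs_le.2 ⟨hy.1.le, hy.2⟩)
    rwa [show π / 2 - -(π / 2) = π by ring, abs_of_pos Real.pi_pos] at this
  have hright : Tendsto (fun T : ℝ => ∫ y in (-(π / 2))..(π / 2), G (T + y * I)) atTop (𝓝 0) := by
    refine squeeze_zero_norm' (a := fun T : ℝ => D * Real.exp (-b * T) * π) ?_ ?_
    · filter_upwards [eventually_ge_atTop R] with T hT
      refine hside fun v hv hv' => norm_exp_strip_le hv ?_
      have := hD (exp v) (exp_ne_zero v) (exp_strip_re_nonneg hv') (by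
        rw [norm_exp, hv]; exact hT.trans (by linarith [Real.add_one_le_exp T]))
      rwa [show -b - 1 = -1 - b by ring]
    · have : Tendsto (fun T : ℝ => Real.exp (-b * T)) atTop (𝓝 0) :=
        Real.tendsto_exp_atBot.comp (tendsto_id.const_mul_atTop_of_neg (by linarith [h.pos_infty]))
      simpa using (this.const_mul D).mul_const π
  have hleft : Tendsto (fun T : ℝ => ∫ y in (-(π / 2))..(π / 2), G ((-T : ℝ) + y * I)) atTop
      (𝓝 0) := by
    refine squeeze_zero_norm' (a := fun T : ℝ => C * Real.exp (a * -T) * π) ?_ ?_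
    · filter_upwards [eventually_ge_atTop (-Real.log r)] with T hT
      refine hside fun v hv hv' => norm_exp_strip_le hv ?_
      refine hC (exp v) (exp_ne_zero v) (exp_strip_re_nonneg hv') ?_
      rw [norm_exp, hv, ← Real.le_log_iff_exp_le hr]
      linarith
    · have : Tendsto (fun T : ℝ => Real.exp (a * -T)) atTop (𝓝 0) :=
        Real.tendsto_exp_atBot.comp (tendsto_neg_atTop_atBot.const_mul_atBot h.pos_zero)
      simpa using (this.const_mul C).mul_const π
  have hlim := intervalIntegral_tendsto_integral (integrable_comp_exp hi) tendsto_neg_atTop_atBot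
    tendsto_id
  have hlim' := hlim.const_mul I
  have hz := (hright.const_mul I).sub (hleft.const_mul I)
  simp only [mul_zero, sub_zero] at hz
  have := tendsto_nhds_unique (hlim'.congr hrect) hz
  rw [integral_Ioi_comp_exp]
  exact (mul_eq_zero.1 this).resolve_left I_ne_zero

end Period

namespace Period
open Set Filter Topology Metric
open scoped Real

/-- A holomorphic function on the slit plane which is bounded on the closed right half plane and
vanishes at `0` to order `c` there. -/
structure HalfPlaneBound (χ : ℂ → ℂ) (c : ℝ) : Prop where
  diff : DifferentiableOn ℂ χ slitPlane
  pos : 0 < c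
  bound : ∃ C, ∀ w : ℂ, w ≠ 0 → 0 ≤ w.re → ‖χ w‖ ≤ C ∧ ‖χ w‖ ≤ C * ‖w‖ ^ c

variable {χ : ℂ → ℂ} {c : ℝ}

theorem le_norm_ofReal_add {ζ : ℝ} (hζ : 0 < ζ) {w : ℂ} (hw : 0 ≤ w.re) :
    ζ ≤ ‖(ζ : ℂ) + w‖ ∧ ‖w‖ ≤ ‖(ζ : ℂ) + w‖ := by
  constructor
  · refine le_trans ?_ (re_le_norm _)
    simp [hw]
  · refine abs_le_of_sq_le_sq' ?_ (norm_nonneg _) |>.2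
    rw [← normSq_eq_norm_sq, ← normSq_eq_norm_sq, normSq_apply, normSq_apply]
    simp only [add_re, ofReal_re, add_im, ofReal_im, zero_add]
    nlinarith [mul_nonneg hζ.le hw]

theorem ofReal_add_ne_zero {ζ : ℝ} (hζ : 0 < ζ) {w : ℂ} (hw : w ∈ slitPlane) :
    (ζ : ℂ) + w ≠ 0 := by
  intro h
  have : w = ((-ζ : ℝ) : ℂ) := by push_cast; linear_combination h
  rw [this, ofReal_mem_slitPlane] at hw
  linarith

theorem HalfPlaneBound.axisBound_add (h : HalfPlaneBound χ c) {ζ : ℝ} (hζ : 0 < ζ) :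
    AxisBound (fun w => χ w / (w * (ζ + w))) c 1 := by
  obtain ⟨C, hC⟩ := h.bound
  have hpos : ∀ w : ℂ, w ≠ 0 → 0 < ‖w‖ := fun w hw => norm_pos_iff.2 hw
  refine ⟨h.pos, one_pos, h.diff.div (by fun_prop) fun w hw =>
    mul_ne_zero (slitPlane_ne_zero hw) (ofReal_add_ne_zero hζ hw),
    ⟨1, one_pos, C / ζ, fun w hw hre _ => ?_⟩, ⟨0, C, fun w hw hre _ => ?_⟩⟩
  · have hw' := hpos w hw
    have hb := (hC w hw hre).2
    have hl := (le_norm_ofReal_add hζ hre).1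
    rw [norm_div, norm_mul, Real.rpow_sub_one hw'.ne']
    calc _ ≤ C * ‖w‖ ^ c / (‖w‖ * ζ) :=
          div_le_div₀ ((norm_nonneg _).trans hb) hb (by positivity) (by gcongr)
      _ = _ := by field_simp
  · have hw' := hpos w hw
    have hb := (hC w hw hre).1
    have hl := (le_norm_ofReal_add hζ hre).2
    rw [norm_div, norm_mul, show (-1 - 1 : ℝ) = -(2 : ℕ) by norm_num, Real.rpow_neg hw'.le,
      Real.rpow_natCast]
    calc _ ≤ C / (‖w‖ * ‖w‖) :=
          div_le_div₀ ((norm_nonneg _).trans hb) hb (by positivity) (by gcongr)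
      _ = _ := by rw [← sq, div_eq_mul_inv]

theorem HalfPlaneBound.axisBound_dslope (h : HalfPlaneBound χ c) {ζ : ℝ} (hζ : 0 < ζ) :
    AxisBound (fun w => -dslope (fun w => χ w - χ ζ * (2 * w / (ζ + w))) ζ w / w)
      (min c 1) 1 := by
  obtain ⟨C, hC⟩ := h.bound
  have hζC : (ζ : ℂ) ≠ 0 := by exact_mod_cast hζ.ne'
  set M : ℂ → ℂ := fun w => χ w - χ ζ * (2 * w / (ζ + w)) with hM
  have hMζ : M ζ = 0 := by
    have : (ζ : ℂ) + ζ ≠ 0 := by rw [← two_mul]; exact mul_ne_zero two_ne_zero hζC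
    simp only [hM]
    rw [← two_mul, div_self (mul_ne_zero two_ne_zero hζC)]
    ring
  have hMdiff : DifferentiableOn ℂ M slitPlane :=
    h.diff.sub ((differentiableOn_const _).mul (DifferentiableOn.div (by fun_prop) (by fun_prop)
      fun w hw => ofReal_add_ne_zero hζ hw))
  have hval : ∀ w : ℂ, w ≠ ζ → -dslope M ζ w / w = M w / (w * (ζ - w)) := by
    intro w hw
    rw [dslope_of_ne _ hw, slope_def_field, hMζ, sub_zero, ← div_neg, neg_sub, div_div, mul_comm w]
  have hpos : ∀ w : ℂ, w ≠ 0 → 0 < ‖w‖ := fun w hw => norm_pos_iff.2 hw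
  refine ⟨lt_min h.pos one_pos, one_pos, ?_,
    ⟨min (ζ / 2) 1, lt_min (by positivity) one_pos,
      (C + ‖χ ζ‖ * (2 / ζ)) * (2 / ζ), fun w hw hre hle => ?_⟩,
    ⟨2 * ζ, (C + ‖χ ζ‖ * 2) * 2, fun w hw hre hge => ?_⟩⟩
  · refine DifferentiableOn.div (DifferentiableOn.neg ?_) differentiableOn_id fun w hw =>
      slitPlane_ne_zero hw
    exact (Complex.differentiableOn_dslope
      (isOpen_slitPlane.mem_nhds (ofReal_mem_slitPlane.2 hζ))).2 hMdiff
  · have hw' := hpos w hw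
    have h1 : ‖w‖ ≤ ζ / 2 := hle.trans (min_le_left _ _)
    have h2 : ‖w‖ ≤ 1 := hle.trans (min_le_right _ _)
    have hC0 : 0 ≤ C := (norm_nonneg _).trans (hC w hw hre).1
    have hsub : ζ / 2 ≤ ‖(ζ : ℂ) - w‖ := by
      have := norm_sub_norm_le (ζ : ℂ) w
      rw [norm_real, Real.norm_of_nonneg hζ.le] at this
      linarith
    rw [hval w (by
      rintro rfl
      rw [norm_real, Real.norm_of_nonneg hζ.le] at h1
      linarith), norm_div, norm_mul]
    have hMw : ‖M w‖ ≤ (C + ‖χ ζ‖ * (2 / ζ)) * ‖w‖ ^ min c 1 := by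
      refine (norm_sub_le _ _).trans ?_
      rw [add_mul]
      refine add_le_add ((hC w hw hre).2.trans ?_) ?_
      · exact mul_le_mul_of_nonneg_left
          (Real.rpow_le_rpow_of_exponent_ge hw' h2 (min_le_left _ _)) hC0
      · rw [norm_mul, norm_div, norm_mul, mul_assoc]
        gcongr
        calc ‖(2 : ℂ)‖ * ‖w‖ / ‖(ζ : ℂ) + w‖ ≤ 2 * ‖w‖ / ζ := by
              rw [RCLike.norm_ofNat]
              gcongr
              exact (le_norm_ofReal_add hζ hre).1
          _ = 2 / ζ * ‖w‖ ^ (1 : ℝ) := by rw [Real.rpow_one]; ring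
          _ ≤ 2 / ζ * ‖w‖ ^ min c 1 := by
              have := Real.rpow_le_rpow_of_exponent_ge hw' h2 (min_le_right c 1)
              gcongr
    rw [Real.rpow_sub_one hw'.ne']
    calc _ ≤ (C + ‖χ ζ‖ * (2 / ζ)) * ‖w‖ ^ min c 1 / (‖w‖ * (ζ / 2)) :=
          div_le_div₀ ((norm_nonneg _).trans hMw) hMw (by positivity) (by gcongr)
      _ = _ := by field_simp
  · have hw' := hpos w hw
    have hC0 : 0 ≤ C := (norm_nonneg _).trans (hC w hw hre).1
    have hsub : ‖w‖ / 2 ≤ ‖(ζ : ℂ) - w‖ := by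
      have := norm_sub_norm_le w (ζ : ℂ)
      rw [norm_real, Real.norm_of_nonneg hζ.le, norm_sub_rev] at this
      linarith
    rw [hval w (by
      rintro rfl
      rw [norm_real, Real.norm_of_nonneg hζ.le] at hge
      linarith), norm_div, norm_mul]
    have hMw : ‖M w‖ ≤ C + ‖χ ζ‖ * 2 := by
      refine (norm_sub_le _ _).trans (add_le_add (hC w hw hre).1 ?_)
      have hl := (le_norm_ofReal_add hζ hre).2
      rw [norm_mul, norm_div, norm_mul, RCLike.norm_ofNat]
      gcongr
      rw [div_le_iff₀ (hw'.trans_le hl)]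
      gcongr
    rw [show (-1 - 1 : ℝ) = -(2 : ℕ) by norm_num, Real.rpow_neg hw'.le, Real.rpow_natCast]
    calc _ ≤ (C + ‖χ ζ‖ * 2) / (‖w‖ * (‖w‖ / 2)) :=
          div_le_div₀ ((norm_nonneg _).trans hMw) hMw (by positivity) (by gcongr)
      _ = _ := by field_simp

theorem axis_ne {κ : ℂ} (hκ : κ = I ∨ κ = -I) {τ : ℝ} (hτ : 0 < τ) (ζ : ℝ) : κ * τ ≠ ζ := by
  intro h
  have := congrArg Complex.im h
  rcases hκ with rfl | rfl <;> simp [hτ.ne'] at this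

/-- The kernel integral on the imaginary axis that picks up the value at `ζ`. -/
theorem HalfPlaneBound.integral_residue (h : HalfPlaneBound χ c) {ζ : ℝ} (hζ : 0 < ζ) :
    IntegrableOn (fun τ : ℝ => χ (I * τ) / (I * τ * (ζ - I * τ)) +
      χ (-I * τ) / (-I * τ * (ζ - -I * τ))) (Ioi 0) ∧
    ∫ τ in Ioi (0 : ℝ), (χ (I * τ) / (I * τ * (ζ - I * τ)) +
      χ (-I * τ) / (-I * τ * (ζ - -I * τ))) = 2 * π * χ ζ / ζ := by
  have hζC : (ζ : ℂ) ≠ 0 := by exact_mod_cast hζ.ne'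
  have hA := h.axisBound_dslope hζ
  set F : ℂ → ℂ := fun w => -dslope (fun w => χ w - χ ζ * (2 * w / (ζ + w))) ζ w / w with hF
  have hi : IntegrableOn (fun τ : ℝ => F (I * τ) + F (-I * τ)) (Ioi 0) :=
    Integrable.add (hA.integrableOn (Or.inl rfl)) (hA.integrableOn (Or.inr rfl))
  obtain ⟨hp, hpv⟩ := integrableOn_inv_sq_add_sq hζ
  have hp' : IntegrableOn (fun τ : ℝ => 4 * χ ζ * (((τ ^ 2 + ζ ^ 2)⁻¹ : ℝ) : ℂ)) (Ioi 0) :=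
    hp.ofReal.const_mul _
  have hval : ∀ {κ : ℂ}, κ = I ∨ κ = -I → ∀ τ ∈ Ioi (0 : ℝ), χ (κ * τ) / (κ * τ * (ζ - κ * τ)) =
      F (κ * τ) + 2 * χ ζ * (((τ ^ 2 + ζ ^ 2)⁻¹ : ℝ) : ℂ) := by
    intro κ hκ τ hτ
    have hκ2 : κ * κ = -1 := by rcases hκ with rfl | rfl <;> simp
    have hne := axis_ne hκ hτ ζ
    have hmem := neg_I_mul_mem_slitPlane hκ hτ
    have h0 := slitPlane_ne_zero hmem
    have h1 := ofReal_add_ne_zero hζ hmem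
    have h2 : (ζ : ℂ) - κ * τ ≠ 0 := sub_ne_zero.2 hne.symm
    have h3 : (τ : ℂ) ^ 2 + ζ ^ 2 = (ζ + κ * τ) * (ζ - κ * τ) := by
      linear_combination τ ^ 2 * hκ2
    have h4 : (ζ : ℂ) + ζ ≠ 0 := by rw [← two_mul]; exact mul_ne_zero two_ne_zero hζC
    have hFv : F (κ * τ) = (χ (κ * τ) - χ ζ * (2 * (κ * τ) / (ζ + κ * τ))) /
        (κ * τ * (ζ - κ * τ)) := by
      simp only [hF]
      rw [dslope_of_ne _ hne, slope_def_field]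
      have h5 : κ * τ - ζ ≠ 0 := sub_ne_zero.2 hne
      rw [show χ (ζ : ℂ) - χ ζ * (2 * ζ / (ζ + ζ)) = 0 by
        rw [← two_mul, div_self (mul_ne_zero two_ne_zero hζC)]; ring, sub_zero, ← div_neg, neg_sub,
        div_div, mul_comm (κ * (τ : ℂ)) (_ - _)]
    rw [hFv]
    push_cast
    rw [h3]
    generalize κ * (τ : ℂ) = w at *
    field_simp
    ring
  have hsum : ∀ τ ∈ Ioi (0 : ℝ), (F (I * τ) + F (-I * τ)) +
      4 * χ ζ * (((τ ^ 2 + ζ ^ 2)⁻¹ : ℝ) : ℂ) = χ (I * τ) / (I * τ * (ζ - I * τ)) +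
      χ (-I * τ) / (-I * τ * (ζ - -I * τ)) := by
    intro τ hτ
    rw [hval (Or.inl rfl) τ hτ, hval (Or.inr rfl) τ hτ]
    ring
  refine ⟨IntegrableOn.congr_fun (hi.add hp') hsum measurableSet_Ioi, ?_⟩
  rw [← setIntegral_congr_fun measurableSet_Ioi hsum, integral_add hi hp', hA.integral_eq_zero,
    integral_const_mul, integral_complex_ofReal, hpv]
  push_cast
  field_simp
  ring

/-- The kernel integral on the imaginary axis with no residue in the right half plane. -/
theorem HalfPlaneBound.integral_no_residue (h : HalfPlaneBound χ c) {ζ : ℝ} (hζ : 0 < ζ) :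
    IntegrableOn (fun τ : ℝ => χ (I * τ) / (I * τ * (ζ + I * τ)) +
      χ (-I * τ) / (-I * τ * (ζ + -I * τ))) (Ioi 0) ∧
    ∫ τ in Ioi (0 : ℝ), (χ (I * τ) / (I * τ * (ζ + I * τ)) +
      χ (-I * τ) / (-I * τ * (ζ + -I * τ))) = 0 := by
  have hA := h.axisBound_add hζ
  exact ⟨Integrable.add (hA.integrableOn (Or.inl rfl)) (hA.integrableOn (Or.inr rfl)),
    hA.integral_eq_zero⟩

end Period

namespace Period
open Set Filter Topology Metric
open scoped Real

theorem pdx_const_mul (c : ℂ) (v : ℂ → ℂ) : pdx (fun z => c * v z) = fun z => c * pdx v z := by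
  funext z
  simp only [pdx]
  exact deriv_const_mul_field c

theorem pdy_const_mul (c : ℂ) (v : ℂ → ℂ) : pdy (fun z => c * v z) = fun z => c * pdy v z := by
  funext z
  simp only [pdy]
  exact deriv_const_mul_field c

theorem IsEigen.const_mul {l : ℂ} {v : ℂ → ℂ} (hv : IsEigen l v) (c : ℂ) :
    IsEigen l (fun z => c * v z) := by
  refine ⟨fun z hz => analyticAt_const.mul (hv.analytic z hz), fun z hz => ?_⟩
  rw [pdx_const_mul, pdx_const_mul, pdy_const_mul, pdy_const_mul]
  beta_reduce
  rw [hv.eqn z hz]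
  ring

theorem IsEigen.add {l : ℂ} {v w : ℂ → ℂ} (hv : IsEigen l v) (hw : IsEigen l w) :
    IsEigen l (fun z => v z + w z) := by
  simpa using hv.sub (hw.const_mul (-1))

theorem hasDerivAt_neg_inv {z : ℂ} (hz : z ≠ 0) :
    HasDerivAt (fun w : ℂ => -w⁻¹) ((z ^ 2)⁻¹) z := by
  simpa using (hasDerivAt_inv hz).fun_neg

theorem hasFDerivAt_fderiv_comp {v g e : ℂ → ℂ} {z g' e' : ℂ} (hv : AnalyticOnNhd ℝ v UH)
    (hgz : g z ∈ UH) (hg : HasDerivAt g g' z) (he : HasDerivAt e e' z) :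
    ∃ L : ℂ →L[ℝ] ℂ, HasFDerivAt (fun w => fderiv ℝ v (g w) (e w)) L z ∧
      ∀ d, L d = fderiv ℝ (fderiv ℝ v) (g z) (d * g') (e z) + fderiv ℝ v (g z) (d * e') := by
  have h1 := (hasFDerivAt_fderiv hv hgz).comp z (hg.hasFDerivAt.restrictScalars ℝ)
  have h2 := h1.clm_apply (he.hasFDerivAt.restrictScalars ℝ)
  refine ⟨_, h2, fun d => ?_⟩
  simp [add_comm]

theorem IsEigen.comp_neg_inv {l : ℂ} {v : ℂ → ℂ} (hv : IsEigen l v) :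
    IsEigen l (fun z => v (-z⁻¹)) := by
  have hg : ∀ z ∈ UH, HasDerivAt (fun w : ℂ => -w⁻¹) ((z ^ 2)⁻¹) z := fun z hz =>
    hasDerivAt_neg_inv (ne_zero_of_mem_UH hz)
  refine ⟨fun z hz => AnalyticAt.fun_comp (g := v) (f := fun w : ℂ => -w⁻¹) (hv.analytic _
    (neg_inv_mem_UH hz))
    ((analyticAt_id.inv (ne_zero_of_mem_UH hz)).neg), fun z hz => ?_⟩
  have hz0 := ne_zero_of_mem_UH hz
  have hgz := neg_inv_mem_UH hz
  have hd : ∀ w ∈ UH, DifferentiableAt ℝ v (-w⁻¹) := fun w hw =>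
    (hv.analytic _ (neg_inv_mem_UH hw)).differentiableAt
  have he : HasDerivAt (fun w : ℂ => (w ^ 2)⁻¹) (-(2 * z) / (z ^ 2) ^ 2) z := by
    simpa using (hasDerivAt_pow 2 z).fun_inv (pow_ne_zero 2 hz0)
  obtain ⟨L, hL, hLd⟩ := hasFDerivAt_fderiv_comp (g := fun w : ℂ => -w⁻¹) hv.analytic hgz
    (hg z hz) he
  obtain ⟨M, hM, hMd⟩ := hasFDerivAt_fderiv_comp (g := fun w : ℂ => -w⁻¹) hv.analytic hgz (hg z hz)
    (he.const_mul I)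
  have hx : _root_.pdx (_root_.pdx fun z => v (-z⁻¹)) z =
      fderiv ℝ (fderiv ℝ v) (-z⁻¹) ((z ^ 2)⁻¹) ((z ^ 2)⁻¹) +
        fderiv ℝ v (-z⁻¹) (-(2 * z) / (z ^ 2) ^ 2) := by
    rw [pdx_congr hz (g := fun w => fderiv ℝ v (-w⁻¹) ((w ^ 2)⁻¹)) fun w hw =>
      pdx_comp_conformal (g := fun w : ℂ => -w⁻¹) (hd w hw) (hg w hw), pdx_of_hasFDerivAt hL, hLd,
      one_mul, one_mul]
  have hy : _root_.pdy (_root_.pdy fun z => v (-z⁻¹)) z =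
      fderiv ℝ (fderiv ℝ v) (-z⁻¹) (I * (z ^ 2)⁻¹) (I * (z ^ 2)⁻¹) -
        fderiv ℝ v (-z⁻¹) (-(2 * z) / (z ^ 2) ^ 2) := by
    rw [pdy_congr hz (g := fun w => fderiv ℝ v (-w⁻¹) (I * (w ^ 2)⁻¹)) fun w hw =>
      pdy_comp_conformal (g := fun w : ℂ => -w⁻¹) (hd w hw) (hg w hw), pdy_of_hasFDerivAt hM, hMd,
      ← mul_assoc I I, I_mul_I, neg_one_mul, map_neg, sub_eq_add_neg]
  have ht := snd_fderiv_trace hv.analytic hgz ((z ^ 2)⁻¹)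
  have hsum : _root_.pdx (_root_.pdx v) (-z⁻¹) + _root_.pdy (_root_.pdy v) (-z⁻¹) = 
      -(l / ((-z⁻¹).im : ℂ) ^ 2 * v (-z⁻¹)) := by
    rw [hv.eqn _ hgz]; ring
  have hn : (normSq ((z ^ 2)⁻¹) : ℂ) / ((-z⁻¹).im : ℂ) ^ 2 = 1 / (z.im : ℂ) ^ 2 := by
    have h1 : (normSq z : ℂ) ≠ 0 := by exact_mod_cast (normSq_pos.2 hz0).ne'
    have h2 : (z.im : ℂ) ≠ 0 := by exact_mod_cast (ne_of_gt hz)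
    rw [neg_im, inv_im, map_inv₀, map_pow]
    push_cast
    field_simp
  rw [hsum] at ht
  rw [hx, hy]
  linear_combination ht - l * v (-z⁻¹) * hn

end Period

namespace Period
open Set Filter Topology Metric
open scoped Real

/-- The eigenfunction attached to a periodic function off the real line: the combination of the
Bessel waves of the two half planes that pairs with `R_ζ^s` to a Cauchy kernel. -/
def cuspWave (s : ℂ) (g : ℂ → ℂ) (z : ℂ) : ℂ :=
  (2 * π : ℂ)⁻¹ * (I ^ (2 * s) * besselWave s I g z + (-I) ^ (2 * s) * besselWave s (-I) g z)

variable {s : ℂ} {g : ℂ → ℂ}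

theorem isEigen_cuspWave (hs : 0 < s.re) (hg : StripDecay g) :
    IsEigen (s * (1 - s)) (cuspWave s g) :=
  (((isEigen_besselWave hs hg (Or.inl rfl)).const_mul _).add
    ((isEigen_besselWave hs hg (Or.inr rfl)).const_mul _)).const_mul _

theorem cuspDecay_of_exp {f : ℂ → ℂ} {K a c : ℝ} (hc : 0 < c)
    (h : ∀ z : ℂ, 1 ≤ z.im → ‖f z‖ ≤ K * z.im ^ a * Real.exp (-(c * z.im))) : CuspDecay f := by
  intro C
  have ht := (tendsto_rpow_mul_exp_neg_mul_atTop_nhds_zero (a - C) c hc).eventually_le_const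
    one_pos
  obtain ⟨T, hT⟩ := (ht.and (eventually_ge_atTop 1)).exists_forall_of_atTop
  refine ⟨|K|, T, fun z hz hzT => ?_⟩
  obtain ⟨h1, h2⟩ := hT z.im hzT
  rw [Real.rpow_sub hz, div_mul_eq_mul_div, div_le_one (Real.rpow_pos_of_pos hz _)] at h1
  calc _ ≤ _ := h z h2
    _ ≤ |K| * (z.im ^ a * Real.exp (-c * z.im)) := by
      rw [mul_assoc, neg_mul]
      gcongr
      exact le_abs_self K
    _ ≤ _ := by gcongr

theorem CuspDecay.const_mul {f : ℂ → ℂ} (hf : CuspDecay f) (c : ℂ) :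
    CuspDecay fun z => c * f z := by
  intro C
  obtain ⟨K, T, h⟩ := hf C
  refine ⟨‖c‖ * K, T, fun z hz hT => ?_⟩
  rw [norm_mul, mul_assoc]
  gcongr
  exact h z hz hT

theorem CuspDecay.add {f g : ℂ → ℂ} (hf : CuspDecay f) (hg : CuspDecay g) :
    CuspDecay fun z => f z + g z := by
  intro C
  obtain ⟨K, T, h⟩ := hf C
  obtain ⟨K', T', h'⟩ := hg C
  refine ⟨K + K', max T T', fun z hz hT => ?_⟩
  rw [add_mul]
  exact (norm_add_le _ _).trans (add_le_add (h z hz ((le_max_left _ _).trans hT))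
    (h' z hz ((le_max_right _ _).trans hT)))

theorem cuspDecay_cuspWave (hs : 0 < s.re) (hg : StripDecay g) : CuspDecay (cuspWave s g) := by
  obtain ⟨K, c, hc, hK⟩ := cuspDecay_besselWave hs hg (Or.inl rfl)
  obtain ⟨K', c', hc', hK'⟩ := cuspDecay_besselWave hs hg (Or.inr rfl)
  exact (((cuspDecay_of_exp hc hK).const_mul _).add ((cuspDecay_of_exp hc' hK').const_mul
    _)).const_mul _

theorem besselWave_sum {ι : Type*} [Fintype ι] (hs : 0 < s.re) {g : ι → ℂ → ℂ}
    (hg : ∀ k, StripDecay (g k)) (c : ι → ℂ) {κ : ℂ} (hκ : κ = I ∨ κ = -I) {z : ℂ} (hz : z ∈ UH) :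
    besselWave s κ (fun w => ∑ k, c k * g k w) z = ∑ k, c k * besselWave s κ (g k) z := by
  have hz' : z.im ≠ 0 := ne_of_gt hz
  have : weightInt (besselWeight s) κ (fun w => ∑ k, c k * g k w) z =
      ∑ k, c k * weightInt (besselWeight s) κ (g k) z := by
    simp only [weightInt, ← integral_const_mul]
    rw [← integral_finsetSum _ fun k _ =>
      (integrableOn_weightInt (expWeight_bessel hs) (hg k) hκ z.re hz').const_mul (c k)]
    refine setIntegral_congr_fun measurableSet_Ioi fun r _ => ?_
    simp only [Finset.mul_sum]
    exact Finset.sum_congr rfl fun k _ => by ring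
  simp only [besselWave, this, Finset.mul_sum]
  exact Finset.sum_congr rfl fun k _ => by ring

theorem cuspWave_sum {ι : Type*} [Fintype ι] (hs : 0 < s.re) {g : ι → ℂ → ℂ}
    (hg : ∀ k, StripDecay (g k)) (c : ι → ℂ) {z : ℂ} (hz : z ∈ UH) :
    cuspWave s (fun w => ∑ k, c k * g k w) z = ∑ k, c k * cuspWave s (g k) z := by
  simp only [cuspWave, besselWave_sum hs hg c (Or.inl rfl) hz,
    besselWave_sum hs hg c (Or.inr rfl) hz, Finset.mul_sum, ← Finset.sum_add_distrib]
  exact Finset.sum_congr rfl fun k _ => by ring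

theorem besselWave_congr {h : ℂ → ℂ} (hgh : ∀ w : ℂ, w.im ≠ 0 → g w = h w) {κ : ℂ}
    (hκ : κ = I ∨ κ = -I) {z : ℂ} (hz : z ∈ UH) : besselWave s κ g z = besselWave s κ h z := by
  have hz' : 0 < z.im := hz
  simp only [besselWave, weightInt]
  congr 1
  refine setIntegral_congr_fun measurableSet_Ioi fun r hr => ?_
  have hr0 : 0 < r := one_pos.trans hr
  rw [hgh _ (by rcases hκ with rfl | rfl <;> simp [hz'.ne', hr0.ne'])]

theorem cuspWave_congr {h : ℂ → ℂ} (hgh : ∀ w : ℂ, w.im ≠ 0 → g w = h w) {z : ℂ} (hz : z ∈ UH) :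
    cuspWave s g z = cuspWave s h z := by
  simp only [cuspWave, besselWave_congr hgh (Or.inl rfl) hz,
    besselWave_congr hgh (Or.inr rfl) hz]

theorem cuspWave_add_one (s : ℂ) (g : ℂ → ℂ) (z : ℂ) :
    cuspWave s g (z + 1) = cuspWave s (fun w => g (w + 1)) z := by
  simp [cuspWave, besselWave, weightInt, add_right_comm]

theorem cpow_axis (κ : ℂ) (hκ : κ = I ∨ κ = -I) {τ : ℝ} (hτ : 0 < τ) :
    (κ * τ) ^ (2 * s) = κ ^ (2 * s) * (τ : ℂ) ^ (2 * s) := by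
  have h0 : κ ≠ 0 := by rcases hκ with rfl | rfl <;> simp
  have h1 : (τ : ℂ) ≠ 0 := by exact_mod_cast hτ.ne'
  rw [cpow_def_of_ne_zero (mul_ne_zero h0 h1), cpow_def_of_ne_zero h0, cpow_def_of_ne_zero h1,
    ← Complex.exp_add, log_mul_ofReal τ hτ κ h0, ofReal_log hτ.le]
  ring_nf

theorem integrableOn_besselWave_axis (hs : 0 < s.re) (hg : BoundaryDecay s g) {κ : ℂ}
    (hκ : κ = I ∨ κ = -I) {ζ : ℝ} (hζ : 0 < ζ) :
    IntegrableOn (fun y : ℝ => besselWave s κ g (y * I) * (y : ℂ) ^ s *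
      ((ζ : ℂ) ^ 2 + (y : ℂ) ^ 2) ^ (-(s + 1))) (Ioi 0) ∧
    IntegrableOn (fun y : ℝ => pdx (besselWave s κ g) (y * I) * (y : ℂ) ^ s *
      ((ζ : ℂ) ^ 2 + (y : ℂ) ^ 2) ^ (-s)) (Ioi 0) := by
  have hm : max 0 (2 * s.re - 1) < 2 * s.re := max_lt (by positivity) (by linarith)
  constructor
  · refine (((profile_bessel hs hg hκ).mul_cpow (2 * s) (b := s + 1) (by simp; linarith)
      hζ).integrableOn (by
        simp only [mul_re, re_ofNat, im_ofNat, zero_mul, sub_zero]; linarith)).congr_fun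
      (fun y hy => ?_) measurableSet_Ioi
    have hyC : (y : ℂ) ≠ 0 := by exact_mod_cast (ne_of_gt hy)
    simp only [besselWave]
    rw [two_mul, cpow_add _ _ hyC]
    simp
    ring
  · refine (((profile_bessel_deriv hs hg hκ).mul_cpow (2 * s) (b := s) hs.le
      hζ).integrableOn (by
        simp only [mul_re, re_ofNat, im_ofNat, zero_mul, sub_zero]; linarith)).congr_fun
      (fun y hy => ?_) measurableSet_Ioi
    have hyC : (y : ℂ) ≠ 0 := by exact_mod_cast (ne_of_gt hy)
    beta_reduce
    rw [pdx_besselWave_axis hs hg hκ hy, two_mul, cpow_add _ _ hyC]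
    push_cast
    ring

theorem pdx_cuspWave (hs : 0 < s.re) (hg : StripDecay g) {z : ℂ} (hz : z ∈ UH) :
    pdx (cuspWave s g) z = (2 * π : ℂ)⁻¹ * (I ^ (2 * s) * pdx (besselWave s I g) z +
      (-I) ^ (2 * s) * pdx (besselWave s (-I) g) z) := by
  have h1 := ((isEigen_besselWave hs hg (Or.inl rfl)).analytic z hz).differentiableAt
  have h2 := ((isEigen_besselWave hs hg (Or.inr rfl)).analytic z hz).differentiableAt
  rw [← re_add_im z] at h1 h2
  have := ((((hasDerivAt_pdx h1).const_mul (I ^ (2 * s))).fun_add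
    ((hasDerivAt_pdx h2).const_mul ((-I) ^ (2 * s)))).const_mul (2 * π : ℂ)⁻¹).deriv
  simp only [re_add_im] at this
  exact this

theorem integrableOn_cuspWave_axis (hs : 0 < s.re) (hg : BoundaryDecay s g) {ζ : ℝ}
    (hζ : 0 < ζ) :
    IntegrableOn (fun y : ℝ => cuspWave s g (y * I) * (y : ℂ) ^ s *
      ((ζ : ℂ) ^ 2 + (y : ℂ) ^ 2) ^ (-(s + 1))) (Ioi 0) ∧
    IntegrableOn (fun y : ℝ => pdx (cuspWave s g) (y * I) * (y : ℂ) ^ s *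
      ((ζ : ℂ) ^ 2 + (y : ℂ) ^ 2) ^ (-s)) (Ioi 0) := by
  obtain ⟨h1, h2⟩ := integrableOn_besselWave_axis hs hg (Or.inl rfl) hζ
  obtain ⟨h3, h4⟩ := integrableOn_besselWave_axis hs hg (Or.inr rfl) hζ
  constructor
  · refine IntegrableOn.congr_fun (((h1.const_mul (I ^ (2 * s))).add
      (h3.const_mul ((-I) ^ (2 * s)))).const_mul (2 * π : ℂ)⁻¹) (fun y _ => ?_) measurableSet_Ioi
    simp only [cuspWave, Pi.add_apply]
    ring
  · refine IntegrableOn.congr_fun (((h2.const_mul (I ^ (2 * s))).add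
      (h4.const_mul ((-I) ^ (2 * s)))).const_mul (2 * π : ℂ)⁻¹) (fun y hy => ?_) measurableSet_Ioi
    rw [pdx_cuspWave hs hg.strip (axis_mem_UH hy)]
    simp only [Pi.add_apply]
    ring

theorem stieltjes_cuspWave (hs : 0 < s.re) (hg : BoundaryDecay s g) {ζ : ℝ} (hζ : 0 < ζ) :
    stieltjes (s + 1) s (fun y => cuspWave s g (y * I)) ζ = (2 * π : ℂ)⁻¹ *
      (I ^ (2 * s) * stieltjes (s + 1) s (fun y => besselWave s I g (y * I)) ζ +
      (-I) ^ (2 * s) * stieltjes (s + 1) s (fun y => besselWave s (-I) g (y * I)) ζ) ∧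
    stieltjes s s (fun y => pdx (cuspWave s g) (y * I)) ζ = (2 * π : ℂ)⁻¹ *
      (I ^ (2 * s) * stieltjes s s (fun y => pdx (besselWave s I g) (y * I)) ζ +
      (-I) ^ (2 * s) * stieltjes s s (fun y => pdx (besselWave s (-I) g) (y * I)) ζ) := by
  obtain ⟨h1, h2⟩ := integrableOn_besselWave_axis hs hg (Or.inl rfl) hζ
  obtain ⟨h3, h4⟩ := integrableOn_besselWave_axis hs hg (Or.inr rfl) hζ
  constructor
  · simp only [stieltjes]
    rw [← integral_const_mul, ← integral_const_mul,
      ← integral_add (h1.const_mul _) (h3.const_mul _), ← integral_const_mul]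
    refine setIntegral_congr_fun measurableSet_Ioi fun y _ => ?_
    simp only [cuspWave]
    ring
  · simp only [stieltjes]
    rw [← integral_const_mul, ← integral_const_mul,
      ← integral_add (h2.const_mul _) (h4.const_mul _), ← integral_const_mul]
    refine setIntegral_congr_fun measurableSet_Ioi fun y hy => ?_
    rw [pdx_cuspWave hs hg.strip (axis_mem_UH hy)]
    ring

end Period

namespace Period
open Set Filter Topology Metric
open scoped Real

variable {s : ℂ} {g : ℂ → ℂ} {κ : ℂ}

theorem kernel_axis (hs : 0 < s.re) (hg : BoundaryDecay s g) (hκ : κ = I ∨ κ = -I) {ζ : ℝ}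
    (hζ : 0 < ζ) (ε : ℂ) (hε : ε * ε = 1) :
    IntegrableOn (fun τ : ℝ => (κ * τ) ^ (2 * s) * g (κ * τ) / (κ * τ * (ζ - ε * (κ * τ))))
      (Ioi 0) ∧
    ∫ τ in Ioi (0 : ℝ), (κ * τ) ^ (2 * s) * g (κ * τ) / (κ * τ * (ζ - ε * (κ * τ))) =
      κ ^ (2 * s) *
        (ε * (∫ τ in Ioi (0 : ℝ), g (κ * τ) * (τ : ℂ) ^ (2 * s) / (τ ^ 2 + ζ ^ 2)) -
          κ * ζ * ∫ τ in Ioi (0 : ℝ), g (κ * τ) / τ * (τ : ℂ) ^ (2 * s) / (τ ^ 2 + ζ ^ 2)) := by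
  have hκ2 : κ * κ = -1 := by rcases hκ with rfl | rfl <;> simp
  obtain ⟨h1, h2⟩ := integrableOn_ray_div hs hg hκ hζ
  have key : ∀ τ ∈ Ioi (0 : ℝ), κ ^ (2 * s) *
      (ε * (g (κ * τ) * (τ : ℂ) ^ (2 * s) / (τ ^ 2 + ζ ^ 2)) -
          κ * ζ * (g (κ * τ) / τ * (τ : ℂ) ^ (2 * s) / (τ ^ 2 + ζ ^ 2))) =
      (κ * τ) ^ (2 * s) * g (κ * τ) / (κ * τ * (ζ - ε * (κ * τ))) := by
    intro τ hτ
    have hτC : (τ : ℂ) ≠ 0 := by exact_mod_cast (ne_of_gt hτ)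
    have h0 : κ ≠ 0 := by rintro rfl; simp at hκ2
    have h3 : (τ : ℂ) ^ 2 + ζ ^ 2 = (ζ + ε * (κ * τ)) * (ζ - ε * (κ * τ)) := by
      linear_combination τ ^ 2 * hκ2 + κ ^ 2 * τ ^ 2 * hε
    have hne : (τ : ℂ) ^ 2 + ζ ^ 2 ≠ 0 := by
      have : 0 < τ ^ 2 + ζ ^ 2 := by positivity
      exact_mod_cast this.ne'
    have hne' : (ζ : ℂ) - ε * (κ * τ) ≠ 0 := by
      intro h; rw [h, mul_zero] at h3; exact hne h3
    rw [cpow_axis κ hκ hτ, show (ζ : ℂ) - ε * (κ * τ) = _ from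
      eq_div_of_mul_eq (c := (ζ : ℂ) + ε * (κ * τ)) (b := (τ : ℂ) ^ 2 + ζ ^ 2)
        (by intro h; rw [h, zero_mul] at h3; exact hne h3) (by rw [h3]; ring)]
    have hp : (ζ : ℂ) + ε * (κ * τ) ≠ 0 := by
      intro h; rw [h, zero_mul] at h3; exact hne h3
    generalize g (κ * τ) = G
    field_simp
    linear_combination (-ζ * κ ^ (2 * s) * G * (τ : ℂ) ^ (2 * s)) * hκ2
  have hi := IntegrableOn.congr_fun (((h1.const_mul ε).sub (h2.const_mul (κ * ζ))).const_mul
    (κ ^ (2 * s))) key measurableSet_Ioi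
  refine ⟨hi, ?_⟩
  rw [← setIntegral_congr_fun measurableSet_Ioi key, integral_const_mul,
    integral_sub (h1.const_mul ε) (h2.const_mul (κ * ζ)), integral_const_mul, integral_const_mul]

/-- A function off the real line that is the boundary combination `P(w) + w^{-2s} Q(-1/w)` of two
functions on the slit plane. -/
structure BoundaryPair (s : ℂ) (P Q g : ℂ → ℂ) : Prop where
  decay : BoundaryDecay s g
  fst : HalfPlaneBound (fun w => w ^ (2 * s) * P w) (2 * s.re)
  snd : HalfPlaneBound (fun w => Q w⁻¹) (2 * s.re)
  eqn : ∀ w : ℂ, w.im ≠ 0 → g w = P w + w ^ (-(2 * s)) * Q (-w⁻¹)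

variable {P Q : ℂ → ℂ}

theorem BoundaryPair.axis (h : BoundaryPair s P Q g) (hκ : κ = I ∨ κ = -I) {τ : ℝ} (hτ : 0 < τ) :
    (κ * τ) ^ (2 * s) * g (κ * τ) =
      (κ * τ) ^ (2 * s) * P (κ * τ) + Q ((-κ * τ)⁻¹) := by
  have h0 : κ * τ ≠ 0 := slitPlane_ne_zero (neg_I_mul_mem_slitPlane hκ hτ)
  rw [h.eqn _ (by rcases hκ with rfl | rfl <;> simp [hτ.ne']), mul_add, ← mul_assoc,
    ← cpow_add _ _ h0, add_neg_cancel, cpow_zero, one_mul, neg_mul, inv_neg]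

theorem BoundaryPair.transform (hs : 0 < s.re) (h : BoundaryPair s P Q g) {ζ : ℝ} (hζ : 0 < ζ) :
    2 * s * ζ * stieltjes (s + 1) s (fun y => cuspWave s g (y * I)) ζ -
      stieltjes s s (fun y => pdx (cuspWave s g) (y * I)) ζ = P ζ ∧
    2 * s * ζ * stieltjes (s + 1) s (fun y => cuspWave s g (y * I)) ζ +
      stieltjes s s (fun y => pdx (cuspWave s g) (y * I)) ζ = (ζ : ℂ) ^ (-(2 * s)) * Q
        (ζ⁻¹ : ℝ) := by
  have hs0 : s ≠ 0 := fun h => by simp [h] at hs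
  have hζC : (ζ : ℂ) ≠ 0 := by exact_mod_cast hζ.ne'
  have hπ : (π : ℂ) ≠ 0 := by exact_mod_cast Real.pi_ne_zero
  have hI : I = I ∨ I = -I := Or.inl rfl
  have hI' : -I = I ∨ -I = -I := Or.inr rfl
  obtain ⟨e1, e2⟩ := stieltjes_cuspWave hs h.decay hζ
  rw [stieltjes_besselWave hs h.decay hI hζ, stieltjes_besselWave hs h.decay hI' hζ] at e1
  rw [stieltjes_pdx_besselWave hs h.decay hI hζ, stieltjes_pdx_besselWave hs h.decay hI' hζ] at e2
  obtain ⟨i1, k1⟩ := kernel_axis hs h.decay hI hζ 1 (by simp)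
  obtain ⟨i2, k2⟩ := kernel_axis hs h.decay hI' hζ 1 (by simp)
  obtain ⟨i3, k3⟩ := kernel_axis hs h.decay hI hζ (-1) (by simp)
  obtain ⟨i4, k4⟩ := kernel_axis hs h.decay hI' hζ (-1) (by simp)
  obtain ⟨r1, v1⟩ := h.fst.integral_residue hζ
  obtain ⟨r2, v2⟩ := h.snd.integral_residue hζ
  obtain ⟨r3, v3⟩ := h.fst.integral_no_residue hζ
  obtain ⟨r4, v4⟩ := h.snd.integral_no_residue hζ
  have hsum : (∫ τ in Ioi (0 : ℝ),
      (I * τ) ^ (2 * s) * g (I * τ) / (I * τ * (ζ - 1 * (I * τ)))) +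
      ∫ τ in Ioi (0 : ℝ), (-I * τ) ^ (2 * s) * g (-I * τ) / (-I * τ * (ζ - 1 * (-I * τ))) =
      2 * π * ((ζ : ℂ) ^ (2 * s) * P ζ) / ζ := by
    have e := integral_sub r1 r4
    rw [v1, v4, sub_zero] at e
    rw [← e, ← integral_add i1 i2]
    refine setIntegral_congr_fun measurableSet_Ioi fun τ hτ => ?_
    rw [h.axis hI hτ, h.axis hI' hτ, neg_neg]
    have hd : ∀ x : ℂ, x / (-I * τ * (ζ + -I * τ)) = -(x / (I * τ * (ζ - 1 * (I * τ)))) := by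
      intro x; rw [← div_neg]; ring_nf
    have hd' : ∀ x : ℂ, x / (I * τ * (ζ + I * τ)) = -(x / (-I * τ * (ζ - 1 * (-I * τ)))) := by
      intro x; rw [← div_neg]; ring_nf
    rw [hd, hd']
    simp only [one_mul]
    ring
  have hsum' : (∫ τ in Ioi (0 : ℝ),
      (I * τ) ^ (2 * s) * g (I * τ) / (I * τ * (ζ - (-1) * (I * τ)))) +
      ∫ τ in Ioi (0 : ℝ), (-I * τ) ^ (2 * s) * g (-I * τ) / (-I * τ * (ζ - (-1) * (-I * τ))) =
      -(2 * π * Q (ζ : ℂ)⁻¹ / ζ) := by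
    have e := integral_sub r3 r2
    rw [v3, v2, zero_sub] at e
    rw [← e, ← integral_add i3 i4]
    refine setIntegral_congr_fun measurableSet_Ioi fun τ hτ => ?_
    rw [h.axis hI hτ, h.axis hI' hτ, neg_neg]
    have hd : ∀ x : ℂ, x / (-I * τ * (ζ - -I * τ)) = -(x / (I * τ * (ζ - -1 * (I * τ)))) := by
      intro x; rw [← div_neg]; ring_nf
    have hd' : ∀ x : ℂ, x / (I * τ * (ζ - I * τ)) = -(x / (-I * τ * (ζ - -1 * (-I * τ)))) := by
      intro x; rw [← div_neg]; ring_nf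
    rw [hd, hd', show (ζ : ℂ) - -1 * (I * τ) = ζ + I * τ by ring,
      show (ζ : ℂ) - -1 * (-I * τ) = ζ + -I * τ by ring]
    ring
  rw [k1, k2] at hsum
  rw [k3, k4] at hsum'
  rw [e1, e2]
  have hpow : (ζ : ℂ) ^ (-(2 * s)) * (ζ : ℂ) ^ (2 * s) = 1 := by
    rw [← cpow_add _ _ hζC, neg_add_cancel, cpow_zero]
  generalize (∫ τ in Ioi (0 : ℝ), g (I * τ) * (τ : ℂ) ^ (2 * s) / (τ ^ 2 + ζ ^ 2)) = J1 at *
  generalize (∫ τ in Ioi (0 : ℝ), g (-I * τ) * (τ : ℂ) ^ (2 * s) / (τ ^ 2 + ζ ^ 2)) = J2 at *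
  generalize (∫ τ in Ioi (0 : ℝ), g (I * τ) / τ * (τ : ℂ) ^ (2 * s) / (τ ^ 2 + ζ ^ 2)) = L1 at *
  generalize (∫ τ in Ioi (0 : ℝ), g (-I * τ) / τ * (τ : ℂ) ^ (2 * s) / (τ ^ 2 + ζ ^ 2)) = L2 at *
  rw [ofReal_inv]
  generalize (ζ : ℂ) ^ (-(2 * s)) = z1 at *
  generalize (ζ : ℂ) ^ (2 * s) = z2 at *
  generalize I ^ (2 * s) = c1 at *
  generalize (-I) ^ (2 * s) = c2 at *
  clear v1 v2 v3 v4 e1 e2 k1 k2 k3 k4 r1 r2 r3 r4 i1 i2 i3 i4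
  have hp : (2 * π : ℂ)⁻¹ * (2 * π) = 1 := inv_mul_cancel₀ (mul_ne_zero two_ne_zero hπ)
  have h2s : s * (2 * s)⁻¹ * 2 = 1 := by field_simp
  generalize (2 * π : ℂ)⁻¹ = p at *
  generalize hq : (2 * s)⁻¹ = q at *
  simp only [div_eq_mul_inv, hq]
  constructor
  · rw [eq_div_iff hζC] at hsum
    linear_combination z1 * p * hsum + P ζ * hpow + P ζ * z1 * z2 * hp +
      ζ * p * z1 * (c1 * J1 + c2 * J2) * h2s
  · rw [← neg_div, eq_div_iff hζC] at hsum'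
    linear_combination (-z1 * p) * hsum' + z1 * Q (ζ : ℂ)⁻¹ * hp +
      ζ * p * z1 * (c1 * J1 + c2 * J2) * h2s

end Period

namespace Period
open Set Filter Topology Metric

variable {s : ℂ} {g h P Q : ℂ → ℂ}

theorem pdx_comp_neg_inv_axis {v : ℂ → ℂ} (hv : AnalyticOnNhd ℝ v UH) {y : ℝ} (hy : 0 < y) :
    pdx (fun w => v (-w⁻¹)) (y * I) = -((y : ℂ)⁻¹ ^ 2 * pdx v ((y⁻¹ : ℝ) * I)) := by
  have hz0 : (y * I : ℂ) ≠ 0 := by simp [hy.ne']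
  have hy0 : (y : ℂ) ≠ 0 := by exact_mod_cast hy.ne'
  have hyz : ((y⁻¹ : ℝ) * I : ℂ) ∈ UH := by simpa using hy
  have e : -(y * I : ℂ)⁻¹ = (y⁻¹ : ℝ) * I := by rw [← neg_inv_axis y⁻¹, inv_inv]
  have hg : HasDerivAt (fun w : ℂ => -w⁻¹) (((-y⁻¹ ^ 2 : ℝ) : ℂ)) (y * I : ℂ) := by
    refine (hasDerivAt_neg_inv hz0).congr_deriv ?_
    push_cast
    rw [mul_pow, I_sq]
    field_simp
  have hd := (hv _ hyz).differentiableAt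
  rw [pdx_eq_fderiv hd]
  rw [← e] at hd
  rw [pdx_comp_conformal (g := fun w : ℂ => -w⁻¹) hd hg, e, fderiv_apply_eq hv hyz, ofReal_re,
    ofReal_im, pdx_eq_fderiv (hv _ hyz).differentiableAt]
  simp

theorem cuspWave_neg_inv (hs : 0 < s.re) (hg : BoundaryPair s P Q g) (hh : BoundaryPair s Q P h)
    {z : ℂ} (hz : z ∈ UH) : cuspWave s h (-z⁻¹) = cuspWave s g z := by
  have hs1 : 0 < (s + 1).re := by simp; linarith
  have hs0 : s ≠ 0 := fun h => by simp [h] at hs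
  have eg := isEigen_cuspWave hs hg.decay.strip
  have eh := isEigen_cuspWave hs hh.decay.strip
  have cg := continuousOn_axis eg.analytic
  have ch := continuousOn_axis eh.analytic
  have cg' := continuousOn_axis (analyticOnNhd_pdx eg.analytic)
  have ch' := continuousOn_axis (analyticOnNhd_pdx eh.analytic)
  have cinv : ContinuousOn (fun y : ℝ => y⁻¹) (Ioi 0) :=
    continuousOn_inv₀.mono fun y hy => ne_of_gt hy
  have minv : MapsTo (fun y : ℝ => y⁻¹) (Ioi 0) (Ioi 0) := fun y (hy : 0 < y) =>
    inv_pos.2 hy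
  have iO : ∀ ζ : ℝ, 0 < ζ → IntegrableOn (fun y : ℝ => cuspWave s h ((y⁻¹ : ℝ) * I) *
      (y : ℂ) ^ s * ((ζ : ℂ) ^ 2 + (y : ℂ) ^ 2) ^ (-(s + 1))) (Ioi 0) := fun ζ hζ => by
    refine integrableOn_stieltjes_inv (φ := fun y => cuspWave s h ((y⁻¹ : ℝ) * I)) hζ ?_
    rw [show 2 * (s + 1) - s - 2 = s by ring]
    simpa only [inv_inv] using (integrableOn_cuspWave_axis hs hh.decay (inv_pos.2 hζ)).1
  have iE : ∀ ζ : ℝ, 0 < ζ → IntegrableOn (fun y : ℝ =>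
      (y : ℂ)⁻¹ ^ 2 * pdx (cuspWave s h) ((y⁻¹ : ℝ) * I) *
      (y : ℂ) ^ s * ((ζ : ℂ) ^ 2 + (y : ℂ) ^ 2) ^ (-s)) (Ioi 0) := fun ζ hζ => by
    refine integrableOn_stieltjes_inv
      (φ := fun y => (y : ℂ)⁻¹ ^ 2 * pdx (cuspWave s h) ((y⁻¹ : ℝ) * I)) hζ ?_
    refine (integrableOn_cuspWave_axis hs hh.decay (inv_pos.2 hζ)).2.congr_fun (fun y hy => ?_)
      measurableSet_Ioi
    have hyc : (y : ℂ) ≠ 0 := by exact_mod_cast (ne_of_gt hy)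
    simp only [inv_inv, ofReal_inv, show 2 * s - s - 2 = s - 2 by ring, cpow_sub _ _ hyc,
      cpow_ofNat]
    field_simp
  have vO : ∀ ζ : ℝ, 0 < ζ → stieltjes (s + 1) s (fun y => cuspWave s h ((y⁻¹ : ℝ) * I)) ζ =
      (ζ : ℂ) ^ (-(2 * s)) * (ζ : ℂ)⁻¹ ^ 2 *
        stieltjes (s + 1) s (fun y => cuspWave s h (y * I)) (ζ⁻¹ : ℝ) := fun ζ hζ => by
    have hζc : (ζ : ℂ) ≠ 0 := by exact_mod_cast hζ.ne'
    rw [stieltjes_inv _ _ _ hζ, show 2 * (s + 1) - s - 2 = s by ring,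
      show -2 * (s + 1) = -(2 * s) - 2 by ring, cpow_sub _ _ hζc, cpow_ofNat, inv_pow,
        div_eq_mul_inv]
    simp only [inv_inv]
  have vE : ∀ ζ : ℝ, 0 < ζ → stieltjes s s
      (fun y => (y : ℂ)⁻¹ ^ 2 * pdx (cuspWave s h) ((y⁻¹ : ℝ) * I)) ζ =
      (ζ : ℂ) ^ (-(2 * s)) *
        stieltjes s s (fun y => pdx (cuspWave s h) (y * I)) (ζ⁻¹ : ℝ) := fun ζ hζ => by
    rw [stieltjes_inv _ _ _ hζ, show 2 * s - s - 2 = s - 2 by ring,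
      show -2 * s = -(2 * s) by ring, ← one_mul (stieltjes s s _ _),
      ← stieltjes_sq_mul (c := 1)]
    simp only [inv_inv, ofReal_inv, one_mul]
  have hpow : ∀ ζ : ℝ, 0 < ζ → (ζ : ℂ) ^ (-(2 * s)) * (ζ : ℂ) ^ (2 * s) = 1 := fun ζ hζ => by
    rw [← cpow_add _ _ (by exact_mod_cast hζ.ne'), neg_add_cancel, cpow_zero]
  have hpow' : ∀ ζ : ℝ, 0 < ζ → ((ζ⁻¹ : ℝ) : ℂ) ^ (-(2 * s)) = (ζ : ℂ) ^ (2 * s) := fun ζ hζ => by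
    rw [ofReal_inv, inv_cpow, cpow_neg, inv_inv]
    rw [arg_ofReal_of_nonneg hζ.le]; exact Real.pi_pos.ne
  have d0 := stieltjes_eq_zero_of_integrableOn (s := s)
    (φ := fun y => cuspWave s g (y * I) - cuspWave s h ((y⁻¹ : ℝ) * I)) hs1
    (cg.sub (ch.comp cinv minv)) (fun ζ hζ => by
      simp only [sub_mul]
      exact (integrableOn_cuspWave_axis hs hg.decay hζ).1.sub (iO ζ hζ)) fun ζ hζ => by
    have hζc : (ζ : ℂ) ≠ 0 := by exact_mod_cast hζ.ne'
    have hv := vO ζ hζ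
    rw [stieltjes] at hv ⊢
    simp only [sub_mul]
    rw [integral_sub (integrableOn_cuspWave_axis hs hg.decay hζ).1 (iO ζ hζ), hv]
    obtain ⟨a1, a2⟩ := hg.transform hs hζ
    obtain ⟨b1, b2⟩ := hh.transform hs (inv_pos.2 hζ)
    rw [hpow' ζ hζ, inv_inv] at b2
    have hp := hpow ζ hζ
    change stieltjes (s + 1) s (fun y => cuspWave s g (y * I)) ζ - _ = 0
    refine (mul_eq_zero.1 ?_).resolve_left (mul_ne_zero (mul_ne_zero (by norm_num : (4 : ℂ) ≠ 0)
      hs0) hζc)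
    have hi : (ζ : ℂ) * (ζ : ℂ)⁻¹ = 1 := mul_inv_cancel₀ hζc
    rw [ofReal_inv] at a2 b1 b2 ⊢
    linear_combination a1 + a2 - (ζ : ℂ) ^ (-(2 * s)) * (b1 + b2) - P ζ * hp -
      4 * s * (ζ : ℂ) ^ (-(2 * s)) * (ζ : ℂ)⁻¹ *
        stieltjes (s + 1) s (fun y => cuspWave s h (y * I)) (ζ : ℂ)⁻¹ * hi
  have d1 := stieltjes_eq_zero_of_integrableOn (s := s)
    (φ := fun y => pdx (cuspWave s g) (y * I) +
      (y : ℂ)⁻¹ ^ 2 * pdx (cuspWave s h) ((y⁻¹ : ℝ) * I)) hs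
    (cg'.add (ContinuousOn.mul
      ((continuous_ofReal.continuousOn.inv₀ fun y hy => by exact_mod_cast (ne_of_gt hy)).pow 2)
      (ch'.comp cinv minv))) (fun ζ hζ => by
      simp only [add_mul]
      exact (integrableOn_cuspWave_axis hs hg.decay hζ).2.add (iE ζ hζ)) fun ζ hζ => by
    have hζc : (ζ : ℂ) ≠ 0 := by exact_mod_cast hζ.ne'
    have hv := vE ζ hζ
    rw [stieltjes] at hv ⊢
    simp only [add_mul]
    rw [integral_add (integrableOn_cuspWave_axis hs hg.decay hζ).2 (iE ζ hζ), hv]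
    obtain ⟨a1, a2⟩ := hg.transform hs hζ
    obtain ⟨b1, b2⟩ := hh.transform hs (inv_pos.2 hζ)
    rw [hpow' ζ hζ, inv_inv] at b2
    have hp := hpow ζ hζ
    change stieltjes s s (fun y => pdx (cuspWave s g) (y * I)) ζ + _ = 0
    linear_combination (a2 - a1) / 2 + (ζ : ℂ) ^ (-(2 * s)) * (b2 - b1) / 2 + P ζ / 2 * hp
  have eD := eg.sub eh.comp_neg_inv
  have := eD.eq_zero_of_axis (fun y hy => by
      rw [← d0 y hy, ← neg_inv_axis y⁻¹, inv_inv]) (fun y hy => by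
      have hyz : (y * I : ℂ) ∈ UH := by simpa using hy
      rw [pdx_sub eg.analytic eh.comp_neg_inv.analytic hyz,
        pdx_comp_neg_inv_axis eh.analytic hy, sub_neg_eq_add]
      exact d1 y hy) z hz
  exact (sub_eq_zero.1 this).symm

end Period

namespace Period
open Set Filter Topology Metric

section SlitPair
variable {E : Type*} [NormedAddCommGroup E] [NormedSpace ℂ E] {A B S : E →L[ℂ] E} {N : ℕ} {s : ℂ}
  {Ψ : ℂ → E}

theorem abs_arg_le_of_re_nonneg {w : ℂ} (hw : 0 ≤ w.re) : |arg w| ≤ 3 * Real.pi / 4 := by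
  have := abs_arg_le_pi_div_two_iff.2 hw
  linarith [Real.pi_pos]

theorem IsSlitExt.halfPlaneBound (hs : 0 < s.re) (h : IsSlitExt A B s Ψ) (L : E →L[ℂ] ℂ) :
    HalfPlaneBound (fun w => w ^ (2 * s) * L (Ψ w)) (2 * s.re) ∧
      HalfPlaneBound (fun w => L (Ψ w⁻¹)) (2 * s.re) := by
  have hd : DifferentiableOn ℂ (fun w => L (Ψ w)) slitPlane :=
    L.differentiable.comp_differentiableOn h.diff
  obtain ⟨C, hC, hb⟩ := h.bound
  have hb' : ∀ w : ℂ, w ≠ 0 → 0 ≤ w.re →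
      ‖L (Ψ w)‖ ≤ ‖L‖ * C ∧ ‖L (Ψ w)‖ ≤ ‖L‖ * C * ‖w‖ ^ (-(2 * s.re)) := fun w hw0 hw => by
    obtain ⟨h1, h2⟩ := hb w hw0 (abs_arg_le_of_re_nonneg hw)
    exact ⟨(L.le_opNorm _).trans (by gcongr), (L.le_opNorm _).trans (by rw [mul_assoc]; gcongr)⟩
  refine ⟨⟨DifferentiableOn.mul (fun w hw => ?_) hd, by positivity, ?_⟩, ⟨?_, by positivity, ?_⟩⟩
  · exact (differentiableAt_id.cpow_const hw).differentiableWithinAt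
  · refine ⟨Real.exp (Real.pi * |(2 * s).im|) * (‖L‖ * C), fun w hw0 hw => ?_⟩
    obtain ⟨h1, h2⟩ := hb' w hw0 hw
    have h3 := norm_cpow_le_exp_mul hw0 (2 * s)
    have hn := norm_pos_iff.2 hw0
    have e : (2 * s).re = 2 * s.re := by simp
    rw [e] at h3
    have hp : ‖w‖ ^ (2 * s.re) * ‖w‖ ^ (-(2 * s.re)) = 1 := by
      rw [← Real.rpow_add hn, add_neg_cancel, Real.rpow_zero]
    rw [norm_mul]
    refine ⟨(mul_le_mul h3 h2 (by positivity) (by positivity)).trans_eq ?_,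
      (mul_le_mul h3 h1 (by positivity) (by positivity)).trans_eq (by ring)⟩
    linear_combination Real.exp (Real.pi * |(2 * s).im|) * (‖L‖ * C) * hp
  · exact hd.comp (fun w hw => (differentiableAt_inv
      (slitPlane_ne_zero hw)).differentiableWithinAt) fun w hw => inv_mem_slitPlane' hw
  · refine ⟨‖L‖ * C, fun w hw0 hw => ?_⟩
    obtain ⟨h1, h2⟩ := hb' w⁻¹ (inv_ne_zero hw0)
      (by rw [inv_re]; exact div_nonneg hw (normSq_nonneg _))
    refine ⟨h1, ?_⟩
    rwa [norm_inv, Real.inv_rpow (norm_nonneg _), Real.rpow_neg (norm_nonneg _), inv_inv] at h2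

theorem IsSlitExt.boundaryPair (hs : 0 < s.re) (hr : OpRel A B S) (h : IsSlitExt A B s Ψ)
    (hN : 0 < N) (hA : A ^ N = 1) (L : E →L[ℂ] ℂ) :
    BoundaryPair s (fun w => L (Ψ w)) (fun w => L (S (Ψ w))) fun w => L (boundaryFn S s Ψ w) := by
  obtain ⟨C, hC, hb⟩ := boundaryFn_bound (S := S) h
  have hb' : ∀ z : ℂ, z ≠ 0 → |z.re| ≤ |z.im| → ‖L (boundaryFn S s Ψ z)‖ ≤ ‖L‖ * C ∧
      ‖L (boundaryFn S s Ψ z)‖ ≤ ‖L‖ * C * ‖z‖ ^ (-(2 * s.re)) := fun w hw0 hw => by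
    obtain ⟨h1, h2⟩ := hb w hw0 hw
    exact ⟨(L.le_opNorm _).trans (by gcongr), (L.le_opNorm _).trans (by rw [mul_assoc]; gcongr)⟩
  refine ⟨⟨stripDecay_of_periodic hN (L.differentiable.comp_differentiableOn
    (differentiableOn_boundaryFn h)) (fun z hz => by rw [boundaryFn_add_nat hr h hA hz])
    (by positivity : 0 < 2 * s.re) fun z hz hzr => (hb' z hz hzr).2,
    ‖L‖ * C, by positivity, hb'⟩, (h.halfPlaneBound hs L).1, (h.halfPlaneBound hs (L ∘L S)).2,
    fun w _ => ?_⟩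
  simp [boundaryFn]

end SlitPair

theorem moeb_coe (g : SL2) (z : UpperHalfPlane) : moeb g z = ((g • z : UpperHalfPlane) : ℂ) := by
  rw [UpperHalfPlane.coe_specialLinearGroup_apply]
  simp [moeb]

theorem moeb_mem_UH (g : SL2) {z : ℂ} (hz : z ∈ UH) : moeb g z ∈ UH := by
  rw [moeb_coe g ⟨z, hz⟩]; exact (g • (⟨z, hz⟩ : UpperHalfPlane)).im_pos

theorem moeb_mul (g h : SL2) {z : ℂ} (hz : z ∈ UH) :
    moeb (g * h : SL2) z = moeb g (moeb h z) := by
  have := moeb_coe (g * h) ⟨z, hz⟩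
  rw [mul_smul, ← moeb_coe, ← moeb_coe] at this
  exact this

theorem moeb_T (z : ℂ) : moeb (ModularGroup.T : SL2) z = z + 1 := by
  simp [moeb, ModularGroup.T]

variable {n μ : ℕ} {α : Fin μ → SL2} {s : ℂ}

theorem equivariant_of_S_T (hrep : IsCosetReps n α) {U : ℂ → Fin μ → ℂ}
    (hS : ∀ z ∈ UH, U (-z⁻¹) = rop n α ModularGroup.S (U z))
    (hT : ∀ z ∈ UH, U (z + 1) = rop n α ModularGroup.T (U z)) (g : SL2) :
    ∀ z ∈ UH, U (moeb g z) = rop n α g (U z) := by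
  have hg : g ∈ Subgroup.closure {ModularGroup.S, ModularGroup.T} := by
    rw [SpecialLinearGroup.SL2Z_generators]; trivial
  induction hg using Subgroup.closure_induction with
  | mem x hx =>
    rintro z hz
    rcases hx with rfl | rfl
    · rw [moeb_S, hS z hz]
    · rw [moeb_T, hT z hz]
  | one => intro z hz; rw [rop_one hrep]; simp [moeb]
  | mul x y _ _ hx hy =>
    intro z hz
    rw [moeb_mul x y hz, hx _ (moeb_mem_UH y hz), hy z hz, rop_mul hrep]
  | inv x _ hx =>
    intro z hz
    have := hx _ (moeb_mem_UH x⁻¹ hz)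
    rw [← moeb_mul x x⁻¹ hz, mul_inv_cancel] at this
    have e : moeb (1 : SL2) z = z := by simp [moeb]
    rw [e] at this
    rw [this, ← rop_mul hrep, inv_mul_cancel, rop_one hrep]

end Period

namespace Period
open Set Filter Topology Metric

theorem exists_bound_of_ends {f : ℝ → ℂ} {σ : ℝ} (hσ : 0 < σ) (hf : ContinuousOn f (Ioi 0))
    (h0 : ∃ K ε : ℝ, 0 < ε ∧ ∀ x : ℝ, 0 < x → x < ε → ‖f x‖ ≤ K)
    (h1 : ∃ K T : ℝ, ∀ x : ℝ, T ≤ x → 0 < x → ‖f x‖ ≤ K * x ^ (-(2 * σ))) :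
    ∃ K, ∀ x : ℝ, 0 < x → ‖f x‖ ≤ K ∧ ‖f x‖ ≤ K * x ^ (-(2 * σ)) := by
  obtain ⟨K₀, ε, hε, h0⟩ := h0
  obtain ⟨K₁, T, h1⟩ := h1
  have hε' : 0 < min ε 1 := lt_min hε one_pos
  have hT : 0 < max T 1 := lt_max_of_lt_right one_pos
  obtain ⟨M, hM⟩ := (isCompact_Icc (a := min ε 1) (b := max T 1)).exists_bound_of_continuousOn
    (hf.mono fun x hx => hε'.trans_le hx.1)
  have hp : 1 ≤ max T 1 ^ (2 * σ) := Real.one_le_rpow (le_max_right _ _) (by linarith)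
  have hMp : |M| ≤ |M| * max T 1 ^ (2 * σ) := le_mul_of_one_le_right (abs_nonneg M) hp
  have a0 := abs_nonneg K₀
  have a1 := abs_nonneg K₁
  have aM := abs_nonneg M
  refine ⟨|K₀| + |K₁| + |M| * max T 1 ^ (2 * σ), fun x hx => ?_⟩
  have hxp : 0 < x ^ (-(2 * σ)) := Real.rpow_pos_of_pos hx _
  rcases lt_or_ge x (min ε 1) with hlt | hge
  · have hb := (h0 x hx (hlt.trans_le (min_le_left _ _))).trans (le_abs_self K₀)
    have hx1 : 1 ≤ x ^ (-(2 * σ)) :=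
      Real.one_le_rpow_of_pos_of_le_one_of_nonpos hx (hlt.le.trans (min_le_right _ _)) (by linarith)
    have hK : ‖f x‖ ≤ |K₀| + |K₁| + |M| * max T 1 ^ (2 * σ) := by linarith
    exact ⟨hK, hK.trans (le_mul_of_one_le_right ((norm_nonneg _).trans hK) hx1)⟩
  · rcases le_or_gt (max T 1) x with hTx | hxT
    · have hb : ‖f x‖ ≤ |K₁| * x ^ (-(2 * σ)) :=
        (h1 x ((le_max_left _ _).trans hTx) hx).trans (by gcongr; exact le_abs_self K₁)
      have hx1 : x ^ (-(2 * σ)) ≤ 1 :=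
        Real.rpow_le_one_of_one_le_of_nonpos ((le_max_right _ _).trans hTx) (by linarith)
      have := mul_le_of_le_one_right a1 hx1
      refine ⟨by linarith, hb.trans ?_⟩
      gcongr
      linarith
    · have hb := (hM x ⟨hge, hxT.le⟩).trans (le_abs_self M)
      have hx1 : 1 ≤ max T 1 ^ (2 * σ) * x ^ (-(2 * σ)) := by
        rw [Real.rpow_neg hx.le, ← div_eq_mul_inv, one_le_div (Real.rpow_pos_of_pos hx _)]
        gcongr
      refine ⟨by linarith, (hb.trans (le_mul_of_one_le_right aM hx1)).trans ?_⟩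
      rw [← mul_assoc]
      gcongr
      linarith

variable {n μ : ℕ} {α : Fin μ → SL2} {s : ℂ}

theorem periodData_of_isPeriodFn (hn : 1 ≤ n) (hs : 0 < s.re) (hrep : IsCosetReps n α)
    {ψ : ℝ → Fin μ → ℂ} (h : IsPeriodFn n α s ψ) :
    PeriodData (rop n α Tmat⁻¹) (rop n α Tmat'⁻¹) n s ψ where
  N_pos := hn
  re_pos := hs
  A_pow := rop_T_inv_pow hrep
  B_pow := rop_T'_inv_pow hrep
  local_ext x hx := exists_holomorphic_extension (AnalyticAt.pi fun i => h.analytic i x hx)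
  three x hx := by
    funext i
    rw [h.threeterm x hx i]
    simp [rop_apply]
  bound := by
    have key : ∀ i, ∃ K, ∀ x : ℝ, 0 < x → ‖ψ x i‖ ≤ K ∧ ‖ψ x i‖ ≤ K * x ^ (-(2 * s.re)) := by
      intro i
      have h0 := h.grow0 i
      have h1 := h.growInf i
      rw [max_eq_left (by linarith)] at h0
      rw [min_eq_right (by linarith)] at h1
      simp only [Real.rpow_zero, mul_one, neg_mul] at h0 h1
      exact exists_bound_of_ends hs (h.analytic i).continuousOn h0 h1
    choose K hK using key
    refine ⟨∑ i, |K i|, fun x hx => ?_⟩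
    have hsum : ∀ i, |K i| ≤ ∑ i, |K i| := fun i =>
      Finset.single_le_sum (f := fun i => |K i|) (fun _ _ => abs_nonneg _) (Finset.mem_univ i)
    have hpos : 0 ≤ ∑ i, |K i| := Finset.sum_nonneg fun _ _ => abs_nonneg _
    have hxp : 0 < x ^ (-(2 * s.re)) := Real.rpow_pos_of_pos hx _
    refine ⟨(pi_norm_le_iff_of_nonneg hpos).2 fun i => (hK i x hx).1.trans
      ((le_abs_self _).trans (hsum i)), (pi_norm_le_iff_of_nonneg (by positivity)).2 fun i =>
        (hK i x hx).2.trans ?_⟩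
    gcongr
    exact (le_abs_self _).trans (hsum i)

theorem opRel_rop (hrep : IsCosetReps n α) :
    OpRel (rop n α Tmat⁻¹) (rop n α Tmat'⁻¹) (rop n α ModularGroup.S) :=
  ⟨rop_S_S hrep, rop_T_S_T hrep, rop_T_S_T' hrep⟩

/-- The vector valued wave built from the boundary function of a slit plane extension. -/
def vvWave (n : ℕ) (α : Fin μ → SL2) (s : ℂ) (Ψ : ℂ → Fin μ → ℂ) (z : ℂ) (j : Fin μ) : ℂ :=
  cuspWave s (fun w => boundaryFn (rop n α ModularGroup.S) s Ψ w j) z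

variable {Ψ : ℂ → Fin μ → ℂ}

theorem boundaryPair_apply (hn : 1 ≤ n) (hs : 0 < s.re) (hrep : IsCosetReps n α)
    (h : IsSlitExt (rop n α Tmat⁻¹) (rop n α Tmat'⁻¹) s Ψ) (j : Fin μ) :
    BoundaryPair s (fun w => Ψ w j) (fun w => rop n α ModularGroup.S (Ψ w) j)
      fun w => boundaryFn (rop n α ModularGroup.S) s Ψ w j :=
  IsSlitExt.boundaryPair hs (opRel_rop hrep) h hn (rop_T_inv_pow hrep)
    (ContinuousLinearMap.proj (R := ℂ) (φ := fun _ : Fin μ => ℂ) j)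

theorem boundaryPair_S_apply (hn : 1 ≤ n) (hs : 0 < s.re) (hrep : IsCosetReps n α)
    (h : IsSlitExt (rop n α Tmat⁻¹) (rop n α Tmat'⁻¹) s Ψ) (j : Fin μ) :
    BoundaryPair s (fun w => rop n α ModularGroup.S (Ψ w) j) (fun w => Ψ w j)
      fun w => rop n α ModularGroup.S (boundaryFn (rop n α ModularGroup.S) s Ψ w) j := by
  have := IsSlitExt.boundaryPair hs (opRel_rop hrep) h hn (rop_T_inv_pow hrep)
    ((ContinuousLinearMap.proj (R := ℂ) (φ := fun _ : Fin μ => ℂ) j).comp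
      (rop n α ModularGroup.S))
  simpa [rop_S_S hrep] using this

theorem isVVCuspForm_vvWave (hn : 1 ≤ n) (hs : 0 < s.re) (hrep : IsCosetReps n α)
    (h : IsSlitExt (rop n α Tmat⁻¹) (rop n α Tmat'⁻¹) s Ψ) :
    IsVVCuspForm n α s (vvWave n α s Ψ) := by
  have hstrip := fun j => (boundaryPair_apply hn hs hrep h j).decay.strip
  have heig := fun j => isEigen_cuspWave hs (hstrip j)
  have hsum : ∀ g : SL2, ∀ z ∈ UH, ∀ j, cuspWave s
      (fun w => rop n α g (boundaryFn (rop n α ModularGroup.S) s Ψ w) j) z =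
        rop n α g (vvWave n α s Ψ z) j := by
    intro g z hz j
    simp only [rop_apply]
    exact cuspWave_sum hs hstrip (fun k => rho n α g j k) hz
  have hS : ∀ z ∈ UH, vvWave n α s Ψ (-z⁻¹) = rop n α ModularGroup.S (vvWave n α s Ψ z) := by
    intro z hz
    funext j
    rw [← hsum _ z hz j]
    exact cuspWave_neg_inv hs (boundaryPair_S_apply hn hs hrep h j)
      (boundaryPair_apply hn hs hrep h j) hz
  have hT : ∀ z ∈ UH, vvWave n α s Ψ (z + 1) = rop n α ModularGroup.T (vvWave n α s Ψ z) := by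
    intro z hz
    funext j
    rw [← hsum _ z hz j, vvWave, cuspWave_add_one]
    refine cuspWave_congr (fun w hw => ?_) hz
    rw [boundaryFn_eq (opRel_rop hrep) h hw, ← Tmat_eq, ← rop_mul hrep, mul_inv_cancel,
      rop_one hrep]
  exact
    { analytic := fun j => (heig j).analytic
      equivar := fun g z hz j => by
        rw [equivariant_of_S_T hrep hS hT g z hz, rop_apply]
      eigen := fun j => (isEigen_iff_laplace (heig j).analytic).1 (heig j)
      decay := fun j => cuspDecay_cuspWave hs (hstrip j) }

theorem exists_cuspForm_of_isPeriodFn (hn : 1 ≤ n) (hs : 0 < s.re) (hrep : IsCosetReps n α)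
    {ψ : ℝ → Fin μ → ℂ} (hψ : IsPeriodFn n α s ψ) :
    ∃ U : ℂ → Fin μ → ℂ, IsVVCuspForm n α s U ∧
      ∀ ζ : ℝ, 0 < ζ → ∀ i : Fin μ, ψ ζ i = Ptrans s (fun w => U w i) ζ := by
  obtain ⟨Ψ, h, hΨ⟩ := (periodData_of_isPeriodFn hn hs hrep hψ).exists_slitExt
  have hU := isVVCuspForm_vvWave hn hs hrep h
  refine ⟨_, hU, fun ζ hζ i => ?_⟩
  rw [Ptrans_eq (v := fun w => vvWave n α s Ψ w i) hs (axisDecay_cuspForm hU i)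
    (axisDecay_pdx_cuspForm hU i) hζ, ← hΨ ζ hζ]
  exact ((boundaryPair_apply hn hs hrep h i).transform hs hζ).1.symm

end Period

/-- for `s ∈ ℂ ∖ ℤ` with `Re s > 0`, the integral transform
`P : S_ind(n,s) → FE(n,s)` is a bijection onto the space of period functions. -/
theorem stmt18 (n : ℕ) (hn : 1 ≤ n) (s : ℂ) (hs : ∀ k : ℤ, s ≠ (k : ℂ))
    (hsre : 0 < s.re) (μ : ℕ) (α : Fin μ → SL2) (hrep : IsCosetReps n α) :
    (∀ U : ℂ → Fin μ → ℂ, IsVVCuspForm n α s U →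
      IsPeriodFn n α s (fun ζ i => Ptrans s (fun w => U w i) ζ)) ∧
    (∀ U V : ℂ → Fin μ → ℂ, IsVVCuspForm n α s U → IsVVCuspForm n α s V →
      (∀ ζ : ℝ, 0 < ζ → ∀ i : Fin μ,
        Ptrans s (fun w => U w i) ζ = Ptrans s (fun w => V w i) ζ) →
      ∀ z : ℂ, 0 < z.im → U z = V z) ∧
    (∀ ψ : ℝ → Fin μ → ℂ, IsPeriodFn n α s ψ →
      ∃ U : ℂ → Fin μ → ℂ, IsVVCuspForm n α s U ∧
        ∀ ζ : ℝ, 0 < ζ → ∀ i : Fin μ, ψ ζ i = Ptrans s (fun w => U w i) ζ) := by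
  refine ⟨fun U hU => ⟨Period.analyticOnNhd_Ptrans hsre hU,
    fun ζ hζ => Period.Ptrans_three_term hrep hsre hU hζ, Period.Ptrans_grow_zero hsre hU,
    Period.Ptrans_grow_infty hsre hU⟩, fun U V hU hV h z hz => Period.eq_of_Ptrans_eq hsre hU
      hV h hz,
    fun ψ hψ => Period.exists_cuspForm_of_isPeriodFn hn hsre hrep hψ⟩

end
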